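/- Suppose additionally that Ω is not a disc, i.e. that the boundary curvature k is not constant, and let C₀ > 0 be given. Then there exist constants B₀, ε₀, C > 0 such that for every B ≥ B₀ and every vector field A satisfying condition (★) with constant C₀ at field strength B, one has λ₁(B·A) ≥ λ₁(B) − C·( ‖curl A − 1‖_{C¹}·√B + e^{−ε₀·B^{1/4}} ), where ‖curl A − 1‖_{C¹} denotes the supremum over the closure of Ω of |curl A − 1| plus the supremum over the closure of Ω of |∇(curl A − 1)|. -/

import Mathlib

open MeasureTheory Filter Set Topology

noncomputable section

namespace SC

/-- The plane `ℝ²`. -/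
abbrev Plane := ℝ × ℝ

/-- Squared Euclidean norm on the plane. -/
def esq (v : Plane) : ℝ := v.1 ^ 2 + v.2 ^ 2

/-- Euclidean dot product on the plane. -/
def dot2 (v w : Plane) : ℝ := v.1 * w.1 + v.2 * w.2

/-- The reference vector potential `F₀(x) = (-x₂/2, x₁/2)`, with `curl F₀ = 1`. -/
def F0 : Plane → Plane := fun x => (-x.2 / 2, x.1 / 2)

/-- `u` is of class `Cⁿ` on a neighborhood of the closure of `Ω`. -/
def CNearCl {E : Type*} [NormedAddCommGroup E] [NormedSpace ℝ E]
    (n : ℕ) (Ω : Set Plane) (u : Plane → E) : Prop :=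
  ∃ U : Set Plane, IsOpen U ∧ closure Ω ⊆ U ∧ ContDiffOn ℝ n u U

/-- The pointwise squared magnetic gradient `|(-i∇ - B·A)u|²`. -/
def magSq (B : ℝ) (A : Plane → Plane) (u : Plane → ℂ) (x : Plane) : ℝ :=
  ‖(-Complex.I) * fderiv ℝ u x ((1 : ℝ), (0 : ℝ)) - ((B * (A x).1 : ℝ) : ℂ) * u x‖ ^ 2 +
  ‖(-Complex.I) * fderiv ℝ u x ((0 : ℝ), (1 : ℝ)) - ((B * (A x).2 : ℝ) : ℂ) * u x‖ ^ 2

/-- `curl A = ∂₁A₂ - ∂₂A₁`. -/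
def curl2 (A : Plane → Plane) (x : Plane) : ℝ :=
  fderiv ℝ (fun y => (A y).2) x ((1 : ℝ), (0 : ℝ)) -
    fderiv ℝ (fun y => (A y).1) x ((0 : ℝ), (1 : ℝ))

/-- The variational ground state energy `λ₁(B·A)` of the magnetic Neumann Laplacian. -/
def lam1A (Ω : Set Plane) (B : ℝ) (A : Plane → Plane) : ℝ :=
  sInf { r : ℝ | ∃ u : Plane → ℂ, CNearCl 1 Ω u ∧ (∫ x in Ω, ‖u x‖ ^ 2) ≠ 0 ∧
    r = (∫ x in Ω, magSq B A u x) / (∫ x in Ω, ‖u x‖ ^ 2) }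

/-- `λ₁(B) = λ₁(B·F₀)`. -/
def lam1 (Ω : Set Plane) (B : ℝ) : ℝ := lam1A Ω B F0

/-- The Ginzburg–Landau energy functional. -/
def GLenergy (Ω : Set Plane) (κ H : ℝ) (ψ : Plane → ℂ) (A : Plane → Plane) : ℝ :=
  ∫ x in Ω, (magSq (κ * H) A ψ x - κ ^ 2 * ‖ψ x‖ ^ 2 + κ ^ 2 / 2 * ‖ψ x‖ ^ 4
    + κ ^ 2 * H ^ 2 * (curl2 A x - 1) ^ 2)

/-- Admissible Ginzburg–Landau configurations. -/
def GLadm (Ω : Set Plane) (ψ : Plane → ℂ) (A : Plane → Plane) : Prop :=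
  CNearCl 1 Ω ψ ∧ CNearCl 1 Ω A

/-- The normal state is a minimizer at `(κ, H)`. -/
def NormalMin (Ω : Set Plane) (κ H : ℝ) : Prop :=
  ∀ ψ A, GLadm Ω ψ A → 0 ≤ GLenergy Ω κ H ψ A

/-- The normal state is the unique minimizer at `(κ, H)`. -/
def NormalUnique (Ω : Set Plane) (κ H : ℝ) : Prop :=
  NormalMin Ω κ H ∧
  ∀ ψ A, GLadm Ω ψ A → (∫ x in Ω, ‖ψ x‖ ^ 2) ≠ 0 → 0 < GLenergy Ω κ H ψ A

/-- `(ψ, A)` is a minimizer of the Ginzburg–Landau energy at `(κ, H)`. -/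
def IsGLMin (Ω : Set Plane) (κ H : ℝ) (ψ : Plane → ℂ) (A : Plane → Plane) : Prop :=
  GLadm Ω ψ A ∧ ∀ ψ' A', GLadm Ω ψ' A' → GLenergy Ω κ H ψ A ≤ GLenergy Ω κ H ψ' A'

/-- Lower global critical field. -/
def HC3low (Ω : Set Plane) (κ : ℝ) : ℝ := sInf {H : ℝ | 0 < H ∧ NormalMin Ω κ H}

/-- Upper global critical field. -/
def HC3up (Ω : Set Plane) (κ : ℝ) : ℝ :=
  sInf {H : ℝ | 0 < H ∧ ∀ H', H < H' → NormalUnique Ω κ H'}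

/-- Lower local critical field. -/
def HlocLow (Ω : Set Plane) (κ : ℝ) : ℝ :=
  sInf {H : ℝ | 0 < H ∧ κ ^ 2 ≤ lam1 Ω (κ * H)}

/-- Upper local critical field. -/
def HlocUp (Ω : Set Plane) (κ : ℝ) : ℝ :=
  sInf {H : ℝ | 0 < H ∧ ∀ H', H < H' → κ ^ 2 ≤ lam1 Ω (κ * H')}

/-- The inward unit normal `ν(s) = (-γ₂'(s), γ₁'(s))`. -/
def nuVec (γ : ℝ → Plane) (s : ℝ) : Plane := (-(deriv γ s).2, (deriv γ s).1)

/-- The curvature `k(s) = ⟨γ''(s), ν(s)⟩`. -/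
def curvOf (γ : ℝ → Plane) (s : ℝ) : ℝ := dot2 (deriv (deriv γ) s) (nuVec γ s)

/-- The maximal curvature. -/
def kmaxOf (γ : ℝ → Plane) : ℝ := sSup (Set.range (curvOf γ))

/-- A smooth counterclockwise arclength parametrization of the boundary of `Ω`. -/
structure BoundaryParam (Ω : Set Plane) where
  γ : ℝ → Plane
  L : ℝ
  L_pos : 0 < L
  smooth : ContDiff ℝ (⊤ : ℕ∞) γ
  periodic : Function.Periodic γ L
  unit_speed : ∀ s, esq (deriv γ s) = 1
  injOn : Set.InjOn γ (Set.Ico 0 L)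
  range_eq : Set.range γ = frontier Ω
  inward : ∀ s, ∃ ε > 0, ∀ t ∈ Set.Ioo (0 : ℝ) ε, γ s + t • nuVec γ s ∈ Ω

/-- The non-degeneracy assumption: finitely many points of maximal curvature,
all of them non-degenerate maxima. -/
def NonDegen {Ω : Set Plane} (P : BoundaryParam Ω) : Prop :=
  ∃ (N : ℕ) (s : Fin N → ℝ), 0 < N ∧ (∀ j, s j ∈ Set.Ico 0 P.L) ∧
    (∀ j, curvOf P.γ (s j) = kmaxOf P.γ) ∧
    (∀ t ∈ Set.Ico 0 P.L, (∀ j, t ≠ s j) → curvOf P.γ t < kmaxOf P.γ) ∧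
    (∀ j, deriv (deriv (curvOf P.γ)) (s j) < 0)

/-- The ground state energy `μ(ζ)` of the de Gennes half-line model operator. -/
def muGen (ζ : ℝ) : ℝ :=
  sInf { r : ℝ | ∃ φ : ℝ → ℝ, ContDiff ℝ 1 φ ∧ HasCompactSupport φ ∧
    (∃ τ, 0 < τ ∧ φ τ ≠ 0) ∧
    r = (∫ τ in Set.Ioi (0 : ℝ), ((deriv φ τ) ^ 2 + (τ + ζ) ^ 2 * (φ τ) ^ 2)) /
        (∫ τ in Set.Ioi (0 : ℝ), (φ τ) ^ 2) }

/-- The de Gennes constant `Θ₀`. -/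
def Theta0 : ℝ := sInf (Set.range muGen)

/-- Standard facts about the de Gennes constant, taken as hypotheses. -/
structure DeGennes where
  ξ₀ : ℝ
  u₀ : ℝ → ℝ
  theta_lb : 1 / 2 < Theta0
  theta_ub : Theta0 < 1
  ξ₀_mem : ξ₀ ∈ Set.Ioo (-1 : ℝ) 0
  ξ₀_min : muGen ξ₀ = Theta0
  ξ₀_uniq : ∀ ζ, muGen ζ = Theta0 → ζ = ξ₀
  ξ₀_sq : ξ₀ ^ 2 = Theta0
  u₀_pos : ∀ τ, 0 ≤ τ → 0 < u₀ τ
  u₀_smooth : ContDiffOn ℝ 2 u₀ (Set.Ici 0)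
  u₀_sq_int : IntegrableOn (fun τ => (u₀ τ) ^ 2) (Set.Ioi 0)
  u₀_normalized : (∫ τ in Set.Ioi (0 : ℝ), (u₀ τ) ^ 2) = 1
  u₀_neumann : derivWithin u₀ (Set.Ici 0) 0 = 0
  u₀_ode : ∀ τ ∈ Set.Ioi (0 : ℝ),
    -(deriv (deriv u₀) τ) + (τ + ξ₀) ^ 2 * u₀ τ = Theta0 * u₀ τ

/-- The universal constant `C₁ = u₀(0)²/3`. -/
def DeGennes.C1 (D : DeGennes) : ℝ := (D.u₀ 0) ^ 2 / 3

/-- Condition (★) on a vector field `A` at field strength `B` with constant `C₀`. -/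
def StarCond (Ω : Set Plane) (C₀ B : ℝ) (A : Plane → Plane) : Prop :=
  CNearCl 2 Ω A ∧
  (∀ x ∈ closure Ω, ‖A x‖ ≤ C₀) ∧
  (∀ x ∈ closure Ω, ‖fderiv ℝ A x‖ ≤ C₀) ∧
  (∀ x ∈ closure Ω, ‖fderiv ℝ (fderiv ℝ A) x‖ ≤ C₀) ∧
  (∀ x ∈ closure Ω, |curl2 A x - 1| ≤ C₀ * B ^ (-(1 : ℝ) / 4)) ∧
  (∀ x ∈ closure Ω, ‖fderiv ℝ (curl2 A) x‖ ≤ C₀ * B ^ (-(1 : ℝ) / 4)) ∧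
  (∀ x ∈ frontier Ω, curl2 A x = 1)

/-- The open unit disc. -/
def unitDisc : Set Plane := {x : Plane | x.1 ^ 2 + x.2 ^ 2 < 1}

/-- `Δ_B`: distance from `B/2 + ξ₀√B + δ₀` to the nearest integer. -/
def DeltaB (ξ₀ δ₀ B : ℝ) : ℝ :=
  sInf (Set.range (fun m : ℤ => |(m : ℝ) - B / 2 - ξ₀ * Real.sqrt B - δ₀|))

/-- Euclidean distance to the boundary of `Ω`. -/
def distBdry (Ω : Set Plane) (x : Plane) : ℝ :=
  sInf ((fun y => Real.sqrt (esq (x - y))) '' frontier Ω)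

end SC


namespace SC

/-! ### Globalization of functions smooth near a compact set -/

lemma exists_smooth_cutoff {K U : Set Plane} (hK : IsClosed K) (hU : IsOpen U) (hKU : K ⊆ U) :
    ∃ χ : Plane → ℝ, ContDiff ℝ (⊤ : ℕ∞) χ ∧ (∃ V, IsOpen V ∧ K ⊆ V ∧ ∀ x ∈ V, χ x = 1) ∧
      (∃ W, IsOpen W ∧ Uᶜ ⊆ W ∧ ∀ x ∈ W, χ x = 0) ∧ ∀ x, 0 ≤ χ x ∧ χ x ≤ 1 := by
  obtain ⟨V1, hV1, hKV1, hV1U⟩ := normal_exists_closure_subset hK hU hKU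
  obtain ⟨V2, hV2, hV12, hV2U⟩ := normal_exists_closure_subset isClosed_closure hU hV1U
  obtain ⟨χ, h1, h2, h3, h4⟩ := exists_contMDiff_zero_iff_one_iff_of_isClosed
    (modelWithCornersSelf ℝ Plane) (n := (⊤ : ℕ∞)) (s := V2ᶜ) (t := closure V1)
    hV2.isClosed_compl isClosed_closure
    (Set.disjoint_left.mpr fun x hx hx' => hx (hV12 hx'))
  refine ⟨χ, h1.contDiff, ⟨V1, hV1, hKV1, fun x hx => (h4 x).1 (subset_closure hx)⟩,
    ⟨(closure V2)ᶜ, isClosed_closure.isOpen_compl, Set.compl_subset_compl.mpr hV2U,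
      fun x hx => (h3 x).1 fun h => hx (subset_closure h)⟩, fun x => ?_⟩
  have := h2 (Set.mem_range_self x)
  exact ⟨this.1, this.2⟩

lemma CNearCl.exists_contDiff {E : Type*} [NormedAddCommGroup E] [NormedSpace ℝ E]
    {n : ℕ} {Ω : Set Plane} {u : Plane → E} (h : CNearCl n Ω u) :
    ∃ v : Plane → E, ContDiff ℝ n v ∧ ∃ V, IsOpen V ∧ closure Ω ⊆ V ∧ ∀ x ∈ V, u x = v x := by
  obtain ⟨U, hU, hcl, hu⟩ := h
  obtain ⟨χ, hχ, ⟨V, hV, hKV, hV1⟩, ⟨W, hW, hUW, hW0⟩, -⟩ :=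
    exists_smooth_cutoff isClosed_closure hU hcl
  refine ⟨fun x => χ x • u x, ?_, V, hV, hKV, fun x hx => by simp [hV1 x hx]⟩
  rw [contDiff_iff_contDiffAt]
  intro x
  by_cases hx : x ∈ U
  · have h1 : ContDiffAt ℝ n χ x := (hχ.of_le (by exact_mod_cast le_top)).contDiffAt
    exact h1.smul (hu.contDiffAt (hU.mem_nhds hx))
  · have : (fun x => χ x • u x) =ᶠ[𝓝 x] fun _ => 0 := by
      filter_upwards [hW.mem_nhds (hUW hx)] with y hy
      simp [hW0 y hy]
    exact contDiffAt_const.congr_of_eventuallyEq this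

lemma cNearCl_of_contDiff {E : Type*} [NormedAddCommGroup E] [NormedSpace ℝ E]
    {n : ℕ} {Ω : Set Plane} {u : Plane → E} (h : ContDiff ℝ n u) : CNearCl n Ω u :=
  ⟨Set.univ, isOpen_univ, Set.subset_univ _, h.contDiffOn⟩

/-! ### Pointwise magnetic algebra -/

/-- Squared Euclidean length of the gradient of a real function. -/
def gradSq (f : Plane → ℝ) (x : Plane) : ℝ :=
  fderiv ℝ f x ((1 : ℝ), (0 : ℝ)) ^ 2 + fderiv ℝ f x ((0 : ℝ), (1 : ℝ)) ^ 2

/-- Multiplication of a complex function by a real function. -/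
def rmul (f : Plane → ℝ) (u : Plane → ℂ) : Plane → ℂ := fun x => (f x : ℂ) * u x

lemma rmul_eq_smul (f : Plane → ℝ) (u : Plane → ℂ) : rmul f u = fun x => f x • u x := by
  funext x; simp [rmul]

lemma contDiff_rmul {n : WithTop ℕ∞} {f : Plane → ℝ} {u : Plane → ℂ} (hf : ContDiff ℝ n f)
    (hu : ContDiff ℝ n u) : ContDiff ℝ n (rmul f u) := by
  rw [rmul_eq_smul]; exact hf.smul hu

lemma fderiv_rmul {f : Plane → ℝ} {u : Plane → ℂ} {x : Plane} (hf : DifferentiableAt ℝ f x)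
    (hu : DifferentiableAt ℝ u x) (v : Plane) :
    fderiv ℝ (rmul f u) x v = (f x : ℂ) * fderiv ℝ u x v + (fderiv ℝ f x v : ℂ) * u x := by
  rw [rmul_eq_smul, fderiv_fun_smul hf hu]
  simp

lemma magSq_nonneg (B : ℝ) (A : Plane → Plane) (u : Plane → ℂ) (x : Plane) :
    0 ≤ magSq B A u x := by unfold magSq; positivity

lemma gradSq_nonneg (f : Plane → ℝ) (x : Plane) : 0 ≤ gradSq f x := by unfold gradSq; positivity

/-- The cross term in the expansion of the magnetic energy of a product. -/
def crossTerm (B : ℝ) (u : Plane → ℂ) (v : Plane) (a : ℝ) (x : Plane) : ℝ :=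
  (((-Complex.I) * fderiv ℝ u x v - ((B * a : ℝ) : ℂ) * u x) *
    (starRingEnd ℂ) (-Complex.I * u x)).re

lemma normSq_aux (a b : ℝ) (z w : ℂ) :
    ‖(a : ℂ) * z + (b : ℂ) * w‖ ^ 2 =
      a ^ 2 * ‖z‖ ^ 2 + 2 * a * b * (z * (starRingEnd ℂ) w).re + b ^ 2 * ‖w‖ ^ 2 := by
  simp only [← Complex.normSq_eq_norm_sq, Complex.normSq_apply]
  simp
  ring

lemma magSq_rmul {B : ℝ} {A : Plane → Plane} {f : Plane → ℝ} {u : Plane → ℂ} {x : Plane}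
    (hf : DifferentiableAt ℝ f x) (hu : DifferentiableAt ℝ u x) :
    magSq B A (rmul f u) x = f x ^ 2 * magSq B A u x +
      2 * f x * (fderiv ℝ f x ((1 : ℝ), (0 : ℝ)) * crossTerm B u ((1 : ℝ), (0 : ℝ)) (A x).1 x +
        fderiv ℝ f x ((0 : ℝ), (1 : ℝ)) * crossTerm B u ((0 : ℝ), (1 : ℝ)) (A x).2 x) +
      gradSq f x * ‖u x‖ ^ 2 := by
  have key : ∀ (v : Plane) (a : ℝ),
      ‖(-Complex.I) * fderiv ℝ (rmul f u) x v - ((B * a : ℝ) : ℂ) * rmul f u x‖ ^ 2 =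
      f x ^ 2 * ‖(-Complex.I) * fderiv ℝ u x v - ((B * a : ℝ) : ℂ) * u x‖ ^ 2 +
        2 * f x * fderiv ℝ f x v * crossTerm B u v a x + fderiv ℝ f x v ^ 2 * ‖u x‖ ^ 2 := by
    intro v a
    have : (-Complex.I) * fderiv ℝ (rmul f u) x v - ((B * a : ℝ) : ℂ) * rmul f u x =
        (f x : ℂ) * ((-Complex.I) * fderiv ℝ u x v - ((B * a : ℝ) : ℂ) * u x) +
        (fderiv ℝ f x v : ℂ) * (-Complex.I * u x) := by
      rw [fderiv_rmul hf hu]; simp only [rmul]; ring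
    rw [this, normSq_aux]
    simp [crossTerm]
  unfold magSq gradSq
  rw [key, key]
  ring

lemma magSq_sub_rmul {B : ℝ} {A : Plane → Plane} {f : Plane → ℝ} {u : Plane → ℂ} {x : Plane}
    (hf : DifferentiableAt ℝ f x) (hu : DifferentiableAt ℝ u x) (ε : ℝ) :
    magSq B A (rmul (fun y => 1 - ε * f y ^ 2) u) x = magSq B A u x -
      2 * ε * (magSq B A (rmul f u) x - gradSq f x * ‖u x‖ ^ 2) +
      ε ^ 2 * magSq B A (rmul (fun y => f y ^ 2) u) x := by
  have h2 : DifferentiableAt ℝ (fun y => f y ^ 2) x := hf.fun_pow 2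
  have h3 : DifferentiableAt ℝ (fun y => 1 - ε * f y ^ 2) x := (h2.const_mul ε).const_sub 1
  have e2 : ∀ v, fderiv ℝ (fun y => f y ^ 2) x v = 2 * f x * fderiv ℝ f x v := by
    intro v; rw [fderiv_fun_pow 2 hf]; simp
  have e3 : ∀ v, fderiv ℝ (fun y => 1 - ε * f y ^ 2) x v = -ε * (2 * f x * fderiv ℝ f x v) := by
    intro v
    rw [fderiv_const_sub, fderiv_const_mul h2]
    simp [e2]
  rw [magSq_rmul h3 hu, magSq_rmul hf hu, magSq_rmul h2 hu]
  simp only [gradSq, e2, e3]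
  ring

/-! ### Global energies -/

/-- Magnetic Dirichlet energy over `Ω`. -/
def energy (Ω : Set Plane) (B : ℝ) (A : Plane → Plane) (u : Plane → ℂ) : ℝ :=
  ∫ x in Ω, magSq B A u x

/-- Squared `L²` norm over `Ω`. -/
def mass (Ω : Set Plane) (u : Plane → ℂ) : ℝ := ∫ x in Ω, ‖u x‖ ^ 2

lemma continuous_magSq {B : ℝ} {A : Plane → Plane} {u : Plane → ℂ} (hA : Continuous A)
    (hu : ContDiff ℝ 1 u) : Continuous (magSq B A u) := by
  have h1 : Continuous (fderiv ℝ u) := hu.continuous_fderiv one_ne_zero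
  have h2 := hu.continuous
  unfold magSq
  fun_prop

lemma continuous_gradSq {f : Plane → ℝ} (hf : ContDiff ℝ 1 f) : Continuous (gradSq f) := by
  have h1 : Continuous (fderiv ℝ f) := hf.continuous_fderiv one_ne_zero
  unfold gradSq
  fun_prop

lemma integrableOn_of_bdd {Ω : Set Plane} (hb : Bornology.IsBounded Ω) {g : Plane → ℝ}
    (hg : Continuous g) : IntegrableOn g Ω :=
  (hg.continuousOn.integrableOn_compact hb.isCompact_closure).mono_set subset_closure

lemma energy_nonneg (Ω : Set Plane) (B : ℝ) (A : Plane → Plane) (u : Plane → ℂ) :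
    0 ≤ energy Ω B A u := integral_nonneg fun x => magSq_nonneg B A u x

lemma mass_nonneg (Ω : Set Plane) (u : Plane → ℂ) : 0 ≤ mass Ω u :=
  integral_nonneg fun x => by positivity

lemma mass_rmul (Ω : Set Plane) (f : Plane → ℝ) (u : Plane → ℂ) :
    mass Ω (rmul f u) = ∫ x in Ω, f x ^ 2 * ‖u x‖ ^ 2 := by
  unfold mass rmul
  congr 1; funext x
  rw [norm_mul, mul_pow, Complex.norm_real, Real.norm_eq_abs, sq_abs]

lemma integral_expand {α : Type*} [MeasurableSpace α] {μ : Measure α} {g₁ g₂ g₃ : α → ℝ}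
    (h₁ : Integrable g₁ μ) (h₂ : Integrable g₂ μ) (h₃ : Integrable g₃ μ) (c d : ℝ) :
    ∫ x, (g₁ x - c * g₂ x + d * g₃ x) ∂μ = (∫ x, g₁ x ∂μ) - c * (∫ x, g₂ x ∂μ) +
      d * ∫ x, g₃ x ∂μ := by
  have e1 := integral_add (f := fun x => g₁ x - c * g₂ x) (g := fun x => d * g₃ x)
    (h₁.sub (h₂.const_mul c)) (h₃.const_mul d)
  have e2 := integral_sub (f := g₁) (g := fun x => c * g₂ x) h₁ (h₂.const_mul c)
  rw [e1, e2, integral_const_mul, integral_const_mul]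

/-- Expansion of the shifted energy along `u - ε f² u`. -/
lemma shifted_energy_expand {Ω : Set Plane} (hb : Bornology.IsBounded Ω) {B E : ℝ}
    {A : Plane → Plane} (hA : Continuous A) {f : Plane → ℝ} (hf : ContDiff ℝ 1 f)
    {u : Plane → ℂ} (hu : ContDiff ℝ 1 u) (ε : ℝ) :
    energy Ω B A (rmul (fun y => 1 - ε * f y ^ 2) u) -
        E * mass Ω (rmul (fun y => 1 - ε * f y ^ 2) u) =
      (energy Ω B A u - E * mass Ω u) -
      2 * ε * (energy Ω B A (rmul f u) - E * mass Ω (rmul f u) -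
        ∫ x in Ω, gradSq f x * ‖u x‖ ^ 2) +
      ε ^ 2 * (energy Ω B A (rmul (fun y => f y ^ 2) u) -
        E * mass Ω (rmul (fun y => f y ^ 2) u)) := by
  have hdf := hf.differentiable one_ne_zero
  have hdu := hu.differentiable one_ne_zero
  have hcu := hu.continuous
  have hcf := hf.continuous
  have i1 := integrableOn_of_bdd hb (continuous_magSq (B := B) hA hu)
  have i2 := integrableOn_of_bdd hb (continuous_magSq (B := B) hA (contDiff_rmul hf hu))
  have i3 := integrableOn_of_bdd hb (continuous_magSq (B := B) hA
    (contDiff_rmul (hf.pow 2) hu))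
  have i4 : IntegrableOn (fun x => gradSq f x * ‖u x‖ ^ 2) Ω := integrableOn_of_bdd hb
    ((continuous_gradSq hf).mul (hcu.norm.pow 2))
  have m1 : IntegrableOn (fun x => ‖u x‖ ^ 2) Ω := integrableOn_of_bdd hb (by fun_prop)
  have m2 : IntegrableOn (fun x => f x ^ 2 * ‖u x‖ ^ 2) Ω := integrableOn_of_bdd hb (by fun_prop)
  have m3 : IntegrableOn (fun x => (f x ^ 2) ^ 2 * ‖u x‖ ^ 2) Ω :=
    integrableOn_of_bdd hb (by fun_prop)
  have hE : energy Ω B A (rmul (fun y => 1 - ε * f y ^ 2) u) = energy Ω B A u -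
      2 * ε * (energy Ω B A (rmul f u) - ∫ x in Ω, gradSq f x * ‖u x‖ ^ 2) +
      ε ^ 2 * energy Ω B A (rmul (fun y => f y ^ 2) u) := by
    unfold energy
    rw [← integral_sub i2 i4, ← integral_expand
      (g₂ := fun x => magSq B A (rmul f u) x - gradSq f x * ‖u x‖ ^ 2) i1 (Integrable.sub i2 i4) i3]
    refine integral_congr_ae (Eventually.of_forall fun x => ?_)
    exact magSq_sub_rmul (hdf x) (hdu x) ε
  have hM : mass Ω (rmul (fun y => 1 - ε * f y ^ 2) u) = mass Ω u -
      2 * ε * mass Ω (rmul f u) + ε ^ 2 * mass Ω (rmul (fun y => f y ^ 2) u) := by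
    rw [mass_rmul, mass_rmul, mass_rmul]
    unfold mass
    rw [← integral_expand m1 m2 m3]
    refine integral_congr_ae (Eventually.of_forall fun x => ?_)
    simp only
    ring
  rw [hE, hM]; ring

/-! ### Ground state energies and localization of near-minimizers -/

/-- `C¹` functions vanishing on `Ω \ S`. -/
def Cls (Ω S : Set Plane) (u : Plane → ℂ) : Prop :=
  ContDiff ℝ 1 u ∧ ∀ x ∈ Ω, x ∉ S → u x = 0

/-- Ground state energy on functions vanishing on `Ω \ S`. -/
def lamS (Ω S : Set Plane) (B : ℝ) (A : Plane → Plane) : ℝ :=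
  sInf {r : ℝ | ∃ u, Cls Ω S u ∧ mass Ω u = 1 ∧ r = energy Ω B A u}

lemma Cls.rmul {Ω S : Set Plane} {u : Plane → ℂ} (hu : Cls Ω S u) {f : Plane → ℝ}
    (hf : ContDiff ℝ 1 f) : Cls Ω S (rmul f u) :=
  ⟨contDiff_rmul hf hu.1, fun x hx hS => by simp [SC.rmul, hu.2 x hx hS]⟩

lemma energy_const_rmul {Ω : Set Plane} {B : ℝ} {A : Plane → Plane}
    {u : Plane → ℂ} (hu : ContDiff ℝ 1 u) (c : ℝ) :
    energy Ω B A (rmul (fun _ => c) u) = c ^ 2 * energy Ω B A u := by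
  unfold energy
  rw [← integral_const_mul]
  refine integral_congr_ae (Eventually.of_forall fun x => ?_)
  simp only
  rw [magSq_rmul (differentiableAt_const c) (hu.differentiable one_ne_zero x)]
  simp [gradSq]

lemma mass_const_rmul (Ω : Set Plane) (u : Plane → ℂ) (c : ℝ) :
    mass Ω (rmul (fun _ => c) u) = c ^ 2 * mass Ω u := by
  rw [mass_rmul, integral_const_mul]; rfl

lemma lamS_bddBelow (Ω S : Set Plane) (B : ℝ) (A : Plane → Plane) :
    BddBelow {r : ℝ | ∃ u, Cls Ω S u ∧ mass Ω u = 1 ∧ r = energy Ω B A u} := by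
  refine ⟨0, ?_⟩
  rintro r ⟨u, -, -, rfl⟩
  exact energy_nonneg Ω B A u

lemma lamS_nonneg (Ω S : Set Plane) (B : ℝ) (A : Plane → Plane) : 0 ≤ lamS Ω S B A := by
  refine Real.sInf_nonneg ?_
  rintro r ⟨u, -, -, rfl⟩
  exact energy_nonneg Ω B A u

lemma exists_normalized {Ω S : Set Plane} {B : ℝ} {A : Plane → Plane} {u : Plane → ℂ}
    (hu : Cls Ω S u) (h : mass Ω u ≠ 0) :
    ∃ v, Cls Ω S v ∧ mass Ω v = 1 ∧ energy Ω B A v = energy Ω B A u / mass Ω u := by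
  have hp : 0 < mass Ω u := lt_of_le_of_ne (mass_nonneg Ω u) (Ne.symm h)
  have hs : (Real.sqrt (mass Ω u))⁻¹ ^ 2 = (mass Ω u)⁻¹ := by
    rw [inv_pow, Real.sq_sqrt hp.le]
  refine ⟨_, hu.rmul (f := fun _ => (Real.sqrt (mass Ω u))⁻¹) contDiff_const, ?_, ?_⟩
  · rw [mass_const_rmul, hs, inv_mul_cancel₀ h]
  · rw [energy_const_rmul hu.1, hs]; field_simp

lemma lamS_mul_mass_le {Ω S : Set Plane} {B : ℝ} {A : Plane → Plane} {u : Plane → ℂ}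
    (hu : Cls Ω S u) : lamS Ω S B A * mass Ω u ≤ energy Ω B A u := by
  by_cases h : mass Ω u = 0
  · rw [h, mul_zero]; exact energy_nonneg _ _ _ _
  · obtain ⟨v, hv, hv1, hve⟩ := exists_normalized (B := B) (A := A) hu h
    have hp : 0 < mass Ω u := lt_of_le_of_ne (mass_nonneg Ω u) (Ne.symm h)
    have := csInf_le (lamS_bddBelow Ω S B A) ⟨v, hv, hv1, rfl⟩
    rw [hve] at this
    calc lamS Ω S B A * mass Ω u ≤ energy Ω B A u / mass Ω u * mass Ω u := by
          gcongr; exact this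
      _ = energy Ω B A u := by field_simp

lemma lamS_near {Ω S : Set Plane} {B : ℝ} {A : Plane → Plane}
    (hne : ∃ u, Cls Ω S u ∧ mass Ω u ≠ 0) {δ : ℝ} (hδ : 0 < δ) :
    ∃ u, Cls Ω S u ∧ mass Ω u = 1 ∧ energy Ω B A u ≤ lamS Ω S B A + δ := by
  obtain ⟨u, hu, hm⟩ := hne
  obtain ⟨v, hv, hv1, -⟩ := exists_normalized (B := B) (A := A) hu hm
  obtain ⟨r, ⟨w, hw, hw1, rfl⟩, hr⟩ := exists_lt_of_csInf_lt
    (s := {r : ℝ | ∃ u, Cls Ω S u ∧ mass Ω u = 1 ∧ r = energy Ω B A u})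
    ⟨_, v, hv, hv1, rfl⟩ (show sInf _ < lamS Ω S B A + δ by unfold lamS; linarith)
  exact ⟨w, hw, hw1, hr.le⟩

lemma energy_congr {Ω : Set Plane} (hΩ : IsOpen Ω) {B : ℝ} {A A' : Plane → Plane}
    {u v : Plane → ℂ} (hA : ∀ x ∈ Ω, A x = A' x) (h : ∀ x ∈ Ω, u x = v x) :
    energy Ω B A u = energy Ω B A' v := by
  refine setIntegral_congr_fun hΩ.measurableSet fun x hx => ?_
  have : u =ᶠ[𝓝 x] v := by filter_upwards [hΩ.mem_nhds hx] with y hy using h y hy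
  simp only [magSq, this.fderiv_eq, h x hx, hA x hx]

lemma mass_congr {Ω : Set Plane} (hΩ : IsOpen Ω) {u v : Plane → ℂ}
    (h : ∀ x ∈ Ω, u x = v x) : mass Ω u = mass Ω v := by
  refine setIntegral_congr_fun hΩ.measurableSet fun x hx => ?_
  simp only [h x hx]

lemma lam1A_eq_lamS {Ω : Set Plane} (hΩ : IsOpen Ω) (B : ℝ) (A : Plane → Plane) :
    lam1A Ω B A = lamS Ω Set.univ B A := by
  unfold lam1A lamS
  congr 1
  ext r
  constructor
  · rintro ⟨u, hu, hm, rfl⟩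
    obtain ⟨v, hv, V, -, hV, huv⟩ := hu.exists_contDiff
    have huv' : ∀ x ∈ Ω, u x = v x := fun x hx => huv x (hV (subset_closure hx))
    have hmv : mass Ω u = mass Ω v := mass_congr hΩ huv'
    have hev : energy Ω B A u = energy Ω B A v := energy_congr hΩ (fun _ _ => rfl) huv'
    have hv' : Cls Ω Set.univ v := ⟨by exact_mod_cast hv, fun x _ h => absurd (Set.mem_univ x) h⟩
    obtain ⟨w, hw, hw1, hwe⟩ := exists_normalized (B := B) (A := A) hv'
      (by rw [← hmv]; exact hm)
    refine ⟨w, hw, hw1, ?_⟩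
    rw [hwe, ← hmv, ← hev]; rfl
  · rintro ⟨u, hu, hm, rfl⟩
    refine ⟨u, cNearCl_of_contDiff (by exact_mod_cast hu.1), ?_, ?_⟩
    · change mass Ω u ≠ 0; rw [hm]; exact one_ne_zero
    · change _ = energy Ω B A u / mass Ω u; rw [hm, div_one]

lemma exists_bound {Ω : Set Plane} (hb : Bornology.IsBounded Ω) {g : Plane → ℝ}
    (hg : Continuous g) : ∃ K, 0 ≤ K ∧ ∀ x ∈ Ω, g x ≤ K := by
  obtain ⟨K, hK⟩ := hb.isCompact_closure.exists_bound_of_continuousOn hg.continuousOn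
  exact ⟨max K 0, le_max_right _ _, fun x hx =>
    ((le_abs_self _).trans (hK x (subset_closure hx))).trans (le_max_left _ _)⟩

lemma magSq_rmul_le {B : ℝ} {A : Plane → Plane} {f : Plane → ℝ} {u : Plane → ℂ} {x : Plane}
    (hf : DifferentiableAt ℝ f x) (hu : DifferentiableAt ℝ u x) :
    magSq B A (rmul f u) x ≤ 2 * f x ^ 2 * magSq B A u x + 2 * gradSq f x * ‖u x‖ ^ 2 := by
  have key : ∀ (v : Plane) (a : ℝ),
      ‖(-Complex.I) * fderiv ℝ (rmul f u) x v - ((B * a : ℝ) : ℂ) * rmul f u x‖ ^ 2 ≤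
      2 * f x ^ 2 * ‖(-Complex.I) * fderiv ℝ u x v - ((B * a : ℝ) : ℂ) * u x‖ ^ 2 +
        2 * fderiv ℝ f x v ^ 2 * ‖u x‖ ^ 2 := by
    intro v a
    have : (-Complex.I) * fderiv ℝ (rmul f u) x v - ((B * a : ℝ) : ℂ) * rmul f u x =
        (f x : ℂ) * ((-Complex.I) * fderiv ℝ u x v - ((B * a : ℝ) : ℂ) * u x) +
        (fderiv ℝ f x v : ℂ) * (-Complex.I * u x) := by
      rw [fderiv_rmul hf hu]; simp only [rmul]; ring
    rw [this]
    have h := norm_add_le ((f x : ℂ) * ((-Complex.I) * fderiv ℝ u x v - ((B * a : ℝ) : ℂ) * u x))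
      ((fderiv ℝ f x v : ℂ) * (-Complex.I * u x))
    simp only [norm_mul, Complex.norm_real, Real.norm_eq_abs, norm_neg, Complex.norm_I,
      one_mul] at h
    have h2 := pow_le_pow_left₀ (norm_nonneg _) h 2
    refine h2.trans ((add_sq_le).trans (le_of_eq ?_))
    rw [mul_pow, mul_pow, sq_abs, sq_abs]; ring
  unfold magSq gradSq
  have h1 := key ((1 : ℝ), (0 : ℝ)) (A x).1
  have h2 := key ((0 : ℝ), (1 : ℝ)) (A x).2
  linarith

/-- Agmon-type localization estimates for near-minimizers. -/
lemma exists_localized_near_min {Ω S : Set Plane} (hΩ : IsOpen Ω) (hb : Bornology.IsBounded Ω)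
    {B : ℝ} {A : Plane → Plane} (hA : Continuous A) (hne : ∃ u, Cls Ω S u ∧ mass Ω u ≠ 0)
    {n : ℕ} (f : Fin n → Plane → ℝ) (hf : ∀ i, ContDiff ℝ 1 (f i)) {ε : ℝ} (hε : 0 < ε) :
    ∃ u, Cls Ω S u ∧ mass Ω u = 1 ∧ energy Ω B A u ≤ lamS Ω S B A + ε ∧
      ∀ i, energy Ω B A (rmul (f i) u) - lamS Ω S B A * mass Ω (rmul (f i) u) ≤
        (∫ x in Ω, gradSq (f i) x * ‖u x‖ ^ 2) + ε := by
  set E := lamS Ω S B A with hE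
  have hE0 : 0 ≤ E := lamS_nonneg _ _ _ _
  have hK : ∀ i, ∃ K, 0 ≤ K ∧ ∀ u, Cls Ω S u → mass Ω u = 1 → energy Ω B A u ≤ E + 1 →
      energy Ω B A (rmul (fun y => f i y ^ 2) u) ≤ K := by
    intro i
    have hg : ContDiff ℝ 1 (fun y => f i y ^ 2) := (hf i).pow 2
    obtain ⟨K1, hK1, hK1'⟩ := exists_bound hb (g := fun y => (f i y ^ 2) ^ 2)
      (hg.continuous.pow 2)
    obtain ⟨K2, hK2, hK2'⟩ := exists_bound hb (continuous_gradSq hg)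
    refine ⟨2 * K1 * (E + 1) + 2 * K2, by positivity, fun u hu hm he => ?_⟩
    have i1 := integrableOn_of_bdd hb (continuous_magSq (B := B) hA hu.1)
    have i2 : IntegrableOn (fun x => ‖u x‖ ^ 2) Ω :=
      integrableOn_of_bdd hb (hu.1.continuous.norm.pow 2)
    have i3 := integrableOn_of_bdd hb (continuous_magSq (B := B) hA (contDiff_rmul hg hu.1))
    have : energy Ω B A (rmul (fun y => f i y ^ 2) u) ≤
        ∫ x in Ω, (2 * K1 * magSq B A u x + 2 * K2 * ‖u x‖ ^ 2) := by
      refine setIntegral_mono_on i3 ((i1.const_mul _).add (i2.const_mul _)) hΩ.measurableSet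
        fun x hx => ?_
      refine (magSq_rmul_le (hg.differentiable one_ne_zero x)
        (hu.1.differentiable one_ne_zero x)).trans ?_
      have := magSq_nonneg B A u x
      have h1 := hK1' x hx
      have h2 := hK2' x hx
      gcongr
    rw [integral_add (i1.const_mul _) (i2.const_mul _), integral_const_mul,
      integral_const_mul] at this
    change _ ≤ 2 * K1 * energy Ω B A u + 2 * K2 * mass Ω u at this
    rw [hm, mul_one] at this
    refine this.trans ?_
    gcongr
  choose K hK0 hK using hK
  set M := ∑ i, K i with hM
  have hKM : ∀ i, K i ≤ M := fun i =>
    Finset.single_le_sum (f := K) (fun j _ => hK0 j) (Finset.mem_univ i)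
  have hM0 : 0 ≤ M := Finset.sum_nonneg fun i _ => hK0 i
  set η := ε / (M + 1) with hη
  have hη0 : 0 < η := by positivity
  obtain ⟨u, hu, hm, he⟩ := lamS_near (B := B) (A := A) hne
    (δ := min (min ε 1) (η * ε)) (by positivity)
  have he1 : energy Ω B A u ≤ E + ε := he.trans (by
    gcongr; exact (min_le_left _ _).trans (min_le_left _ _))
  have he2 : energy Ω B A u ≤ E + 1 := he.trans (by
    gcongr; exact (min_le_left _ _).trans (min_le_right _ _))
  have he3 : energy Ω B A u ≤ E + η * ε := he.trans (by
    gcongr; exact (min_le_right _ _))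
  refine ⟨u, hu, hm, he1, fun i => ?_⟩
  have h1 := shifted_energy_expand hb (B := B) (E := E) hA (hf i) hu.1 η
  have hc : ContDiff ℝ 1 (fun y => 1 - η * f i y ^ 2) :=
    contDiff_const.sub (contDiff_const.mul ((hf i).pow 2))
  have h2 := lamS_mul_mass_le (B := B) (A := A) (hu.rmul hc)
  have h3 := (hK i u hu hm he2).trans (hKM i)
  have h4 := mul_nonneg hE0 (mass_nonneg Ω (rmul (fun y => f i y ^ 2) u))
  rw [hm] at h1
  set X := energy Ω B A (rmul (f i) u) - E * mass Ω (rmul (f i) u) -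
    ∫ x in Ω, gradSq (f i) x * ‖u x‖ ^ 2 with hX
  have h5 : 2 * η * X ≤ η * ε + η ^ 2 * M := by
    have : η ^ 2 * (energy Ω B A (rmul (fun y => f i y ^ 2) u) -
        E * mass Ω (rmul (fun y => f i y ^ 2) u)) ≤ η ^ 2 * M := by
      gcongr; linarith
    rw [← hE] at h2
    linarith
  have h6 : η * M ≤ ε := by
    rw [hη, div_mul_eq_mul_div, div_le_iff₀ (by positivity)]; nlinarith
  have h7 : η * (2 * X) ≤ η * (2 * ε) := by nlinarith
  have h8 := le_of_mul_le_mul_left h7 hη0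
  linarith

lemma exists_cls_univ {Ω : Set Plane} (hΩ : IsOpen Ω) (hb : Bornology.IsBounded Ω)
    (hne : Ω.Nonempty) : ∃ u, Cls Ω Set.univ u ∧ mass Ω u ≠ 0 := by
  refine ⟨fun _ => 1, ⟨contDiff_const, fun x _ h => absurd (Set.mem_univ x) h⟩, ?_⟩
  have h1 : 0 < volume Ω := hΩ.measure_pos volume hne
  have h2 : volume Ω < ⊤ := hb.measure_lt_top
  simp only [mass, norm_one, one_pow, integral_const, smul_eq_mul, mul_one]
  simp only [Measure.real, Measure.restrict_apply_univ]
  exact (ENNReal.toReal_pos h1.ne' h2.ne).ne'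

end SC

namespace SC

/-! ### The interior lower bound -/

lemma integral_fderiv_mul_comm {p q : Plane → ℝ} (hp : ContDiff ℝ 1 p) (hpc : HasCompactSupport p)
    (hq : ContDiff ℝ 1 q) (hqc : HasCompactSupport q) (v w : Plane) :
    ∫ x, fderiv ℝ p x w * fderiv ℝ q x v = ∫ x, fderiv ℝ q x w * fderiv ℝ p x v := by
  obtain ⟨Cp, hCp⟩ := ContDiff.lipschitzWith_of_hasCompactSupport hpc hp one_ne_zero
  obtain ⟨Cq, hCq⟩ := ContDiff.lipschitzWith_of_hasCompactSupport hqc hq one_ne_zero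
  have cp : Continuous fun x => fderiv ℝ p x v :=
    (hp.continuous_fderiv one_ne_zero).clm_apply continuous_const
  have cq : Continuous fun x => fderiv ℝ q x v :=
    (hq.continuous_fderiv one_ne_zero).clm_apply continuous_const
  have dp := hp.differentiable one_ne_zero
  have dq := hq.differentiable one_ne_zero
  have sp : HasCompactSupport fun x => fderiv ℝ p x v :=
    (hpc.fderiv ℝ).comp_left (g := fun l : Plane →L[ℝ] ℝ => l v) (by simp)
  have sq : HasCompactSupport fun x => fderiv ℝ q x v :=
    (hqc.fderiv ℝ).comp_left (g := fun l : Plane →L[ℝ] ℝ => l v) (by simp)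
  have t1 := hCp.integral_inv_smul_sub_mul_tendsto_integral_lineDeriv_mul
    (μ := (volume : Measure Plane)) (cq.integrable_of_hasCompactSupport sq) w
  have t2 := hCq.integral_inv_smul_sub_mul_tendsto_integral_lineDeriv_mul
    (μ := (volume : Measure Plane)) (cp.integrable_of_hasCompactSupport sp) (-w)
  have e1 : ∀ x, lineDeriv ℝ p x w = fderiv ℝ p x w := fun x => (dp x).lineDeriv_eq_fderiv
  have e2 : ∀ x, lineDeriv ℝ q x (-w) = -fderiv ℝ q x w := fun x => by
    rw [(dq x).lineDeriv_eq_fderiv, map_neg]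
  simp only [e1] at t1
  simp only [e2, neg_mul, integral_neg] at t2
  have key : ∀ t : ℝ, ∫ x, (t⁻¹ • (p (x + t • w) - p x)) * fderiv ℝ q x v =
      -∫ x, (t⁻¹ • (q (x + t • (-w)) - q x)) * fderiv ℝ p x v := by
    intro t
    set φ : Plane → ℝ := fun x => t⁻¹ • (p (x + t • w) - p x) with hφ
    have dshift : ∀ x, DifferentiableAt ℝ (fun x => p (x + t • w)) x := fun x =>
      (dp _).comp x ((differentiableAt_id).add_const _)
    have fshift : ∀ x, fderiv ℝ (fun x => p (x + t • w)) x = fderiv ℝ p (x + t • w) := fun x => by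
      rw [fderiv_comp_add_right]
    have hφd : Differentiable ℝ φ := fun x =>
      ((dshift x).fun_sub (dp x)).fun_const_smul t⁻¹
    have hφ' : ∀ x, fderiv ℝ φ x v = t⁻¹ * (fderiv ℝ p (x + t • w) v - fderiv ℝ p x v) := by
      intro x
      rw [hφ, fderiv_fun_const_smul ((dshift x).fun_sub (dp x)), fderiv_fun_sub (dshift x) (dp x), fshift]
      simp
    have cφ : Continuous φ := hφd.continuous
    have cφ' : Continuous fun x => fderiv ℝ φ x v := by
      simp only [hφ']
      exact continuous_const.mul ((cp.comp (continuous_id.add continuous_const)).sub cp)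
    have ibp := integral_mul_fderiv_eq_neg_fderiv_mul_of_integrable (μ := (volume : Measure Plane))
      (f := φ) (g := q) (v := v)
      ((cφ'.mul hq.continuous).integrable_of_hasCompactSupport hqc.mul_left)
      ((cφ.mul cq).integrable_of_hasCompactSupport sq.mul_left)
      ((cφ.mul hq.continuous).integrable_of_hasCompactSupport hqc.mul_left)
      (fun x _ => hφd x) (fun x _ => dq x)
    rw [ibp]
    congr 1
    have i1 : Integrable (fun x => t⁻¹ * (fderiv ℝ p (x + t • w) v * q x)) :=
      Integrable.const_mul (((cp.comp (continuous_id.add continuous_const)).mul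
        hq.continuous).integrable_of_hasCompactSupport hqc.mul_left) _
    have i2 : Integrable (fun x => t⁻¹ * (fderiv ℝ p x v * q x)) :=
      Integrable.const_mul ((cp.mul hq.continuous).integrable_of_hasCompactSupport hqc.mul_left) _
    have i3 : Integrable (fun x => t⁻¹ * (fderiv ℝ p x v * q (x + t • (-w)))) :=
      Integrable.const_mul ((cp.mul (hq.continuous.comp
        (continuous_id.add continuous_const))).integrable_of_hasCompactSupport sp.mul_right) _
    calc ∫ x, fderiv ℝ φ x v * q x
        = ∫ x, (t⁻¹ * (fderiv ℝ p (x + t • w) v * q x) - t⁻¹ * (fderiv ℝ p x v * q x)) := by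
          congr 1; funext x; rw [hφ']; ring
      _ = (∫ x, t⁻¹ * (fderiv ℝ p (x + t • w) v * q x)) - ∫ x, t⁻¹ * (fderiv ℝ p x v * q x) :=
          integral_sub i1 i2
      _ = (∫ x, t⁻¹ * (fderiv ℝ p x v * q (x + t • (-w)))) -
            ∫ x, t⁻¹ * (fderiv ℝ p x v * q x) := by
          congr 1
          rw [← integral_add_right_eq_self
            (fun x => t⁻¹ * (fderiv ℝ p x v * q (x + t • (-w)))) (t • w)]
          congr 1; funext x; simp [add_assoc]
      _ = ∫ x, (t⁻¹ * (fderiv ℝ p x v * q (x + t • (-w))) - t⁻¹ * (fderiv ℝ p x v * q x)) :=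
          (integral_sub i3 i2).symm
      _ = _ := by congr 1; funext x; simp only [smul_eq_mul]; ring
  simp only [key] at t1
  have := tendsto_nhds_unique t1 t2.neg
  simpa using this

lemma fderiv_re_im {w : Plane → ℂ} {x : Plane} (hw : DifferentiableAt ℝ w x) (v : Plane) :
    fderiv ℝ (fun y => (w y).re) x v = (fderiv ℝ w x v).re ∧
    fderiv ℝ (fun y => (w y).im) x v = (fderiv ℝ w x v).im := by
  have h1 := (Complex.reCLM.hasFDerivAt (x := w x)).comp x hw.hasFDerivAt
  have h2 := (Complex.imCLM.hasFDerivAt (x := w x)).comp x hw.hasFDerivAt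
  constructor
  · have : HasFDerivAt (fun y => (w y).re) (Complex.reCLM.comp (fderiv ℝ w x)) x := h1
    rw [this.fderiv]; rfl
  · have : HasFDerivAt (fun y => (w y).im) (Complex.imCLM.comp (fderiv ℝ w x)) x := h2
    rw [this.fderiv]; rfl

lemma magSq_ge {B : ℝ} {A : Plane → Plane} {w : Plane → ℂ} {x : Plane}
    (hw : DifferentiableAt ℝ w x) :
    2 * (fderiv ℝ (fun y => (w y).re) x ((0 : ℝ), (1 : ℝ)) *
          fderiv ℝ (fun y => (w y).im) x ((1 : ℝ), (0 : ℝ)) -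
        fderiv ℝ (fun y => (w y).im) x ((0 : ℝ), (1 : ℝ)) *
          fderiv ℝ (fun y => (w y).re) x ((1 : ℝ), (0 : ℝ))) * (-1) +
      B * ((A x).1 * fderiv ℝ (fun y => (w y).re ^ 2 + (w y).im ^ 2) x ((0 : ℝ), (1 : ℝ)) -
        (A x).2 * fderiv ℝ (fun y => (w y).re ^ 2 + (w y).im ^ 2) x ((1 : ℝ), (0 : ℝ)))
      ≤ magSq B A w x := by
  have hr : DifferentiableAt ℝ (fun y => (w y).re) x := Complex.reCLM.differentiableAt.comp x hw
  have hi : DifferentiableAt ℝ (fun y => (w y).im) x := Complex.imCLM.differentiableAt.comp x hw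
  have e : ∀ v, fderiv ℝ (fun y => (w y).re ^ 2 + (w y).im ^ 2) x v =
      2 * (w x).re * (fderiv ℝ w x v).re + 2 * (w x).im * (fderiv ℝ w x v).im := by
    intro v
    rw [fderiv_fun_add (hr.fun_pow 2) (hi.fun_pow 2), fderiv_fun_pow 2 hr, fderiv_fun_pow 2 hi]
    simp [(fderiv_re_im hw v).1, (fderiv_re_im hw v).2]
  simp only [e, (fderiv_re_im hw _).1, (fderiv_re_im hw _).2, magSq,
    ← Complex.normSq_eq_norm_sq, Complex.normSq_apply]
  set a := fderiv ℝ w x ((1 : ℝ), (0 : ℝ))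
  set b := fderiv ℝ w x ((0 : ℝ), (1 : ℝ))
  simp
  nlinarith [sq_nonneg ((a.im - B * (A x).1 * (w x).re) + (b.re + B * (A x).2 * (w x).im)),
    sq_nonneg ((-a.re - B * (A x).1 * (w x).im) + (b.im - B * (A x).2 * (w x).re))]

lemma energy_univ_ge {B : ℝ} {A : Plane → Plane} (hA : ContDiff ℝ 1 A) {w : Plane → ℂ}
    (hw : ContDiff ℝ 1 w) (hc : HasCompactSupport w) :
    B * ∫ x, curl2 A x * ‖w x‖ ^ 2 ≤ ∫ x, magSq B A w x := by
  set p : Plane → ℝ := fun y => (w y).re with hp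
  set q : Plane → ℝ := fun y => (w y).im with hq
  have dp : ContDiff ℝ 1 p := Complex.reCLM.contDiff.comp hw
  have dq : ContDiff ℝ 1 q := Complex.imCLM.contDiff.comp hw
  have sp : HasCompactSupport p := hc.comp_left (g := Complex.re) (by simp)
  have sq : HasCompactSupport q := hc.comp_left (g := Complex.im) (by simp)
  set r : Plane → ℝ := fun y => p y ^ 2 + q y ^ 2 with hr
  have dr : ContDiff ℝ 1 r := (dp.pow 2).add (dq.pow 2)
  have sr : HasCompactSupport r := by
    refine hc.comp_left (g := fun z : ℂ => z.re ^ 2 + z.im ^ 2) (by simp)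
  have hrn : ∀ x, ‖w x‖ ^ 2 = r x := fun x => by
    rw [← Complex.normSq_eq_norm_sq, Complex.normSq_apply]; simp only [hr, hp, hq]; ring
  have dA1 : ContDiff ℝ 1 fun x => (A x).1 := contDiff_fst.comp hA
  have dA2 : ContDiff ℝ 1 fun x => (A x).2 := contDiff_snd.comp hA
  have c : ∀ {g : Plane → ℝ}, ContDiff ℝ 1 g → ∀ v, Continuous fun x => fderiv ℝ g x v :=
    fun hg v => (hg.continuous_fderiv one_ne_zero).clm_apply continuous_const
  have s : ∀ {g : Plane → ℝ}, HasCompactSupport g → ∀ v,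
      HasCompactSupport fun x => fderiv ℝ g x v :=
    fun hg v => (hg.fderiv ℝ).comp_left (g := fun l : Plane →L[ℝ] ℝ => l v) (by simp)
  have ibp : ∀ {g : Plane → ℝ}, ContDiff ℝ 1 g → ∀ v,
      ∫ x, g x * fderiv ℝ r x v = -∫ x, fderiv ℝ g x v * r x := fun hg v =>
    integral_mul_fderiv_eq_neg_fderiv_mul_of_integrable
      (((c hg v).mul dr.continuous).integrable_of_hasCompactSupport sr.mul_left)
      ((hg.continuous.mul (c dr v)).integrable_of_hasCompactSupport (s sr v).mul_left)
      ((hg.continuous.mul dr.continuous).integrable_of_hasCompactSupport sr.mul_left)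
      (fun x _ => hg.differentiable one_ne_zero x) (fun x _ => dr.differentiable one_ne_zero x)
  set e₁ : Plane := ((1 : ℝ), (0 : ℝ))
  set e₂ : Plane := ((0 : ℝ), (1 : ℝ))
  have j1 : Integrable fun x => fderiv ℝ p x e₂ * fderiv ℝ q x e₁ :=
    ((c dp _).mul (c dq _)).integrable_of_hasCompactSupport (s sq _).mul_left
  have j2 : Integrable fun x => fderiv ℝ q x e₂ * fderiv ℝ p x e₁ :=
    ((c dq _).mul (c dp _)).integrable_of_hasCompactSupport (s sp _).mul_left
  have j3 : Integrable fun x => (A x).1 * fderiv ℝ r x e₂ :=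
    (dA1.continuous.mul (c dr _)).integrable_of_hasCompactSupport (s sr _).mul_left
  have j4 : Integrable fun x => (A x).2 * fderiv ℝ r x e₁ :=
    (dA2.continuous.mul (c dr _)).integrable_of_hasCompactSupport (s sr _).mul_left
  have j5 : Integrable fun x => fderiv ℝ (fun y => (A y).2) x e₁ * r x :=
    ((c dA2 _).mul dr.continuous).integrable_of_hasCompactSupport sr.mul_left
  have j6 : Integrable fun x => fderiv ℝ (fun y => (A y).1) x e₂ * r x :=
    ((c dA1 _).mul dr.continuous).integrable_of_hasCompactSupport sr.mul_left
  have hm : Integrable (magSq B A w) := by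
    refine (continuous_magSq hA.continuous hw).integrable_of_hasCompactSupport ?_
    refine HasCompactSupport.of_support_subset_isCompact hc.isCompact fun x hx => ?_
    by_contra h
    have h0 : w =ᶠ[𝓝 x] fun _ => 0 := notMem_tsupport_iff_eventuallyEq.mp h
    exact hx (by simp [magSq, h0.fderiv_eq, h0.self_of_nhds])
  have k1 : Integrable fun x => 2 * (fderiv ℝ p x e₂ * fderiv ℝ q x e₁ -
      fderiv ℝ q x e₂ * fderiv ℝ p x e₁) * (-1) := ((j1.sub j2).const_mul 2).mul_const (-1)
  have k2 : Integrable fun x => B * ((A x).1 * fderiv ℝ r x e₂ - (A x).2 * fderiv ℝ r x e₁) :=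
    (j3.sub j4).const_mul B
  have h1 := integral_mono (k1.add k2) hm fun x => magSq_ge (hw.differentiable one_ne_zero x)
  refine le_trans (le_of_eq ?_) h1
  simp only [Pi.add_apply]
  rw [integral_add k1 k2, integral_mul_const, integral_const_mul, integral_const_mul, integral_sub j1 j2,
    integral_sub j3 j4, integral_fderiv_mul_comm dp sp dq sq e₁ e₂, ibp dA1, ibp dA2, sub_self]
  simp only [hrn, curl2, sub_mul]
  rw [integral_sub j5 j6]
  ring

/-- Extending by zero a function which vanishes near the boundary. -/
lemma contDiff_indicator {Ω : Set Plane} {u : Plane → ℂ} (hu : ContDiff ℝ 1 u) {N : Set Plane}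
    (hN : IsOpen N) (hfr : frontier Ω ⊆ N) (h0 : ∀ x ∈ N, x ∈ Ω → u x = 0) :
    ContDiff ℝ 1 (Ω.indicator u) := by
  rw [contDiff_iff_contDiffAt]
  intro x
  by_cases h1 : x ∈ interior Ω
  · refine hu.contDiffAt.congr_of_eventuallyEq ?_
    filter_upwards [isOpen_interior.mem_nhds h1] with y hy
    rw [Set.indicator_of_mem (interior_subset hy)]
  by_cases h2 : x ∈ frontier Ω
  · refine (contDiffAt_const (c := (0 : ℂ))).congr_of_eventuallyEq ?_
    filter_upwards [hN.mem_nhds (hfr h2)] with y hy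
    by_cases hy' : y ∈ Ω
    · rw [Set.indicator_of_mem hy', h0 y hy hy']
    · rw [Set.indicator_of_notMem hy']
  · have h3 : x ∉ closure Ω := fun h => h2 ⟨h, h1⟩
    refine (contDiffAt_const (c := (0 : ℂ))).congr_of_eventuallyEq ?_
    filter_upwards [isClosed_closure.isOpen_compl.mem_nhds h3] with y hy
    rw [Set.indicator_of_notMem fun h => hy (subset_closure h)]

lemma energy_ge_of_vanish {Ω : Set Plane} (hΩ : IsOpen Ω) (hb : Bornology.IsBounded Ω) {B : ℝ}
    {A : Plane → Plane} (hA : ContDiff ℝ 1 A) {u : Plane → ℂ} (hu : ContDiff ℝ 1 u)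
    {N : Set Plane} (hN : IsOpen N) (hfr : frontier Ω ⊆ N) (h0 : ∀ x ∈ N, x ∈ Ω → u x = 0) :
    B * ∫ x in Ω, curl2 A x * ‖u x‖ ^ 2 ≤ energy Ω B A u := by
  have hw := contDiff_indicator hu hN hfr h0
  have hc : HasCompactSupport (Ω.indicator u) :=
    HasCompactSupport.of_support_subset_isCompact hb.isCompact_closure
      ((Set.support_indicator_subset).trans subset_closure)
  refine (le_of_eq ?_).trans ((energy_univ_ge (B := B) hA hw hc).trans (le_of_eq ?_))
  · rw [← integral_indicator hΩ.measurableSet]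
    congr 2; funext x
    by_cases hx : x ∈ Ω <;> simp [hx]
  · unfold energy
    rw [← integral_indicator hΩ.measurableSet]
    congr 1; funext x
    by_cases hx : x ∈ Ω
    · rw [Set.indicator_of_mem hx]
      have : Ω.indicator u =ᶠ[𝓝 x] u := by
        filter_upwards [hΩ.mem_nhds hx] with y hy
        rw [Set.indicator_of_mem hy]
      simp only [magSq, this.fderiv_eq, this.self_of_nhds]
    · rw [Set.indicator_of_notMem hx]
      have hz : Ω.indicator u x = 0 := Set.indicator_of_notMem hx u
      have : Ω.indicator u =ᶠ[𝓝 x] fun _ => 0 := by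
        by_cases h2 : x ∈ frontier Ω
        · filter_upwards [hN.mem_nhds (hfr h2)] with y hy
          by_cases hy' : y ∈ Ω
          · rw [Set.indicator_of_mem hy', h0 y hy hy']
          · rw [Set.indicator_of_notMem hy']
        · have h3 : x ∉ closure Ω := fun h => h2 ⟨h, fun h' => hx (interior_subset h')⟩
          filter_upwards [isClosed_closure.isOpen_compl.mem_nhds h3] with y hy
          rw [Set.indicator_of_notMem fun h => hy (subset_closure h)]
      simp [magSq, this.fderiv_eq, hz]

end SC

namespace SC

/-! ### Boundary frame and tubular coordinates -/

section Frame

variable {Ω : Set Plane} (P : BoundaryParam Ω)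

/-- Tubular coordinates `(s, t) ↦ γ(s) + t ν(s)`. -/
def tube (γ : ℝ → Plane) (p : ℝ × ℝ) : Plane := γ p.1 + p.2 • nuVec γ p.1

lemma contDiff_tangent : ContDiff ℝ (⊤ : ℕ∞) (deriv P.γ) :=
  (contDiff_infty_iff_deriv.1 P.smooth).2

lemma contDiff_nuVec : ContDiff ℝ (⊤ : ℕ∞) (nuVec P.γ) :=
  (contDiff_snd.comp (contDiff_tangent P)).neg.prodMk (contDiff_fst.comp (contDiff_tangent P))

lemma contDiff_curvOf : ContDiff ℝ (⊤ : ℕ∞) (curvOf P.γ) := by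
  have h1 := (contDiff_infty_iff_deriv.1 (contDiff_tangent P)).2
  have h2 := contDiff_nuVec P
  exact ((contDiff_fst.comp h1).mul (contDiff_fst.comp h2)).add
    ((contDiff_snd.comp h1).mul (contDiff_snd.comp h2))

lemma contDiff_tube : ContDiff ℝ (⊤ : ℕ∞) (tube P.γ) :=
  (P.smooth.comp contDiff_fst).add (contDiff_snd.smul ((contDiff_nuVec P).comp contDiff_fst))

lemma periodic_tangent : Function.Periodic (deriv P.γ) P.L := by
  intro s
  have : (fun x => P.γ (x + P.L)) = P.γ := funext P.periodic
  rw [← deriv_comp_add_const, this]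

lemma periodic_nuVec : Function.Periodic (nuVec P.γ) P.L := by
  intro s; simp only [nuVec, periodic_tangent P s]

lemma periodic_curvOf : Function.Periodic (curvOf P.γ) P.L := by
  intro s
  have : (fun x => deriv P.γ (x + P.L)) = deriv P.γ := funext (periodic_tangent P)
  simp only [curvOf, periodic_nuVec P s]
  rw [← deriv_comp_add_const, this]

lemma tube_add_period (s t : ℝ) : tube P.γ (s + P.L, t) = tube P.γ (s, t) := by
  simp only [tube, P.periodic s, periodic_nuVec P s]

lemma hasDerivAt_gamma (s : ℝ) : HasDerivAt P.γ (deriv P.γ s) s :=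
  ((contDiff_infty_iff_deriv.1 P.smooth).1 s).hasDerivAt

lemma tangent_sq (s : ℝ) : (deriv P.γ s).1 ^ 2 + (deriv P.γ s).2 ^ 2 = 1 := P.unit_speed s

lemma hasDerivAt_tangent (s : ℝ) :
    HasDerivAt (deriv P.γ) (curvOf P.γ s • nuVec P.γ s) s := by
  have h := ((contDiff_infty_iff_deriv.1 (contDiff_tangent P)).1 s).hasDerivAt
  have h1 : HasDerivAt (fun s => (deriv P.γ s).1) (deriv (deriv P.γ) s).1 s :=
    (hasFDerivAt_fst (𝕜 := ℝ) (p := deriv P.γ s)).comp_hasDerivAt s h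
  have h2 : HasDerivAt (fun s => (deriv P.γ s).2) (deriv (deriv P.γ) s).2 s :=
    (hasFDerivAt_snd (𝕜 := ℝ) (p := deriv P.γ s)).comp_hasDerivAt s h
  have h3 := (h1.fun_pow 2).add (h2.fun_pow 2)
  have h4 : ((fun s => (deriv P.γ s).1 ^ 2) + fun s => (deriv P.γ s).2 ^ 2) = fun _ => 1 :=
    funext fun s => tangent_sq P s
  rw [h4] at h3
  have h5 := h3.unique (hasDerivAt_const s (1 : ℝ))
  have h6 := tangent_sq P s
  refine h.congr_deriv ?_
  simp only [curvOf, dot2, nuVec]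
  norm_num at h5
  set T := deriv P.γ s
  set T' := deriv (deriv P.γ) s
  ext
  · simp only [Prod.smul_fst, smul_eq_mul]
    linear_combination T.1 / 2 * h5 - T'.1 * h6
  · simp only [Prod.smul_snd, smul_eq_mul]
    linear_combination T.2 / 2 * h5 - T'.2 * h6

lemma hasDerivAt_nuVec (s : ℝ) :
    HasDerivAt (nuVec P.γ) (-curvOf P.γ s • deriv P.γ s) s := by
  have h := hasDerivAt_tangent P s
  have h1 : HasDerivAt (fun s => (deriv P.γ s).1) (curvOf P.γ s • nuVec P.γ s).1 s :=
    (hasFDerivAt_fst (𝕜 := ℝ) (p := deriv P.γ s)).comp_hasDerivAt s h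
  have h2 : HasDerivAt (fun s => (deriv P.γ s).2) (curvOf P.γ s • nuVec P.γ s).2 s :=
    (hasFDerivAt_snd (𝕜 := ℝ) (p := deriv P.γ s)).comp_hasDerivAt s h
  have h3 : HasDerivAt (nuVec P.γ) _ s := h2.fun_neg.prodMk h1
  refine h3.congr_deriv ?_
  ext <;> simp [nuVec]

/-- The differential of the tubular coordinates. -/
def tubeDeriv (γ : ℝ → Plane) (p : ℝ × ℝ) : ℝ × ℝ →L[ℝ] Plane :=
  (ContinuousLinearMap.fst ℝ ℝ ℝ).smulRight ((1 - p.2 * curvOf γ p.1) • deriv γ p.1) +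
    (ContinuousLinearMap.snd ℝ ℝ ℝ).smulRight (nuVec γ p.1)

lemma hasFDerivAt_tube (p : ℝ × ℝ) : HasFDerivAt (tube P.γ) (tubeDeriv P.γ p) p := by
  have h1 := (hasDerivAt_gamma P p.1).hasFDerivAt.comp p (hasFDerivAt_fst (𝕜 := ℝ) (p := p))
  have h2 := (hasDerivAt_nuVec P p.1).hasFDerivAt.comp p (hasFDerivAt_fst (𝕜 := ℝ) (p := p))
  have h3 : HasFDerivAt (tube P.γ) _ p := h1.add ((hasFDerivAt_snd (𝕜 := ℝ) (p := p)).smul h2)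
  refine h3.congr_fderiv ?_
  ext <;> simp [tubeDeriv] <;> ring

lemma tubeDeriv_apply (p v : ℝ × ℝ) : tubeDeriv P.γ p v =
    (v.1 * (1 - p.2 * curvOf P.γ p.1)) • deriv P.γ p.1 + v.2 • nuVec P.γ p.1 := by
  simp [tubeDeriv, smul_smul]

lemma det_tubeDeriv (p : ℝ × ℝ) : (tubeDeriv P.γ p).det = 1 - p.2 * curvOf P.γ p.1 := by
  have h := tangent_sq P p.1
  rw [ContinuousLinearMap.det, ← LinearMap.det_toMatrix (Module.Basis.finTwoProd ℝ),
    Matrix.det_fin_two]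
  simp [LinearMap.toMatrix_apply, tubeDeriv, nuVec]
  linear_combination (1 - p.2 * curvOf P.γ p.1) * h

/-- The differential as an equivalence, away from the focal set. -/
def tubeEquiv (p : ℝ × ℝ) (hp : 1 - p.2 * curvOf P.γ p.1 ≠ 0) : (ℝ × ℝ) ≃L[ℝ] Plane :=
  ContinuousLinearMap.toContinuousLinearEquivOfDetNeZero (tubeDeriv P.γ p)
    (by rw [det_tubeDeriv]; exact hp)

lemma hasStrictFDerivAt_tube (p : ℝ × ℝ) (hp : 1 - p.2 * curvOf P.γ p.1 ≠ 0) :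
    HasStrictFDerivAt (tube P.γ) (tubeEquiv P p hp : ℝ × ℝ →L[ℝ] Plane) p := by
  have h : HasStrictFDerivAt (tube P.γ) (tubeDeriv P.γ p) p := by
    have := (contDiff_tube P).contDiffAt.hasStrictFDerivAt (x := p) (by simp)
    rwa [(hasFDerivAt_tube P p).fderiv] at this
  exact h

lemma exists_curv_bound : ∃ K, 0 < K ∧ ∀ s, |curvOf P.γ s| ≤ K := by
  obtain ⟨K, hK⟩ := isCompact_Icc.exists_bound_of_continuousOn (s := Icc 0 (0 + P.L))
    (contDiff_curvOf P).continuous.continuousOn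
  refine ⟨max K 1, by positivity, fun s => ?_⟩
  obtain ⟨y, hy, hy'⟩ := (periodic_curvOf P).exists_mem_Ico₀ P.L_pos s
  rw [hy']
  exact (hK y ⟨hy.1, by linarith [hy.2]⟩).trans (le_max_left _ _)

end Frame

end SC

namespace SC

/-- `t₁` is an admissible width of a tubular neighborhood of `∂Ω`, where the curvature is
bounded by `K`. -/
structure IsTube {Ω : Set Plane} (P : BoundaryParam Ω) (K t₁ : ℝ) : Prop where
  pos : 0 < t₁
  K_pos : 0 < K
  curv : ∀ s, |curvOf P.γ s| ≤ K
  small : t₁ * K ≤ 1 / 2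
  inj : ∀ p q : ℝ × ℝ, |p.2| < t₁ → |q.2| < t₁ → tube P.γ p = tube P.γ q →
    p.2 = q.2 ∧ ∃ n : ℤ, p.1 = q.1 + n * P.L
  mem : ∀ p : ℝ × ℝ, 0 < p.2 → p.2 < t₁ → tube P.γ p ∈ Ω
  notMem : ∀ p : ℝ × ℝ, -t₁ < p.2 → p.2 ≤ 0 → tube P.γ p ∉ Ω

section Tube

variable {Ω : Set Plane} {P : BoundaryParam Ω}

lemma exists_tube_injective (P : BoundaryParam Ω) : ∃ t₁ > 0,
    ∀ p q : ℝ × ℝ, |p.2| < t₁ → |q.2| < t₁ → tube P.γ p = tube P.γ q →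
      p.2 = q.2 ∧ ∃ n : ℤ, p.1 = q.1 + n * P.L := by
  have : Fact (0 < P.L) := ⟨P.L_pos⟩
  set f : AddCircle P.L × ℝ → Plane := fun q =>
    P.periodic.lift q.1 + q.2 • (periodic_nuVec P).lift q.1 with hf
  have hfc : ∀ p : ℝ × ℝ, f ((p.1 : AddCircle P.L), p.2) = tube P.γ p := fun p => by
    simp [hf, tube, Function.Periodic.lift_coe]
  have hcont : Continuous f := by
    have h1 : Continuous P.periodic.lift :=
      continuous_coinduced_dom.mpr P.smooth.continuous
    have h2 : Continuous (periodic_nuVec P).lift :=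
      continuous_coinduced_dom.mpr (contDiff_nuVec P).continuous
    exact (h1.comp continuous_fst).add (continuous_snd.smul (h2.comp continuous_fst))
  set S : Set (AddCircle P.L × ℝ) := univ ×ˢ {0} with hS
  have hcomp : IsCompact S := isCompact_univ.prod isCompact_singleton
  have hinj : Set.InjOn f S := by
    rintro ⟨a, t⟩ ha ⟨b, t'⟩ hb hab
    obtain rfl : t = 0 := ha.2
    obtain rfl : t' = 0 := hb.2
    obtain ⟨a', ha', rfl⟩ := (AddCircle.coe_image_Ico_eq P.L 0).symm ▸ (mem_univ a)
    obtain ⟨b', hb', rfl⟩ := (AddCircle.coe_image_Ico_eq P.L 0).symm ▸ (mem_univ b)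
    have h := hab
    rw [hfc (a', 0), hfc (b', 0)] at h
    simp only [tube, zero_smul, add_zero] at h
    rw [zero_add] at ha' hb'
    rw [P.injOn ha' hb' h]
  have hloc : ∀ x ∈ S, ∃ u ∈ 𝓝 x, Set.InjOn f u := by
    rintro ⟨a, t⟩ ha
    obtain rfl : t = 0 := ha.2
    obtain ⟨s, rfl⟩ := QuotientAddGroup.mk_surjective a
    have h0 : (1 : ℝ) - ((s, (0 : ℝ)) : ℝ × ℝ).2 * curvOf P.γ ((s, (0 : ℝ)) : ℝ × ℝ).1 ≠ 0 := by
      simp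
    have hst := hasStrictFDerivAt_tube P (s, 0) h0
    set e := hst.toOpenPartialHomeomorph (tube P.γ)
    have he : e.source ∈ 𝓝 (s, (0 : ℝ)) :=
      e.open_source.mem_nhds hst.mem_toOpenPartialHomeomorph_source
    have hei : Set.InjOn (tube P.γ) e.source := e.injOn
    obtain ⟨U, hU, V, hV, hUV⟩ := mem_nhds_prod_iff.mp he
    have hU' : ((↑) : ℝ → AddCircle P.L) '' U ∈ 𝓝 (s : AddCircle P.L) :=
      QuotientAddGroup.isOpenMap_coe.image_mem_nhds hU
    refine ⟨((↑) '' U) ×ˢ V, prod_mem_nhds hU' hV, ?_⟩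
    rintro ⟨_, x⟩ ⟨⟨a, ha, rfl⟩, hx⟩ ⟨_, y⟩ ⟨⟨b, hb, rfl⟩, hy⟩ hxy
    rw [hfc (a, x), hfc (b, y)] at hxy
    have := hei (hUV ⟨ha, hx⟩) (hUV ⟨hb, hy⟩) hxy
    simp only [Prod.mk.injEq] at this
    rw [this.1, this.2]
  obtain ⟨W, hW, hWi⟩ := hinj.exists_mem_nhdsSet hcomp (fun x _ => hcont.continuousAt) hloc
  obtain ⟨W', hW'o, hSW', hW'W⟩ := mem_nhdsSet_iff_exists.mp hW
  obtain ⟨u, v, hu, hv, hu1, hv1, huv⟩ := generalized_tube_lemma isCompact_univ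
    isCompact_singleton hW'o hSW'
  obtain ⟨t₁, ht₁, hball⟩ := Metric.isOpen_iff.mp hv 0 (hv1 rfl)
  refine ⟨t₁, ht₁, fun p q hp hq h => ?_⟩
  have hp' : ((p.1 : AddCircle P.L), p.2) ∈ W :=
    hW'W (huv ⟨hu1 (mem_univ _), hball (by simpa using hp)⟩)
  have hq' : ((q.1 : AddCircle P.L), q.2) ∈ W :=
    hW'W (huv ⟨hu1 (mem_univ _), hball (by simpa using hq)⟩)
  have h2 := hWi hp' hq' (by rw [hfc, hfc, h])
  simp only [Prod.mk.injEq] at h2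
  refine ⟨h2.2, ?_⟩
  have h3 : ((p.1 - q.1 : ℝ) : AddCircle P.L) = 0 := by
    rw [AddCircle.coe_sub, h2.1, sub_self]
  obtain ⟨n, hn⟩ := (AddCircle.coe_eq_zero_iff P.L).mp h3
  exact ⟨n, by rw [zsmul_eq_mul] at hn; linarith⟩

lemma jac_pos {K t₁ : ℝ} (hsm : t₁ * K ≤ 1 / 2) (hK : ∀ s, |curvOf P.γ s| ≤ K) {p : ℝ × ℝ}
    (hp : |p.2| < t₁) : 1 / 2 ≤ 1 - p.2 * curvOf P.γ p.1 := by
  have h1 : |p.2 * curvOf P.γ p.1| ≤ t₁ * K := by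
    rw [abs_mul]
    exact mul_le_mul hp.le (hK _) (abs_nonneg _) ((abs_nonneg _).trans hp.le)
  have := le_abs_self (p.2 * curvOf P.γ p.1)
  linarith

lemma isOpen_image_tube {t₁ : ℝ}
    (hJ : ∀ p : ℝ × ℝ, |p.2| < t₁ → 1 / 2 ≤ 1 - p.2 * curvOf P.γ p.1) {O : Set (ℝ × ℝ)}
    (hO : IsOpen O) (hsub : ∀ p ∈ O, |p.2| < t₁) : IsOpen (tube P.γ '' O) := by
  rw [isOpen_iff_mem_nhds]
  rintro _ ⟨p, hp, rfl⟩
  have hne : 1 - p.2 * curvOf P.γ p.1 ≠ 0 := by linarith [hJ p (hsub p hp)]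
  rw [← (hasStrictFDerivAt_tube P p hne).map_nhds_eq_of_equiv]
  exact image_mem_map (hO.mem_nhds hp)

lemma exists_mem_frontier {T : Set Plane} (hT : IsPreconnected T) (hΩ : IsOpen Ω)
    (h1 : (T ∩ Ω).Nonempty) (h2 : ∃ x ∈ T, x ∉ Ω) : ∃ x ∈ T, x ∈ frontier Ω := by
  by_contra! hcon
  have hcl : ∀ x ∈ T, x ∉ Ω → x ∉ closure Ω := fun x hx hxΩ hxc =>
    hcon x hx ⟨hxc, fun h => hxΩ (interior_subset h)⟩
  obtain ⟨y, hy, hyΩ⟩ := h2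
  obtain ⟨x, -, hx1, hx2⟩ := hT Ω (closure Ω)ᶜ hΩ isClosed_closure.isOpen_compl
    (fun x hx => by
      by_cases h : x ∈ Ω
      · exact Or.inl h
      · exact Or.inr (hcl x hx h)) h1 ⟨y, hy, hcl y hy hyΩ⟩
  exact hx2 (subset_closure hx1)

lemma exists_isTube (hΩ : IsOpen Ω) (hb : Bornology.IsBounded Ω) (P : BoundaryParam Ω) :
    ∃ K t₁, IsTube P K t₁ := by
  obtain ⟨t₀, ht₀, hinj⟩ := exists_tube_injective P
  obtain ⟨K, hK, hK'⟩ := exists_curv_bound P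
  set t₁ := min t₀ (1 / (2 * K)) with ht₁
  have ht₁0 : 0 < t₁ := by positivity
  have hsm : t₁ * K ≤ 1 / 2 := by
    calc t₁ * K ≤ 1 / (2 * K) * K := by gcongr; exact min_le_right _ _
      _ = 1 / 2 := by field_simp
  have hinj' : ∀ p q : ℝ × ℝ, |p.2| < t₁ → |q.2| < t₁ → tube P.γ p = tube P.γ q →
      p.2 = q.2 ∧ ∃ n : ℤ, p.1 = q.1 + n * P.L := fun p q hp hq =>
    hinj p q (hp.trans_le (min_le_left _ _)) (hq.trans_le (min_le_left _ _))
  have hfr : ∀ p : ℝ × ℝ, |p.2| < t₁ → tube P.γ p ∈ frontier Ω → p.2 = 0 := by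
    intro p hp h
    rw [← P.range_eq] at h
    obtain ⟨s, hs⟩ := h
    exact (hinj' p (s, 0) hp (by simpa using ht₁0) (by rw [← hs]; simp [tube])).1
  have hcont : Continuous (tube P.γ) := (contDiff_tube P).continuous
  have hpre : ∀ a b : ℝ, IsPreconnected (tube P.γ '' (univ ×ˢ Ioo a b)) := fun a b =>
    (isPreconnected_univ.prod isPreconnected_Ioo).image _ hcont.continuousOn
  have hmem : ∀ p : ℝ × ℝ, 0 < p.2 → p.2 < t₁ → tube P.γ p ∈ Ω := by
    intro p hp1 hp2
    by_contra hcon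
    obtain ⟨ε, hε, hin⟩ := P.inward 0
    have h1 : ((tube P.γ '' (univ ×ˢ Ioo 0 t₁)) ∩ Ω).Nonempty := by
      have hm : 0 < min ε t₁ / 2 := by positivity
      have hm1 : min ε t₁ / 2 < ε := by linarith [min_le_left ε t₁]
      have hm2 : min ε t₁ / 2 < t₁ := by linarith [min_le_right ε t₁]
      exact ⟨_, ⟨(0, min ε t₁ / 2), ⟨mem_univ _, hm, hm2⟩, rfl⟩, hin _ ⟨hm, hm1⟩⟩
    obtain ⟨x, ⟨q, hq, rfl⟩, hx⟩ := exists_mem_frontier (hpre 0 t₁) hΩ h1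
      ⟨_, ⟨p, ⟨mem_univ _, hp1, hp2⟩, rfl⟩, hcon⟩
    have := hfr q (by rw [abs_of_pos hq.2.1]; exact hq.2.2) hx
    exact hq.2.1.ne' this
  refine ⟨K, t₁, ht₁0, hK, hK', hsm, hinj', hmem, fun p hp1 hp2 hcon => ?_⟩
  have hopen : ∀ s : ℝ, tube P.γ (s, 0) ∉ Ω := fun s h => by
    have : P.γ s ∈ frontier Ω := P.range_eq ▸ mem_range_self s
    rw [hΩ.frontier_eq] at this
    exact this.2 (by simpa [tube] using h)
  have hp3 : p.2 < 0 := lt_of_le_of_ne hp2 fun h => hopen p.1 (by rw [← h]; exact hcon)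
  have hneg : ∀ q : ℝ × ℝ, -t₁ < q.2 → q.2 < 0 → tube P.γ q ∈ Ω := by
    intro q hq1 hq2
    by_contra hq
    obtain ⟨x, ⟨r, hr, rfl⟩, hx⟩ := exists_mem_frontier (hpre (-t₁) 0) hΩ
      ⟨_, ⟨p, ⟨mem_univ _, hp1, hp3⟩, rfl⟩, hcon⟩ ⟨_, ⟨q, ⟨mem_univ _, hq1, hq2⟩, rfl⟩, hq⟩
    have := hfr r (by rw [abs_of_neg hr.2.2]; linarith [hr.2.1]) hx
    exact hr.2.2.ne this
  have hT : IsOpen (tube P.γ '' (univ ×ˢ Ioo (-t₁) t₁)) :=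
    isOpen_image_tube (t₁ := t₁) (fun q hq => jac_pos hsm hK' hq) (isOpen_univ.prod isOpen_Ioo)
      fun q hq => abs_lt.mpr hq.2
  have hTc : tube P.γ '' (univ ×ˢ Ioo (-t₁) t₁) ⊆ closure Ω := by
    rintro _ ⟨q, hq, rfl⟩
    rcases lt_trichotomy q.2 0 with h | h | h
    · exact subset_closure (hneg q hq.2.1 h)
    · refine frontier_subset_closure ?_
      rw [← P.range_eq]
      exact ⟨q.1, by simp [tube, h]⟩
    · exact subset_closure (hmem q h hq.2.2)
  have hclo : IsOpen (closure Ω) := by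
    have : closure Ω = Ω ∪ tube P.γ '' (univ ×ˢ Ioo (-t₁) t₁) := by
      refine subset_antisymm (fun x hx => ?_) (union_subset subset_closure hTc)
      by_cases hxΩ : x ∈ Ω
      · exact Or.inl hxΩ
      · have : x ∈ frontier Ω := ⟨hx, fun h => hxΩ (interior_subset h)⟩
        rw [← P.range_eq] at this
        obtain ⟨s, rfl⟩ := this
        exact Or.inr ⟨(s, 0), ⟨mem_univ _, by simpa using ht₁0⟩, by simp [tube]⟩
    rw [this]
    exact hΩ.union hT
  have huniv : closure Ω = univ :=
    IsClopen.eq_univ ⟨isClosed_closure, hclo⟩ ⟨_, subset_closure hcon⟩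
  have hbc := hb.closure
  rw [huniv] at hbc
  exact NormedSpace.unbounded_univ ℝ Plane hbc

end Tube

end SC

namespace SC

section Descent

variable {Ω : Set Plane} {P : BoundaryParam Ω} {K t₁ : ℝ}

lemma IsTube.jac (hT : IsTube P K t₁) {p : ℝ × ℝ} (hp : |p.2| < t₁) :
    1 / 2 ≤ 1 - p.2 * curvOf P.γ p.1 := jac_pos hT.small hT.curv hp

/-- A function of tubular coordinates, compatible with the identifications made by the tube map
and supported in a set with closed image, descends to the plane. -/
lemma exists_descent (hT : IsTube P K t₁) {E : Type*} [NormedAddCommGroup E] [NormedSpace ℝ E]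
    {O K' : Set (ℝ × ℝ)} (hO : IsOpen O) (hsub : ∀ p ∈ O, |p.2| < t₁) {F : ℝ × ℝ → E}
    (hF : ContDiff ℝ 1 F)
    (hcons : ∀ p ∈ O, ∀ q ∈ O, tube P.γ p = tube P.γ q → F p = F q) (hK' : K' ⊆ O)
    (hcl : IsClosed (tube P.γ '' K')) (h0 : ∀ p ∈ O, p ∉ K' → F p = 0) :
    ∃ G : Plane → E, ContDiff ℝ 1 G ∧ (∀ p ∈ O, G (tube P.γ p) = F p) ∧
      ∀ x, x ∉ tube P.γ '' K' → G x = 0 := by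
  classical
  set G : Plane → E := fun x => if h : ∃ p ∈ O, tube P.γ p = x then F h.choose else 0 with hG
  have h1 : ∀ p ∈ O, G (tube P.γ p) = F p := fun p hp => by
    have h : ∃ q ∈ O, tube P.γ q = tube P.γ p := ⟨p, hp, rfl⟩
    simp only [hG, dif_pos h]
    exact hcons _ h.choose_spec.1 _ hp h.choose_spec.2
  have h2 : ∀ x, x ∉ tube P.γ '' K' → G x = 0 := fun x hx => by
    by_cases h : ∃ p ∈ O, tube P.γ p = x
    · obtain ⟨p, hp, rfl⟩ := h
      rw [h1 p hp]
      exact h0 p hp fun hpK => hx ⟨p, hpK, rfl⟩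
    · simp only [hG, dif_neg h]
  refine ⟨G, contDiff_iff_contDiffAt.mpr fun x => ?_, h1, h2⟩
  by_cases hx : x ∈ tube P.γ '' K'
  · obtain ⟨p, hpK, rfl⟩ := hx
    have hp := hK' hpK
    have hne : 1 - p.2 * curvOf P.γ p.1 ≠ 0 := by linarith [hT.jac (hsub p hp)]
    have hs := hasStrictFDerivAt_tube P p hne
    set e := hs.toOpenPartialHomeomorph (tube P.γ) with he
    have hpe : p ∈ e.source := hs.mem_toOpenPartialHomeomorph_source
    have htp : tube P.γ p ∈ e.target := hs.image_mem_toOpenPartialHomeomorph_target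
    have hep : e.symm (tube P.γ p) = p := e.left_inv hpe
    have hcd : ContDiffAt ℝ 1 e.symm (tube P.γ p) := by
      refine e.contDiffAt_symm (f₀' := tubeEquiv P p hne) htp ?_ ?_
      · rw [hep]; exact hs.hasFDerivAt
      · rw [hep]; exact (contDiff_tube P).contDiffAt.of_le (by simp)
    have hco : ContDiffAt ℝ 1 (fun y => F (e.symm y)) (tube P.γ p) := hF.contDiffAt.comp _ hcd
    refine hco.congr_of_eventuallyEq ?_
    have hev : ∀ᶠ y in 𝓝 (tube P.γ p), e.symm y ∈ O :=
      (e.continuousAt_symm htp).eventually_mem (by rw [hep]; exact hO.mem_nhds hp)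
    filter_upwards [hev, e.open_target.mem_nhds htp] with y hy hyt
    have : tube P.γ (e.symm y) = y := e.right_inv hyt
    rw [← h1 _ hy, this]
  · have : G =ᶠ[𝓝 x] fun _ => 0 := by
      filter_upwards [hcl.isOpen_compl.mem_nhds hx] with y hy using h2 y hy
    exact contDiffAt_const.congr_of_eventuallyEq this

/-- The image of a horizontal strip is compact. -/
lemma isClosed_image_strip (P : BoundaryParam Ω) (r : ℝ) :
    IsClosed (tube P.γ '' (univ ×ˢ Icc (-r) r)) := by
  have h : tube P.γ '' (univ ×ˢ Icc (-r) r) = tube P.γ '' (Icc 0 P.L ×ˢ Icc (-r) r) := by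
    refine subset_antisymm ?_ (image_mono (prod_mono (subset_univ _) subset_rfl))
    rintro _ ⟨⟨s, t⟩, ⟨-, ht⟩, rfl⟩
    have hper : Function.Periodic (fun s => tube P.γ (s, t)) P.L :=
      fun s => tube_add_period P s t
    obtain ⟨y, hy, hy'⟩ := hper.exists_mem_Ico₀ P.L_pos s
    exact ⟨(y, t), ⟨⟨hy.1, hy.2.le⟩, ht⟩, hy'.symm⟩
  rw [h]
  exact ((isCompact_Icc.prod isCompact_Icc).image (contDiff_tube P).continuous).isClosed

lemma isClosed_image_rect (P : BoundaryParam Ω) (a b c d : ℝ) :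
    IsClosed (tube P.γ '' (Icc a b ×ˢ Icc c d)) :=
  ((isCompact_Icc.prod isCompact_Icc).image (contDiff_tube P).continuous).isClosed

/-- The tube map is injective on one period. -/
lemma IsTube.injOn_rect (hT : IsTube P K t₁) (a : ℝ) :
    InjOn (tube P.γ) (Ioo a (a + P.L) ×ˢ Ioo (-t₁) t₁) := by
  rintro ⟨s, t⟩ ⟨hs, ht⟩ ⟨s', t'⟩ ⟨hs', ht'⟩ h
  obtain ⟨h2, n, hn⟩ := hT.inj _ _ (abs_lt.mpr ht) (abs_lt.mpr ht') h
  simp only [mem_Ioo] at *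
  have hL := P.L_pos
  have hn0 : n = 0 := by
    have h1 : (n : ℝ) * P.L < 1 * P.L := by linarith [hs.2, hs'.1]
    have h3 : (-1 : ℝ) * P.L < n * P.L := by linarith [hs.1, hs'.2]
    have h4 := lt_of_mul_lt_mul_right h1 hL.le
    have h5 := lt_of_mul_lt_mul_right h3 hL.le
    have h6 : n < 1 := by exact_mod_cast h4
    have h7 : -1 < n := by exact_mod_cast h5
    omega
  subst hn0
  simp at hn
  rw [hn, h2]

/-- Change of variables on one period of the tube. -/
lemma IsTube.integral_eq (hT : IsTube P K t₁) (hΩ : IsOpen Ω) (a : ℝ) {g : Plane → ℝ}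
    (hg : ∀ x ∈ Ω, x ∉ tube P.γ '' (Ioo a (a + P.L) ×ˢ Ioo 0 t₁) → g x = 0) :
    ∫ x in Ω, g x = ∫ p in Ioo a (a + P.L) ×ˢ Ioo 0 t₁,
      (1 - p.2 * curvOf P.γ p.1) * g (tube P.γ p) := by
  set R := Ioo a (a + P.L) ×ˢ Ioo 0 t₁ with hR
  have hRm : MeasurableSet R := (isOpen_Ioo.prod isOpen_Ioo).measurableSet
  have hRs : ∀ p ∈ R, |p.2| < t₁ := fun p hp => by
    rw [abs_of_pos hp.2.1]; exact hp.2.2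
  have hsub : tube P.γ '' R ⊆ Ω := by
    rintro _ ⟨p, hp, rfl⟩
    exact hT.mem p hp.2.1 hp.2.2
  rw [setIntegral_eq_of_subset_of_forall_sdiff_eq_zero hΩ.measurableSet hsub
    fun x hx => hg x hx.1 hx.2]
  rw [integral_image_eq_integral_abs_det_fderiv_smul volume hRm
    (fun p _ => (hasFDerivAt_tube P p).hasFDerivWithinAt)
    ((hT.injOn_rect a).mono (prod_mono subset_rfl (Ioo_subset_Ioo_left (by linarith [hT.pos]))))]
  refine setIntegral_congr_fun hRm fun p hp => ?_
  simp only [det_tubeDeriv, smul_eq_mul]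
  rw [abs_of_pos (by linarith [hT.jac (hRs p hp)])]

lemma fderiv_tube_comp {E : Type*} [NormedAddCommGroup E] [NormedSpace ℝ E] {u : Plane → E}
    (hu : ContDiff ℝ 1 u) (p v : ℝ × ℝ) :
    fderiv ℝ (fun q => u (tube P.γ q)) p v = fderiv ℝ u (tube P.γ p) (tubeDeriv P.γ p v) := by
  have h := ((hu.differentiable one_ne_zero) (tube P.γ p)).hasFDerivAt.comp p
    (hasFDerivAt_tube P p)
  have h' : HasFDerivAt (fun q => u (tube P.γ q)) _ p := h
  rw [h'.fderiv]
  rfl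

lemma fderiv_tube_normal {E : Type*} [NormedAddCommGroup E] [NormedSpace ℝ E] {u : Plane → E}
    (hu : ContDiff ℝ 1 u) (p : ℝ × ℝ) :
    fderiv ℝ (fun q => u (tube P.γ q)) p (0, 1) =
      fderiv ℝ u (tube P.γ p) (nuVec P.γ p.1) := by
  rw [fderiv_tube_comp hu, tubeDeriv_apply]; simp

lemma fderiv_tube_tangent {E : Type*} [NormedAddCommGroup E] [NormedSpace ℝ E] {u : Plane → E}
    (hu : ContDiff ℝ 1 u) (p : ℝ × ℝ) :
    fderiv ℝ (fun q => u (tube P.γ q)) p (1, 0) =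
      (1 - p.2 * curvOf P.γ p.1) • fderiv ℝ u (tube P.γ p) (deriv P.γ p.1) := by
  rw [fderiv_tube_comp hu, tubeDeriv_apply]; simp

lemma frame_sum_aux (X : Plane →L[ℝ] ℂ) {c d : ℝ} (h : c ^ 2 + d ^ 2 = 1) :
    ‖X (1, 0)‖ ^ 2 + ‖X (0, 1)‖ ^ 2 = ‖X (c, d)‖ ^ 2 + ‖X (-d, c)‖ ^ 2 := by
  have e1 : X (c, d) = c • X (1, 0) + d • X (0, 1) := by
    rw [← map_smul, ← map_smul, ← map_add]; simp
  have e2 : X (-d, c) = (-d) • X (1, 0) + c • X (0, 1) := by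
    rw [← map_smul, ← map_smul, ← map_add]; simp
  rw [e1, e2]
  simp only [← Complex.normSq_eq_norm_sq, Complex.normSq_apply]
  simp
  linear_combination (-((X (1, 0)).re ^ 2 + (X (1, 0)).im ^ 2 + (X (0, 1)).re ^ 2 +
    (X (0, 1)).im ^ 2)) * h

/-- The magnetic density in the moving frame. -/
lemma magSq_frame (B : ℝ) (A : Plane → Plane) (u : Plane → ℂ) (x : Plane) (s : ℝ) :
    magSq B A u x =
      ‖(-Complex.I) * fderiv ℝ u x (deriv P.γ s) -
        ((B * dot2 (A x) (deriv P.γ s) : ℝ) : ℂ) * u x‖ ^ 2 +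
      ‖(-Complex.I) * fderiv ℝ u x (nuVec P.γ s) -
        ((B * dot2 (A x) (nuVec P.γ s) : ℝ) : ℂ) * u x‖ ^ 2 := by
  set X : Plane →L[ℝ] ℂ := (-Complex.I) • fderiv ℝ u x -
    ((B * (A x).1) • ContinuousLinearMap.fst ℝ ℝ ℝ +
      (B * (A x).2) • ContinuousLinearMap.snd ℝ ℝ ℝ).smulRight (u x) with hX
  have hXa : ∀ v : Plane, X v = (-Complex.I) * fderiv ℝ u x v -
      ((B * dot2 (A x) v : ℝ) : ℂ) * u x := fun v => by
    simp [hX, dot2]; left; ring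
  have h := frame_sum_aux X (tangent_sq P s)
  simp only [hXa] at h
  unfold magSq nuVec
  simp only [dot2, mul_one, mul_zero, add_zero, zero_add] at h ⊢
  exact h

end Descent

end SC

namespace SC

/-! ### Parametric integrals and the gauge function -/

section Parametric

variable {E : Type*} [NormedAddCommGroup E] [NormedSpace ℝ E]

lemma hasDerivAt_slice_fst {g : ℝ × ℝ → E} (hg : ContDiff ℝ 1 g) (s t : ℝ) :
    HasDerivAt (fun x => g (x, t)) (fderiv ℝ g (s, t) (1, 0)) s :=
  ((hg.differentiable one_ne_zero) (s, t)).hasFDerivAt.comp_hasDerivAt s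
    ((hasDerivAt_id s).prodMk (hasDerivAt_const s t))

lemma hasDerivAt_slice_snd {g : ℝ × ℝ → E} (hg : ContDiff ℝ 1 g) (s t : ℝ) :
    HasDerivAt (fun x => g (s, x)) (fderiv ℝ g (s, t) (0, 1)) t :=
  ((hg.differentiable one_ne_zero) (s, t)).hasFDerivAt.comp_hasDerivAt t
    ((hasDerivAt_const t s).prodMk (hasDerivAt_id t))

lemma continuous_fderiv_dir {g : ℝ × ℝ → E} (hg : ContDiff ℝ 1 g) (v : ℝ × ℝ) :
    Continuous fun p => fderiv ℝ g p v :=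
  (hg.continuous_fderiv one_ne_zero).clm_apply continuous_const

lemma hasDerivAt_parametric [CompleteSpace E] {g : ℝ × ℝ → E} (hg : ContDiff ℝ 1 g)
    (a b s : ℝ) :
    HasDerivAt (fun x => ∫ t in a..b, g (x, t)) (∫ t in a..b, fderiv ℝ g (s, t) (1, 0)) s := by
  have hc := continuous_fderiv_dir hg (1, 0)
  obtain ⟨C, hC⟩ := ((isCompact_Icc (a := s - 1) (b := s + 1)).prod
    (isCompact_uIcc (a := a) (b := b))).exists_bound_of_continuousOn hc.continuousOn
  have hgs : ∀ x, Continuous fun t => g (x, t) := fun x =>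
    hg.continuous.comp (Continuous.prodMk_right x)
  have hgs' : ∀ x, Continuous fun t => fderiv ℝ g (x, t) (1, 0) := fun x =>
    hc.comp (Continuous.prodMk_right x)
  refine (intervalIntegral.hasDerivAt_integral_of_dominated_loc_of_deriv_le
    (F := fun x t => g (x, t)) (F' := fun x t => fderiv ℝ g (x, t) (1, 0)) (bound := fun _ => C)
    (s := Icc (s - 1) (s + 1)) (Icc_mem_nhds (by linarith) (by linarith))
    (Eventually.of_forall fun x => (hgs x).aestronglyMeasurable)
    ((hgs s).intervalIntegrable _ _) (hgs' s).aestronglyMeasurable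
    (Eventually.of_forall fun t ht x hx => hC (x, t) ⟨hx, uIoc_subset_uIcc ht⟩)
    (by simp) (Eventually.of_forall fun t _ x _ => hasDerivAt_slice_fst hg x t)).2

lemma hasStrictFDerivAt_primitive {g : ℝ × ℝ → ℝ} (hg : ContDiff ℝ 1 g) (p : ℝ × ℝ) :
    HasStrictFDerivAt (fun q : ℝ × ℝ => ∫ t in (0 : ℝ)..q.2, g (q.1, t))
      ((ContinuousLinearMap.toSpanSingleton ℝ
        (∫ t in (0 : ℝ)..p.2, fderiv ℝ g (p.1, t) (1, 0))).coprod
        (ContinuousLinearMap.toSpanSingleton ℝ (g p))) p := by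
  have hc := continuous_fderiv_dir hg (1, 0)
  have hgs : ∀ x, Continuous fun t => g (x, t) := fun x =>
    hg.continuous.comp (Continuous.prodMk_right x)
  refine hasStrictFDerivAt_uncurry_coprod (𝕜 := ℝ)
    (f := fun s t => ∫ t' in (0 : ℝ)..t, g (s, t'))
    (f₁ := fun s t => ContinuousLinearMap.toSpanSingleton ℝ
        (∫ t' in (0 : ℝ)..t, fderiv ℝ g (s, t') (1, 0)))
    (f₂ := fun s t => ContinuousLinearMap.toSpanSingleton ℝ (g (s, t)))
    (Eventually.of_forall fun v => (hasDerivAt_parametric hg 0 v.2 v.1).hasFDerivAt)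
    (Eventually.of_forall fun v => ?_) (Continuous.continuousAt ?_) (Continuous.continuousAt ?_)
  · exact (intervalIntegral.integral_hasDerivAt_right ((hgs v.1).intervalIntegrable _ _)
      ((hgs v.1).stronglyMeasurableAtFilter _ _) (hgs v.1).continuousAt).hasFDerivAt
  · have h : Continuous fun p : ℝ × ℝ => ∫ t' in (0 : ℝ)..p.2, fderiv ℝ g (p.1, t') (1, 0) :=
      intervalIntegral.continuous_parametric_primitive_of_continuous
        (f := fun s t => fderiv ℝ g (s, t) (1, 0)) hc
    exact (ContinuousLinearMap.toSpanSingletonCLE (𝕜 := ℝ) (E := ℝ)).continuous.comp h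
  · exact (ContinuousLinearMap.toSpanSingletonCLE (𝕜 := ℝ) (E := ℝ)).continuous.comp hg.continuous

lemma contDiff_primitive {g : ℝ × ℝ → ℝ} (hg : ContDiff ℝ 1 g) :
    ContDiff ℝ 1 (fun q : ℝ × ℝ => ∫ t in (0 : ℝ)..q.2, g (q.1, t)) := by
  rw [contDiff_one_iff_fderiv]
  refine ⟨fun p => (hasStrictFDerivAt_primitive hg p).differentiableAt, ?_⟩
  have hc := continuous_fderiv_dir hg (1, 0)
  have h : Continuous fun p : ℝ × ℝ => ∫ t' in (0 : ℝ)..p.2, fderiv ℝ g (p.1, t') (1, 0) :=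
    intervalIntegral.continuous_parametric_primitive_of_continuous
      (f := fun s t => fderiv ℝ g (s, t) (1, 0)) hc
  have he : fderiv ℝ (fun q : ℝ × ℝ => ∫ t in (0 : ℝ)..q.2, g (q.1, t)) = fun p =>
      (∫ t in (0 : ℝ)..p.2, fderiv ℝ g (p.1, t) (1, 0)) • ContinuousLinearMap.fst ℝ ℝ ℝ +
        g p • ContinuousLinearMap.snd ℝ ℝ ℝ := by
    funext p
    rw [(hasStrictFDerivAt_primitive hg p).hasFDerivAt.fderiv]
    ext <;> simp
  rw [he]
  exact (h.smul continuous_const).add (hg.continuous.smul continuous_const)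

end Parametric

section Gauge

variable {Ω : Set Plane} {P : BoundaryParam Ω}

lemma hasDerivAt_dot2 {f g : ℝ → Plane} {f' g' : Plane} {x : ℝ} (hf : HasDerivAt f f' x)
    (hg : HasDerivAt g g' x) :
    HasDerivAt (fun y => dot2 (f y) (g y)) (dot2 f' (g x) + dot2 (f x) g') x := by
  have a1 : HasDerivAt (fun y => (f y).1) f'.1 x :=
    (hasFDerivAt_fst (𝕜 := ℝ) (p := f x)).comp_hasDerivAt x hf
  have a2 : HasDerivAt (fun y => (f y).2) f'.2 x :=
    (hasFDerivAt_snd (𝕜 := ℝ) (p := f x)).comp_hasDerivAt x hf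
  have b1 : HasDerivAt (fun y => (g y).1) g'.1 x :=
    (hasFDerivAt_fst (𝕜 := ℝ) (p := g x)).comp_hasDerivAt x hg
  have b2 : HasDerivAt (fun y => (g y).2) g'.2 x :=
    (hasFDerivAt_snd (𝕜 := ℝ) (p := g x)).comp_hasDerivAt x hg
  refine ((a1.mul b1).add (a2.mul b2)).congr_deriv ?_
  simp [dot2]; ring

lemma contDiff_dot2 {E : Type*} [NormedAddCommGroup E] [NormedSpace ℝ E] {f g : E → Plane}
    (hf : ContDiff ℝ 1 f) (hg : ContDiff ℝ 1 g) : ContDiff ℝ 1 fun x => dot2 (f x) (g x) :=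
  (hf.fst.mul hg.fst).add (hf.snd.mul hg.snd)

lemma curl2_frame {A : Plane → Plane} {x : Plane} (hA : DifferentiableAt ℝ A x) (s : ℝ) :
    curl2 A x = dot2 (fderiv ℝ A x (deriv P.γ s)) (nuVec P.γ s) -
      dot2 (fderiv ℝ A x (nuVec P.γ s)) (deriv P.γ s) := by
  have e1 : fderiv ℝ (fun y => (A y).1) x = (ContinuousLinearMap.fst ℝ ℝ ℝ).comp (fderiv ℝ A x) :=
    ((hasFDerivAt_fst (𝕜 := ℝ) (p := A x)).comp x hA.hasFDerivAt).fderiv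
  have e2 : fderiv ℝ (fun y => (A y).2) x = (ContinuousLinearMap.snd ℝ ℝ ℝ).comp (fderiv ℝ A x) :=
    ((hasFDerivAt_snd (𝕜 := ℝ) (p := A x)).comp x hA.hasFDerivAt).fderiv
  set X := fderiv ℝ A x
  have h := tangent_sq P s
  have f1 : X (deriv P.γ s) = (deriv P.γ s).1 • X (1, 0) + (deriv P.γ s).2 • X (0, 1) := by
    rw [← map_smul, ← map_smul, ← map_add]; simp
  have f2 : X (nuVec P.γ s) = (-(deriv P.γ s).2) • X (1, 0) + (deriv P.γ s).1 • X (0, 1) := by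
    rw [← map_smul, ← map_smul, ← map_add]; simp [nuVec]
  unfold curl2
  rw [e1, e2, f1, f2]
  simp [dot2, nuVec]
  linear_combination ((X (0, 1)).1 - (X (1, 0)).2) * h

/-- A gauge function normalizing the normal component of the potential. -/
lemma exists_gauge (P : BoundaryParam Ω) {A : Plane → Plane} (hA : ContDiff ℝ 1 A) (a : ℝ) :
    ∃ φ : ℝ × ℝ → ℝ, ContDiff ℝ 1 φ ∧ ∀ p : ℝ × ℝ,
      fderiv ℝ φ p (0, 1) = dot2 (A (tube P.γ p)) (nuVec P.γ p.1) ∧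
      (1 - p.2 * curvOf P.γ p.1) * dot2 (A (tube P.γ p)) (deriv P.γ p.1) -
        fderiv ℝ φ p (1, 0) =
      -∫ t in (0 : ℝ)..p.2, (1 - t * curvOf P.γ p.1) * curl2 A (tube P.γ (p.1, t)) := by
  have hAt : ContDiff ℝ 1 fun p : ℝ × ℝ => A (tube P.γ p) :=
    hA.comp ((contDiff_tube P).of_le (by simp))
  have hν : ContDiff ℝ 1 fun p : ℝ × ℝ => nuVec P.γ p.1 :=
    ((contDiff_nuVec P).of_le (by simp)).comp contDiff_fst
  have hγ : ContDiff ℝ 1 fun p : ℝ × ℝ => deriv P.γ p.1 :=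
    ((contDiff_tangent P).of_le (by simp)).comp contDiff_fst
  have hk : ContDiff ℝ 1 fun p : ℝ × ℝ => curvOf P.γ p.1 :=
    ((contDiff_curvOf P).of_le (by simp)).comp contDiff_fst
  set ωt : ℝ × ℝ → ℝ := fun p => dot2 (A (tube P.γ p)) (nuVec P.γ p.1) with hωt
  set ωs : ℝ × ℝ → ℝ := fun p =>
    (1 - p.2 * curvOf P.γ p.1) * dot2 (A (tube P.γ p)) (deriv P.γ p.1) with hωs
  have hωt1 : ContDiff ℝ 1 ωt := by
    exact contDiff_dot2 hAt hν
  have hωs1 : ContDiff ℝ 1 ωs := by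
    exact (contDiff_const.sub (contDiff_snd.mul hk)).mul (contDiff_dot2 hAt hγ)
  have hω0c : Continuous fun s : ℝ => ωs (s, 0) := hωs1.continuous.comp (by fun_prop)
  set G0 : ℝ → ℝ := fun s => ∫ σ in a..s, ωs (σ, 0) with hG0
  have hG0d : ∀ s, HasDerivAt G0 (ωs (s, 0)) s := fun s =>
    intervalIntegral.integral_hasDerivAt_right (hω0c.intervalIntegrable _ _)
      (hω0c.stronglyMeasurableAtFilter _ _) hω0c.continuousAt
  have hG0c : ContDiff ℝ 1 G0 := by
    rw [contDiff_one_iff_deriv]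
    exact ⟨fun s => (hG0d s).differentiableAt, by
      rw [show deriv G0 = fun s => ωs (s, 0) from funext fun s => (hG0d s).deriv]; exact hω0c⟩
  have hprim := contDiff_primitive hωt1
  refine ⟨fun p => G0 p.1 + ∫ t in (0 : ℝ)..p.2, ωt (p.1, t),
    (hG0c.comp contDiff_fst).add hprim, fun p => ?_⟩
  have hd : HasFDerivAt (fun p : ℝ × ℝ => G0 p.1 + ∫ t in (0 : ℝ)..p.2, ωt (p.1, t)) _ p :=
    ((hG0d p.1).hasFDerivAt.comp p (hasFDerivAt_fst (𝕜 := ℝ) (p := p))).add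
      (hasStrictFDerivAt_primitive hωt1 p).hasFDerivAt
  rw [hd.fderiv]
  refine ⟨by simp [hωt], ?_⟩
  have hdt : ∀ t, HasDerivAt (fun x => ωs (p.1, x)) (fderiv ℝ ωs (p.1, t) (0, 1)) t :=
    fun t => hasDerivAt_slice_snd hωs1 p.1 t
  have hcs : Continuous fun t => fderiv ℝ ωs (p.1, t) (0, 1) :=
    (continuous_fderiv_dir hωs1 (0, 1)).comp (Continuous.prodMk_right p.1)
  have hct : Continuous fun t => fderiv ℝ ωt (p.1, t) (1, 0) :=
    (continuous_fderiv_dir hωt1 (1, 0)).comp (Continuous.prodMk_right p.1)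
  have hftc : ∫ t in (0 : ℝ)..p.2, fderiv ℝ ωs (p.1, t) (0, 1) = ωs (p.1, p.2) - ωs (p.1, 0) :=
    intervalIntegral.integral_eq_sub_of_hasDerivAt (fun t _ => hdt t)
      (hcs.intervalIntegrable _ _)
  have hpt : ∀ t, fderiv ℝ ωt (p.1, t) (1, 0) - fderiv ℝ ωs (p.1, t) (0, 1) =
      (1 - t * curvOf P.γ p.1) * curl2 A (tube P.γ (p.1, t)) := fun t => by
    have hAd : DifferentiableAt ℝ A (tube P.γ (p.1, t)) :=
      (hA.differentiable one_ne_zero) _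
    have dAs := hasDerivAt_slice_fst hAt p.1 t
    have dAt := hasDerivAt_slice_snd hAt p.1 t
    have dν := hasDerivAt_nuVec P p.1
    have e1 : fderiv ℝ ωt (p.1, t) (1, 0) = _ :=
      (hasDerivAt_slice_fst hωt1 p.1 t).unique (hasDerivAt_dot2 dAs dν)
    have dj : HasDerivAt (fun x : ℝ => 1 - x * curvOf P.γ p.1) (-curvOf P.γ p.1) t := by
      simpa using ((hasDerivAt_id t).mul_const (curvOf P.γ p.1)).const_sub 1
    have e2 : fderiv ℝ ωs (p.1, t) (0, 1) = _ :=
      (hasDerivAt_slice_snd hωs1 p.1 t).unique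
        (dj.mul (hasDerivAt_dot2 dAt (hasDerivAt_const t (deriv P.γ p.1))))
    rw [e1, e2, curl2_frame (P := P) hAd p.1, fderiv_tube_normal hA, fderiv_tube_tangent hA]
    simp [dot2]; ring
  have h_integ : (∫ t in (0 : ℝ)..p.2, (1 - t * curvOf P.γ p.1) * curl2 A (tube P.γ (p.1, t))) =
      (∫ t in (0 : ℝ)..p.2, fderiv ℝ ωt (p.1, t) (1, 0)) -
        ∫ t in (0 : ℝ)..p.2, fderiv ℝ ωs (p.1, t) (0, 1) := by
    rw [← intervalIntegral.integral_sub (hct.intervalIntegrable _ _)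
      (hcs.intervalIntegrable _ _)]
    exact intervalIntegral.integral_congr fun t _ => (hpt t).symm
  rw [h_integ, hftc]
  simp [hωs]
  ring

end Gauge

end SC

namespace SC

section Strip

variable {Ω : Set Plane} {P : BoundaryParam Ω} {K t₁ : ℝ}

/-- The defining properties of a gauge function normalizing the normal component of `A` in
tubular coordinates. -/
def IsGauge (P : BoundaryParam Ω) (A : Plane → Plane) (φ : ℝ × ℝ → ℝ) : Prop :=
  ContDiff ℝ 1 φ ∧ ∀ p : ℝ × ℝ,
    fderiv ℝ φ p (0, 1) = dot2 (A (tube P.γ p)) (nuVec P.γ p.1) ∧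
    (1 - p.2 * curvOf P.γ p.1) * dot2 (A (tube P.γ p)) (deriv P.γ p.1) -
      fderiv ℝ φ p (1, 0) =
    -∫ t in (0 : ℝ)..p.2, (1 - t * curvOf P.γ p.1) * curl2 A (tube P.γ (p.1, t))

/-- The magnetic flux through the normal segment of length `p.2` at `p.1`. -/
def fluxPot (P : BoundaryParam Ω) (A : Plane → Plane) (p : ℝ × ℝ) : ℝ :=
  ∫ t in (0 : ℝ)..p.2, (1 - t * curvOf P.γ p.1) * curl2 A (tube P.γ (p.1, t))

/-- Energy density on the strip for curvature `k` and tangential potential `-a`. -/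
def sden (B k a : ℝ) (w : ℝ × ℝ → ℂ) (p : ℝ × ℝ) : ℝ :=
  (1 - p.2 * k) * ‖fderiv ℝ w p (0, 1)‖ ^ 2 +
    (1 - p.2 * k)⁻¹ * ‖(-Complex.I) * fderiv ℝ w p (1, 0) + ((B * a : ℝ) : ℂ) * w p‖ ^ 2

/-- A plane function in tubular coordinates and in the normal gauge. -/
def toStrip (P : BoundaryParam Ω) (B : ℝ) (φ : ℝ × ℝ → ℝ) (u : Plane → ℂ) (p : ℝ × ℝ) : ℂ :=
  Complex.exp (-((B * φ p : ℝ) : ℂ) * Complex.I) * u (tube P.γ p)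

lemma norm_phase (r : ℝ) : ‖Complex.exp ((r : ℂ) * Complex.I)‖ = 1 :=
  Complex.norm_exp_ofReal_mul_I r

lemma norm_toStrip (B : ℝ) (φ : ℝ × ℝ → ℝ) (u : Plane → ℂ) (p : ℝ × ℝ) :
    ‖toStrip P B φ u p‖ = ‖u (tube P.γ p)‖ := by
  unfold toStrip
  rw [norm_mul, ← Complex.ofReal_neg, norm_phase, one_mul]

lemma contDiff_phase {φ : ℝ × ℝ → ℝ} (hφ : ContDiff ℝ 1 φ) (c : ℝ) :
    ContDiff ℝ 1 fun p => Complex.exp (((c * φ p : ℝ) : ℂ) * Complex.I) := by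
  have h : ContDiff ℝ 1 fun p => ((c * φ p : ℝ) : ℂ) :=
    Complex.ofRealCLM.contDiff.comp (contDiff_const.mul hφ)
  exact (h.mul contDiff_const).cexp

lemma toStrip_eq (B : ℝ) (φ : ℝ × ℝ → ℝ) (u : Plane → ℂ) (p : ℝ × ℝ) : toStrip P B φ u p =
    Complex.exp ((((-B) * φ p : ℝ) : ℂ) * Complex.I) * u (tube P.γ p) := by
  unfold toStrip; simp

lemma contDiff_toStrip (B : ℝ) {φ : ℝ × ℝ → ℝ} (hφ : ContDiff ℝ 1 φ) {u : Plane → ℂ}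
    (hu : ContDiff ℝ 1 u) : ContDiff ℝ 1 (toStrip P B φ u) := by
  have h : ContDiff ℝ 1 fun p : ℝ × ℝ => u (tube P.γ p) :=
    hu.comp ((contDiff_tube P).of_le (by simp))
  rw [show toStrip P B φ u = _ from funext (toStrip_eq B φ u)]
  exact (contDiff_phase hφ (-B)).mul h

lemma fderiv_phase_mul {φ : ℝ × ℝ → ℝ} (hφ : ContDiff ℝ 1 φ) (c : ℝ) {g : ℝ × ℝ → ℂ}
    (hg : ContDiff ℝ 1 g) (p v : ℝ × ℝ) :
    fderiv ℝ (fun q => Complex.exp (((c * φ q : ℝ) : ℂ) * Complex.I) * g q) p v =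
      Complex.exp (((c * φ p : ℝ) : ℂ) * Complex.I) *
        (fderiv ℝ g p v + ((c * fderiv ℝ φ p v : ℝ) : ℂ) * Complex.I * g p) := by
  have h1 : HasFDerivAt φ (fderiv ℝ φ p) p := ((hφ.differentiable one_ne_zero) p).hasFDerivAt
  have h2 : HasFDerivAt (fun q => ((c * φ q : ℝ) : ℂ)) (Complex.ofRealCLM.comp
      (c • fderiv ℝ φ p)) p := (Complex.ofRealCLM.hasFDerivAt).comp p (h1.const_mul c)
  have h3 := ((h2.mul_const Complex.I).cexp).mul ((hg.differentiable one_ne_zero) p).hasFDerivAt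
  have h4 : HasFDerivAt (fun q => Complex.exp (((c * φ q : ℝ) : ℂ) * Complex.I) * g q) _ p := h3
  rw [h4.fderiv]
  simp
  ring

/-- The energy density in tubular coordinates. -/
lemma magSq_toStrip {A : Plane → Plane} {φ : ℝ × ℝ → ℝ} (hφ : IsGauge P A φ)
    (B : ℝ) {u : Plane → ℂ} (hu : ContDiff ℝ 1 u) {p : ℝ × ℝ}
    (hp : 1 - p.2 * curvOf P.γ p.1 ≠ 0) :
    (1 - p.2 * curvOf P.γ p.1) * magSq B A u (tube P.γ p) =
      sden B (curvOf P.γ p.1) (fluxPot P A p) (toStrip P B φ u) p := by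
  obtain ⟨hφ1, hφ2⟩ := hφ
  obtain ⟨hn, ht⟩ := hφ2 p
  set g : ℝ × ℝ → ℂ := fun q => u (tube P.γ q) with hg
  have hg1 : ContDiff ℝ 1 g := hu.comp ((contDiff_tube P).of_le (by simp))
  have hw : toStrip P B φ u = fun q => Complex.exp ((((-B) * φ q : ℝ) : ℂ) * Complex.I) * g q :=
    funext fun q => toStrip_eq B φ u q
  set j := 1 - p.2 * curvOf P.γ p.1 with hj
  set e := Complex.exp ((((-B) * φ p : ℝ) : ℂ) * Complex.I) with he
  have hen : ‖e‖ = 1 := norm_phase _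
  have hgn := fderiv_tube_normal (P := P) hu p
  have hgt := fderiv_tube_tangent (P := P) hu p
  rw [← hg] at hgn hgt
  rw [← hj] at hgt
  have d1 := fderiv_phase_mul hφ1 (-B) hg1 p (0, 1)
  have d2 := fderiv_phase_mul hφ1 (-B) hg1 p (1, 0)
  rw [magSq_frame (P := P) B A u _ p.1]
  unfold sden
  rw [hw, d1, d2, ← he, ← hj, hgn, hgt]
  set X := fderiv ℝ u (tube P.γ p) (deriv P.γ p.1)
  set Y := fderiv ℝ u (tube P.γ p) (nuVec P.γ p.1)
  have hflux : fluxPot P A p = fderiv ℝ φ p (1, 0) - j * dot2 (A (tube P.γ p)) (deriv P.γ p.1) := by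
    unfold fluxPot; linarith
  rw [hflux, hn]
  have n1 : ‖e * (Y + ((-B * dot2 (A (tube P.γ p)) (nuVec P.γ p.1) : ℝ) : ℂ) *
      Complex.I * g p)‖ = ‖(-Complex.I) * Y -
        ((B * dot2 (A (tube P.γ p)) (nuVec P.γ p.1) : ℝ) : ℂ) * u (tube P.γ p)‖ := by
    have : (-Complex.I) * Y -
        ((B * dot2 (A (tube P.γ p)) (nuVec P.γ p.1) : ℝ) : ℂ) * u (tube P.γ p) =
        (-Complex.I) * (Y + ((-B * dot2 (A (tube P.γ p)) (nuVec P.γ p.1) : ℝ) : ℂ) *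
      Complex.I * g p) := by
      push_cast
      linear_combination (-(B : ℂ) * (dot2 (A (tube P.γ p)) (nuVec P.γ p.1) : ℝ) * g p) *
        Complex.I_sq
    rw [this, norm_mul, norm_mul, hen]; simp
  have n2 : ‖(-Complex.I) * (e * (j • X + ((-B * fderiv ℝ φ p (1, 0) : ℝ) : ℂ) * Complex.I *
      g p)) + ((B * (fderiv ℝ φ p (1, 0) - j * dot2 (A (tube P.γ p)) (deriv P.γ p.1)) : ℝ) : ℂ) *
        (e * g p)‖ = |j| * ‖(-Complex.I) * X -
        ((B * dot2 (A (tube P.γ p)) (deriv P.γ p.1) : ℝ) : ℂ) * u (tube P.γ p)‖ := by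
    have : (-Complex.I) * (e * (j • X + ((-B * fderiv ℝ φ p (1, 0) : ℝ) : ℂ) * Complex.I *
      g p)) + ((B * (fderiv ℝ φ p (1, 0) - j * dot2 (A (tube P.γ p)) (deriv P.γ p.1)) : ℝ) : ℂ) *
        (e * g p) = e * ((j : ℂ) * ((-Complex.I) * X -
        ((B * dot2 (A (tube P.γ p)) (deriv P.γ p.1) : ℝ) : ℂ) * u (tube P.γ p))) := by
      rw [Complex.real_smul]
      push_cast
      linear_combination (e * (B : ℂ) * ((fderiv ℝ φ p (1, 0) : ℝ) : ℂ) * g p) * Complex.I_sq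
    rw [this, norm_mul, norm_mul, hen, Complex.norm_real, Real.norm_eq_abs, one_mul]
  rw [n1, n2, mul_pow, sq_abs]
  field_simp
  ring

/-- Under a field equal to `1` on the boundary, the flux potential is close to that of the
constant field. -/
lemma fluxPot_approx (hT : IsTube P K t₁) {A : Plane → Plane} (hA : ContDiff ℝ 2 A) {D : ℝ}
    (hD : ∀ x ∈ closure Ω, ‖fderiv ℝ (curl2 A) x‖ ≤ D) (h1 : ∀ x ∈ frontier Ω, curl2 A x = 1)
    {p : ℝ × ℝ} (hp0 : 0 ≤ p.2) (hp1 : p.2 < t₁) :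
    |fluxPot P A p - (p.2 - curvOf P.γ p.1 * p.2 ^ 2 / 2)| ≤ D * p.2 ^ 2 := by
  have hc1 : ContDiff ℝ 1 (curl2 A) := by
    have hA' : ContDiff ℝ (1 + 1) A := by
      rw [one_add_one_eq_two]; exact hA
    have a1 : ContDiff ℝ 1 (fderiv ℝ fun y => (A y).2) := hA'.snd.fderiv_right le_rfl
    have a2 : ContDiff ℝ 1 (fderiv ℝ fun y => (A y).1) := hA'.fst.fderiv_right le_rfl
    exact (a1.clm_apply contDiff_const).sub (a2.clm_apply contDiff_const)
  have hfr : tube P.γ (p.1, 0) ∈ frontier Ω := by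
    rw [← P.range_eq]; exact ⟨p.1, by simp [tube]⟩
  have hcl : ∀ t ∈ Icc (0 : ℝ) p.2, tube P.γ (p.1, t) ∈ closure Ω := fun t ht => by
    rcases eq_or_lt_of_le ht.1 with h | h
    · rw [← h]; exact frontier_subset_closure hfr
    · exact subset_closure (hT.mem _ h (by simpa using lt_of_le_of_lt ht.2 hp1))
  have hD0 : 0 ≤ D := (norm_nonneg _).trans (hD _ (hcl 0 ⟨le_rfl, hp0⟩))
  have hν : ‖nuVec P.γ p.1‖ ≤ 1 := by
    have h := tangent_sq P p.1
    rw [Prod.norm_def]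
    simp only [nuVec, Real.norm_eq_abs]
    refine max_le (abs_le_one_iff_mul_self_le_one.mpr ?_) (abs_le_one_iff_mul_self_le_one.mpr ?_)
      <;> nlinarith [sq_nonneg (deriv P.γ p.1).1, sq_nonneg (deriv P.γ p.1).2]
  have hgc : ContDiff ℝ 1 fun q : ℝ × ℝ => curl2 A (tube P.γ q) :=
    hc1.comp ((contDiff_tube P).of_le (by simp))
  have hb : ∀ t ∈ Icc (0 : ℝ) p.2, |curl2 A (tube P.γ (p.1, t)) - 1| ≤ D * t := fun t ht => by
    have hd : ∀ x ∈ Icc (0 : ℝ) t, HasDerivWithinAt (fun x => curl2 A (tube P.γ (p.1, x)))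
        (fderiv ℝ (fun q : ℝ × ℝ => curl2 A (tube P.γ q)) (p.1, x) (0, 1)) (Icc 0 t) x :=
      fun x _ => (hasDerivAt_slice_snd hgc p.1 x).hasDerivWithinAt
    have := norm_image_sub_le_of_norm_deriv_le_segment' hd (C := D) (fun x hx => by
      rw [fderiv_tube_normal hc1]
      refine ((fderiv ℝ (curl2 A) _).le_opNorm _).trans ?_
      exact (mul_le_mul (hD _ (hcl x ⟨hx.1, hx.2.le.trans ht.2⟩)) hν (norm_nonneg _) hD0).trans
        (by simp)) t ⟨ht.1, le_rfl⟩
    rw [h1 _ hfr, Real.norm_eq_abs, sub_zero] at this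
    exact this
  set k := curvOf P.γ p.1 with hk
  have hfc : Continuous fun t : ℝ => (1 - t * k) * curl2 A (tube P.γ (p.1, t)) :=
    (by fun_prop : Continuous fun t : ℝ => 1 - t * k).mul
      (hgc.continuous.comp (Continuous.prodMk_right p.1))
  have hpoly : ∫ t in (0 : ℝ)..p.2, (1 - t * k) = p.2 - k * p.2 ^ 2 / 2 := by
    rw [intervalIntegral.integral_sub (by simp)
      ((by fun_prop : Continuous fun t : ℝ => t * k).intervalIntegrable _ _)]
    simp
    ring
  have hcc : Continuous fun t : ℝ => (1 - t * k) := by fun_prop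
  have hdiff : fluxPot P A p - (p.2 - k * p.2 ^ 2 / 2) =
      ∫ t in (0 : ℝ)..p.2, (1 - t * k) * (curl2 A (tube P.γ (p.1, t)) - 1) := by
    rw [← hpoly, fluxPot, ← hk, ← intervalIntegral.integral_sub (hfc.intervalIntegrable _ _)
      (hcc.intervalIntegrable _ _)]
    exact intervalIntegral.integral_congr fun t _ => by ring
  rw [hdiff]
  have hbd := intervalIntegral.norm_integral_le_of_norm_le (μ := volume) hp0
    (f := fun t => (1 - t * k) * (curl2 A (tube P.γ (p.1, t)) - 1)) (g := fun t => 2 * D * t)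
    (Eventually.of_forall fun t ht => by
      have ht' : t ∈ Icc (0 : ℝ) p.2 := ⟨ht.1.le, ht.2⟩
      have hj := abs_le.mp (hT.curv p.1)
      rw [norm_mul, Real.norm_eq_abs, Real.norm_eq_abs]
      have h2 : |1 - t * k| ≤ 2 := by
        have h3 : |t * k| ≤ 1 / 2 := by
          rw [abs_mul, abs_of_nonneg ht'.1]
          exact (mul_le_mul (ht'.2.trans hp1.le) (hT.curv p.1) (abs_nonneg _) hT.pos.le).trans
            hT.small
        rw [abs_le] at h3 ⊢
        constructor <;> linarith [h3.1, h3.2]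
      calc |1 - t * k| * |curl2 A (tube P.γ (p.1, t)) - 1| ≤ 2 * (D * t) :=
            mul_le_mul h2 (hb t ht') (abs_nonneg _) (by norm_num)
        _ = 2 * D * t := by ring)
    ((by fun_prop : Continuous fun t : ℝ => 2 * D * t).intervalIntegrable _ _)
  rw [Real.norm_eq_abs] at hbd
  refine hbd.trans (le_of_eq ?_)
  rw [intervalIntegral.integral_const_mul]
  simp
  ring

end Strip

end SC

namespace SC

/-! ### The one-dimensional model -/

/-- The one-dimensional model quadratic form with curvature `κ`. -/
def q1 (κ ξ T : ℝ) (f : ℝ → ℝ) : ℝ :=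
  ∫ τ in (0:ℝ)..T, ((1 - κ * τ) * (deriv f τ) ^ 2 +
    (ξ + τ - κ * τ ^ 2 / 2) ^ 2 / (1 - κ * τ) * (f τ) ^ 2)

/-- The one-dimensional weighted mass with curvature `κ`. -/
def n1 (κ T : ℝ) (f : ℝ → ℝ) : ℝ := ∫ τ in (0:ℝ)..T, (1 - κ * τ) * (f τ) ^ 2

/-- Admissible functions of the one-dimensional model. -/
def Adm1 (T : ℝ) (f : ℝ → ℝ) : Prop := ContDiff ℝ 1 f ∧ ∀ τ, T ≤ τ → f τ = 0

lemma Adm1.mul {T : ℝ} {f F : ℝ → ℝ} (hf : Adm1 T f) (hF : ContDiff ℝ 1 F) :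
    Adm1 T (fun τ => F τ * f τ) :=
  ⟨hF.mul hf.1, fun τ h => by simp [hf.2 τ h]⟩

lemma m_bounds {κ T τ : ℝ} (hκ : |κ| * T ≤ 1 / 2) (h0 : 0 ≤ τ) (h1 : τ ≤ T) :
    1 / 2 ≤ 1 - κ * τ ∧ 1 - κ * τ ≤ 3 / 2 := by
  have h : |κ * τ| ≤ 1 / 2 := by
    rw [abs_mul, abs_of_nonneg h0]
    exact (mul_le_mul_of_nonneg_left h1 (abs_nonneg κ)).trans hκ
  constructor <;> linarith [abs_le.1 h]

lemma contOn_pot {κ T : ℝ} (hκ : |κ| * T ≤ 1 / 2) (hT : 0 ≤ T) (ξ : ℝ) :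
    ContinuousOn (fun τ : ℝ => (ξ + τ - κ * τ ^ 2 / 2) ^ 2 / (1 - κ * τ)) (uIcc 0 T) := by
  refine ContinuousOn.div (by fun_prop) (by fun_prop) fun τ hτ => ?_
  rw [uIcc_of_le hT] at hτ
  linarith [(m_bounds hκ hτ.1 hτ.2).1]

lemma contOn_q1 {κ T : ℝ} (hκ : |κ| * T ≤ 1 / 2) (hT : 0 ≤ T) (ξ : ℝ) {f : ℝ → ℝ}
    (hf : ContDiff ℝ 1 f) :
    ContinuousOn (fun τ : ℝ => (1 - κ * τ) * (deriv f τ) ^ 2 +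
      (ξ + τ - κ * τ ^ 2 / 2) ^ 2 / (1 - κ * τ) * (f τ) ^ 2) (uIcc 0 T) := by
  have h1 := hf.continuous_deriv le_rfl
  have h2 := hf.continuous
  exact (Continuous.continuousOn (by fun_prop)).add
    ((contOn_pot hκ hT ξ).mul (h2.pow 2).continuousOn)

lemma cont_n1 (κ : ℝ) {f : ℝ → ℝ} (hf : ContDiff ℝ 1 f) :
    Continuous (fun τ : ℝ => (1 - κ * τ) * (f τ) ^ 2) := by
  have h2 := hf.continuous
  fun_prop

lemma q1_nonneg {κ T : ℝ} (hκ : |κ| * T ≤ 1 / 2) (hT : 0 ≤ T) (ξ : ℝ) (f : ℝ → ℝ) :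
    0 ≤ q1 κ ξ T f := by
  refine intervalIntegral.integral_nonneg hT fun τ hτ => ?_
  have := (m_bounds hκ hτ.1 hτ.2).1
  have h : 0 < 1 - κ * τ := by linarith
  positivity

lemma n1_nonneg {κ T : ℝ} (hκ : |κ| * T ≤ 1 / 2) (hT : 0 ≤ T) (f : ℝ → ℝ) :
    0 ≤ n1 κ T f := by
  refine intervalIntegral.integral_nonneg hT fun τ hτ => ?_
  have := (m_bounds hκ hτ.1 hτ.2).1
  have h : 0 < 1 - κ * τ := by linarith
  positivity

/-- Integration by parts: lower bound of the form by mass and boundary term. -/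
lemma q1_ge {κ T : ℝ} (hκ : |κ| * T ≤ 1 / 2) (hT : 0 ≤ T) (ξ : ℝ) {f : ℝ → ℝ}
    (hf : Adm1 T f) : n1 κ T f + ξ * (f 0) ^ 2 ≤ q1 κ ξ T f := by
  have hc := hf.1.continuous
  have hc' := hf.1.continuous_deriv le_rfl
  have hd : ∀ τ, HasDerivAt (fun τ => (ξ + τ - κ * τ ^ 2 / 2) * (f τ) ^ 2)
      ((1 - κ * τ) * (f τ) ^ 2 + (ξ + τ - κ * τ ^ 2 / 2) * (2 * f τ * deriv f τ)) τ := by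
    intro τ
    have h1 : HasDerivAt (fun τ => ξ + τ - κ * τ ^ 2 / 2) (1 - κ * τ) τ := by
      have := ((hasDerivAt_id τ).const_add ξ).sub
        ((((hasDerivAt_id τ).pow 2).const_mul κ).div_const 2)
      refine this.congr_deriv ?_
      simp
      ring
    have h2 : HasDerivAt f (deriv f τ) τ := (hf.1.differentiable one_ne_zero τ).hasDerivAt
    refine (h1.mul (h2.pow 2)).congr_deriv ?_
    simp
  have h_integ : Continuous (fun τ => (1 - κ * τ) * (f τ) ^ 2 +
      (ξ + τ - κ * τ ^ 2 / 2) * (2 * f τ * deriv f τ)) := by fun_prop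
  have hF := intervalIntegral.integral_eq_sub_of_hasDerivAt (a := 0) (b := T)
    (fun τ _ => hd τ) (h_integ.intervalIntegrable _ _)
  rw [hf.2 T le_rfl] at hF
  have hi1 := (cont_n1 κ hf.1).intervalIntegrable (μ := volume) 0 T
  have hi2 := (contOn_q1 hκ hT ξ hf.1).intervalIntegrable (μ := volume)
  have hmono : (∫ τ in (0:ℝ)..T, ((1 - κ * τ) * (f τ) ^ 2 -
      ((1 - κ * τ) * (f τ) ^ 2 + (ξ + τ - κ * τ ^ 2 / 2) * (2 * f τ * deriv f τ)))) ≤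
      q1 κ ξ T f := by
    refine intervalIntegral.integral_mono_on hT (hi1.sub (h_integ.intervalIntegrable _ _)) hi2 ?_
    intro τ hτ
    have hm := (m_bounds hκ hτ.1 hτ.2).1
    have h : 0 < 1 - κ * τ := by linarith
    have h3 : 0 ≤ ((1 - κ * τ) * deriv f τ + (ξ + τ - κ * τ ^ 2 / 2) * f τ) ^ 2 / (1 - κ * τ) := by
      positivity
    have h4 : ((1 - κ * τ) * deriv f τ + (ξ + τ - κ * τ ^ 2 / 2) * f τ) ^ 2 / (1 - κ * τ)
      = (1 - κ * τ) * (deriv f τ) ^ 2 +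
      (ξ + τ - κ * τ ^ 2 / 2) ^ 2 / (1 - κ * τ) * (f τ) ^ 2 +
        (ξ + τ - κ * τ ^ 2 / 2) * (2 * f τ * deriv f τ) := by
      field_simp
      ring
    linarith
  rw [intervalIntegral.integral_sub hi1 (h_integ.intervalIntegrable _ _), hF] at hmono
  simp only [n1]
  simp at hmono
  linarith

/-- Near-minimizers satisfy weighted estimates. -/
lemma near1 {κ T Λ : ℝ} (hκ : |κ| * T ≤ 1 / 2) (hT : 0 ≤ T) (hΛ : 0 ≤ Λ)
    (hlow : ∀ ξ f, Adm1 T f → Λ * n1 κ T f ≤ q1 κ ξ T f) {F : ℝ → ℝ} (hF : ContDiff ℝ 1 F)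
    {ε : ℝ} (hε : 0 < ε) :
    ∃ δ > 0, ∀ ξ f, Adm1 T f → n1 κ T f = 1 → q1 κ ξ T f ≤ Λ + δ →
      q1 κ ξ T (fun τ => F τ * f τ) - Λ * n1 κ T (fun τ => F τ * f τ) ≤
        (∫ τ in (0:ℝ)..T, (1 - κ * τ) * (deriv F τ) ^ 2 * (f τ) ^ 2) + ε := by
  have hFc := hF.continuous
  have hFc' := hF.continuous_deriv le_rfl
  obtain ⟨S, hS⟩ := (isCompact_Icc (a := (0:ℝ)) (b := T)).exists_bound_of_continuousOn
    (f := fun τ => 2 * F τ ^ 4 + 8 * F τ ^ 2 * (deriv F τ) ^ 2) (by fun_prop)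
  have hS0 : 0 ≤ S := (norm_nonneg _).trans (hS 0 ⟨le_rfl, hT⟩)
  set W := S * (Λ + 2) + 1 with hW
  have hWpos : 0 < W := by positivity
  set e := ε / W with he
  have hepos : 0 < e := by positivity
  refine ⟨min 1 (ε * e), by positivity, fun ξ f hf hn hq => ?_⟩
  have hfc := hf.1.continuous
  have hfc' := hf.1.continuous_deriv le_rfl
  have hG : ContDiff ℝ 1 (fun τ => 1 - e * F τ ^ 2) :=
    contDiff_const.sub (contDiff_const.mul (hF.pow 2))
  have hA1 := hf.mul hF
  have hA2 := hf.mul (hF.pow 2)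
  have hA3 := hf.mul hG
  have hd : ∀ τ, HasDerivAt f (deriv f τ) τ :=
    fun τ => (hf.1.differentiable one_ne_zero τ).hasDerivAt
  have hdF : ∀ τ, HasDerivAt F (deriv F τ) τ :=
    fun τ => (hF.differentiable one_ne_zero τ).hasDerivAt
  have e1 : ∀ τ, deriv (fun τ => F τ * f τ) τ = deriv F τ * f τ + F τ * deriv f τ :=
    fun τ => ((hdF τ).mul (hd τ)).deriv
  have e2 : ∀ τ, deriv (fun τ => F τ ^ 2 * f τ) τ =
      2 * F τ * deriv F τ * f τ + F τ ^ 2 * deriv f τ := by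
    intro τ
    refine (((hdF τ).pow 2).mul (hd τ)).deriv.trans ?_
    simp
  have e3 : ∀ τ, deriv (fun τ => (1 - e * F τ ^ 2) * f τ) τ =
      - e * (2 * F τ * deriv F τ) * f τ + (1 - e * F τ ^ 2) * deriv f τ := by
    intro τ
    have h1 : HasDerivAt (fun τ => 1 - e * F τ ^ 2) (- (e * (2 * F τ * deriv F τ))) τ := by
      refine ((((hdF τ).pow 2).const_mul e).const_sub 1).congr_deriv ?_
      simp
    refine (h1.mul (hd τ)).deriv.trans ?_
    simp
  -- integrability
  have iq : ∀ g, Adm1 T g → IntervalIntegrable (fun τ : ℝ => (1 - κ * τ) * (deriv g τ) ^ 2 +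
      (ξ + τ - κ * τ ^ 2 / 2) ^ 2 / (1 - κ * τ) * (g τ) ^ 2) volume 0 T :=
    fun g hg => (contOn_q1 hκ hT ξ hg.1).intervalIntegrable
  have inn : ∀ g, Adm1 T g → IntervalIntegrable (fun τ : ℝ => (1 - κ * τ) * (g τ) ^ 2)
      volume 0 T := fun g hg => (cont_n1 κ hg.1).intervalIntegrable _ _
  have iF : IntervalIntegrable (fun τ => (1 - κ * τ) * (deriv F τ) ^ 2 * (f τ) ^ 2)
      volume 0 T := Continuous.intervalIntegrable (by fun_prop) _ _
  have hL : ∀ g, Adm1 T g → q1 κ ξ T g - Λ * n1 κ T g = ∫ τ in (0:ℝ)..T,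
      ((1 - κ * τ) * (deriv g τ) ^ 2 +
      (ξ + τ - κ * τ ^ 2 / 2) ^ 2 / (1 - κ * τ) * (g τ) ^ 2 -
      Λ * ((1 - κ * τ) * (g τ) ^ 2)) := by
    intro g hg
    rw [intervalIntegral.integral_sub (iq g hg) ((inn g hg).const_mul Λ),
      intervalIntegral.integral_const_mul]
    rfl
  have iL : ∀ g, Adm1 T g → IntervalIntegrable (fun τ : ℝ => (1 - κ * τ) * (deriv g τ) ^ 2 +
      (ξ + τ - κ * τ ^ 2 / 2) ^ 2 / (1 - κ * τ) * (g τ) ^ 2 -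
      Λ * ((1 - κ * τ) * (g τ) ^ 2)) volume 0 T :=
    fun g hg => (iq g hg).sub ((inn g hg).const_mul Λ)
  have key : q1 κ ξ T (fun τ => (1 - e * F τ ^ 2) * f τ) -
      Λ * n1 κ T (fun τ => (1 - e * F τ ^ 2) * f τ) =
      (q1 κ ξ T f - Λ * n1 κ T f) - 2 * e * ((q1 κ ξ T (fun τ => F τ * f τ) -
        Λ * n1 κ T (fun τ => F τ * f τ)) -
        ∫ τ in (0:ℝ)..T, (1 - κ * τ) * (deriv F τ) ^ 2 * (f τ) ^ 2) +
      e ^ 2 * (q1 κ ξ T (fun τ => F τ ^ 2 * f τ) - Λ * n1 κ T (fun τ => F τ ^ 2 * f τ)) := by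
    rw [hL _ hA1, hL _ hA2, hL _ hA3, hL _ hf, ← intervalIntegral.integral_sub (iL _ hA1) iF,
      ← intervalIntegral.integral_const_mul, ← intervalIntegral.integral_const_mul,
      ← intervalIntegral.integral_sub (iL _ hf) (((iL _ hA1).sub iF).const_mul _),
      ← intervalIntegral.integral_add ((iL _ hf).sub (((iL _ hA1).sub iF).const_mul _))
        ((iL _ hA2).const_mul _)]
    congr 1
    ext τ
    rw [e1, e2, e3]
    ring
  have hpos := hlow ξ _ hA3
  have hub : q1 κ ξ T (fun τ => F τ ^ 2 * f τ) ≤ S * (q1 κ ξ T f + n1 κ T f) := by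
    have : S * (q1 κ ξ T f + n1 κ T f) = ∫ τ in (0:ℝ)..T, S * (((1 - κ * τ) * (deriv f τ) ^ 2 +
      (ξ + τ - κ * τ ^ 2 / 2) ^ 2 / (1 - κ * τ) * (f τ) ^ 2) + (1 - κ * τ) * (f τ) ^ 2) := by
      rw [intervalIntegral.integral_const_mul, intervalIntegral.integral_add (iq _ hf) (inn _ hf)]
      rfl
    rw [this]
    refine intervalIntegral.integral_mono_on hT (iq _ hA2)
      (((iq _ hf).add (inn _ hf)).const_mul S) fun τ hτ => ?_
    have hm := (m_bounds hκ hτ.1 hτ.2).1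
    have h : 0 < 1 - κ * τ := by linarith
    have hs := (le_abs_self _).trans (hS τ hτ)
    rw [e2]
    have hV : 0 ≤ (ξ + τ - κ * τ ^ 2 / 2) ^ 2 / (1 - κ * τ) := by positivity
    set V := (ξ + τ - κ * τ ^ 2 / 2) ^ 2 / (1 - κ * τ)
    set m := 1 - κ * τ
    have hP : 0 ≤ F τ ^ 4 := by positivity
    have hQ : 0 ≤ F τ ^ 2 * (deriv F τ) ^ 2 := by positivity
    have a1 : m * (2 * F τ * deriv F τ * f τ + F τ ^ 2 * deriv f τ) ^ 2 ≤
        m * (2 * F τ ^ 4 * deriv f τ ^ 2 + 8 * (F τ ^ 2 * (deriv F τ) ^ 2) * f τ ^ 2) := by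
      refine mul_le_mul_of_nonneg_left ?_ h.le
      nlinarith [sq_nonneg (2 * F τ * deriv F τ * f τ - F τ ^ 2 * deriv f τ)]
    have a2 : 2 * F τ ^ 4 * (m * deriv f τ ^ 2) ≤ S * (m * deriv f τ ^ 2) :=
      mul_le_mul_of_nonneg_right (by linarith) (by positivity)
    have a3 : 8 * (F τ ^ 2 * (deriv F τ) ^ 2) * (m * f τ ^ 2) ≤ S * (m * f τ ^ 2) :=
      mul_le_mul_of_nonneg_right (by linarith) (by positivity)
    have a4 : F τ ^ 4 * (V * f τ ^ 2) ≤ S * (V * f τ ^ 2) :=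
      mul_le_mul_of_nonneg_right (by linarith) (by positivity)
    calc _ ≤ m * (2 * F τ ^ 4 * deriv f τ ^ 2 + 8 * (F τ ^ 2 * (deriv F τ) ^ 2) * f τ ^ 2) +
          F τ ^ 4 * (V * f τ ^ 2) := by
            refine add_le_add a1 (le_of_eq ?_)
            ring
      _ ≤ _ := by linarith
  have hnn := n1_nonneg hκ hT (fun τ => F τ ^ 2 * f τ)
  have hX : q1 κ ξ T (fun τ => F τ ^ 2 * f τ) - Λ * n1 κ T (fun τ => F τ ^ 2 * f τ) ≤ W := by
    have : S * (q1 κ ξ T f + n1 κ T f) ≤ S * (Λ + 2) := by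
      refine mul_le_mul_of_nonneg_left ?_ hS0
      linarith [min_le_left 1 (ε * e)]
    have := mul_nonneg hΛ hnn
    linarith
  have h5 : q1 κ ξ T f - Λ * n1 κ T f ≤ ε * e := by
    rw [hn]
    linarith [min_le_right 1 (ε * e)]
  have h6 : e ^ 2 * (q1 κ ξ T (fun τ => F τ ^ 2 * f τ) -
      Λ * n1 κ T (fun τ => F τ ^ 2 * f τ)) ≤ e * ε := by
    calc _ ≤ e ^ 2 * W := mul_le_mul_of_nonneg_left hX (by positivity)
      _ = e * ε := by rw [he]; field_simp
  set Y := (q1 κ ξ T (fun τ => F τ * f τ) - Λ * n1 κ T (fun τ => F τ * f τ)) -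
        ∫ τ in (0:ℝ)..T, (1 - κ * τ) * (deriv F τ) ^ 2 * (f τ) ^ 2
  have h7 : 2 * e * Y ≤ 2 * e * ε := by linarith
  have := le_of_mul_le_mul_left h7 (by positivity)
  linarith

end SC

namespace SC

lemma exists_pow_le_cosh : ∃ C > 0, ∀ τ : ℝ, 0 ≤ τ →
    (1 + τ) ^ 10 ≤ C * Real.cosh (3 / 10 * τ) ^ 2 := by
  refine ⟨4 * ((50 / 3) ^ 10 * Real.exp (3 / 5)), by positivity, fun τ hτ => ?_⟩
  have h1 : (3 / 50) * (1 + τ) ≤ Real.exp ((3 / 50) * (1 + τ)) := by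
    linarith [Real.add_one_le_exp ((3 / 50) * (1 + τ))]
  have h2 := pow_le_pow_left₀ (by positivity) h1 10
  rw [← Real.exp_nat_mul] at h2
  have h3 : Real.exp (3 / 10 * τ) / 2 ≤ Real.cosh (3 / 10 * τ) := by
    rw [Real.cosh_eq]
    linarith [Real.exp_pos (-(3 / 10 * τ))]
  have h4 := pow_le_pow_left₀ (by positivity) h3 2
  have h5 : Real.exp (((10:ℕ):ℝ) * (3 / 50 * (1 + τ))) =
      Real.exp (3 / 5) * Real.exp (3 / 10 * τ) ^ 2 := by
    rw [← Real.exp_nat_mul, ← Real.exp_add]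
    congr 1
    push_cast
    ring
  rw [h5, mul_pow] at h2
  have h6 : (1 + τ) ^ 10 ≤ (50 / 3) ^ 10 * (Real.exp (3 / 5) * Real.exp (3 / 10 * τ) ^ 2) := by
    calc (1 + τ) ^ 10 = (50 / 3) ^ 10 * ((3 / 50) ^ 10 * (1 + τ) ^ 10) := by ring
      _ ≤ _ := mul_le_mul_of_nonneg_left h2 (by positivity)
  have h7 : Real.exp (3 / 10 * τ) ^ 2 ≤ 4 * Real.cosh (3 / 10 * τ) ^ 2 := by linarith
  calc _ ≤ _ := h6
    _ ≤ (50 / 3) ^ 10 * (Real.exp (3 / 5) * (4 * Real.cosh (3 / 10 * τ) ^ 2)) := by gcongr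
    _ = _ := by ring

lemma xi_sq_pointwise {κ T τ ξ : ℝ} (hκ : |κ| * T ≤ 1 / 2) (h0 : 0 ≤ τ) (h1 : τ ≤ T) (y z : ℝ) :
    ξ ^ 2 * ((1 - κ * τ) * y ^ 2) ≤ 9 / 2 * ((1 - κ * τ) * z ^ 2 +
      (ξ + τ - κ * τ ^ 2 / 2) ^ 2 / (1 - κ * τ) * y ^ 2) +
      45 * ((1 - κ * τ) * Real.cosh (3 / 10 * τ) ^ 2 * y ^ 2) := by
  obtain ⟨hm, hm'⟩ := m_bounds hκ h0 h1
  have h : 0 < 1 - κ * τ := by linarith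
  have hs : (3 / 10 * τ) ^ 2 ≤ Real.cosh (3 / 10 * τ) ^ 2 := by
    rw [Real.cosh_sq]
    have := Real.self_le_sinh_iff.2 (by linarith : 0 ≤ 3 / 10 * τ)
    have := pow_le_pow_left₀ (by linarith : 0 ≤ 3 / 10 * τ) this 2
    linarith
  set a := ξ + τ - κ * τ ^ 2 / 2 with ha
  have hξ : ξ ^ 2 ≤ 2 * a ^ 2 + 4 * τ ^ 2 := by
    have : ξ = a - (τ * (1 - κ * τ / 2)) := by rw [ha]; ring
    have hb : (τ * (1 - κ * τ / 2)) ^ 2 ≤ 2 * τ ^ 2 := by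
      rw [mul_pow]
      have : (1 - κ * τ / 2) ^ 2 ≤ 2 := by nlinarith
      nlinarith [sq_nonneg τ]
    rw [this]
    nlinarith [sq_nonneg (a + (τ * (1 - κ * τ / 2)))]
  have h3 : ξ ^ 2 * (1 - κ * τ) ≤ 9 / 2 * (a ^ 2 / (1 - κ * τ)) +
      45 * ((1 - κ * τ) * Real.cosh (3 / 10 * τ) ^ 2) := by
    have h4 : a ^ 2 * (1 - κ * τ) ≤ 9 / 4 * (a ^ 2 / (1 - κ * τ)) := by
      rw [← mul_div_assoc, le_div_iff₀ h]
      have : (1 - κ * τ) ^ 2 ≤ 9 / 4 := by nlinarith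
      nlinarith [sq_nonneg a]
    have h5 : ξ ^ 2 * (1 - κ * τ) ≤ (2 * a ^ 2 + 4 * τ ^ 2) * (1 - κ * τ) :=
      mul_le_mul_of_nonneg_right hξ h.le
    have h6 : τ ^ 2 * (1 - κ * τ) ≤
        (100 / 9 * Real.cosh (3 / 10 * τ) ^ 2) * (1 - κ * τ) :=
      mul_le_mul_of_nonneg_right (by linarith) h.le
    have h7 : 0 ≤ (1 - κ * τ) * Real.cosh (3 / 10 * τ) ^ 2 := by positivity
    linarith
  have h8 := mul_le_mul_of_nonneg_right h3 (sq_nonneg y)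
  have h9 : 0 ≤ (1 - κ * τ) * z ^ 2 := by positivity
  linarith

lemma moment_pointwise {κ T τ C : ℝ} (hκ : |κ| * T ≤ 1 / 2) (h0 : 0 ≤ τ) (h1 : τ ≤ T) (hC : 0 < C)
    (hc : (1 + τ) ^ 10 ≤ C * Real.cosh (3 / 10 * τ) ^ 2) (ξ y z : ℝ) :
    (1 + τ) ^ 10 * (y ^ 2 + z ^ 2) ≤ 2 * C * (((1 - κ * τ) * z ^ 2 +
      (ξ + τ - κ * τ ^ 2 / 2) ^ 2 / (1 - κ * τ) * y ^ 2) + 2 * ((1 - κ * τ) *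
        (3 / 10 * Real.cosh (3 / 10 * τ) * y + Real.sinh (3 / 10 * τ) * z) ^ 2 +
      (ξ + τ - κ * τ ^ 2 / 2) ^ 2 / (1 - κ * τ) * (Real.sinh (3 / 10 * τ) * y) ^ 2) +
      118 / 100 * ((1 - κ * τ) * Real.cosh (3 / 10 * τ) ^ 2 * y ^ 2)) := by
  obtain ⟨hm, hm'⟩ := m_bounds hκ h0 h1
  have h : 0 < 1 - κ * τ := by linarith
  have hcs := Real.cosh_sq (3 / 10 * τ)
  set m := 1 - κ * τ
  set c := Real.cosh (3 / 10 * τ)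
  set s := Real.sinh (3 / 10 * τ)
  have hV : 0 ≤ (ξ + τ - κ * τ ^ 2 / 2) ^ 2 / m := by positivity
  set V := (ξ + τ - κ * τ ^ 2 / 2) ^ 2 / m
  have e1 : c ^ 2 * z ^ 2 ≤ z ^ 2 + 2 * (3 / 10 * c * y + s * z) ^ 2 + 18 / 100 * (c ^ 2 * y ^ 2) := by
    rw [hcs]
    nlinarith [sq_nonneg (s * z + 2 * (3 / 10 * c * y))]
  have e2 : c ^ 2 * (y ^ 2 + z ^ 2) ≤ 2 * (m * (z ^ 2 + 2 * (3 / 10 * c * y + s * z) ^ 2 +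
      118 / 100 * (c ^ 2 * y ^ 2))) := by
    have : 0 ≤ z ^ 2 + 2 * (3 / 10 * c * y + s * z) ^ 2 + 118 / 100 * (c ^ 2 * y ^ 2) := by positivity
    nlinarith
  have e3 : (1 + τ) ^ 10 * (y ^ 2 + z ^ 2) ≤ C * (c ^ 2 * (y ^ 2 + z ^ 2)) := by
    rw [← mul_assoc]
    exact mul_le_mul_of_nonneg_right hc (by positivity)
  have e4 : 0 ≤ V * y ^ 2 := by positivity
  have e5 : 0 ≤ V * (s * y) ^ 2 := by positivity
  calc _ ≤ _ := e3
    _ ≤ C * (2 * (m * (z ^ 2 + 2 * (3 / 10 * c * y + s * z) ^ 2 +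
      118 / 100 * (c ^ 2 * y ^ 2)))) := mul_le_mul_of_nonneg_left e2 hC.le
    _ = 2 * C * (m * z ^ 2 + 2 * (m * (3 / 10 * c * y + s * z) ^ 2) +
      118 / 100 * (m * c ^ 2 * y ^ 2)) := by ring
    _ ≤ _ := by
      refine mul_le_mul_of_nonneg_left ?_ (by positivity)
      linarith

/-- Near-minimizers of the one-dimensional model, with uniform control. -/
lemma exists_good_near_min : ∃ M > 0, ∀ (κ T Λ : ℝ), |κ| * T ≤ 1 / 2 → 0 ≤ T → 0 ≤ Λ → Λ ≤ 4 / 5 →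
    (∀ ξ f, Adm1 T f → Λ * n1 κ T f ≤ q1 κ ξ T f) →
    (∀ δ > 0, ∃ ξ f, Adm1 T f ∧ n1 κ T f = 1 ∧ q1 κ ξ T f ≤ Λ + δ) →
    ∀ δ > 0, ∃ ξ f, Adm1 T f ∧ n1 κ T f = 1 ∧ q1 κ ξ T f ≤ Λ + δ ∧ |ξ| ≤ M ∧
      1 / M ≤ (f 0) ^ 2 ∧ (∫ τ in (0:ℝ)..T, (1 + τ) ^ 10 * ((f τ) ^ 2 + (deriv f τ) ^ 2)) ≤ M := by
  obtain ⟨C, hC, hcosh⟩ := exists_pow_le_cosh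
  refine ⟨max 2500 (68 * C), by positivity, fun κ T Λ hκ hT hΛ0 hΛ1 hlow happ δ hδ => ?_⟩
  have hFd : ∀ τ : ℝ, HasDerivAt (fun τ : ℝ => Real.sinh (3 / 10 * τ))
      (3 / 10 * Real.cosh (3 / 10 * τ)) τ := by
    intro τ
    have := ((hasDerivAt_id τ).const_mul (3 / 10 : ℝ)).sinh
    refine this.congr_deriv ?_
    simp
    ring
  have hF : ContDiff ℝ 1 (fun τ : ℝ => Real.sinh (3 / 10 * τ)) :=
    Real.contDiff_sinh.comp (contDiff_const.mul contDiff_id)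
  obtain ⟨δ0, hδ0, hnear⟩ := near1 hκ hT hΛ0 hlow hF one_pos
  obtain ⟨ξ, f, hf, hn, hq⟩ := happ (min δ (min δ0 (1 / 10))) (by positivity)
  have hq1 : q1 κ ξ T f ≤ Λ + δ := hq.trans (by gcongr; exact min_le_left _ _)
  have hq2 : q1 κ ξ T f ≤ Λ + δ0 :=
    hq.trans (by gcongr; exact (min_le_right _ _).trans (min_le_left _ _))
  have hq3 : q1 κ ξ T f ≤ Λ + 1 / 10 :=
    hq.trans (by gcongr; exact (min_le_right _ _).trans (min_le_right _ _))
  have hN := hnear ξ f hf hn hq2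
  have hfc := hf.1.continuous
  have hfc' := hf.1.continuous_deriv le_rfl
  have hA := hf.mul hF
  have hd : ∀ τ, HasDerivAt f (deriv f τ) τ :=
    fun τ => (hf.1.differentiable one_ne_zero τ).hasDerivAt
  have hge := q1_ge hκ hT ξ hA
  simp only [mul_zero, Real.sinh_zero, zero_mul, ne_eq, OfNat.ofNat_ne_zero, not_false_eq_true,
    zero_pow, add_zero] at hge
  set X := ∫ τ in (0:ℝ)..T, (1 - κ * τ) * Real.cosh (3 / 10 * τ) ^ 2 * (f τ) ^ 2 with hX
  have iX : IntervalIntegrable (fun τ => (1 - κ * τ) * Real.cosh (3 / 10 * τ) ^ 2 * (f τ) ^ 2)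
      volume 0 T := Continuous.intervalIntegrable (by fun_prop) _ _
  have iq : ∀ g, Adm1 T g → IntervalIntegrable (fun τ : ℝ => (1 - κ * τ) * (deriv g τ) ^ 2 +
      (ξ + τ - κ * τ ^ 2 / 2) ^ 2 / (1 - κ * τ) * (g τ) ^ 2) volume 0 T :=
    fun g hg => (contOn_q1 hκ hT ξ hg.1).intervalIntegrable
  have inn := (cont_n1 κ hf.1).intervalIntegrable (μ := volume) 0 T
  have eX : n1 κ T (fun τ => Real.sinh (3 / 10 * τ) * f τ) = X - 1 := by
    rw [← hn, hX]
    simp only [n1]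
    rw [← intervalIntegral.integral_sub iX inn]
    congr 1
    ext τ
    rw [Real.cosh_sq]
    ring
  have eF : (∫ τ in (0:ℝ)..T, (1 - κ * τ) * (deriv (fun τ : ℝ => Real.sinh (3 / 10 * τ)) τ) ^ 2 *
      (f τ) ^ 2) = 9 / 100 * X := by
    rw [hX, ← intervalIntegral.integral_const_mul]
    congr 1
    ext τ
    rw [(hFd τ).deriv]
    ring
  rw [eF, eX] at hN
  rw [eX] at hge
  have hX0 : 0 ≤ X - 1 := eX ▸ n1_nonneg hκ hT _
  have hX11 : X ≤ 11 := by nlinarith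
  have hqF : q1 κ ξ T (fun τ => Real.sinh (3 / 10 * τ) * f τ) ≤ 10 := by nlinarith
  have hξ250 : |ξ| ≤ 250 := by
    have : ξ ^ 2 ≤ 9 / 2 * q1 κ ξ T f + 45 * X := by
      have e1 : ξ ^ 2 = ∫ τ in (0:ℝ)..T, ξ ^ 2 * ((1 - κ * τ) * f τ ^ 2) := by
        rw [intervalIntegral.integral_const_mul]
        change _ = ξ ^ 2 * n1 κ T f
        rw [hn, mul_one]
      rw [e1, q1, hX, ← intervalIntegral.integral_const_mul,
        ← intervalIntegral.integral_const_mul, ← intervalIntegral.integral_add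
          ((iq f hf).const_mul _) (iX.const_mul _)]
      exact intervalIntegral.integral_mono_on hT (inn.const_mul _)
        (((iq f hf).const_mul _).add (iX.const_mul _))
        fun τ hτ => xi_sq_pointwise hκ hτ.1 hτ.2 _ _
    have h2 : ξ ^ 2 ≤ 250 ^ 2 := by linarith
    exact abs_le_of_sq_le_sq h2 (by norm_num)
  have hb := q1_ge hκ hT ξ hf
  rw [hn] at hb
  refine ⟨ξ, f, hf, hn, hq1, (hξ250.trans (by norm_num)).trans (le_max_left _ _), ?_, ?_⟩
  · have h1 : 1 / 10 ≤ 250 * f 0 ^ 2 := by nlinarith [sq_nonneg (f 0), (abs_le.1 hξ250).1]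
    have h2 : 1 / max 2500 (68 * C) ≤ 1 / 2500 :=
      one_div_le_one_div_of_le (by norm_num) (le_max_left _ _)
    linarith
  · refine le_trans ?_ (le_max_right _ _)
    have hs : Real.sinh (3 / 10 * 0) = 0 := by simp
    have iqF := iq _ hA
    have e1 : (∫ τ in (0:ℝ)..T, 2 * C * (((1 - κ * τ) * (deriv f τ) ^ 2 +
      (ξ + τ - κ * τ ^ 2 / 2) ^ 2 / (1 - κ * τ) * (f τ) ^ 2) + 2 * ((1 - κ * τ) *
        (deriv (fun τ => Real.sinh (3 / 10 * τ) * f τ) τ) ^ 2 +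
      (ξ + τ - κ * τ ^ 2 / 2) ^ 2 / (1 - κ * τ) * (Real.sinh (3 / 10 * τ) * f τ) ^ 2) +
      118 / 100 * ((1 - κ * τ) * Real.cosh (3 / 10 * τ) ^ 2 * (f τ) ^ 2))) =
      2 * C * (q1 κ ξ T f + 2 * q1 κ ξ T (fun τ => Real.sinh (3 / 10 * τ) * f τ) +
        118 / 100 * X) := by
      rw [intervalIntegral.integral_const_mul, intervalIntegral.integral_add
        ((iq f hf).add (iqF.const_mul _)) (iX.const_mul _), intervalIntegral.integral_add
        (iq f hf) (iqF.const_mul _), intervalIntegral.integral_const_mul,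
        intervalIntegral.integral_const_mul]
      rfl
    have e2 : (∫ τ in (0:ℝ)..T, (1 + τ) ^ 10 * ((f τ) ^ 2 + (deriv f τ) ^ 2)) ≤
      2 * C * (q1 κ ξ T f + 2 * q1 κ ξ T (fun τ => Real.sinh (3 / 10 * τ) * f τ) +
        118 / 100 * X) := by
      rw [← e1]
      refine intervalIntegral.integral_mono_on hT (Continuous.intervalIntegrable (by fun_prop) _ _)
        ((((iq f hf).add (iqF.const_mul _)).add (iX.const_mul _)).const_mul _) fun τ hτ => ?_
      rw [show deriv (fun τ => Real.sinh (3 / 10 * τ) * f τ) τ =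
        3 / 10 * Real.cosh (3 / 10 * τ) * f τ + Real.sinh (3 / 10 * τ) * deriv f τ from
        ((hFd τ).mul (hd τ)).deriv]
      exact moment_pointwise hκ hτ.1 hτ.2 hC (hcosh τ hτ.1) ξ _ _
    refine e2.trans ?_
    nlinarith
end SC

namespace SC

lemma hasDerivAt_max_sq (τ : ℝ) :
    HasDerivAt (fun τ : ℝ => max (4 - τ) 0 ^ 2) (2 * max (4 - τ) 0 * (-1)) τ := by
  have h1 : ∀ x : ℝ, HasDerivAt (fun x : ℝ => max x 0 ^ 2) (2 * max x 0) x := by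
    intro x
    rcases lt_trichotomy x 0 with h | h | h
    · have : (fun x : ℝ => max x 0 ^ 2) =ᶠ[𝓝 x] fun _ => 0 := by
        filter_upwards [gt_mem_nhds h] with y hy
        simp [max_eq_right hy.le]
      rw [max_eq_right h.le, mul_zero]
      exact (hasDerivAt_const x (0:ℝ)).congr_of_eventuallyEq this
    · subst h
      simp only [max_self, mul_zero]
      rw [hasDerivAt_iff_isLittleO]
      simp only [max_self, ne_eq, OfNat.ofNat_ne_zero, not_false_eq_true, zero_pow, sub_zero,
        smul_zero]
      have hO : (fun x : ℝ => max x 0 ^ 2) =O[𝓝 0] fun x : ℝ => x ^ 2 := by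
        refine Asymptotics.isBigO_of_le _ fun x => ?_
        rw [Real.norm_of_nonneg (by positivity), Real.norm_of_nonneg (by positivity)]
        rcases le_total x 0 with h | h
        · simp [max_eq_right h, sq_nonneg]
        · simp [max_eq_left h]
      refine hO.trans_isLittleO ?_
      have := Asymptotics.isLittleO_pow_pow (𝕜 := ℝ) (m := 1) (n := 2) (by norm_num)
      simpa using this
    · have : (fun x : ℝ => max x 0 ^ 2) =ᶠ[𝓝 x] fun x => x ^ 2 := by
        filter_upwards [lt_mem_nhds h] with y hy
        simp [max_eq_left hy.le]
      rw [max_eq_left h.le]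
      refine HasDerivAt.congr_of_eventuallyEq ?_ this
      simpa using hasDerivAt_pow 2 x
  exact (h1 (4 - τ)).comp τ ((hasDerivAt_id τ).const_sub 4)

/-- An explicit trial function for the one-dimensional model. -/
lemma exists_trial1 {κ T : ℝ} (hκ : |κ| * T ≤ 1 / 2) (hT : 4 ≤ T) (hκ' : |κ| ≤ 1 / 400) :
    ∃ ξ f, Adm1 T f ∧ 0 < n1 κ T f ∧ q1 κ ξ T f ≤ 4 / 5 * n1 κ T f := by
  set f : ℝ → ℝ := fun τ => (max (4 - τ) 0 ^ 2) with hf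
  have hT0 : 0 ≤ T := by linarith
  have hfd : ∀ τ, HasDerivAt f (2 * max (4 - τ) 0 * (-1)) τ := hasDerivAt_max_sq
  have hder : deriv f = fun τ => 2 * max (4 - τ) 0 * (-1) := funext fun τ => (hfd τ).deriv
  have hc1 : ContDiff ℝ 1 f := by
    rw [contDiff_one_iff_deriv]
    exact ⟨fun τ => (hfd τ).differentiableAt, by rw [hder]; fun_prop⟩
  have hadm : Adm1 T f := ⟨hc1, fun τ h => by
    simp only [hf]; rw [max_eq_right (by linarith)]; simp⟩
  have hin : ∀ τ ∈ uIcc (0:ℝ) 4, f τ = (4 - τ) ^ 2 ∧ deriv f τ = -2 * (4 - τ) := by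
    intro τ h
    rw [uIcc_of_le (by norm_num)] at h
    have : 0 ≤ 4 - τ := by linarith [h.2]
    rw [hder]
    simp only [hf, max_eq_left this]
    exact ⟨trivial, by ring⟩
  have hout : ∀ τ ∈ uIcc (4:ℝ) T, f τ = 0 ∧ deriv f τ = 0 := by
    intro τ h
    rw [uIcc_of_le hT] at h
    have : 4 - τ ≤ 0 := by linarith [h.1]
    rw [hder]
    simp [hf, max_eq_right this]
  have hmem : (4:ℝ) ∈ uIcc 0 T := by rw [uIcc_of_le hT0]; exact ⟨by norm_num, hT⟩
  have hs1 : uIcc (0:ℝ) 4 ⊆ uIcc 0 T := uIcc_subset_uIcc left_mem_uIcc hmem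
  have hs2 : uIcc (4:ℝ) T ⊆ uIcc 0 T := uIcc_subset_uIcc hmem right_mem_uIcc
  have hκ4 : |κ| * 4 ≤ 1 / 2 := by linarith
  have hb : ∀ τ ∈ Icc (0:ℝ) 4, |κ * τ| ≤ 1 / 100 := by
    intro τ h
    rw [abs_mul, abs_of_nonneg h.1]
    nlinarith [abs_nonneg κ, h.1, h.2]
  have hcn := contOn_q1 hκ hT0 (-2 / 3) hc1
  have hqe : q1 κ (-2 / 3) T f ≤ ∫ τ in (0:ℝ)..4, (101 / 100 * (4 * (4 - τ) ^ 2) +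
      (102 / 100 * (τ - 2 / 3) ^ 2 + 204 / 10000) / (99 / 100) * (4 - τ) ^ 4) := by
    rw [q1, ← intervalIntegral.integral_add_adjacent_intervals (b := 4)
      (hcn.mono hs1).intervalIntegrable (hcn.mono hs2).intervalIntegrable]
    rw [intervalIntegral.integral_congr (a := 4) (b := T) (g := fun _ => 0)
      (fun τ hτ => by simp [hout τ hτ])]
    simp only [intervalIntegral.integral_zero, add_zero]
    refine intervalIntegral.integral_mono_on (by norm_num) (hcn.mono hs1).intervalIntegrable
      (Continuous.intervalIntegrable (by fun_prop) _ _) fun τ hτ => ?_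
    have h1 := hin τ (by rwa [uIcc_of_le (by norm_num)])
    rw [h1.1, h1.2]
    have h2 := abs_le.1 (hb τ hτ)
    have h3 : (99 / 100 : ℝ) ≤ 1 - κ * τ := by linarith
    refine add_le_add ?_ ?_
    · nlinarith [sq_nonneg (4 - τ)]
    · rw [show ((4 - τ) ^ 2) ^ 2 = (4 - τ) ^ 4 by ring]
      refine mul_le_mul_of_nonneg_right ?_ (by positivity)
      refine div_le_div₀ (by positivity) ?_ (by norm_num) h3
      have hy : |κ * τ ^ 2 / 2| ≤ 2 / 100 := by
        rw [show κ * τ ^ 2 / 2 = κ * τ * (τ / 2) by ring, abs_mul,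
          abs_of_nonneg (by linarith [hτ.1] : 0 ≤ τ / 2)]
        nlinarith [abs_nonneg (κ * τ), hb τ hτ, hτ.2, hτ.1]
      have hy2 : (κ * τ ^ 2 / 2) ^ 2 ≤ (2 / 100) ^ 2 := sq_le_sq' (abs_le.1 hy).1 (abs_le.1 hy).2
      nlinarith [sq_nonneg ((τ - 2 / 3) * (1 / 7) + 7 * (κ * τ ^ 2 / 2)),
        sq_nonneg ((τ - 2 / 3) + 50 * (κ * τ ^ 2 / 2))]
  have hne : (∫ τ in (0:ℝ)..4, 99 / 100 * (4 - τ) ^ 4) ≤ n1 κ T f := by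
    have hcm := (cont_n1 κ hc1)
    rw [n1, ← intervalIntegral.integral_add_adjacent_intervals (b := 4)
      (hcm.intervalIntegrable 0 4) (hcm.intervalIntegrable 4 T)]
    rw [intervalIntegral.integral_congr (a := 4) (b := T) (g := fun _ => 0)
      (fun τ hτ => by simp [hout τ hτ])]
    simp only [intervalIntegral.integral_zero, add_zero]
    refine intervalIntegral.integral_mono_on (by norm_num)
      (Continuous.intervalIntegrable (by fun_prop) _ _) (hcm.intervalIntegrable 0 4) fun τ hτ => ?_
    have h1 := hin τ (by rwa [uIcc_of_le (by norm_num)])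
    have h2 := abs_le.1 (hb τ hτ)
    rw [h1.1, show ((4 - τ) ^ 2) ^ 2 = (4 - τ) ^ 4 by ring]
    exact mul_le_mul_of_nonneg_right (by linarith) (by positivity)
  have i1 : (∫ τ in (0:ℝ)..4, 99 / 100 * (4 - τ) ^ 4) = 99 / 100 * (1024 / 5) := by
    rw [intervalIntegral.integral_eq_sub_of_hasDerivAt
      (f := fun τ => 99 / 100 * (-(4 - τ) ^ 5 / 5))]
    · norm_num
    · intro τ _
      have := (((((hasDerivAt_id τ).const_sub 4).pow 5).neg.div_const 5).const_mul (99 / 100 : ℝ))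
      refine this.congr_deriv ?_
      simp
    · exact Continuous.intervalIntegrable (by fun_prop) _ _
  have i2 : (∫ τ in (0:ℝ)..4, (101 / 100 * (4 * (4 - τ) ^ 2) +
      (102 / 100 * (τ - 2 / 3) ^ 2 + 204 / 10000) / (99 / 100) * (4 - τ) ^ 4)) ≤ 159 := by
    rw [intervalIntegral.integral_eq_sub_of_hasDerivAt
      (f := fun τ => 101 / 100 * (-4 / 3 * (4 - τ) ^ 3) + 102 / 99 *
        (-(4 - τ) ^ 7 / 7 + 2 * (10 / 3) * (4 - τ) ^ 6 / 6 - (10 / 3) ^ 2 * (4 - τ) ^ 5 / 5) -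
        204 / 9900 * (4 - τ) ^ 5 / 5)]
    · norm_num
    · intro τ _
      have hx := (hasDerivAt_id τ).const_sub 4
      have := (((hx.pow 3).const_mul (-4 / 3 : ℝ)).const_mul (101 / 100 : ℝ)).add
        (((((hx.pow 7).neg.div_const 7).add (((hx.pow 6).const_mul (2 * (10 / 3) : ℝ)).div_const 6)).sub
        (((hx.pow 5).const_mul ((10 / 3 : ℝ) ^ 2)).div_const 5)).const_mul (102 / 99 : ℝ)) |>.sub
        (((hx.pow 5).const_mul (204 / 9900 : ℝ)).div_const 5)
      refine this.congr_deriv ?_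
      simp
      ring
    · exact Continuous.intervalIntegrable (by fun_prop) _ _
  rw [i1] at hne
  refine ⟨-2 / 3, f, hadm, by linarith, ?_⟩
  calc _ ≤ _ := hqe
    _ ≤ _ := i2
    _ ≤ _ := by linarith

/-- The infimum of the one-dimensional model. -/
lemma exists_inf1 {κ T : ℝ} (hκ : |κ| * T ≤ 1 / 2) (hT : 4 ≤ T) (hκ' : |κ| ≤ 1 / 400) :
    ∃ Λ : ℝ, 0 ≤ Λ ∧ Λ ≤ 4 / 5 ∧ (∀ ξ f, Adm1 T f → Λ * n1 κ T f ≤ q1 κ ξ T f) ∧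
      (∀ δ > 0, ∃ ξ f, Adm1 T f ∧ n1 κ T f = 1 ∧ q1 κ ξ T f ≤ Λ + δ) := by
  have hT0 : 0 ≤ T := by linarith
  have hscale : ∀ ξ f, Adm1 T f → 0 < n1 κ T f → ∃ g, Adm1 T g ∧ n1 κ T g = 1 ∧
      q1 κ ξ T g = q1 κ ξ T f / n1 κ T f := by
    intro ξ f hf hn
    set c := (Real.sqrt (n1 κ T f))⁻¹ with hc
    have hc2 : c ^ 2 = (n1 κ T f)⁻¹ := by rw [hc, inv_pow, Real.sq_sqrt hn.le]
    refine ⟨fun τ => c * f τ, hf.mul contDiff_const, ?_, ?_⟩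
    · have : n1 κ T (fun τ => c * f τ) = c ^ 2 * n1 κ T f := by
        simp only [n1]
        rw [← intervalIntegral.integral_const_mul]
        congr 1
        ext τ
        ring
      rw [this, hc2, inv_mul_cancel₀ hn.ne']
    · have : q1 κ ξ T (fun τ => c * f τ) = c ^ 2 * q1 κ ξ T f := by
        simp only [q1]
        rw [← intervalIntegral.integral_const_mul]
        congr 1
        ext τ
        rw [deriv_const_mul _ (hf.1.differentiable one_ne_zero τ)]
        ring
      rw [this, hc2, div_eq_inv_mul]
  set S : Set ℝ := {r | ∃ ξ f, Adm1 T f ∧ n1 κ T f = 1 ∧ r = q1 κ ξ T f} with hS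
  have hbdd : BddBelow S := ⟨0, by rintro r ⟨ξ, f, -, -, rfl⟩; exact q1_nonneg hκ hT0 ξ f⟩
  obtain ⟨ξ₀, f₀, hf₀, hn₀, hq₀⟩ := exists_trial1 hκ hT hκ'
  obtain ⟨g₀, hg₀, hng₀, hqg₀⟩ := hscale ξ₀ f₀ hf₀ hn₀
  have hne : S.Nonempty := ⟨_, ξ₀, g₀, hg₀, hng₀, rfl⟩
  refine ⟨sInf S, ?_, ?_, ?_, ?_⟩
  · refine le_csInf hne ?_
    rintro r ⟨ξ, f, -, -, rfl⟩
    exact q1_nonneg hκ hT0 ξ f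
  · refine (csInf_le hbdd ⟨ξ₀, g₀, hg₀, hng₀, rfl⟩).trans ?_
    rw [hqg₀, div_le_iff₀ hn₀]
    exact hq₀
  · intro ξ f hf
    rcases (n1_nonneg hκ hT0 f).eq_or_lt with h | h
    · rw [← h, mul_zero]
      exact q1_nonneg hκ hT0 ξ f
    · obtain ⟨g, hg, hng, hqg⟩ := hscale ξ f hf h
      have := csInf_le hbdd ⟨ξ, g, hg, hng, rfl⟩
      rwa [hqg, le_div_iff₀ h] at this
  · intro δ hδ
    obtain ⟨r, ⟨ξ, f, hf, hn, rfl⟩, hr⟩ := exists_lt_of_csInf_lt hne (lt_add_of_pos_right (sInf S) hδ)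
    exact ⟨ξ, f, hf, hn, hr.le⟩

end SC

namespace SC

/-- The quadratic remainder in front of the derivative. -/
def remA (k : ℝ) (p : ℝ × ℝ × ℝ) (t : ℝ) : ℝ :=
  (0) + t * (((-1/9) * p.2.1 + (1/3) * k * p.2.1 + (1/9) * p.1 * k * p.2.1 ^ 2) + t  *
    (((-2/3) + (-5/6) * k + (-5/27) * p.1 * p.2.1 + (-1/6) * p.1 * k * p.2.1) + t * (((-8/27)
    * p.1 + (-1/3) * p.1 * k + (-1/27) * p.1 ^ 2 * p.2.1 + (-1/27) * p.1 ^ 2 * k * p.2.1) + t  *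
    (((-1/27) * p.1 ^ 2 + (-1/27) * p.1 ^ 2 * k)))))

/-- Coefficient of degree 0 of the remainder `remB`. -/
def remBCoeff0 (k : ℝ) (p : ℝ × ℝ × ℝ) : ℝ :=
  (1/3) + (1/9) * p.2.2 ^ 2 + (-1/9) * p.2.1 ^ 2 * p.2.2 + (1/3) * k

/-- Coefficient of degree 1 of the remainder `remB`. -/
def remBCoeff1 (k : ℝ) (p : ℝ × ℝ × ℝ) : ℝ :=
  (-1) * p.2.1 * p.2.2 + (1/3) * p.2.1 ^ 3 + (-5/3) * k * p.2.1 * p.2.2 + (-1/3) * k * p.2.1 ^ 3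
    + (-2/9) * p.1 + (2/27) * p.1 * p.2.2 ^ 2 + (-7/27) * p.1 * p.2.1 ^ 2 * p.2.2 + (1/9) * p.1
    * p.2.1 ^ 4 + (-8/9) * p.1 * k + (-1/9) * p.1 * k * p.2.2 ^ 2 + (-1/3) * p.1 * k * p.2.1 ^ 2
    * p.2.2 + (-2/9) * p.1 * k * p.2.1 ^ 4 + (-2/3) * p.1 * k ^ 2 + (-1/9) * p.1 ^ 2 * k * p.2.1
    + (-1/27) * p.1 ^ 2 * k * p.2.1 * p.2.2 ^ 2 + (-1/27) * p.1 ^ 2 * k * p.2.1 ^ 5 + (-1/9) *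
    p.1 ^ 2 * k ^ 2 * p.2.1

/-- Coefficient of degree 2 of the remainder `remB`. -/
def remBCoeff2 (k : ℝ) (p : ℝ × ℝ × ℝ) : ℝ :=
  (-2/9) * p.2.2 + (11/9) * p.2.1 ^ 2 + (-1/6) * k * p.2.2 + (7/6) * k * p.2.1 ^ 2 + (-5/27) *
    p.1 * p.2.1 * p.2.2 + (16/27) * p.1 * p.2.1 ^ 3 + (14/9) * p.1 * k * p.2.1 * p.2.2 + (4/9) *
    p.1 * k * p.2.1 ^ 3 + (8/3) * p.1 * k ^ 2 * p.2.1 * p.2.2 + (-1/9) * p.1 ^ 2 + (1/81) * p.1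
    ^ 2 * p.2.2 ^ 2 + (-2/81) * p.1 ^ 2 * p.2.1 ^ 2 * p.2.2 + (2/27) * p.1 ^ 2 * p.2.1 ^ 4 +
    (-1/18) * p.1 ^ 2 * k + (-5/54) * p.1 ^ 2 * k * p.2.2 ^ 2 + (8/9) * p.1 ^ 2 * k * p.2.1 ^ 2
    * p.2.2 + (-1/54) * p.1 ^ 2 * k * p.2.1 ^ 4 + (7/18) * p.1 ^ 2 * k ^ 2 + (4/3) * p.1 ^ 2 * k
    ^ 2 * p.2.1 ^ 2 * p.2.2 + (1/3) * p.1 ^ 2 * k ^ 3 + (2/27) * p.1 ^ 3 * k * p.2.1 + (-2/81) *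
    p.1 ^ 3 * k * p.2.1 * p.2.2 ^ 2 + (10/81) * p.1 ^ 3 * k * p.2.1 ^ 3 * p.2.2 + (-1/81) * p.1
    ^ 3 * k * p.2.1 ^ 5 + (5/27) * p.1 ^ 3 * k ^ 2 * p.2.1 + (2/9) * p.1 ^ 3 * k ^ 2 * p.2.1 ^ 3
    * p.2.2 + (1/9) * p.1 ^ 3 * k ^ 3 * p.2.1 + (1/81) * p.1 ^ 4 * k ^ 2 * p.2.1 ^ 4 * p.2.2

/-- Coefficient of degree 3 of the remainder `remB`. -/
def remBCoeff3 (k : ℝ) (p : ℝ × ℝ × ℝ) : ℝ :=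
  (10/9) * p.2.1 + 2 * k * p.2.1 + (-8/27) * p.1 * p.2.2 + (25/27) * p.1 * p.2.1 ^ 2 + (-2/9) *
    p.1 * k * p.2.2 + p.1 * k * p.2.1 ^ 2 + (-2/3) * p.1 * k ^ 2 * p.2.1 ^ 2 + (19/81) * p.1 ^ 2
    * p.2.1 ^ 3 + (20/27) * p.1 ^ 2 * k * p.2.1 * p.2.2 + (-1/27) * p.1 ^ 2 * k * p.2.1 ^ 3 +
    (1/9) * p.1 ^ 2 * k ^ 2 * p.2.1 * p.2.2 + (-5/9) * p.1 ^ 2 * k ^ 2 * p.2.1 ^ 3 + (-1) * p.1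
    ^ 2 * k ^ 3 * p.2.1 * p.2.2 + (1/81) * p.1 ^ 3 * p.2.1 ^ 4 + (4/27) * p.1 ^ 3 * k + (-2/81)
    * p.1 ^ 3 * k * p.2.2 ^ 2 + (5/27) * p.1 ^ 3 * k * p.2.1 ^ 2 * p.2.2 + (-8/81) * p.1 ^ 3 * k
    * p.2.1 ^ 4 + (17/54) * p.1 ^ 3 * k ^ 2 + (-1/3) * p.1 ^ 3 * k ^ 2 * p.2.1 ^ 2 * p.2.2 +
    (-4/27) * p.1 ^ 3 * k ^ 2 * p.2.1 ^ 4 + (1/6) * p.1 ^ 3 * k ^ 3 + (-2/3) * p.1 ^ 3 * k ^ 3 *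
    p.2.1 ^ 2 * p.2.2 + (1/27) * p.1 ^ 4 * k * p.2.1 + (-1/243) * p.1 ^ 4 * k * p.2.1 * p.2.2 ^
    2 + (2/243) * p.1 ^ 4 * k * p.2.1 ^ 3 * p.2.2 + (-1/81) * p.1 ^ 4 * k * p.2.1 ^ 5 + (2/27) *
    p.1 ^ 4 * k ^ 2 * p.2.1 + (-10/81) * p.1 ^ 4 * k ^ 2 * p.2.1 ^ 3 * p.2.2 + (-1/81) * p.1 ^ 4
    * k ^ 2 * p.2.1 ^ 5 + (1/27) * p.1 ^ 4 * k ^ 3 * p.2.1 + (-4/27) * p.1 ^ 4 * k ^ 3 * p.2.1 ^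
    3 * p.2.2 + (-1/81) * p.1 ^ 5 * k ^ 2 * p.2.1 ^ 4 * p.2.2 + (-1/81) * p.1 ^ 5 * k ^ 3 *
    p.2.1 ^ 4 * p.2.2

/-- Coefficient of degree 4 of the remainder `remB`. -/
def remBCoeff4 (k : ℝ) (p : ℝ × ℝ × ℝ) : ℝ :=
  (2/9) + (1/2) * k + (31/54) * p.1 * p.2.1 + (1/12) * p.1 * k * p.2.1 + (-5/3) * p.1 * k ^ 2 *
    p.2.1 + (-2/27) * p.1 ^ 2 * p.2.2 + (67/324) * p.1 ^ 2 * p.2.1 ^ 2 + (11/54) * p.1 ^ 2 * k *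
    p.2.2 + (-35/54) * p.1 ^ 2 * k * p.2.1 ^ 2 + (5/12) * p.1 ^ 2 * k ^ 2 * p.2.2 + (-61/36) *
    p.1 ^ 2 * k ^ 2 * p.2.1 ^ 2 + (1/6) * p.1 ^ 2 * k ^ 3 * p.2.2 + (2/81) * p.1 ^ 3 * p.2.1 ^ 3
    + (4/27) * p.1 ^ 3 * k * p.2.1 * p.2.2 + (-127/324) * p.1 ^ 3 * k * p.2.1 ^ 3 + (-13/54) *
    p.1 ^ 3 * k ^ 2 * p.2.1 * p.2.2 + (-19/27) * p.1 ^ 3 * k ^ 2 * p.2.1 ^ 3 + (-4/9) * p.1 ^ 3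
    * k ^ 3 * p.2.1 * p.2.2 + (1/54) * p.1 ^ 4 * k + (-1/486) * p.1 ^ 4 * k * p.2.2 ^ 2 +
    (1/243) * p.1 ^ 4 * k * p.2.1 ^ 2 * p.2.2 + (-19/243) * p.1 ^ 4 * k * p.2.1 ^ 4 + (1/27) *
    p.1 ^ 4 * k ^ 2 + (-67/324) * p.1 ^ 4 * k ^ 2 * p.2.1 ^ 2 * p.2.2 + (-43/324) * p.1 ^ 4 * k
    ^ 2 * p.2.1 ^ 4 + (1/54) * p.1 ^ 4 * k ^ 3 + (-2/9) * p.1 ^ 4 * k ^ 3 * p.2.1 ^ 2 * p.2.2 +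
    (-1/243) * p.1 ^ 5 * k * p.2.1 ^ 5 + (-2/81) * p.1 ^ 5 * k ^ 2 * p.2.1 ^ 3 * p.2.2 +
    (-5/486) * p.1 ^ 5 * k ^ 2 * p.2.1 ^ 5 + (-2/81) * p.1 ^ 5 * k ^ 3 * p.2.1 ^ 3 * p.2.2 +
    (-1/2916) * p.1 ^ 6 * k ^ 2 * p.2.1 ^ 6

/-- Coefficient of degree 5 of the remainder `remB`. -/
def remBCoeff5 (k : ℝ) (p : ℝ × ℝ × ℝ) : ℝ :=
  (5/27) * p.1 + (5/36) * p.1 * k + (-1/3) * p.1 * k ^ 2 + (29/324) * p.1 ^ 2 * p.2.1 + (-11/18)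
    * p.1 ^ 2 * k * p.2.1 + (-8/9) * p.1 ^ 2 * k ^ 2 * p.2.1 + (5/12) * p.1 ^ 2 * k ^ 3 * p.2.1
    + (5/324) * p.1 ^ 3 * p.2.1 ^ 2 + (10/81) * p.1 ^ 3 * k * p.2.2 + (-145/324) * p.1 ^ 3 * k *
    p.2.1 ^ 2 + (11/54) * p.1 ^ 3 * k ^ 2 * p.2.2 + (-43/108) * p.1 ^ 3 * k ^ 2 * p.2.1 ^ 2 +
    (1/12) * p.1 ^ 3 * k ^ 3 * p.2.2 + (5/12) * p.1 ^ 3 * k ^ 3 * p.2.1 ^ 2 + (2/81) * p.1 ^ 4 *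
    k * p.2.1 * p.2.2 + (-19/162) * p.1 ^ 4 * k * p.2.1 ^ 3 + (-1/36) * p.1 ^ 4 * k ^ 2 * p.2.1
    * p.2.2 + (-11/324) * p.1 ^ 4 * k ^ 2 * p.2.1 ^ 3 + (-1/18) * p.1 ^ 4 * k ^ 3 * p.2.1 *
    p.2.2 + (5/27) * p.1 ^ 4 * k ^ 3 * p.2.1 ^ 3 + (-5/486) * p.1 ^ 5 * k * p.2.1 ^ 4 + (-5/324)
    * p.1 ^ 5 * k ^ 2 * p.2.1 ^ 2 * p.2.2 + (5/243) * p.1 ^ 5 * k ^ 2 * p.2.1 ^ 4 + (-5/324) *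
    p.1 ^ 5 * k ^ 3 * p.2.1 ^ 2 * p.2.2 + (5/108) * p.1 ^ 5 * k ^ 3 * p.2.1 ^ 4 + (5/972) * p.1
    ^ 6 * k ^ 2 * p.2.1 ^ 5 + (1/162) * p.1 ^ 6 * k ^ 3 * p.2.1 ^ 5 + (1/2916) * p.1 ^ 7 * k ^ 2
    * p.2.1 ^ 6 + (1/2916) * p.1 ^ 7 * k ^ 3 * p.2.1 ^ 6

/-- Coefficient of degree 6 of the remainder `remB`. -/
def remBCoeff6 (k : ℝ) (p : ℝ × ℝ × ℝ) : ℝ :=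
  (1/27) * p.1 ^ 2 + (-17/108) * p.1 ^ 2 * k + (-19/72) * p.1 ^ 2 * k ^ 2 + (1/24) * p.1 ^ 2 * k
    ^ 3 + (1/324) * p.1 ^ 3 * p.2.1 + (-19/81) * p.1 ^ 3 * k * p.2.1 + (-1/36) * p.1 ^ 3 * k ^ 2
    * p.2.1 + (13/36) * p.1 ^ 3 * k ^ 3 * p.2.1 + (1/81) * p.1 ^ 4 * k * p.2.2 + (-149/1944) *
    p.1 ^ 4 * k * p.2.1 ^ 2 + (7/324) * p.1 ^ 4 * k ^ 2 * p.2.2 + (43/324) * p.1 ^ 4 * k ^ 2 *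
    p.2.1 ^ 2 + (1/108) * p.1 ^ 4 * k ^ 3 * p.2.2 + (5/18) * p.1 ^ 4 * k ^ 3 * p.2.1 ^ 2 +
    (-1/108) * p.1 ^ 5 * k * p.2.1 ^ 3 + (-1/324) * p.1 ^ 5 * k ^ 2 * p.2.1 * p.2.2 + (67/972) *
    p.1 ^ 5 * k ^ 2 * p.2.1 ^ 3 + (-1/324) * p.1 ^ 5 * k ^ 3 * p.2.1 * p.2.2 + (5/54) * p.1 ^ 5
    * k ^ 3 * p.2.1 ^ 3 + (83/5832) * p.1 ^ 6 * k ^ 2 * p.2.1 ^ 4 + (5/324) * p.1 ^ 6 * k ^ 3 *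
    p.2.1 ^ 4 + (1/972) * p.1 ^ 7 * k ^ 2 * p.2.1 ^ 5 + (1/972) * p.1 ^ 7 * k ^ 3 * p.2.1 ^ 5

/-- Coefficient of degree 7 of the remainder `remB`. -/
def remBCoeff7 (k : ℝ) (p : ℝ × ℝ × ℝ) : ℝ :=
  (-11/162) * p.1 ^ 3 * k + (-5/108) * p.1 ^ 3 * k ^ 2 + (1/24) * p.1 ^ 3 * k ^ 3 + (-59/1944) *
    p.1 ^ 4 * k * p.2.1 + (23/324) * p.1 ^ 4 * k ^ 2 * p.2.1 + (13/108) * p.1 ^ 4 * k ^ 3 *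
    p.2.1 + (-7/1944) * p.1 ^ 5 * k * p.2.1 ^ 2 + (107/1944) * p.1 ^ 5 * k ^ 2 * p.2.1 ^ 2 +
    (7/108) * p.1 ^ 5 * k ^ 3 * p.2.1 ^ 2 + (10/729) * p.1 ^ 6 * k ^ 2 * p.2.1 ^ 3 + (7/486) *
    p.1 ^ 6 * k ^ 3 * p.2.1 ^ 3 + (7/5832) * p.1 ^ 7 * k ^ 2 * p.2.1 ^ 4 + (7/5832) * p.1 ^ 7 *
    k ^ 3 * p.2.1 ^ 4

/-- Coefficient of degree 8 of the remainder `remB`. -/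
def remBCoeff8 (k : ℝ) (p : ℝ × ℝ × ℝ) : ℝ :=
  (-1/162) * p.1 ^ 4 * k + (31/5184) * p.1 ^ 4 * k ^ 2 + (1/72) * p.1 ^ 4 * k ^ 3 + (-1/1944) *
    p.1 ^ 5 * k * p.2.1 + (131/7776) * p.1 ^ 5 * k ^ 2 * p.2.1 + (1/54) * p.1 ^ 5 * k ^ 3 *
    p.2.1 + (31/5184) * p.1 ^ 6 * k ^ 2 * p.2.1 ^ 2 + (1/162) * p.1 ^ 6 * k ^ 3 * p.2.1 ^ 2 +
    (1/1458) * p.1 ^ 7 * k ^ 2 * p.2.1 ^ 3 + (1/1458) * p.1 ^ 7 * k ^ 3 * p.2.1 ^ 3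

/-- Coefficient of degree 9 of the remainder `remB`. -/
def remBCoeff9 (k : ℝ) (p : ℝ × ℝ × ℝ) : ℝ :=
  (13/7776) * p.1 ^ 5 * k ^ 2 + (1/576) * p.1 ^ 5 * k ^ 3 + (53/46656) * p.1 ^ 6 * k ^ 2 * p.2.1
    + (1/864) * p.1 ^ 6 * k ^ 3 * p.2.1 + (1/5184) * p.1 ^ 7 * k ^ 2 * p.2.1 ^ 2 + (1/5184) *
    p.1 ^ 7 * k ^ 3 * p.2.1 ^ 2

/-- Coefficient of degree 10 of the remainder `remB`. -/
def remBCoeff10 (k : ℝ) (p : ℝ × ℝ × ℝ) : ℝ :=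
  (1/15552) * p.1 ^ 6 * k ^ 2 + (1/15552) * p.1 ^ 6 * k ^ 3 + (1/46656) * p.1 ^ 7 * k ^ 2 *
    p.2.1 + (1/46656) * p.1 ^ 7 * k ^ 3 * p.2.1

/-- The quadratic remainder in front of the function. -/
def remB (k : ℝ) (p : ℝ × ℝ × ℝ) (t : ℝ) : ℝ :=
  remBCoeff0 k p + t * (remBCoeff1 k p + t * (remBCoeff2 k p + t * (remBCoeff3 k p + t *
    (remBCoeff4 k p + t * (remBCoeff5 k p + t * (remBCoeff6 k p + t * (remBCoeff7 k p + t *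
    (remBCoeff8 k p + t * (remBCoeff9 k p + t * (remBCoeff10 k p))))))))))

lemma remA_identity (k H x L t : ℝ) :
    (1 - (k + 1) * H * t) * (1 + H * t / 3) ^ 2 * (1 + H * t / 3 + H * x / 3) -
      (1 + H * x / 3) * (1 - k * H * (t + H * (t ^ 2 / 6 + x * t / 3))) =
      H ^ 2 * remA k (H, x, L) t := by
  simp only [remA]
  ring

set_option maxHeartbeats 2000000 in
lemma remB_identity (k H x L t : ℝ) :
    ((1 + H * t / 3) ^ 2 * ((x + H * (x ^ 2 - L) / 3 + t - (k + 1) * H * t ^ 2 / 2) ^ 2 -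
        L * (1 - (k + 1) * H * t) ^ 2) + (1 - (k + 1) * H * t) ^ 2 * (H / 3) ^ 2 -
      (1 - (k + 1) * H * t) * ((1 - (k + 1) * H * t) * (H / 3) * (H / 3) -
        (k + 1) * H * (1 + H * t / 3) * (H / 3))) *
        (1 - k * H * (t + H * (t ^ 2 / 6 + x * t / 3))) -
      (1 + H * x / 3) * (1 + H * t / 3 + H * x / 3) * (1 - (k + 1) * H * t) *
        ((x + (t + H * (t ^ 2 / 6 + x * t / 3)) -
          k * H * (t + H * (t ^ 2 / 6 + x * t / 3)) ^ 2 / 2) ^ 2 -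
        L * (1 - k * H * (t + H * (t ^ 2 / 6 + x * t / 3))) ^ 2) =
      H ^ 2 * remB k (H, x, L) t := by
  simp only [remB, remBCoeff0, remBCoeff1, remBCoeff2, remBCoeff3, remBCoeff4, remBCoeff5, remBCoeff6, remBCoeff7, remBCoeff8, remBCoeff9, remBCoeff10]
  ring

/-- Uniform polynomial growth in `t` for parameters in `K`. -/
def PolyB (K : Set (ℝ × ℝ × ℝ)) (n : ℕ) (R : ℝ × ℝ × ℝ → ℝ → ℝ) : Prop :=
  ∃ C, 0 ≤ C ∧ ∀ p ∈ K, ∀ t, 0 ≤ t → |R p t| ≤ C * (1 + t) ^ n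

lemma PolyB.base {K : Set (ℝ × ℝ × ℝ)} (hK : IsCompact K) {c : ℝ × ℝ × ℝ → ℝ}
    (hc : Continuous c) : PolyB K 0 (fun p _ => c p) := by
  obtain ⟨C, hC⟩ := hK.exists_bound_of_continuousOn hc.continuousOn
  exact ⟨max C 0, le_max_right _ _, fun p hp t _ => by
    simpa using Or.inl (hC p hp)⟩

lemma PolyB.step {K : Set (ℝ × ℝ × ℝ)} (hK : IsCompact K) {c : ℝ × ℝ × ℝ → ℝ}
    (hc : Continuous c) {n : ℕ} {R : ℝ × ℝ × ℝ → ℝ → ℝ} (hR : PolyB K n R) :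
    PolyB K (n + 1) (fun p t => c p + t * R p t) := by
  obtain ⟨C, hC0, hC⟩ := hK.exists_bound_of_continuousOn hc.continuousOn |>.imp
    fun C h => (⟨le_max_right C 0, fun p hp => (h p hp).trans (le_max_left C 0)⟩ :
      0 ≤ max C 0 ∧ ∀ p ∈ K, ‖c p‖ ≤ max C 0)
  obtain ⟨D, hD0, hD⟩ := hR
  refine ⟨max C 0 + D, by positivity, fun p hp t ht => ?_⟩
  have h1 : (1:ℝ) ≤ (1 + t) ^ (n + 1) := one_le_pow₀ (by linarith)
  have h2 := hD p hp t ht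
  calc |c p + t * R p t| ≤ |c p| + |t * R p t| := abs_add_le _ _
    _ ≤ max C 0 * (1 + t) ^ (n + 1) + D * (1 + t) ^ (n + 1) := by
      refine add_le_add ((hC p hp).trans (le_mul_of_one_le_right hC0 h1)) ?_
      rw [abs_mul, abs_of_nonneg ht, pow_succ]
      have : 0 ≤ D * (1 + t) ^ n := by positivity
      calc t * |R p t| ≤ (1 + t) * (D * (1 + t) ^ n) :=
            mul_le_mul (by linarith) h2 (abs_nonneg _) (by linarith)
        _ = _ := by ring
    _ = _ := by ring

lemma remA_bound (k : ℝ) {K : Set (ℝ × ℝ × ℝ)} (hK : IsCompact K) : PolyB K 4 (remA k) := by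
  unfold remA
  refine PolyB.step hK (by fun_prop) ?_
  refine PolyB.step hK (by fun_prop) ?_
  refine PolyB.step hK (by fun_prop) ?_
  refine PolyB.step hK (by fun_prop) ?_
  exact PolyB.base hK (by fun_prop)

set_option maxHeartbeats 2000000 in
lemma remB_bound (k : ℝ) {K : Set (ℝ × ℝ × ℝ)} (hK : IsCompact K) : PolyB K 10 (remB k) := by
  unfold remB
  refine PolyB.step hK (by unfold remBCoeff0; fun_prop) ?_
  refine PolyB.step hK (by unfold remBCoeff1; fun_prop) ?_
  refine PolyB.step hK (by unfold remBCoeff2; fun_prop) ?_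
  refine PolyB.step hK (by unfold remBCoeff3; fun_prop) ?_
  refine PolyB.step hK (by unfold remBCoeff4; fun_prop) ?_
  refine PolyB.step hK (by unfold remBCoeff5; fun_prop) ?_
  refine PolyB.step hK (by unfold remBCoeff6; fun_prop) ?_
  refine PolyB.step hK (by unfold remBCoeff7; fun_prop) ?_
  refine PolyB.step hK (by unfold remBCoeff8; fun_prop) ?_
  refine PolyB.step hK (by unfold remBCoeff9; fun_prop) ?_
  exact PolyB.base hK (by unfold remBCoeff10; fun_prop)

lemma transform_algebra {m0 m1 : ℝ} (h0 : m0 ≠ 0) (h1 : m1 ≠ 0)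
    (g dg e a1 a0 pre dψ Λ y w : ℝ) :
    m1 * (g * (dψ * w) + dg * y) ^ 2 + a1 ^ 2 / m1 * (g * y) ^ 2 - Λ * (m1 * (g * y) ^ 2) =
      pre * ((m0 * w ^ 2 + a0 ^ 2 / m0 * y ^ 2 - Λ * (m0 * y ^ 2)) * dψ) +
      (e * y ^ 2 + m1 * g * dg * (2 * y * (dψ * w))) + ((m1 * g ^ 2 * dψ - pre * m0) * dψ * w ^ 2 +
      ((g ^ 2 * (a1 ^ 2 - Λ * m1 ^ 2) + m1 ^ 2 * dg ^ 2 - m1 * e) * m0 -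
        pre * dψ * m1 * (a0 ^ 2 - Λ * m0 ^ 2)) / (m1 * m0) * y ^ 2) := by
  field_simp
  ring

end SC

namespace SC

lemma Adm1.deriv_eq_zero {T : ℝ} {f : ℝ → ℝ} (hf : Adm1 T f) {τ : ℝ} (hτ : T ≤ τ) :
    deriv f τ = 0 := by
  have h1 : HasDerivWithinAt f (deriv f τ) (Ici τ) τ :=
    (hf.1.differentiable one_ne_zero τ).hasDerivAt.hasDerivWithinAt
  have h2 : HasDerivWithinAt f 0 (Ici τ) τ :=
    (hasDerivWithinAt_const τ (Ici τ) (0:ℝ)).congr (fun y hy => hf.2 y (hτ.trans hy)) (hf.2 τ hτ)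
  exact (uniqueDiffWithinAt_Ici τ).eq_deriv _ h1 h2

/-- The change of variable used to compare two curvatures. -/
def chgVar (H ξ τ : ℝ) : ℝ := τ + H * (τ ^ 2 / 6 + ξ * τ / 3)

/-- The transplanted function. -/
def chgFun (H ξ : ℝ) (f : ℝ → ℝ) (τ : ℝ) : ℝ := (1 + H * τ / 3) * f (chgVar H ξ τ)

lemma hasDerivAt_chgVar (H ξ τ : ℝ) :
    HasDerivAt (chgVar H ξ) (1 + H * τ / 3 + H * ξ / 3) τ := by
  have h := hasDerivAt_id τ
  have := h.add ((((h.pow 2).div_const 6).add ((h.const_mul ξ).div_const 3)).const_mul H)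
  refine this.congr_deriv ?_
  simp
  ring

lemma contDiff_chgVar (H ξ : ℝ) : ContDiff ℝ 1 (chgVar H ξ) := by
  unfold chgVar
  fun_prop

section
variable {H ξ T : ℝ} (hH0 : 0 < H) (hHξ : H * |ξ| ≤ 1)
include hH0 hHξ

lemma half_le_chgVar {τ : ℝ} (h0 : 0 ≤ τ) : τ / 2 ≤ chgVar H ξ τ := by
  have h1 : -1 ≤ H * ξ := by
    have := neg_abs_le ξ
    nlinarith
  have h3 : chgVar H ξ τ - τ / 2 = τ * (1 / 2 + H * ξ / 3) + H * τ ^ 2 / 6 := by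
    unfold chgVar; ring
  have : 0 ≤ τ * (1 / 2 + H * ξ / 3) + H * τ ^ 2 / 6 :=
    add_nonneg (mul_nonneg h0 (by linarith)) (by positivity)
  linarith

lemma chgVar_le (hHT : H * T ≤ 1 / 3) {τ : ℝ} (h0 : 0 ≤ τ) (h1 : τ ≤ 2 * T) :
    chgVar H ξ τ ≤ 3 * T := by
  have h2 : H * ξ ≤ 1 := by
    have := le_abs_self ξ
    nlinarith
  have h3 : H * τ ≤ 2 / 3 := by nlinarith
  have h4 : chgVar H ξ τ = τ * (1 + H * τ / 6 + H * ξ / 3) := by unfold chgVar; ring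
  rw [h4]
  nlinarith

lemma dchg_bounds (hHT : H * T ≤ 1 / 3) {τ : ℝ} (h0 : 0 ≤ τ) (h1 : τ ≤ 2 * T) :
    1 / 2 ≤ 1 + H * τ / 3 + H * ξ / 3 ∧ 1 + H * τ / 3 + H * ξ / 3 ≤ 2 := by
  have h2 : H * ξ ≤ 1 := by
    have := le_abs_self ξ
    nlinarith
  have h2' : -1 ≤ H * ξ := by
    have := neg_abs_le ξ
    nlinarith
  have h3 : H * τ ≤ 2 / 3 := by nlinarith
  have h4 : 0 ≤ H * τ := by positivity
  constructor <;> linarith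

lemma integral_chg (hT : 0 ≤ T) (hHT : H * T ≤ 1 / 3) {G : ℝ → ℝ}
    (hG : ContinuousOn G (Icc 0 (3 * T))) (hG0 : ∀ σ, T ≤ σ → G σ = 0) :
    (∫ τ in (0:ℝ)..(2 * T), G (chgVar H ξ τ) * (1 + H * τ / 3 + H * ξ / 3)) =
      ∫ σ in (0:ℝ)..T, G σ := by
  have hT2 : 0 ≤ 2 * T := by linarith
  have h := intervalIntegral.integral_comp_mul_deriv' (a := 0) (b := 2 * T) (f := chgVar H ξ)
    (f' := fun τ => 1 + H * τ / 3 + H * ξ / 3) (g := G) (fun τ _ => hasDerivAt_chgVar H ξ τ)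
    (by fun_prop) (hG.mono ?_)
  · have e0 : chgVar H ξ 0 = 0 := by simp [chgVar]
    have e1 : T ≤ chgVar H ξ (2 * T) := by
      have := half_le_chgVar hH0 hHξ hT2
      linarith
    have e2 := chgVar_le hH0 hHξ hHT hT2 le_rfl
    simp only [Function.comp] at h
    rw [h, e0, ← intervalIntegral.integral_add_adjacent_intervals (b := T)]
    · rw [intervalIntegral.integral_congr (a := T) (g := fun _ => 0)]
      · simp
      · intro σ hσ
        rw [uIcc_of_le e1] at hσ
        exact hG0 σ hσ.1
    · refine (hG.mono ?_).intervalIntegrable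
      rw [uIcc_of_le hT]
      exact Icc_subset_Icc le_rfl (by linarith)
    · refine (hG.mono ?_).intervalIntegrable
      rw [uIcc_of_le e1]
      exact Icc_subset_Icc hT e2
  · rintro _ ⟨τ, hτ, rfl⟩
    rw [uIcc_of_le hT2] at hτ
    exact ⟨le_trans (by linarith [hτ.1]) (half_le_chgVar hH0 hHξ hτ.1),
      chgVar_le hH0 hHξ hHT hτ.1 hτ.2⟩

lemma Adm1.chgFun {f : ℝ → ℝ} (hT : 0 ≤ T) (hf : Adm1 T f) : Adm1 (2 * T) (chgFun H ξ f) := by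
  refine ⟨?_, fun τ hτ => ?_⟩
  · unfold SC.chgFun
    exact ContDiff.mul (by fun_prop) (hf.1.comp (contDiff_chgVar H ξ))
  · have := half_le_chgVar hH0 hHξ (by linarith : 0 ≤ τ)
    simp only [SC.chgFun]
    rw [hf.2 _ (by linarith), mul_zero]

end

lemma hasDerivAt_chgFun {f : ℝ → ℝ} (hf : ContDiff ℝ 1 f) (H ξ τ : ℝ) :
    HasDerivAt (chgFun H ξ f) ((1 + H * τ / 3) * ((1 + H * τ / 3 + H * ξ / 3) *
      deriv f (chgVar H ξ τ)) + H / 3 * f (chgVar H ξ τ)) τ := by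
  have h1 : HasDerivAt (fun τ => 1 + H * τ / 3) (H / 3) τ := by
    have := (((hasDerivAt_id τ).const_mul H).div_const 3).const_add 1
    refine this.congr_deriv ?_
    simp
  have h2 : HasDerivAt (fun τ => f (chgVar H ξ τ))
      (deriv f (chgVar H ξ τ) * (1 + H * τ / 3 + H * ξ / 3)) τ :=
    (hf.differentiable one_ne_zero _).hasDerivAt.comp τ (hasDerivAt_chgVar H ξ τ)
  refine (h1.mul h2).congr_deriv ?_
  ring

lemma remainder_estimate {C1 C2 H Y dψ w y rA rB m : ℝ} (hC1 : 0 ≤ C1) (hC2 : 0 ≤ C2) (hY : 0 ≤ Y)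
    (hd : 1 / 2 ≤ dψ) (hm : 1 / 4 ≤ m) (hA : rA ≤ C1 * (2 ^ 10 * Y)) (hB : |rB| ≤ C2 * (2 ^ 10 * Y)) :
    H ^ 2 * rA * dψ * w ^ 2 + H ^ 2 * rB / m * y ^ 2 ≤
      (2 ^ 10 * (2 * C1 + 8 * C2) + 1) * H ^ 2 * (Y * (y ^ 2 + w ^ 2) * dψ) := by
  have hd0 : 0 ≤ dψ := by linarith
  have hB2 : H ^ 2 * rB / m ≤ H ^ 2 * (4 * (C2 * (2 ^ 10 * Y))) := by
    rw [div_le_iff₀ (by linarith), mul_assoc]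
    refine mul_le_mul_of_nonneg_left ?_ (sq_nonneg H)
    have : 0 ≤ C2 * (2 ^ 10 * Y) := by positivity
    nlinarith [le_abs_self rB]
  have e1 : H ^ 2 * rA * dψ * w ^ 2 ≤ H ^ 2 * (C1 * (2 ^ 10 * Y)) * dψ * w ^ 2 := by gcongr
  have e2 : H ^ 2 * rB / m * y ^ 2 ≤ H ^ 2 * (4 * (C2 * (2 ^ 10 * Y))) * y ^ 2 := by gcongr
  have e3 : H ^ 2 * (4 * (C2 * (2 ^ 10 * Y))) * y ^ 2 ≤
      H ^ 2 * (4 * (C2 * (2 ^ 10 * Y))) * y ^ 2 * (2 * dψ) :=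
    le_mul_of_one_le_right (by positivity) (by linarith)
  have hz : 0 ≤ H ^ 2 * Y * dψ := by positivity
  have h4 : H ^ 2 * (C1 * (2 ^ 10 * Y)) * dψ * w ^ 2 +
      H ^ 2 * (4 * (C2 * (2 ^ 10 * Y))) * y ^ 2 * (2 * dψ) =
      (H ^ 2 * Y * dψ) * (2 ^ 10 * (C1 * w ^ 2) + 2 ^ 10 * 8 * (C2 * y ^ 2)) := by ring
  have h5 : (2 ^ 10 * (2 * C1 + 8 * C2) + 1) * H ^ 2 * (Y * (y ^ 2 + w ^ 2) * dψ) =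
      (H ^ 2 * Y * dψ) * (2 ^ 10 * (2 * (C1 * y ^ 2) + 2 * (C1 * w ^ 2) +
        8 * (C2 * y ^ 2) + 8 * (C2 * w ^ 2)) + y ^ 2 + w ^ 2) := by ring
  have h6 : (H ^ 2 * Y * dψ) * (2 ^ 10 * (C1 * w ^ 2) + 2 ^ 10 * 8 * (C2 * y ^ 2)) ≤
      (H ^ 2 * Y * dψ) * (2 ^ 10 * (2 * (C1 * y ^ 2) + 2 * (C1 * w ^ 2) +
        8 * (C2 * y ^ 2) + 8 * (C2 * w ^ 2)) + y ^ 2 + w ^ 2) := by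
    refine mul_le_mul_of_nonneg_left ?_ hz
    have := mul_nonneg hC1 (sq_nonneg w)
    have := mul_nonneg hC1 (sq_nonneg y)
    have := mul_nonneg hC2 (sq_nonneg w)
    have := sq_nonneg w
    have := sq_nonneg y
    linarith
  linarith

set_option maxHeartbeats 800000 in
/-- Comparison of the model forms at two curvatures. -/
lemma transform_ineq (k X : ℝ) : ∃ C > 0, ∀ H T ξ Λ : ℝ, 0 < H → H ≤ 1 → |ξ| ≤ X → H * |ξ| ≤ 1 →
    0 ≤ T → H * T ≤ 1 / 3 → 0 ≤ Λ → Λ ≤ 1 →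
    |k * H| * (3 * T) ≤ 1 / 2 → |(k + 1) * H| * (3 * T) ≤ 1 / 2 → ∀ f, Adm1 T f →
    q1 ((k + 1) * H) (ξ + H * (ξ ^ 2 - Λ) / 3) (2 * T) (chgFun H ξ f) -
        Λ * n1 ((k + 1) * H) (2 * T) (chgFun H ξ f) ≤
      (1 + H * ξ / 3) * (q1 (k * H) ξ T f - Λ * n1 (k * H) T f) - H / 3 * (f 0) ^ 2 +
      C * H ^ 2 * (∫ τ in (0:ℝ)..T, (1 + τ) ^ 10 * ((f τ) ^ 2 + (deriv f τ) ^ 2)) := by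
  have hK : IsCompact ((Icc 0 1 : Set ℝ) ×ˢ ((Icc (-X) X : Set ℝ) ×ˢ (Icc 0 1 : Set ℝ))) :=
    isCompact_Icc.prod (isCompact_Icc.prod isCompact_Icc)
  obtain ⟨C1, hC1, hA⟩ := remA_bound k hK
  obtain ⟨C2, hC2, hB⟩ := remB_bound k hK
  refine ⟨2 ^ 10 * (2 * C1 + 8 * C2) + 1, by positivity, fun H T ξ Λ hH0 hH1 hX hHξ hT hHT hΛ0 hΛ1
    hκ0 hκ1 f hf => ?_⟩
  have hp : (H, ξ, Λ) ∈ ((Icc 0 1 : Set ℝ) ×ˢ ((Icc (-X) X : Set ℝ) ×ˢ (Icc 0 1 : Set ℝ))) :=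
    ⟨⟨hH0.le, hH1⟩, ⟨(abs_le.1 hX).1, (abs_le.1 hX).2⟩, hΛ0, hΛ1⟩
  have hT2 : 0 ≤ 2 * T := by linarith
  have hT3 : 0 ≤ 3 * T := by linarith
  have hκ1' : |(k + 1) * H| * (2 * T) ≤ 1 / 2 := by nlinarith [abs_nonneg ((k + 1) * H)]
  have hκ0' : |k * H| * T ≤ 1 / 2 := by nlinarith [abs_nonneg (k * H)]
  have hu := hf.chgFun hH0 hHξ hT
  have hfc := hf.1.continuous
  have hfc' := hf.1.continuous_deriv le_rfl
  have hψc := (contDiff_chgVar H ξ).continuous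
  set κ0 := k * H with hk0
  set κ1 := (k + 1) * H with hk1
  set ξ' := ξ + H * (ξ ^ 2 - Λ) / 3 with hξ'
  set u := chgFun H ξ f with hu_def
  set ψ := chgVar H ξ with hψ_def
  have hud : ∀ τ, deriv u τ = (1 + H * τ / 3) * ((1 + H * τ / 3 + H * ξ / 3) *
      deriv f (ψ τ)) + H / 3 * f (ψ τ) := fun τ => (hasDerivAt_chgFun hf.1 H ξ τ).deriv
  -- the two forms as single integrals
  have hL1 : q1 κ1 ξ' (2 * T) u - Λ * n1 κ1 (2 * T) u = ∫ τ in (0:ℝ)..(2 * T),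
      (((1 - κ1 * τ) * (deriv u τ) ^ 2 +
      (ξ' + τ - κ1 * τ ^ 2 / 2) ^ 2 / (1 - κ1 * τ) * (u τ) ^ 2) -
      Λ * ((1 - κ1 * τ) * (u τ) ^ 2)) := by
    rw [intervalIntegral.integral_sub (contOn_q1 hκ1' hT2 ξ' hu.1).intervalIntegrable
      (((cont_n1 κ1 hu.1).intervalIntegrable _ _).const_mul Λ),
      intervalIntegral.integral_const_mul]
    rfl
  set G : ℝ → ℝ := fun σ => ((1 - κ0 * σ) * (deriv f σ) ^ 2 +
      (ξ + σ - κ0 * σ ^ 2 / 2) ^ 2 / (1 - κ0 * σ) * (f σ) ^ 2) -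
      Λ * ((1 - κ0 * σ) * (f σ) ^ 2) with hG
  have hGc : ContinuousOn G (Icc 0 (3 * T)) := by
    have := (contOn_q1 hκ0 hT3 ξ hf.1).sub
      (((cont_n1 κ0 hf.1).const_mul Λ).continuousOn)
    rwa [uIcc_of_le hT3] at this
  have hG0 : ∀ σ, T ≤ σ → G σ = 0 := fun σ hσ => by
    simp [hG, hf.2 σ hσ, hf.deriv_eq_zero hσ]
  have hL0 : q1 κ0 ξ T f - Λ * n1 κ0 T f = ∫ σ in (0:ℝ)..T, G σ := by
    rw [intervalIntegral.integral_sub (contOn_q1 hκ0' hT ξ hf.1).intervalIntegrable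
      (((cont_n1 κ0 hf.1).intervalIntegrable _ _).const_mul Λ),
      intervalIntegral.integral_const_mul]
    rfl
  set Mo : ℝ → ℝ := fun σ => (1 + σ) ^ 10 * ((f σ) ^ 2 + (deriv f σ) ^ 2) with hMo
  have hMoc : Continuous Mo := by fun_prop
  have hMo0 : ∀ σ, T ≤ σ → Mo σ = 0 := fun σ hσ => by
    simp [hMo, hf.2 σ hσ, hf.deriv_eq_zero hσ]
  have cG := integral_chg hH0 hHξ hT hHT hGc hG0
  have cM := integral_chg hH0 hHξ hT hHT hMoc.continuousOn hMo0
  -- the boundary term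
  set D : ℝ → ℝ := fun τ => ((1 - κ1 * τ) * (H / 3) * (H / 3) -
        κ1 * (1 + H * τ / 3) * (H / 3)) * (f (ψ τ)) ^ 2 + (1 - κ1 * τ) * (1 + H * τ / 3) * (H / 3) *
      (2 * f (ψ τ) * ((1 + H * τ / 3 + H * ξ / 3) * deriv f (ψ τ))) with hD
  have hDc : Continuous D := by fun_prop
  have hDi : ∫ τ in (0:ℝ)..(2 * T), D τ = - (H / 3 * (f 0) ^ 2) := by
    rw [intervalIntegral.integral_eq_sub_of_hasDerivAt
      (f := fun τ => (1 - κ1 * τ) * (1 + H * τ / 3) * (H / 3) * (f (ψ τ)) ^ 2) ?_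
      (hDc.intervalIntegrable _ _)]
    · have h1 : f (ψ (2 * T)) = 0 := by
        have := half_le_chgVar hH0 hHξ hT2
        exact hf.2 _ (by linarith)
      have h2 : ψ 0 = 0 := by simp [hψ_def, chgVar]
      rw [h1, h2]
      ring
    · intro τ _
      have h1 : HasDerivAt (fun τ => 1 + H * τ / 3) (H / 3) τ := by
        have := (((hasDerivAt_id τ).const_mul H).div_const 3).const_add 1
        refine this.congr_deriv ?_
        simp
      have h2 : HasDerivAt (fun τ => f (ψ τ))
          (deriv f (ψ τ) * (1 + H * τ / 3 + H * ξ / 3)) τ :=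
        (hf.1.differentiable one_ne_zero _).hasDerivAt.comp τ (hasDerivAt_chgVar H ξ τ)
      have h3 : HasDerivAt (fun τ => 1 - κ1 * τ) (-κ1) τ := by
        have := ((hasDerivAt_id τ).const_mul κ1).const_sub 1
        refine this.congr_deriv ?_
        simp
      refine (((h3.mul h1).mul_const (H / 3)).mul (h2.pow 2)).congr_deriv ?_
      simp [hD]
      ring
  have hdψc : Continuous fun τ : ℝ => 1 + H * τ / 3 + H * ξ / 3 := by fun_prop
  have iG : IntervalIntegrable (fun τ => G (ψ τ) * (1 + H * τ / 3 + H * ξ / 3)) volume 0 (2 * T) := by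
    refine ContinuousOn.intervalIntegrable (ContinuousOn.mul (hGc.comp hψc.continuousOn ?_)
      hdψc.continuousOn)
    intro τ hτ
    rw [uIcc_of_le hT2] at hτ
    exact ⟨le_trans (by linarith [hτ.1]) (half_le_chgVar hH0 hHξ hτ.1),
      chgVar_le hH0 hHξ hHT hτ.1 hτ.2⟩
  have iM : IntervalIntegrable (fun τ => Mo (ψ τ) * (1 + H * τ / 3 + H * ξ / 3)) volume 0 (2 * T) :=
    ((hMoc.comp hψc).mul hdψc).intervalIntegrable _ _
  rw [hL1, hL0, ← cG, ← cM]
  set C := 2 ^ 10 * (2 * C1 + 8 * C2) + 1 with hCdef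
  have hrhs : (1 + H * ξ / 3) * (∫ τ in (0:ℝ)..(2 * T), G (ψ τ) * (1 + H * τ / 3 + H * ξ / 3)) -
      H / 3 * (f 0) ^ 2 + C * H ^ 2 *
        (∫ τ in (0:ℝ)..(2 * T), Mo (ψ τ) * (1 + H * τ / 3 + H * ξ / 3)) =
      ∫ τ in (0:ℝ)..(2 * T), ((1 + H * ξ / 3) * (G (ψ τ) * (1 + H * τ / 3 + H * ξ / 3)) + D τ +
        C * H ^ 2 * (Mo (ψ τ) * (1 + H * τ / 3 + H * ξ / 3))) := by
    rw [intervalIntegral.integral_add ((iG.const_mul _).add (hDc.intervalIntegrable _ _))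
      (iM.const_mul _), intervalIntegral.integral_add (iG.const_mul _)
      (hDc.intervalIntegrable _ _), hDi, intervalIntegral.integral_const_mul,
      intervalIntegral.integral_const_mul]
    ring
  rw [hrhs]
  refine intervalIntegral.integral_mono_on hT2
    ((contOn_q1 hκ1' hT2 ξ' hu.1).intervalIntegrable.sub
      (((cont_n1 κ1 hu.1).intervalIntegrable _ _).const_mul Λ))
    (((iG.const_mul _).add (hDc.intervalIntegrable _ _)).add (iM.const_mul _)) fun τ hτ => ?_
  have hψ1 := half_le_chgVar hH0 hHξ hτ.1
  have hψ2 := chgVar_le hH0 hHξ hHT hτ.1 hτ.2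
  have hdψ := dchg_bounds hH0 hHξ hHT hτ.1 hτ.2
  have hm1 := (m_bounds hκ1' hτ.1 hτ.2).1
  have hm0 := (m_bounds hκ0 (le_trans (by linarith [hτ.1]) hψ1) hψ2).1
  have hrA := hA _ hp τ hτ.1
  have hrB := hB _ hp τ hτ.1
  have hiA := remA_identity k H ξ Λ τ
  have hiB := remB_identity k H ξ Λ τ
  have hψe : τ + H * (τ ^ 2 / 6 + ξ * τ / 3) = ψ τ := rfl
  rw [hψe] at hiA hiB
  rw [← hk0, ← hk1] at hiA hiB
  rw [← hξ'] at hiB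
  have hm1' : 1 - κ1 * τ ≠ 0 := by linarith
  have hm0' : 1 - κ0 * ψ τ ≠ 0 := by linarith
  have key := transform_algebra hm0' hm1' (1 + H * τ / 3) (H / 3)
    ((1 - κ1 * τ) * (H / 3) * (H / 3) - κ1 * (1 + H * τ / 3) * (H / 3))
    (ξ' + τ - κ1 * τ ^ 2 / 2) (ξ + ψ τ - κ0 * ψ τ ^ 2 / 2) (1 + H * ξ / 3)
    (1 + H * τ / 3 + H * ξ / 3) Λ (f (ψ τ)) (deriv f (ψ τ))
  rw [hud, show u τ = (1 + H * τ / 3) * f (ψ τ) from rfl]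
  rw [key, hiA, hiB]
  refine add_le_add le_rfl ?_
  -- remainder estimate
  have hq : (1 + τ) ^ 10 ≤ 2 ^ 10 * (1 + ψ τ) ^ 10 := by
    rw [← mul_pow]
    exact pow_le_pow_left₀ (by linarith [hτ.1]) (by linarith) 10
  have hq4 : (1 + τ) ^ 4 ≤ (1 + τ) ^ 10 := pow_le_pow_right₀ (by linarith [hτ.1]) (by norm_num)
  have hrA' : remA k (H, ξ, Λ) τ ≤ C1 * (2 ^ 10 * (1 + ψ τ) ^ 10) :=
    (le_abs_self _).trans (hrA.trans (mul_le_mul_of_nonneg_left (hq4.trans hq) hC1))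
  have hrB' : |remB k (H, ξ, Λ) τ| ≤ C2 * (2 ^ 10 * (1 + ψ τ) ^ 10) :=
    hrB.trans (mul_le_mul_of_nonneg_left hq hC2)
  have hY : 0 ≤ (1 + ψ τ) ^ 10 := by
    have : 0 ≤ 1 + ψ τ := by linarith [hτ.1]
    positivity
  have hmm : (1:ℝ) / 4 ≤ (1 - κ1 * τ) * (1 - κ0 * ψ τ) := le_trans (by norm_num)
    (mul_le_mul hm1 hm0 (by norm_num) (le_trans (by norm_num) hm1))
  exact remainder_estimate hC1 hC2 hY hdψ.1 hmm hrA' hrB'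

end SC

namespace SC

lemma chgFun_mass_pointwise {m0 m1 g d y : ℝ} (hm1 : 1 / 2 ≤ m1) (hm0 : m0 ≤ 3 / 2)
    (hg : 1 ≤ g) (hd0 : 1 / 2 ≤ d) (hd : d ≤ 2) : m0 * y ^ 2 * d ≤ 6 * (m1 * (g * y) ^ 2) := by
  have h1 : m0 * d ≤ 3 := by nlinarith
  have h2 : 1 ≤ g ^ 2 := by nlinarith
  have h3 : 1 / 2 ≤ m1 * g ^ 2 := by nlinarith
  nlinarith [sq_nonneg y]

lemma chgFun_mass_pointwise' {m g d y P Y : ℝ} (hm : m ≤ 3 / 2) (hg : 1 ≤ g) (hg2 : g ≤ 2)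
    (hd0 : 1 / 2 ≤ d) (hP : P ≤ 2 ^ 10 * Y) (hP1 : 1 ≤ P) (z : ℝ) :
    m * (g * y) ^ 2 ≤ 2 ^ 14 * (Y * (y ^ 2 + z ^ 2) * d) := by
  have h1 : g ^ 2 ≤ 4 := by nlinarith
  have h2 : m * (g * y) ^ 2 ≤ 6 * y ^ 2 := by
    have : m * g ^ 2 ≤ 6 := by nlinarith [sq_nonneg g]
    nlinarith [sq_nonneg y]
  have h3 : 1 ≤ 2 ^ 10 * Y := hP1.trans hP
  have h4 : 1 / 2 ≤ 2 ^ 10 * Y * d := by nlinarith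
  nlinarith [sq_nonneg y, sq_nonneg z, mul_le_mul_of_nonneg_right h4 (add_nonneg (sq_nonneg y) (sq_nonneg z))]

lemma chgFun_moment_pointwise {g d y z P Y e : ℝ} (hg : 1 ≤ g) (hg2 : g ≤ 2)
    (hd0 : 1 / 2 ≤ d) (hd : d ≤ 2) (he : |e| ≤ 1) (hP : P ≤ 2 ^ 10 * Y) (hP1 : 0 ≤ P) :
    P * ((g * y) ^ 2 + (g * (d * z) + e * y) ^ 2) ≤ 2 ^ 17 * (Y * (y ^ 2 + z ^ 2) * d) := by
  have h1 : (g * y) ^ 2 ≤ 4 * y ^ 2 := by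
    rw [mul_pow]; exact mul_le_mul_of_nonneg_right (by nlinarith) (sq_nonneg y)
  have h2 : (g * (d * z)) ^ 2 ≤ 16 * z ^ 2 := by
    have : (g * (d * z)) ^ 2 = (g * d) ^ 2 * z ^ 2 := by ring
    rw [this]
    have h3 : g * d ≤ 4 := by nlinarith
    have h4 : 0 ≤ g * d := by nlinarith
    exact mul_le_mul_of_nonneg_right (by nlinarith) (sq_nonneg z)
  have h3 : (e * y) ^ 2 ≤ y ^ 2 := by
    rw [mul_pow]
    have : e ^ 2 ≤ 1 := by rw [← sq_abs]; nlinarith [abs_nonneg e]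
    nlinarith [sq_nonneg y]
  have h4 : (g * y) ^ 2 + (g * (d * z) + e * y) ^ 2 ≤ 32 * (y ^ 2 + z ^ 2) := by
    nlinarith [sq_nonneg (g * (d * z) - e * y), sq_nonneg y]
  have h5 := add_nonneg (sq_nonneg y) (sq_nonneg z)
  have h6 : P * ((g * y) ^ 2 + (g * (d * z) + e * y) ^ 2) ≤ P * (32 * (y ^ 2 + z ^ 2)) :=
    mul_le_mul_of_nonneg_left h4 hP1
  have hY : 0 ≤ Y := by linarith
  have h7 : P * (32 * (y ^ 2 + z ^ 2)) ≤ 2 ^ 10 * Y * (32 * (y ^ 2 + z ^ 2)) :=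
    mul_le_mul_of_nonneg_right hP (by positivity)
  have h8 : 0 ≤ Y * (y ^ 2 + z ^ 2) := by positivity
  nlinarith

section
variable {H ξ T κ0 κ1 : ℝ} {f : ℝ → ℝ} (hH0 : 0 < H) (hHξ : H * |ξ| ≤ 1) (hT : 0 ≤ T)
  (hHT : H * T ≤ 1 / 3) (hf : Adm1 T f)
include hH0 hHξ hT hHT hf

lemma le_chgFun_mass (hκ0 : |κ0| * (3 * T) ≤ 1 / 2) (hκ1 : |κ1| * (3 * T) ≤ 1 / 2) :
    n1 κ0 T f ≤ 6 * n1 κ1 (2 * T) (chgFun H ξ f) := by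
  have hT2 : 0 ≤ 2 * T := by linarith
  have hκ1' : |κ1| * (2 * T) ≤ 1 / 2 := by nlinarith [abs_nonneg κ1]
  have hu := hf.chgFun hH0 hHξ hT
  have hψ := (contDiff_chgVar H ξ).continuous
  unfold n1
  rw [← integral_chg hH0 hHξ hT hHT (G := fun σ => (1 - κ0 * σ) * (f σ) ^ 2)
    (cont_n1 κ0 hf.1).continuousOn (fun σ hσ => by simp [hf.2 σ hσ]),
    ← intervalIntegral.integral_const_mul]
  refine intervalIntegral.integral_mono_on hT2 (Continuous.intervalIntegrable ?_ _ _)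
    (((cont_n1 κ1 hu.1).const_mul 6).intervalIntegrable _ _) fun τ hτ => ?_
  · exact ((cont_n1 κ0 hf.1).comp hψ).mul (by fun_prop)
  have hψ1 := half_le_chgVar hH0 hHξ hτ.1
  have hψ2 := chgVar_le hH0 hHξ hHT hτ.1 hτ.2
  have hd := dchg_bounds hH0 hHξ hHT hτ.1 hτ.2
  have hm0 := (m_bounds hκ0 (le_trans (by linarith [hτ.1]) hψ1) hψ2).2
  have hm1 := (m_bounds hκ1' hτ.1 hτ.2).1
  have hg : 1 ≤ 1 + H * τ / 3 := by
    have := mul_nonneg hH0.le hτ.1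
    linarith
  exact chgFun_mass_pointwise hm1 hm0 hg hd.1 hd.2

omit hT hHT hf in
lemma one_add_pow_le {τ : ℝ} (h0 : 0 ≤ τ) : (1 + τ) ^ 4 ≤ 2 ^ 10 * (1 + chgVar H ξ τ) ^ 10 := by
  have hψ1 := half_le_chgVar hH0 hHξ h0
  calc (1 + τ) ^ 4 ≤ (1 + τ) ^ 10 := pow_le_pow_right₀ (by linarith) (by norm_num)
    _ ≤ (2 * (1 + chgVar H ξ τ)) ^ 10 := pow_le_pow_left₀ (by linarith) (by linarith) 10
    _ = _ := by rw [mul_pow]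

lemma integral_chg_moment :
    (∫ τ in (0:ℝ)..(2 * T), (1 + chgVar H ξ τ) ^ 10 * ((f (chgVar H ξ τ)) ^ 2 +
      (deriv f (chgVar H ξ τ)) ^ 2) * (1 + H * τ / 3 + H * ξ / 3)) =
    ∫ τ in (0:ℝ)..T, (1 + τ) ^ 10 * ((f τ) ^ 2 + (deriv f τ) ^ 2) := by
  have h1 := hf.1.continuous
  have h2 := hf.1.continuous_deriv le_rfl
  exact integral_chg hH0 hHξ hT hHT
    (G := fun τ => (1 + τ) ^ 10 * ((f τ) ^ 2 + (deriv f τ) ^ 2))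
    (by fun_prop) (fun σ hσ => by simp [hf.2 σ hσ, hf.deriv_eq_zero hσ])

lemma cont_chg_moment : Continuous (fun τ : ℝ => (1 + chgVar H ξ τ) ^ 10 * ((f (chgVar H ξ τ)) ^ 2 +
      (deriv f (chgVar H ξ τ)) ^ 2) * (1 + H * τ / 3 + H * ξ / 3)) := by
  have h1 := hf.1.continuous
  have h2 := hf.1.continuous_deriv le_rfl
  have hψ := (contDiff_chgVar H ξ).continuous
  fun_prop

lemma chgFun_mass_le (hκ1 : |κ1| * (3 * T) ≤ 1 / 2) : n1 κ1 (2 * T) (chgFun H ξ f) ≤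
    2 ^ 14 * ∫ τ in (0:ℝ)..T, (1 + τ) ^ 10 * ((f τ) ^ 2 + (deriv f τ) ^ 2) := by
  have hT2 : 0 ≤ 2 * T := by linarith
  have hκ1' : |κ1| * (2 * T) ≤ 1 / 2 := by nlinarith [abs_nonneg κ1]
  have hu := hf.chgFun hH0 hHξ hT
  unfold n1
  rw [← integral_chg_moment hH0 hHξ hT hHT hf, ← intervalIntegral.integral_const_mul]
  refine intervalIntegral.integral_mono_on hT2 ((cont_n1 κ1 hu.1).intervalIntegrable _ _)
    (((cont_chg_moment hH0 hHξ hT hHT hf).const_mul _).intervalIntegrable _ _) fun τ hτ => ?_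
  have hd := dchg_bounds hH0 hHξ hHT hτ.1 hτ.2
  have hm1 := (m_bounds hκ1' hτ.1 hτ.2).2
  have h0 := mul_nonneg hH0.le hτ.1
  have h1 : H * τ ≤ 2 / 3 := by nlinarith [hτ.2]
  exact chgFun_mass_pointwise' hm1 (by linarith) (by linarith) hd.1
    (one_add_pow_le hH0 hHξ hτ.1) (one_le_pow₀ (by linarith [hτ.1])) _

lemma chgFun_moment_le (hH1 : H ≤ 1) :
    (∫ τ in (0:ℝ)..(2 * T), (1 + τ) ^ 4 * ((chgFun H ξ f τ) ^ 2 + (deriv (chgFun H ξ f) τ) ^ 2)) ≤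
    2 ^ 17 * ∫ τ in (0:ℝ)..T, (1 + τ) ^ 10 * ((f τ) ^ 2 + (deriv f τ) ^ 2) := by
  have hT2 : 0 ≤ 2 * T := by linarith
  have hu := hf.chgFun hH0 hHξ hT
  have hu1 := hu.1.continuous
  have hu2 := hu.1.continuous_deriv le_rfl
  rw [← integral_chg_moment hH0 hHξ hT hHT hf, ← intervalIntegral.integral_const_mul]
  refine intervalIntegral.integral_mono_on hT2 (Continuous.intervalIntegrable (by fun_prop) _ _)
    (((cont_chg_moment hH0 hHξ hT hHT hf).const_mul _).intervalIntegrable _ _) fun τ hτ => ?_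
  have hd := dchg_bounds hH0 hHξ hHT hτ.1 hτ.2
  have h0 := mul_nonneg hH0.le hτ.1
  have h1 : H * τ ≤ 2 / 3 := by nlinarith [hτ.2]
  rw [(hasDerivAt_chgFun hf.1 H ξ τ).deriv, mul_comm (1 + H * τ / 3 + H * ξ / 3) (deriv f _),
    mul_comm (deriv f _) (1 + H * τ / 3 + H * ξ / 3)]
  refine chgFun_moment_pointwise (by linarith) (by linarith) hd.1 hd.2 ?_
    (one_add_pow_le hH0 hHξ hτ.1) (pow_nonneg (by linarith [hτ.1]) 4)
  rw [abs_of_nonneg (by positivity)]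
  linarith

end

lemma abs_shift_le {H ξ Λ M : ℝ} (h0 : 0 ≤ H) (h1 : H ≤ 1) (hξ : |ξ| ≤ M) (hΛ0 : 0 ≤ Λ)
    (hΛ1 : Λ ≤ 1) : |ξ + H * (ξ ^ 2 - Λ) / 3| ≤ M + M ^ 2 + 1 := by
  have h2 : ξ ^ 2 ≤ M ^ 2 := by rw [← sq_abs]; exact pow_le_pow_left₀ (abs_nonneg _) hξ 2
  have h3 : |ξ ^ 2 - Λ| ≤ M ^ 2 + 1 := by
    rw [abs_le]; constructor <;> nlinarith [sq_nonneg ξ, sq_nonneg M]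
  have h4 : H * |ξ ^ 2 - Λ| ≤ 1 * (M ^ 2 + 1) := mul_le_mul h1 h3 (abs_nonneg _) zero_le_one
  have h5 := sq_nonneg M
  calc |ξ + H * (ξ ^ 2 - Λ) / 3| ≤ |ξ| + |H * (ξ ^ 2 - Λ) / 3| := abs_add_le _ _
    _ ≤ M + M ^ 2 + 1 := by
      rw [abs_div, abs_mul, abs_of_nonneg h0, abs_of_pos (by norm_num : (0:ℝ) < 3)]
      linarith

set_option maxHeartbeats 1000000 in
/-- Two curvatures `k0 < k1`: the ground energy of the half-line model with the smaller curvature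
exceeds the energy of a trial function for the larger one by an amount of the order of the
curvature. -/
lemma exists_model_gap {k0 k1 t2 : ℝ} (hk : k0 < k1) (ht2 : 0 < t2) (hk0 : |k0| * (3 * t2) ≤ 1 / 2)
    (hk1 : |k1| * (3 * t2) ≤ 1 / 2) (hkt : (k1 - k0) * t2 ≤ 1 / 3) :
    ∃ c > 0, ∃ M ≥ 1, ∃ h0 > 0, ∀ h, 0 < h → h ≤ h0 →
      ∃ Λ : ℝ, 0 ≤ Λ ∧ Λ ≤ 4 / 5 ∧
        (∀ ξ f, Adm1 (t2 / h) f → Λ * n1 (k0 * h) (t2 / h) f ≤ q1 (k0 * h) ξ (t2 / h) f) ∧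
        ∃ ξ f, |ξ| ≤ M ∧ Adm1 (2 * (t2 / h)) f ∧ 1 / M ≤ n1 (k1 * h) (2 * (t2 / h)) f ∧
          q1 (k1 * h) ξ (2 * (t2 / h)) f ≤ (Λ - c * h) * n1 (k1 * h) (2 * (t2 / h)) f ∧
          (∫ τ in (0:ℝ)..(2 * (t2 / h)), (1 + τ) ^ 4 * ((f τ) ^ 2 + (deriv f τ) ^ 2)) ≤ M := by
  obtain ⟨M0, hM0, hgood⟩ := exists_good_near_min
  set d := k1 - k0 with hd
  have hd0 : 0 < d := by linarith
  obtain ⟨C, hC, htr⟩ := transform_ineq (k0 / d) M0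
  set S := d * (1 + M0 + 12 * C * M0 ^ 2) + 4 / t2 + 400 * |k0| with hS
  have hS0 : 0 < S := by positivity
  set N := 2 ^ 14 * M0 with hN
  have hN0 : 0 < N := by positivity
  refine ⟨d / (6 * M0 * N), by positivity, max (max 6 (2 ^ 17 * M0)) (M0 + M0 ^ 2 + 1),
    le_max_of_le_left (le_max_of_le_left (by norm_num)), 1 / S, by positivity,
    fun h hh hh0 => ?_⟩
  set Mx := max (max 6 (2 ^ 17 * M0)) (M0 + M0 ^ 2 + 1) with hMx
  have hhS : S * h ≤ 1 := by rwa [le_div_iff₀ hS0, mul_comm] at hh0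
  set H := d * h with hH
  have hH0 : 0 < H := by positivity
  have p1 : 0 ≤ H * M0 := by positivity
  have p2 : 0 ≤ H * (12 * C * M0 ^ 2) := by positivity
  have p3 : 0 ≤ 4 / t2 * h := by positivity
  have p4 : 0 ≤ 400 * |k0| * h := by positivity
  have hsum : H + H * M0 + H * (12 * C * M0 ^ 2) + 4 / t2 * h + 400 * |k0| * h ≤ 1 := by
    refine le_of_eq_of_le ?_ hhS
    rw [hS, hH]; ring
  have hH1 : H ≤ 1 := by linarith
  have hHM : H * M0 ≤ 1 := by linarith
  have hHC : H * (12 * C * M0 ^ 2) ≤ 1 := by linarith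
  set T := t2 / h with hT
  have hT0 : 0 ≤ T := by positivity
  have hT4 : 4 ≤ T := by
    rw [hT, le_div_iff₀ hh]
    have : 4 / t2 * h * t2 = 4 * h := by field_simp
    nlinarith
  have hhT : h * T = t2 := by rw [hT]; field_simp
  have hkH : k0 / d * H = k0 * h := by rw [hH]; field_simp
  have hkH1 : (k0 / d + 1) * H = k1 * h := by
    rw [add_mul, hkH, hH, hd]; ring
  have habs0 : |k0 * h| * (3 * T) ≤ 1 / 2 := by
    rw [abs_mul, abs_of_pos hh]
    calc |k0| * h * (3 * T) = |k0| * (3 * (h * T)) := by ring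
      _ ≤ 1 / 2 := by rw [hhT]; exact hk0
  have habs1 : |k1 * h| * (3 * T) ≤ 1 / 2 := by
    rw [abs_mul, abs_of_pos hh]
    calc |k1| * h * (3 * T) = |k1| * (3 * (h * T)) := by ring
      _ ≤ 1 / 2 := by rw [hhT]; exact hk1
  have habs0' : |k0 * h| * T ≤ 1 / 2 := by nlinarith [abs_nonneg (k0 * h)]
  have hHT : H * T ≤ 1 / 3 := by
    calc H * T = d * (h * T) := by rw [hH]; ring
      _ ≤ 1 / 3 := by rw [hhT]; exact hkt
  obtain ⟨Λ, hΛ0, hΛ1, hlow, happ⟩ := exists_inf1 habs0' hT4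
    (by rw [abs_mul, abs_of_pos hh]; linarith : |k0 * h| ≤ 1 / 400)
  obtain ⟨ξ, f, hf, hn, hq, hξ, hf0, hmom⟩ := hgood _ T Λ habs0' hT0 hΛ0 hΛ1 hlow happ
    (H / (24 * M0)) (by positivity)
  have hHξ : H * |ξ| ≤ 1 := le_trans (mul_le_mul_of_nonneg_left hξ hH0.le) hHM
  have hmain := htr H T ξ Λ hH0 hH1 hξ hHξ hT0 hHT hΛ0 (by linarith)
    (by rw [hkH]; exact habs0) (by rw [hkH1]; exact habs1) f hf
  rw [hkH, hkH1, hn] at hmain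
  have hmass := le_chgFun_mass hH0 hHξ hT0 hHT hf habs0 habs1
  rw [hn] at hmass
  have hmass2 := chgFun_mass_le hH0 hHξ hT0 hHT hf habs1
  have hmom2 := chgFun_moment_le hH0 hHξ hT0 hHT hf hH1
  set Mom := ∫ τ in (0:ℝ)..T, (1 + τ) ^ 10 * ((f τ) ^ 2 + (deriv f τ) ^ 2) with hMom
  set nn := n1 (k1 * h) (2 * T) (chgFun H ξ f) with hnn
  refine ⟨Λ, hΛ0, hΛ1, hlow, ξ + H * (ξ ^ 2 - Λ) / 3, chgFun H ξ f, ?_, hf.chgFun hH0 hHξ hT0, ?_, ?_,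
    ?_⟩
  · exact (abs_shift_le hH0.le hH1 hξ hΛ0 (hΛ1.trans (by norm_num))).trans (le_max_right _ _)
  · have h6 : (6:ℝ) ≤ Mx := le_max_of_le_left (le_max_left _ _)
    calc 1 / Mx ≤ 1 / 6 := one_div_le_one_div_of_le (by norm_num) h6
      _ ≤ nn := by linarith
  · have hb1 : (1 + H * ξ / 3) ≤ 2 := by
      have := mul_le_mul_of_nonneg_left (le_abs_self ξ) hH0.le
      linarith
    have hb2 : (1 + H * ξ / 3) * (q1 (k0 * h) ξ T f - Λ * 1) ≤ H / M0 * (1 / 12) := by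
      have hlo := hlow ξ f hf
      rw [hn] at hlo
      calc (1 + H * ξ / 3) * (q1 (k0 * h) ξ T f - Λ * 1) ≤ 2 * (H / (24 * M0)) :=
            mul_le_mul hb1 (by linarith) (by linarith) (by norm_num)
        _ = H / M0 * (1 / 12) := by field_simp; norm_num
    have hb3 : H / M0 * (1 / 3) ≤ H / 3 * f 0 ^ 2 := by
      calc H / M0 * (1 / 3) = H / 3 * (1 / M0) := by ring
        _ ≤ _ := mul_le_mul_of_nonneg_left hf0 (by positivity)
    have hb4 : C * H ^ 2 * Mom ≤ H / M0 * (1 / 12) := by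
      calc C * H ^ 2 * Mom ≤ C * H ^ 2 * M0 := mul_le_mul_of_nonneg_left hmom (by positivity)
        _ = H / M0 * (1 / 12) * (H * (12 * C * M0 ^ 2)) := by field_simp
        _ ≤ H / M0 * (1 / 12) * 1 := mul_le_mul_of_nonneg_left hHC (by positivity)
        _ = _ := mul_one _
    have hb5 : nn ≤ N := hmass2.trans (mul_le_mul_of_nonneg_left hmom (by norm_num))
    have hb6 : d / (6 * M0 * N) * h * nn ≤ H / M0 * (1 / 6) := by
      calc d / (6 * M0 * N) * h * nn ≤ d / (6 * M0 * N) * h * N :=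
            mul_le_mul_of_nonneg_left hb5 (by positivity)
        _ = H / M0 * (1 / 6) := by rw [hH]; field_simp
    linarith
  · calc _ ≤ 2 ^ 17 * Mom := hmom2
      _ ≤ 2 ^ 17 * M0 := mul_le_mul_of_nonneg_left hmom (by norm_num)
      _ ≤ Mx := le_max_of_le_left (le_max_right _ _)

end SC

namespace SC

/-- The model gap in terms of the field strength. -/
lemma exists_model_gap_field {k0 k1 t2 : ℝ} (hk : k0 < k1) (ht2 : 0 < t2)
    (hk0 : |k0| * (3 * t2) ≤ 1 / 2) (hk1 : |k1| * (3 * t2) ≤ 1 / 2)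
    (hkt : (k1 - k0) * t2 ≤ 1 / 3) :
    ∃ c > 0, ∃ M ≥ 1, ∃ B₁ ≥ 1, ∀ B ≥ B₁, ∃ Λ : ℝ, 0 ≤ Λ ∧ Λ ≤ 4 / 5 ∧
      (∀ ξ f, Adm1 (t2 * √B) f →
        Λ * n1 (k0 / √B) (t2 * √B) f ≤ q1 (k0 / √B) ξ (t2 * √B) f) ∧
      ∃ ξ f, |ξ| ≤ M ∧ Adm1 (2 * (t2 * √B)) f ∧ 1 / M ≤ n1 (k1 / √B) (2 * (t2 * √B)) f ∧
        q1 (k1 / √B) ξ (2 * (t2 * √B)) f ≤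
          (Λ - c / √B) * n1 (k1 / √B) (2 * (t2 * √B)) f ∧
        (∫ τ in (0:ℝ)..(2 * (t2 * √B)), (1 + τ) ^ 4 * ((f τ) ^ 2 + (deriv f τ) ^ 2)) ≤ M := by
  obtain ⟨c, hc, M, hM, h0, hh0, H⟩ := exists_model_gap hk ht2 hk0 hk1 hkt
  refine ⟨c, hc, M, hM, max 1 ((1 / h0) ^ 2), le_max_left _ _, fun B hB => ?_⟩
  have hB1 : 1 ≤ B := (le_max_left _ _).trans hB
  have hr : 0 < √B := Real.sqrt_pos.2 (by linarith)
  have h1 : 1 / h0 ≤ √B := Real.le_sqrt_of_sq_le ((le_max_right _ _).trans hB)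
  have h := H (1 / √B) (by positivity) (by
    rw [div_le_iff₀ hr]; rw [div_le_iff₀ hh0] at h1; linarith)
  simpa only [div_div_eq_mul_div, div_one, mul_one_div] using h

end SC

namespace SC

open Complex in
/-- Fourier coefficients on an interval. -/
def fc (a b : ℝ) (n : ℤ) (f : ℝ → ℂ) : ℂ :=
  ∫ s in a..b, cexp (-((2 * Real.pi / (b - a) * n * s : ℝ) : ℂ) * I) * f s

lemma hasSum_fc {a b : ℝ} (hab : a < b) {f : ℝ → ℂ} (hf : Continuous f) :
    HasSum (fun n : ℤ => (b - a)⁻¹ * ‖fc a b n f‖ ^ 2) (∫ s in a..b, ‖f s‖ ^ 2) := by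
  have hba : 0 < b - a := by linarith
  have hL2 : MemLp f 2 (volume.restrict (Ioc a b)) := by
    have h : MemLp f 2 (volume.restrict (Icc a b)) := by
      obtain ⟨M, hM⟩ := isCompact_Icc.exists_bound_of_continuousOn (s := Icc a b) hf.continuousOn
      exact MemLp.of_bound hf.aestronglyMeasurable M
        ((ae_restrict_iff' measurableSet_Icc).2 (Eventually.of_forall hM))
    exact h.mono_measure (Measure.restrict_mono Ioc_subset_Icc_self le_rfl)
  have h := (hasSum_sq_fourierCoeffOn hab hL2).mul_left (b - a)
  have e1 : (b - a) * ((b - a)⁻¹ • ∫ x in a..b, ‖f x‖ ^ 2) = ∫ x in a..b, ‖f x‖ ^ 2 := by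
    rw [smul_eq_mul, mul_inv_cancel_left₀ hba.ne']
  rw [e1] at h
  refine (funext fun n => ?_ : (fun n : ℤ => (b - a)⁻¹ * ‖fc a b n f‖ ^ 2) =
    fun n => (b - a) * ‖fourierCoeffOn hab f n‖ ^ 2) ▸ h
  have e2 : fourierCoeffOn hab f n = (1 / (b - a)) • fc a b n f := by
    rw [fourierCoeffOn_eq_integral, fc]
    congr 1
    refine intervalIntegral.integral_congr fun s _ => ?_
    simp only [fourier_coe_apply, smul_eq_mul]
    congr 2
    push_cast
    ring
  rw [e2, norm_smul, mul_pow, Real.norm_of_nonneg (by positivity)]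
  field_simp

lemma fc_deriv {a b : ℝ} {f f' : ℝ → ℂ} (hf : ∀ s, HasDerivAt f (f' s) s) (hf' : Continuous f')
    (ha : f a = 0) (hb : f b = 0) (n : ℤ) (c : ℝ) :
    fc a b n (fun s => -Complex.I * f' s + (c : ℂ) * f s) =
      ((2 * Real.pi / (b - a) * n + c : ℝ) : ℂ) * fc a b n f := by
  have hfc : Continuous f := continuous_iff_continuousAt.2 fun s => (hf s).continuousAt
  set ω : ℝ := 2 * Real.pi / (b - a) * n with hω
  set e : ℝ → ℂ := fun s => Complex.exp (-((ω * s : ℝ) : ℂ) * Complex.I) with he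
  have hed : ∀ s, HasDerivAt e (e s * (-(ω : ℂ) * Complex.I)) s := by
    intro s
    have h1 : HasDerivAt (fun s : ℝ => ((ω * s : ℝ) : ℂ)) (ω : ℂ) s := by
      have := ((hasDerivAt_id s).const_mul ω).ofReal_comp
      refine this.congr_deriv ?_
      simp
    exact (h1.neg.mul_const Complex.I).cexp
  have hec : Continuous e := continuous_iff_continuousAt.2 fun s => (hed s).continuousAt
  have hI : (∫ s in a..b, (e s * (-(ω : ℂ) * Complex.I) * f s + e s * f' s)) = 0 := by
    rw [intervalIntegral.integral_eq_sub_of_hasDerivAt (f := fun s => e s * f s)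
      (fun s _ => (hed s).mul (hf s)) (Continuous.intervalIntegrable (by fun_prop) _ _), ha, hb]
    simp
  have hi1 : IntervalIntegrable (fun s => e s * f s) volume a b :=
    Continuous.intervalIntegrable (by fun_prop) _ _
  have hi2 : IntervalIntegrable (fun s => e s * (-(ω : ℂ) * Complex.I) * f s + e s * f' s)
      volume a b := Continuous.intervalIntegrable (by fun_prop) _ _
  have e3 : fc a b n (fun s => -Complex.I * f' s + (c : ℂ) * f s) =
      ∫ s in a..b, (-Complex.I * (e s * (-(ω : ℂ) * Complex.I) * f s + e s * f' s) +
        ((ω + c : ℝ) : ℂ) * (e s * f s)) := by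
    unfold fc
    refine intervalIntegral.integral_congr fun s _ => ?_
    have : Complex.I * Complex.I = -1 := Complex.I_mul_I
    change e s * (-Complex.I * f' s + (c : ℂ) * f s) = _
    push_cast
    linear_combination (-e s * ω * f s) * this
  rw [e3, intervalIntegral.integral_add (hi2.const_mul _) (hi1.const_mul _),
    intervalIntegral.integral_const_mul, intervalIntegral.integral_const_mul, hI, mul_zero, zero_add]
  rfl

section
variable {k B t2 Λ : ℝ} (hB : 0 < B) (hk : |k| * t2 ≤ 1 / 2) (ht2 : 0 ≤ t2)
  (hlow : ∀ ξ f, Adm1 (t2 * √B) f → Λ * n1 (k / √B) (t2 * √B) f ≤ q1 (k / √B) ξ (t2 * √B) f)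
include hB hk ht2 hlow

omit ht2 hk in
lemma mode_ineq (c : ℝ) {g : ℝ → ℝ} (hg : ContDiff ℝ 1 g) (hg0 : ∀ t, t2 ≤ t → g t = 0) :
    B * Λ * (∫ t in (0:ℝ)..t2, (1 - t * k) * (g t) ^ 2) ≤
      ∫ t in (0:ℝ)..t2, ((1 - t * k) * (deriv g t) ^ 2 +
        (1 - t * k)⁻¹ * ((c + B * (t - k * t ^ 2 / 2)) ^ 2 * (g t) ^ 2)) := by
  set r := √B with hr
  have hr0 : 0 < r := Real.sqrt_pos.2 hB
  have hrB : r ^ 2 = B := Real.sq_sqrt hB.le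
  have hf : Adm1 (t2 * r) (fun τ => g (r⁻¹ * τ)) := by
    refine ⟨hg.comp (by fun_prop), fun τ hτ => hg0 _ ?_⟩
    rw [inv_mul_eq_div, le_div_iff₀ hr0]
    exact hτ
  have hd : ∀ τ, deriv (fun τ => g (r⁻¹ * τ)) τ = r⁻¹ * deriv g (r⁻¹ * τ) := by
    intro τ
    rw [deriv_comp_mul_left, smul_eq_mul]
  have hsc : ∀ F : ℝ → ℝ, (∫ τ in (0:ℝ)..(t2 * r), F (r⁻¹ * τ)) = r * ∫ t in (0:ℝ)..t2, F t := by
    intro F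
    rw [intervalIntegral.integral_comp_mul_left F (inv_ne_zero hr0.ne')]
    simp only [inv_inv, mul_zero, smul_eq_mul]
    congr 2
    field_simp
  have h := hlow (c / r) _ hf
  have e1 : n1 (k / r) (t2 * r) (fun τ => g (r⁻¹ * τ)) =
      r * ∫ t in (0:ℝ)..t2, (1 - t * k) * (g t) ^ 2 := by
    rw [← hsc, n1]
    refine intervalIntegral.integral_congr fun τ _ => ?_
    congr 1
    ring
  have e2 : q1 (k / r) (c / r) (t2 * r) (fun τ => g (r⁻¹ * τ)) =
      r * (B⁻¹ * ∫ t in (0:ℝ)..t2, ((1 - t * k) * (deriv g t) ^ 2 +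
        (1 - t * k)⁻¹ * ((c + B * (t - k * t ^ 2 / 2)) ^ 2 * (g t) ^ 2))) := by
    rw [← intervalIntegral.integral_const_mul, ← hsc, q1]
    refine intervalIntegral.integral_congr fun τ _ => ?_
    simp only [hd]
    rw [← hrB]
    have e3 : 1 - r⁻¹ * τ * k = 1 - k / r * τ := by ring
    have e4 : c + r ^ 2 * (r⁻¹ * τ - k * (r⁻¹ * τ) ^ 2 / 2) =
        r * (c / r + τ - k / r * τ ^ 2 / 2) := by
      field_simp
      ring
    rw [e3, e4]
    have e5 : (r ^ 2)⁻¹ * r ^ 2 = 1 := inv_mul_cancel₀ (by positivity)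
    rw [mul_add]
    congr 1
    · rw [mul_pow, inv_pow]; ring
    · rw [mul_pow, div_eq_mul_inv]
      calc _ = (c / r + τ - k / r * τ ^ 2 / 2) ^ 2 * (1 - k / r * τ)⁻¹ * g (r⁻¹ * τ) ^ 2 * 1 := by ring
        _ = _ := by rw [← e5]; ring
  rw [e1, e2] at h
  have h2 : Λ * (∫ t in (0:ℝ)..t2, (1 - t * k) * (g t) ^ 2) ≤ B⁻¹ * ∫ t in (0:ℝ)..t2,
      ((1 - t * k) * (deriv g t) ^ 2 +
        (1 - t * k)⁻¹ * ((c + B * (t - k * t ^ 2 / 2)) ^ 2 * (g t) ^ 2)) := by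
    refine le_of_mul_le_mul_left ?_ hr0
    rw [← mul_assoc, mul_comm r Λ, mul_assoc]
    exact h
  rwa [inv_mul_eq_div, le_div_iff₀ hB, mul_comm, ← mul_assoc] at h2

lemma mode_ineq_complex (c : ℝ) {g : ℝ → ℂ} (hg : ContDiff ℝ 1 g) (hg0 : ∀ t, t2 ≤ t → g t = 0) :
    B * Λ * (∫ t in (0:ℝ)..t2, (1 - t * k) * ‖g t‖ ^ 2) ≤
      ∫ t in (0:ℝ)..t2, ((1 - t * k) * ‖deriv g t‖ ^ 2 +
        (1 - t * k)⁻¹ * ((c + B * (t - k * t ^ 2 / 2)) ^ 2 * ‖g t‖ ^ 2)) := by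
  have hre : ContDiff ℝ 1 (fun t => (g t).re) := Complex.reCLM.contDiff.comp hg
  have him : ContDiff ℝ 1 (fun t => (g t).im) := Complex.imCLM.contDiff.comp hg
  have dre : ∀ t, deriv (fun t => (g t).re) t = (deriv g t).re := fun t =>
    (Complex.reCLM.hasFDerivAt.comp_hasDerivAt t (hg.differentiable one_ne_zero t).hasDerivAt).deriv
  have dim : ∀ t, deriv (fun t => (g t).im) t = (deriv g t).im := fun t =>
    (Complex.imCLM.hasFDerivAt.comp_hasDerivAt t (hg.differentiable one_ne_zero t).hasDerivAt).deriv
  have h1 := mode_ineq hB hlow c hre (fun t ht => by simp [hg0 t ht])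
  have h2 := mode_ineq hB hlow c him (fun t ht => by simp [hg0 t ht])
  have hm : ∀ t ∈ uIcc 0 t2, 1 - t * k ≠ 0 := by
    intro t ht
    rw [uIcc_of_le ht2] at ht
    have := (m_bounds hk ht.1 ht.2).1
    rw [mul_comm]
    linarith
  have cI : ∀ f : ℝ → ℝ, ContDiff ℝ 1 f → IntervalIntegrable (fun t => (1 - t * k) * (deriv f t) ^ 2 +
        (1 - t * k)⁻¹ * ((c + B * (t - k * t ^ 2 / 2)) ^ 2 * (f t) ^ 2)) volume 0 t2 := by
    intro f hf
    have h1 := hf.continuous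
    have h2 := hf.continuous_deriv le_rfl
    refine ContinuousOn.intervalIntegrable (ContinuousOn.add (by fun_prop) (ContinuousOn.mul
      (ContinuousOn.inv₀ (by fun_prop) hm) (by fun_prop)))
  have cM : ∀ f : ℝ → ℝ, ContDiff ℝ 1 f → IntervalIntegrable (fun t => (1 - t * k) * (f t) ^ 2)
      volume 0 t2 := by
    intro f hf
    have h1 := hf.continuous
    exact Continuous.intervalIntegrable (by fun_prop) _ _
  have hsq : ∀ z : ℂ, ‖z‖ ^ 2 = z.re ^ 2 + z.im ^ 2 := fun z => by
    rw [Complex.sq_norm, Complex.normSq_apply]; ring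
  have hadd := add_le_add h1 h2
  rw [← mul_add, ← intervalIntegral.integral_add (cM _ hre) (cM _ him),
    ← intervalIntegral.integral_add (cI _ hre) (cI _ him)] at hadd
  refine le_of_eq_of_le ?_ (le_of_le_of_eq hadd ?_)
  · congr 1
    refine intervalIntegral.integral_congr fun t _ => ?_
    simp only [hsq]; ring
  · refine intervalIntegral.integral_congr fun t _ => ?_
    simp only [hsq, dre, dim]; ring

end

lemma integral_sden_slice (B k α : ℝ) {w : ℝ × ℝ → ℂ} (hw : ContDiff ℝ 1 w) (a b t : ℝ) :
    (∫ s in a..b, sden B k α w (s, t)) = (1 - t * k) * (∫ s in a..b, ‖fderiv ℝ w (s, t) (0, 1)‖ ^ 2) +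
      (1 - t * k)⁻¹ * ∫ s in a..b,
        ‖-Complex.I * fderiv ℝ w (s, t) (1, 0) + ((B * α : ℝ) : ℂ) * w (s, t)‖ ^ 2 := by
  have h0 := hw.continuous
  have h1 := continuous_fderiv_dir hw (0, 1)
  have h2 := continuous_fderiv_dir hw (1, 0)
  have i1 : IntervalIntegrable (fun s => ‖fderiv ℝ w (s, t) (0, 1)‖ ^ 2) volume a b :=
    Continuous.intervalIntegrable (((h1.comp (by fun_prop : Continuous fun s : ℝ => (s, t))).norm).pow 2)
      _ _
  have i2 : IntervalIntegrable (fun s => ‖-Complex.I * fderiv ℝ w (s, t) (1, 0) +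
      ((B * α : ℝ) : ℂ) * w (s, t)‖ ^ 2) volume a b :=
    Continuous.intervalIntegrable (((continuous_const.mul
      (h2.comp (by fun_prop : Continuous fun s : ℝ => (s, t)))).add (by fun_prop)).norm.pow 2) _ _
  change (∫ s in a..b, ((1 - t * k) * ‖fderiv ℝ w (s, t) (0, 1)‖ ^ 2 + (1 - t * k)⁻¹ *
    ‖-Complex.I * fderiv ℝ w (s, t) (1, 0) + ((B * α : ℝ) : ℂ) * w (s, t)‖ ^ 2)) = _
  rw [intervalIntegral.integral_add (i1.const_mul _) (i2.const_mul _),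
    intervalIntegral.integral_const_mul, intervalIntegral.integral_const_mul]

lemma hasDerivAt_fc {w : ℝ × ℝ → ℂ} (hw : ContDiff ℝ 1 w) (a b : ℝ) (n : ℤ) (t : ℝ) :
    HasDerivAt (fun t => fc a b n (fun s => w (s, t)))
      (fc a b n (fun s => fderiv ℝ w (s, t) (0, 1))) t := by
  set e : ℝ → ℂ := fun s => Complex.exp (-((2 * Real.pi / (b - a) * n * s : ℝ) : ℂ) * Complex.I)
    with he
  have hec : ContDiff ℝ 1 e := by
    have h1 : ContDiff ℝ 1 (fun s : ℝ => 2 * Real.pi / (b - a) * n * s) :=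
      contDiff_const.mul contDiff_id
    exact ContDiff.cexp (ContDiff.mul (ContDiff.neg (Complex.ofRealCLM.contDiff.comp h1))
      contDiff_const)
  have hg : ContDiff ℝ 1 (fun p : ℝ × ℝ => e p.2 * w (p.2, p.1)) :=
    (hec.comp contDiff_snd).mul (hw.comp (contDiff_snd.prodMk contDiff_fst))
  have h := hasDerivAt_parametric hg a b t
  refine h.congr_deriv ?_
  refine intervalIntegral.integral_congr fun s _ => ?_
  have h1 := hasDerivAt_slice_fst hg t s
  have h2 := (hasDerivAt_slice_snd hw s t).const_mul (e s)
  exact h1.unique h2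

lemma continuous_fc {g : ℝ × ℝ → ℂ} (hg : Continuous g) (a b : ℝ) (n : ℤ) :
    Continuous (fun t => fc a b n (fun s => g (s, t))) := by
  unfold fc
  refine intervalIntegral.continuous_parametric_intervalIntegral_of_continuous' ?_ a b
  simp only [Function.uncurry_def]
  fun_prop

lemma contDiff_fc {w : ℝ × ℝ → ℂ} (hw : ContDiff ℝ 1 w) (a b : ℝ) (n : ℤ) :
    ContDiff ℝ 1 (fun t => fc a b n (fun s => w (s, t))) := by
  rw [contDiff_one_iff_deriv]
  refine ⟨fun t => (hasDerivAt_fc hw a b n t).differentiableAt, ?_⟩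
  have : deriv (fun t => fc a b n (fun s => w (s, t))) =
      fun t => fc a b n (fun s => fderiv ℝ w (s, t) (0, 1)) :=
    funext fun t => (hasDerivAt_fc hw a b n t).deriv
  rw [this]
  exact continuous_fc (continuous_fderiv_dir hw (0, 1)) a b n

/-- The frozen-curvature form on a strip is bounded below by the one-dimensional ground energy. -/
lemma frozen_lower_aux {k B t2 Λ a b : ℝ} (hab : a < b) (hB : 0 < B) (hk : |k| * t2 ≤ 1 / 2) (ht2 : 0 ≤ t2)
    (hlow : ∀ ξ f, Adm1 (t2 * √B) f → Λ * n1 (k / √B) (t2 * √B) f ≤ q1 (k / √B) ξ (t2 * √B) f)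
    {w : ℝ × ℝ → ℂ} (hw : ContDiff ℝ 1 w)
    (hwa : ∀ t ∈ Icc 0 t2, w (a, t) = 0) (hwb : ∀ t ∈ Icc 0 t2, w (b, t) = 0)
    (hwt : ∀ s ∈ Icc a b, ∀ t, t2 ≤ t → w (s, t) = 0) :
    B * Λ * (∫ t in (0:ℝ)..t2, (1 - t * k) * ∫ s in a..b, ‖w (s, t)‖ ^ 2) ≤
      ∫ t in (0:ℝ)..t2, ∫ s in a..b, sden B k (t - k * t ^ 2 / 2) w (s, t) := by
  have hba : 0 < b - a := by linarith
  have hw0 := hw.continuous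
  have hw1 := continuous_fderiv_dir hw (0, 1)
  have hw2 := continuous_fderiv_dir hw (1, 0)
  have hsl : ∀ t : ℝ, Continuous fun s : ℝ => (s, t) := fun t => by fun_prop
  set c : ℤ → ℝ → ℂ := fun n t => fc a b n (fun s => w (s, t)) with hc
  have hcC : ∀ n, ContDiff ℝ 1 (c n) := fun n => contDiff_fc hw a b n
  have hc0 : ∀ n t, t2 ≤ t → c n t = 0 := by
    intro n t ht
    simp only [hc, fc]
    rw [intervalIntegral.integral_congr (g := fun _ => (0:ℂ))]
    · simp
    · intro s hs
      rw [uIcc_of_le hab.le] at hs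
      simp [hwt s hs t ht]
  have hmp : ∀ t ∈ Icc 0 t2, 1 / 2 ≤ 1 - t * k := by
    intro t ht
    have := (m_bounds hk ht.1 ht.2).1
    rwa [mul_comm] at this
  have hm : ∀ t ∈ uIcc 0 t2, 1 - t * k ≠ 0 := by
    intro t ht
    rw [uIcc_of_le ht2] at ht
    have := hmp t ht
    linarith
  set ω := 2 * Real.pi / (b - a) with hω
  set J : ℤ → ℝ → ℝ := fun n t => (1 - t * k) * ‖deriv (c n) t‖ ^ 2 +
        (1 - t * k)⁻¹ * ((ω * n + B * (t - k * t ^ 2 / 2)) ^ 2 * ‖c n t‖ ^ 2) with hJ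
  have iJ : ∀ n, IntervalIntegrable (J n) volume 0 t2 := by
    intro n
    have h1 := (hcC n).continuous
    have h2 := (hcC n).continuous_deriv le_rfl
    refine ContinuousOn.intervalIntegrable (ContinuousOn.add (by fun_prop) (ContinuousOn.mul
      (ContinuousOn.inv₀ (by fun_prop) hm) (by fun_prop)))
  have iL : IntervalIntegrable (fun t => ∫ s in a..b, sden B k (t - k * t ^ 2 / 2) w (s, t))
      volume 0 t2 := by
    simp_rw [integral_sden_slice B k _ hw a b]
    refine ContinuousOn.intervalIntegrable (ContinuousOn.add (Continuous.continuousOn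
      (Continuous.mul (by fun_prop) ?_)) (ContinuousOn.mul (ContinuousOn.inv₀ (by fun_prop) hm)
      (Continuous.continuousOn ?_)))
    · refine intervalIntegral.continuous_parametric_intervalIntegral_of_continuous' ?_ a b
      simp only [Function.uncurry_def]
      fun_prop
    · refine intervalIntegral.continuous_parametric_intervalIntegral_of_continuous' ?_ a b
      simp only [Function.uncurry_def]
      fun_prop
  have hpt : ∀ F : Finset ℤ, ∀ t ∈ Icc 0 t2, ∑ n ∈ F, (b - a)⁻¹ * J n t ≤
      ∫ s in a..b, sden B k (t - k * t ^ 2 / 2) w (s, t) := by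
    intro F t ht
    rw [integral_sden_slice B k _ hw a b]
    have hm0 : 0 ≤ 1 - t * k := by linarith [hmp t ht]
    have s1 := sum_le_hasSum F (fun n _ => by positivity)
      (hasSum_fc hab (hw1.comp (hsl t)))
    have hcont2 : Continuous (fun s => -Complex.I * fderiv ℝ w (s, t) (1, 0) +
        ((B * (t - k * t ^ 2 / 2) : ℝ) : ℂ) * w (s, t)) :=
      (continuous_const.mul (hw2.comp (hsl t))).add (continuous_const.mul (hw0.comp (hsl t)))
    have s2 := sum_le_hasSum F (fun n _ => by positivity) (hasSum_fc hab hcont2)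
    have e1 : ∀ n : ℤ, (b - a)⁻¹ * J n t = (1 - t * k) * ((b - a)⁻¹ *
        ‖fc a b n (fun s => fderiv ℝ w (s, t) (0, 1))‖ ^ 2) + (1 - t * k)⁻¹ * ((b - a)⁻¹ *
        ‖fc a b n (fun s => -Complex.I * fderiv ℝ w (s, t) (1, 0) +
        ((B * (t - k * t ^ 2 / 2) : ℝ) : ℂ) * w (s, t))‖ ^ 2) := by
      intro n
      rw [fc_deriv (f := fun s => w (s, t)) (fun s => hasDerivAt_slice_fst hw s t)
        (hw2.comp (hsl t)) (hwa t ht) (hwb t ht) n, norm_mul, mul_pow,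
        Complex.norm_real, Real.norm_eq_abs, sq_abs]
      simp only [hJ, hc]
      rw [(hasDerivAt_fc hw a b n t).deriv]
      ring
    simp_rw [e1]
    rw [Finset.sum_add_distrib, ← Finset.mul_sum F _ (1 - t * k), ← Finset.mul_sum F _ (1 - t * k)⁻¹]
    exact add_le_add (mul_le_mul_of_nonneg_left s1 hm0)
      (mul_le_mul_of_nonneg_left s2 (inv_nonneg.2 hm0))
  have hcm : ∀ n, Continuous (fun t => (b - a)⁻¹ * ((1 - t * k) * ‖c n t‖ ^ 2)) := by
    intro n
    have h1 := (hcC n).continuous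
    fun_prop
  have hfin : ∀ F : Finset ℤ, ∑ n ∈ F, (∫ t in (0:ℝ)..t2, (b - a)⁻¹ * ((1 - t * k) * ‖c n t‖ ^ 2)) *
      (B * Λ) ≤ ∫ t in (0:ℝ)..t2, ∫ s in a..b, sden B k (t - k * t ^ 2 / 2) w (s, t) := by
    intro F
    calc _ ≤ ∑ n ∈ F, ∫ t in (0:ℝ)..t2, (b - a)⁻¹ * J n t := by
          refine Finset.sum_le_sum fun n _ => ?_
          rw [intervalIntegral.integral_const_mul, intervalIntegral.integral_const_mul]
          have := mode_ineq_complex hB hk ht2 hlow (ω * n) (hcC n) (hc0 n)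
          calc _ = (b - a)⁻¹ * (B * Λ * ∫ t in (0:ℝ)..t2, (1 - t * k) * ‖c n t‖ ^ 2) := by ring
            _ ≤ _ := mul_le_mul_of_nonneg_left this (by positivity)
      _ = ∫ t in (0:ℝ)..t2, ∑ n ∈ F, (b - a)⁻¹ * J n t :=
          (intervalIntegral.integral_finsetSum fun n _ => (iJ n).const_mul _).symm
      _ ≤ _ := by
          refine intervalIntegral.integral_mono_on ht2 ?_ iL fun t ht => hpt F t ht
          have := IntervalIntegrable.sum F (f := fun n t => (b - a)⁻¹ * J n t)
            (fun n _ => (iJ n).const_mul _)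
          refine this.congr ?_
          exact fun t _ => by simp
  have hHS : ∀ t, HasSum (fun n => (b - a)⁻¹ * ((1 - t * k) * ‖c n t‖ ^ 2))
      ((1 - t * k) * ∫ s in a..b, ‖w (s, t)‖ ^ 2) := by
    intro t
    have := (hasSum_fc hab (hw0.comp (hsl t))).mul_left (1 - t * k)
    refine this.congr_fun ?_ |> fun h => h
    intro n
    simp only [hc, Function.comp_def]
    ring
  have hsum := intervalIntegral.hasSum_integral_of_dominated_convergence (μ := volume)
    (F := fun n t => (b - a)⁻¹ * ((1 - t * k) * ‖c n t‖ ^ 2)) (a := 0) (b := t2)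
    (f := fun t => (1 - t * k) * ∫ s in a..b, ‖w (s, t)‖ ^ 2)
    (fun n t => (b - a)⁻¹ * ((1 - t * k) * ‖c n t‖ ^ 2))
    (fun n => (hcm n).aestronglyMeasurable) ?_ ?_ ?_ ?_
  · have h2 := hsum.mul_right (B * Λ)
    rw [mul_comm]
    exact hasSum_le_of_sum_le h2 hfin
  · intro n
    refine Eventually.of_forall fun t ht => ?_
    rw [uIoc_of_le ht2] at ht
    have := hmp t ⟨ht.1.le, ht.2⟩
    rw [Real.norm_of_nonneg]
    have h3 : 0 ≤ 1 - t * k := by linarith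
    positivity
  · exact Eventually.of_forall fun t _ => (hHS t).summable
  · simp_rw [fun t => (hHS t).tsum_eq]
    refine Continuous.intervalIntegrable (Continuous.mul (by fun_prop) ?_) _ _
    refine intervalIntegral.continuous_parametric_intervalIntegral_of_continuous' ?_ a b
    simp only [Function.uncurry_def]
    fun_prop
  · exact Eventually.of_forall fun t _ => hHS t

end SC

namespace SC

lemma integral_rect_eq {a b T : ℝ} (hab : a ≤ b) (hT : 0 ≤ T) {F : ℝ × ℝ → ℝ}
    (hF : ContinuousOn F (Icc a b ×ˢ Icc 0 T)) :
    (∫ p in Ioo a b ×ˢ Ioo 0 T, F p) = ∫ t in (0:ℝ)..T, ∫ s in a..b, F (s, t) := by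
  have hi : IntegrableOn F (Icc a b ×ˢ Icc 0 T) :=
    hF.integrableOn_compact (isCompact_Icc.prod isCompact_Icc)
  have hi2 : IntegrableOn F (Ioo a b ×ˢ Ioo 0 T) :=
    hi.mono_set (prod_mono Ioo_subset_Icc_self Ioo_subset_Icc_self)
  rw [Measure.volume_eq_prod] at hi2 ⊢
  rw [← setIntegral_prod_swap, setIntegral_prod]
  · rw [intervalIntegral.integral_of_le hT, integral_Ioc_eq_integral_Ioo]
    refine setIntegral_congr_fun measurableSet_Ioo fun t _ => ?_
    simp only [Prod.swap]
    rw [intervalIntegral.integral_of_le hab, integral_Ioc_eq_integral_Ioo]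
  · have := hi2.swap
    exact this

lemma continuousOn_sden {B : ℝ} {k α : ℝ × ℝ → ℝ} {w : ℝ × ℝ → ℂ} {R : Set (ℝ × ℝ)}
    (hk : Continuous k) (hα : Continuous α) (hw : ContDiff ℝ 1 w)
    (hm : ∀ p ∈ R, 1 - p.2 * k p ≠ 0) :
    ContinuousOn (fun p => sden B (k p) (α p) w p) R := by
  have hw0 := hw.continuous
  have hw1 := continuous_fderiv_dir hw (0, 1)
  have hw2 := continuous_fderiv_dir hw (1, 0)
  unfold sden
  refine ContinuousOn.add (Continuous.continuousOn (by fun_prop)) (ContinuousOn.mul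
    (ContinuousOn.inv₀ (by fun_prop) hm) (Continuous.continuousOn ?_))
  exact ((continuous_const.mul hw2).add
    ((Complex.continuous_ofReal.comp (continuous_const.mul hα)).mul hw0)).norm.pow 2

lemma sden_congr {B k α : ℝ} {w v : ℝ × ℝ → ℂ} {p : ℝ × ℝ} (h : w =ᶠ[𝓝 p] v) :
    sden B k α w p = sden B k α v p := by
  unfold sden
  rw [h.fderiv_eq, h.eq_of_nhds]

/-- The frozen-curvature form on a strip is bounded below by the one-dimensional ground energy. -/
lemma frozen_lower {k B t2 t3 Λ a b : ℝ} (hab : a < b) (hB : 0 < B) (hk : |k| * t2 ≤ 1 / 2)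
    (ht2 : 0 ≤ t2) (ht3 : t2 < t3)
    (hlow : ∀ ξ f, Adm1 (t2 * √B) f → Λ * n1 (k / √B) (t2 * √B) f ≤ q1 (k / √B) ξ (t2 * √B) f)
    {w : ℝ × ℝ → ℂ} (hw : ContDiff ℝ 1 w)
    (hwa : ∀ t ∈ Icc 0 t2, w (a, t) = 0) (hwb : ∀ t ∈ Icc 0 t2, w (b, t) = 0)
    (hwt : ∀ s ∈ Icc a b, ∀ t ∈ Icc t2 t3, w (s, t) = 0) :
    B * Λ * (∫ p in Ioo a b ×ˢ Ioo 0 t2, (1 - p.2 * k) * ‖w p‖ ^ 2) ≤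
      ∫ p in Ioo a b ×ˢ Ioo 0 t2, sden B k (p.2 - k * p.2 ^ 2 / 2) w p := by
  have h23 : 0 < t3 - t2 := by linarith
  set χ : ℝ → ℝ := fun t => Real.smoothTransition ((t3 - t) / (t3 - t2)) with hχ
  have hχC : ContDiff ℝ 1 χ := Real.smoothTransition.contDiff.comp (by fun_prop)
  have hχ1 : ∀ t ≤ t2, χ t = 1 := fun t ht =>
    Real.smoothTransition.one_of_one_le (by rw [le_div_iff₀ h23]; linarith)
  have hχ0 : ∀ t, t3 ≤ t → χ t = 0 := fun t ht =>
    Real.smoothTransition.zero_of_nonpos (div_nonpos_of_nonpos_of_nonneg (by linarith) h23.le)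
  set W : ℝ × ℝ → ℂ := fun p => (χ p.2 : ℂ) * w p with hW
  have hWC : ContDiff ℝ 1 W :=
    (Complex.ofRealCLM.contDiff.comp (hχC.comp contDiff_snd)).mul hw
  have hWw : ∀ p : ℝ × ℝ, p.2 ≤ t2 → W p = w p := fun p hp => by simp [hW, hχ1 _ hp]
  have hR : ∀ p ∈ Ioo a b ×ˢ Ioo 0 t2, W =ᶠ[𝓝 p] w := by
    intro p hp
    have : {q : ℝ × ℝ | q.2 < t2} ∈ 𝓝 p := (isOpen_lt continuous_snd continuous_const).mem_nhds hp.2.2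
    filter_upwards [this] with q hq
    exact hWw q (le_of_lt hq)
  have hms : MeasurableSet (Ioo a b ×ˢ Ioo 0 t2) := measurableSet_Ioo.prod measurableSet_Ioo
  have e1 : (∫ p in Ioo a b ×ˢ Ioo 0 t2, (1 - p.2 * k) * ‖w p‖ ^ 2) =
      ∫ p in Ioo a b ×ˢ Ioo 0 t2, (1 - p.2 * k) * ‖W p‖ ^ 2 :=
    setIntegral_congr_fun hms fun p hp => by simp only [(hR p hp).eq_of_nhds]
  have e2 : (∫ p in Ioo a b ×ˢ Ioo 0 t2, sden B k (p.2 - k * p.2 ^ 2 / 2) w p) =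
      ∫ p in Ioo a b ×ˢ Ioo 0 t2, sden B k (p.2 - k * p.2 ^ 2 / 2) W p :=
    setIntegral_congr_fun hms fun p hp => (sden_congr (hR p hp)).symm
  have hmp : ∀ p ∈ Icc a b ×ˢ Icc 0 t2, 1 - p.2 * k ≠ 0 := by
    intro p hp
    have := (m_bounds hk hp.2.1 hp.2.2).1
    rw [mul_comm]
    linarith
  have hW0 := hWC.continuous
  rw [e1, e2, integral_rect_eq hab.le ht2 (Continuous.continuousOn (by fun_prop)),
    integral_rect_eq hab.le ht2 (continuousOn_sden (k := fun _ => k)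
      (α := fun p => p.2 - k * p.2 ^ 2 / 2) continuous_const (by fun_prop) hWC hmp)]
  have := frozen_lower_aux hab hB hk ht2 hlow hWC
    (fun t ht => by rw [hWw _ ht.2]; exact hwa t ht)
    (fun t ht => by rw [hWw _ ht.2]; exact hwb t ht) ?_
  · simpa only [intervalIntegral.integral_const_mul] using this
  · intro s hs t ht
    rcases le_total t t3 with h | h
    · simp [hW, hwt s hs t ⟨ht, h⟩]
    · simp [hW, hχ0 t h]

end SC

namespace SC

set_option maxHeartbeats 1000000 in
lemma freeze_aux {r t m m' ε ε' X y y' W : ℝ} (hr : 1 ≤ r) (ht : 0 ≤ t) (hm : 1 / 2 ≤ m)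
    (hm2 : m ≤ 3 / 2) (hm' : 1 / 2 ≤ m') (hε : 0 ≤ ε) (hε' : 0 ≤ ε') (hε1 : ε' ≤ 1)
    (hmm : |m - m'| ≤ ε * t) (hX : 0 ≤ X) (hy' : 0 ≤ y')
    (hyy : y' ≤ y + r ^ 2 * (ε' * t ^ 2) * W) :
    m' * X + m'⁻¹ * y' ^ 2 ≤ (m * X + m⁻¹ * y ^ 2) + 4 * r * (ε + ε') * ((1 + r * t) *
      ((m * X + m⁻¹ * y ^ 2) / r ^ 2) + (1 + r * t) ^ 4 * W ^ 2) := by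
  have hm0 : 0 < m := by linarith
  have hm0' : 0 < m' := by linarith
  have hr0 : 0 < r := by linarith
  set x := r * t with hx
  have hx0 : 0 ≤ x := by positivity
  set S := m * X + m⁻¹ * y ^ 2 with hS
  have hy2 : 0 ≤ m⁻¹ * y ^ 2 := by positivity
  have hmX : 0 ≤ m * X := by positivity
  have hS0 : 0 ≤ S := by positivity
  have hmabs := abs_le.1 hmm
  have h1 : m' * X ≤ m * X + 2 * (ε * t) * (m * X) := by
    have h11 : m' * X ≤ m * X + ε * t * X := by nlinarith
    have h12 : X ≤ 2 * (m * X) := by nlinarith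
    have h13 := mul_le_mul_of_nonneg_left h12 (mul_nonneg hε ht)
    linarith
  have h2 : m'⁻¹ ≤ m⁻¹ + 2 * (ε * t) * m⁻¹ := by
    have h21 : m'⁻¹ ≤ 2 := by rw [inv_le_comm₀ hm0' (by norm_num)]; linarith
    have h22 : m'⁻¹ - m⁻¹ = (m - m') * m'⁻¹ * m⁻¹ := by field_simp
    have h23 : (m - m') * m'⁻¹ ≤ ε * t * 2 :=
      mul_le_mul hmabs.2 h21 (by positivity) (by positivity)
    have h24 := mul_le_mul_of_nonneg_right h23 (inv_nonneg.2 hm0.le)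
    linarith
  have h3 : y' ^ 2 ≤ y ^ 2 + 2 * y * (ε' * (x ^ 2 * W)) + ε' * (x ^ 4 * W ^ 2) := by
    have h31 : r ^ 2 * (ε' * t ^ 2) * W = ε' * (x ^ 2 * W) := by rw [hx]; ring
    rw [h31] at hyy
    have h32 := pow_le_pow_left₀ hy' hyy 2
    have h33 : ε' ^ 2 * (x ^ 4 * W ^ 2) ≤ ε' * (x ^ 4 * W ^ 2) := by
      refine mul_le_mul_of_nonneg_right ?_ (by positivity)
      nlinarith
    nlinarith
  have h4 : 2 * y * (ε' * (x ^ 2 * W)) ≤ ε' * (r * (y ^ 2 / r ^ 2 + x ^ 4 * W ^ 2)) := by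
    have h41 : 2 * y * (x ^ 2 * W) ≤ r * (y ^ 2 / r ^ 2 + x ^ 4 * W ^ 2) := by
      have h42 := mul_nonneg hr0.le (sq_nonneg (y / r - x ^ 2 * W))
      have h43 : r * (y / r - x ^ 2 * W) ^ 2 = r * (y ^ 2 / r ^ 2 + x ^ 4 * W ^ 2) -
          2 * y * (x ^ 2 * W) := by field_simp; ring
      linarith
    have := mul_le_mul_of_nonneg_left h41 hε'
    linarith
  have h5 : y ^ 2 ≤ 3 / 2 * S := by
    have h51 : y ^ 2 = m * (m⁻¹ * y ^ 2) := by field_simp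
    nlinarith
  have hy5 : y ^ 2 / r ^ 2 ≤ 3 / 2 * (S / r ^ 2) := by
    rw [← mul_div_assoc]
    exact div_le_div_of_nonneg_right h5 (by positivity)
  have hV : 0 ≤ x ^ 4 * W ^ 2 := by positivity
  have h6 : y' ^ 2 ≤ y ^ 2 + ε' * r * (3 / 2 * (S / r ^ 2) + 2 * (x ^ 4 * W ^ 2)) := by
    have h61 : ε' * (x ^ 4 * W ^ 2) ≤ ε' * (r * (x ^ 4 * W ^ 2)) :=
      mul_le_mul_of_nonneg_left (le_mul_of_one_le_left hV hr) hε'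
    have h62 := mul_le_mul_of_nonneg_left hy5 (mul_nonneg hε' hr0.le)
    nlinarith
  set R := ε' * r * (3 / 2 * (S / r ^ 2) + 2 * (x ^ 4 * W ^ 2)) with hR
  have hR0 : 0 ≤ R := by positivity
  have h7 : m'⁻¹ * y' ^ 2 ≤ m⁻¹ * y ^ 2 + 2 * (ε * t) * (m⁻¹ * y ^ 2) + 2 * R := by
    have h71 : m'⁻¹ ≤ 2 := by rw [inv_le_comm₀ hm0' (by norm_num)]; linarith
    have h72 := mul_le_mul_of_nonneg_left h6 (inv_nonneg.2 hm0'.le)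
    have h73 := mul_le_mul_of_nonneg_right h2 (sq_nonneg y)
    have h74 := mul_le_mul_of_nonneg_right h71 hR0
    linarith
  have h8 : m' * X + m'⁻¹ * y' ^ 2 ≤ S + 2 * (ε * t) * S + 2 * R := by
    linarith
  have h9 : ε * t * S = r * ε * (x * (S / r ^ 2)) := by rw [hx]; field_simp
  have hx4 : x ^ 4 ≤ (1 + x) ^ 4 := pow_le_pow_left₀ hx0 (by linarith) 4
  set Z := S / r ^ 2 with hZ
  have hZ0 : 0 ≤ Z := by positivity
  set Y := (1 + x) * Z + (1 + x) ^ 4 * W ^ 2 with hY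
  have hxZ : 0 ≤ x * Z := by positivity
  have hW4 : 0 ≤ (1 + x) ^ 4 * W ^ 2 := by positivity
  have f1 : x * Z ≤ Y := by linarith
  have f2 : 3 / 2 * Z + 2 * (x ^ 4 * W ^ 2) ≤ 2 * Y := by
    have g2 : x ^ 4 * W ^ 2 ≤ (1 + x) ^ 4 * W ^ 2 := mul_le_mul_of_nonneg_right hx4 (sq_nonneg W)
    linarith
  have f3 := mul_le_mul_of_nonneg_left f1 (mul_nonneg hr0.le hε)
  have f4 := mul_le_mul_of_nonneg_left f2 (mul_nonneg hε' hr0.le)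
  have f5 : 0 ≤ Y := by positivity
  have f6 : 0 ≤ r * ε * Y := by positivity
  rw [← h9] at f3
  calc _ ≤ _ := h8
    _ ≤ S + 2 * (r * ε * Y) + 2 * (ε' * r * (2 * Y)) := by linarith
    _ ≤ _ := by linarith

/-- Changing the curvature and the potential in the strip form. -/
lemma sden_freeze {B k k' a a' ε ε' : ℝ} {w : ℝ × ℝ → ℂ} {p : ℝ × ℝ} (hB : 1 ≤ B) (ht : 0 ≤ p.2)
    (hm : 1 / 2 ≤ 1 - p.2 * k) (hm2 : 1 - p.2 * k ≤ 3 / 2) (hm' : 1 / 2 ≤ 1 - p.2 * k')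
    (hε : 0 ≤ ε) (hε' : 0 ≤ ε') (hε1 : ε' ≤ 1) (hk : |k - k'| ≤ ε) (ha : |a - a'| ≤ ε' * p.2 ^ 2) :
    sden B k' a' w p ≤ sden B k a w p + 4 * √B * (ε + ε') * ((1 + √B * p.2) *
      (sden B k a w p / B) + (1 + √B * p.2) ^ 4 * ‖w p‖ ^ 2) := by
  have hB0 : 0 < B := by linarith
  have hr2 : √B ^ 2 = B := Real.sq_sqrt hB0.le
  have hr : 1 ≤ √B := by rw [Real.one_le_sqrt]; exact hB
  have h := freeze_aux (ε := ε) (X := ‖fderiv ℝ w p (0, 1)‖ ^ 2)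
    (y := ‖-Complex.I * fderiv ℝ w p (1, 0) + ((B * a : ℝ) : ℂ) * w p‖)
    (y' := ‖-Complex.I * fderiv ℝ w p (1, 0) + ((B * a' : ℝ) : ℂ) * w p‖) (W := ‖w p‖)
    hr ht hm hm2 hm' hε hε' hε1 ?_ (sq_nonneg _) (norm_nonneg _) ?_
  · rw [hr2] at h
    exact h
  · have : 1 - p.2 * k - (1 - p.2 * k') = -((k - k') * p.2) := by ring
    rw [this, abs_neg, abs_mul, abs_of_nonneg ht]
    exact mul_le_mul_of_nonneg_right hk ht
  · have e : -Complex.I * fderiv ℝ w p (1, 0) + ((B * a' : ℝ) : ℂ) * w p =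
        (-Complex.I * fderiv ℝ w p (1, 0) + ((B * a : ℝ) : ℂ) * w p) +
          ((B * (a' - a) : ℝ) : ℂ) * w p := by push_cast; ring
    rw [e]
    refine (norm_add_le _ _).trans (add_le_add le_rfl ?_)
    rw [norm_mul, Complex.norm_real, Real.norm_eq_abs, abs_mul, abs_of_pos hB0, hr2, abs_sub_comm]
    gcongr

lemma sden_nonneg {B k a : ℝ} {w : ℝ × ℝ → ℂ} {p : ℝ × ℝ} (hm : 0 ≤ 1 - p.2 * k) :
    0 ≤ sden B k a w p := by
  unfold sden
  have := inv_nonneg.2 hm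
  positivity

end SC

namespace SC

lemma exists_bump (c : ℝ) {a b : ℝ} (ha : 0 < a) (hab : a < b) : ∃ χ : ℝ → ℝ, ContDiff ℝ 1 χ ∧
    (∀ t, |t - c| ≤ a → χ t = 1) ∧ (∀ t, b ≤ |t - c| → χ t = 0) ∧ ∀ t, 0 ≤ χ t ∧ χ t ≤ 1 := by
  let f : ContDiffBump c := ⟨a, b, ha, hab⟩
  refine ⟨f, f.contDiff, fun t ht => f.one_of_mem_closedBall ?_, fun t ht => f.zero_of_le_dist ?_,
    fun t => ⟨f.nonneg, f.le_one⟩⟩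
  · rw [Metric.mem_closedBall, Real.dist_eq]; exact ht
  · rw [Real.dist_eq]; exact ht

/-- A `C¹` ramp vanishing up to `1` with slope at most `1`. -/
lemma exists_ramp : ∃ p : ℝ → ℝ, ContDiff ℝ 1 p ∧ (∀ τ ≤ 1, p τ = 0) ∧
    (∀ τ, 0 ≤ deriv p τ ∧ deriv p τ ≤ 1) ∧ ∀ τ, τ - 2 ≤ p τ := by
  have hc : Continuous fun x : ℝ => Real.smoothTransition (x - 1) :=
    Real.smoothTransition.continuous.comp (by fun_prop)
  have hd : ∀ τ, HasDerivAt (fun τ => ∫ x in (1:ℝ)..τ, Real.smoothTransition (x - 1))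
      (Real.smoothTransition (τ - 1)) τ := fun τ =>
    intervalIntegral.integral_hasDerivAt_right (hc.intervalIntegrable _ _)
      (hc.stronglyMeasurableAtFilter _ _) hc.continuousAt
  have hde : deriv (fun τ => ∫ x in (1:ℝ)..τ, Real.smoothTransition (x - 1)) =
      fun τ => Real.smoothTransition (τ - 1) := funext fun τ => (hd τ).deriv
  have h0 : ∀ τ ≤ (1:ℝ), (∫ x in (1:ℝ)..τ, Real.smoothTransition (x - 1)) = 0 := by
    intro τ hτ
    rw [intervalIntegral.integral_symm]
    rw [intervalIntegral.integral_congr (g := fun _ => (0:ℝ))]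
    · simp
    · intro x hx
      rw [uIcc_of_le hτ] at hx
      exact Real.smoothTransition.zero_of_nonpos (by linarith [hx.2])
  refine ⟨_, contDiff_one_iff_deriv.2 ⟨fun τ => (hd τ).differentiableAt, by rw [hde]; exact hc⟩,
    h0, fun τ => ?_, fun τ => ?_⟩
  · rw [hde]
    exact ⟨Real.smoothTransition.nonneg _, Real.smoothTransition.le_one _⟩
  · rcases le_or_gt τ 2 with h | h
    · rcases le_or_gt τ 1 with h1 | h1
      · rw [h0 τ h1]; linarith
      · have : 0 ≤ ∫ x in (1:ℝ)..τ, Real.smoothTransition (x - 1) :=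
          intervalIntegral.integral_nonneg h1.le fun x _ => Real.smoothTransition.nonneg _
        linarith
    · rw [← intervalIntegral.integral_add_adjacent_intervals (b := 2)
        (hc.intervalIntegrable _ _) (hc.intervalIntegrable _ _)]
      have h1 : 0 ≤ ∫ x in (1:ℝ)..2, Real.smoothTransition (x - 1) :=
        intervalIntegral.integral_nonneg (by norm_num) fun x _ => Real.smoothTransition.nonneg _
      have h2 : (∫ x in (2:ℝ)..τ, Real.smoothTransition (x - 1)) = ∫ x in (2:ℝ)..τ, (1:ℝ) := by
        refine intervalIntegral.integral_congr fun x hx => ?_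
        rw [uIcc_of_le h.le] at hx
        exact Real.smoothTransition.one_of_one_le (by linarith [hx.1])
      rw [h2, intervalIntegral.integral_const, smul_eq_mul]
      linarith

lemma gradSq_comp {g : ℝ → ℝ} {ρ : Plane → ℝ} (hg : ContDiff ℝ 1 g) (hρ : ContDiff ℝ 1 ρ)
    (x : Plane) : gradSq (fun y => g (ρ y)) x = deriv g (ρ x) ^ 2 * gradSq ρ x := by
  have h : HasFDerivAt (fun y => g (ρ y)) (deriv g (ρ x) • fderiv ℝ ρ x) x :=
    ((hg.differentiable one_ne_zero) (ρ x)).hasDerivAt.comp_hasFDerivAt x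
      ((hρ.differentiable one_ne_zero) x).hasFDerivAt
  unfold gradSq
  rw [h.fderiv]
  simp only [smul_apply, smul_eq_mul]
  ring

lemma sq_mul_magSq_le {B : ℝ} {A : Plane → Plane} {f : Plane → ℝ} {u : Plane → ℂ} {x : Plane}
    (hf : DifferentiableAt ℝ f x) (hu : DifferentiableAt ℝ u x) :
    f x ^ 2 * magSq B A u x ≤ 2 * magSq B A (rmul f u) x + 2 * gradSq f x * ‖u x‖ ^ 2 := by
  have key : ∀ z w v : ℂ, ∀ b : ℝ, z + ((b : ℂ) * (-Complex.I)) * w = v →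
      ‖z‖ ^ 2 ≤ 2 * ‖v‖ ^ 2 + 2 * (b ^ 2 * ‖w‖ ^ 2) := by
    intro z w v b h
    have h1 : z = v - ((b : ℂ) * (-Complex.I)) * w := by rw [← h]; ring
    have h2 : ‖z‖ ≤ ‖v‖ + |b| * ‖w‖ := by
      rw [h1]
      refine (norm_sub_le _ _).trans ?_
      simp
    have h3 := pow_le_pow_left₀ (norm_nonneg _) h2 2
    have h4 : (|b| * ‖w‖) ^ 2 = b ^ 2 * ‖w‖ ^ 2 := by rw [mul_pow, sq_abs]
    nlinarith [sq_nonneg (‖v‖ - |b| * ‖w‖)]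
  have key' : ∀ (v : Plane) (a : ℝ), f x ^ 2 * ‖(-Complex.I) * fderiv ℝ u x v -
      ((B * a : ℝ) : ℂ) * u x‖ ^ 2 ≤ 2 * ‖(-Complex.I) * fderiv ℝ (rmul f u) x v -
      ((B * a : ℝ) : ℂ) * rmul f u x‖ ^ 2 + 2 * ((fderiv ℝ f x v) ^ 2 * ‖u x‖ ^ 2) := by
    intro v a
    have e : f x ^ 2 * ‖(-Complex.I) * fderiv ℝ u x v - ((B * a : ℝ) : ℂ) * u x‖ ^ 2 =
        ‖(f x : ℂ) * ((-Complex.I) * fderiv ℝ u x v - ((B * a : ℝ) : ℂ) * u x)‖ ^ 2 := by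
      rw [norm_mul, mul_pow, Complex.norm_real, Real.norm_eq_abs, sq_abs]
    rw [e]
    refine key _ _ _ _ ?_
    rw [fderiv_rmul hf hu]
    simp only [rmul]
    ring
  have h1 := key' (1, 0) (A x).1
  have h2 := key' (0, 1) (A x).2
  unfold magSq gradSq
  linarith

/-- The abstract weighted estimate behind exponential localization. -/
lemma agmon_step {Ω : Set Plane} (hΩ : IsOpen Ω) (hb : Bornology.IsBounded Ω)
    {B lam β κ ε : ℝ} {A : Plane → Plane} (hA : Continuous A) {f : Plane → ℝ} (hf : ContDiff ℝ 1 f)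
    {u : Plane → ℂ} (hu : ContDiff ℝ 1 u) (hm : mass Ω u = 1) (hlam : 0 ≤ lam) (hβ : 0 < β)
    (hκ0 : 0 ≤ κ) (hκ : κ ≤ β / 4) (hε : ε ≤ β / 4)
    (hgrad : ∀ x ∈ Ω, gradSq f x ≤ κ * (1 + f x ^ 2))
    (hnear : energy Ω B A (rmul f u) - lam * mass Ω (rmul f u) ≤
      (∫ x in Ω, gradSq f x * ‖u x‖ ^ 2) + ε)
    (hlow : (lam + β) * mass Ω (rmul f u) ≤ energy Ω B A (rmul f u)) :
    mass Ω (rmul f u) ≤ 1 ∧ ∫ x in Ω, f x ^ 2 * magSq B A u x ≤ 2 * lam + 4 * β := by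
  have hfc := hf.continuous
  have huc := hu.continuous
  have hgc := continuous_gradSq hf
  have hmc := continuous_magSq (B := B) hA hu
  have hmc2 := continuous_magSq (B := B) hA (contDiff_rmul hf hu)
  have hmass := mass_rmul Ω f u
  have i1 : IntegrableOn (fun x => ‖u x‖ ^ 2) Ω := integrableOn_of_bdd hb (by fun_prop)
  have i2 : IntegrableOn (fun x => f x ^ 2 * ‖u x‖ ^ 2) Ω := integrableOn_of_bdd hb (by fun_prop)
  have i3 : IntegrableOn (fun x => gradSq f x * ‖u x‖ ^ 2) Ω := integrableOn_of_bdd hb (by fun_prop)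
  have i4 : IntegrableOn (fun x => f x ^ 2 * magSq B A u x) Ω := integrableOn_of_bdd hb (by fun_prop)
  have i5 : IntegrableOn (magSq B A (rmul f u)) Ω := integrableOn_of_bdd hb hmc2
  have h1 : (∫ x in Ω, gradSq f x * ‖u x‖ ^ 2) ≤ κ * (1 + mass Ω (rmul f u)) := by
    have e : κ * (1 + mass Ω (rmul f u)) = ∫ x in Ω, κ * (‖u x‖ ^ 2 + f x ^ 2 * ‖u x‖ ^ 2) := by
      rw [integral_const_mul, integral_add i1 i2, ← hmass, ← hm]; rfl
    rw [e]
    refine setIntegral_mono_on i3 ((i1.add i2).const_mul κ) hΩ.measurableSet fun x hx => ?_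
    have := mul_le_mul_of_nonneg_right (hgrad x hx) (sq_nonneg ‖u x‖)
    calc _ ≤ _ := this
      _ = _ := by ring
  set m := mass Ω (rmul f u)
  have hm0 : 0 ≤ m := mass_nonneg _ _
  have hm1 : m ≤ 1 := by nlinarith
  refine ⟨hm1, ?_⟩
  have h2 : (∫ x in Ω, f x ^ 2 * magSq B A u x) ≤
      ∫ x in Ω, (2 * magSq B A (rmul f u) x + 2 * (gradSq f x * ‖u x‖ ^ 2)) := by
    refine setIntegral_mono_on i4 ((i5.const_mul 2).add (i3.const_mul 2)) hΩ.measurableSet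
      fun x hx => ?_
    have := sq_mul_magSq_le (B := B) (A := A) ((hf.differentiable one_ne_zero) x)
      ((hu.differentiable one_ne_zero) x)
    linarith
  rw [integral_add (i5.const_mul 2) (i3.const_mul 2), integral_const_mul, integral_const_mul] at h2
  have h3 : (∫ x in Ω, magSq B A (rmul f u) x) = energy Ω B A (rmul f u) := rfl
  rw [h3] at h2
  have h4 : lam * m ≤ lam := by nlinarith
  have h5 : κ * (1 + m) ≤ β / 2 := by nlinarith
  linarith

end SC

namespace SC

section Weights

variable {Ω : Set Plane} {P : BoundaryParam Ω} {K t₁ : ℝ}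

/-- A global `C¹` function equal to the normal coordinate near the boundary. -/
structure IsRho (P : BoundaryParam Ω) (t₁ : ℝ) (ρ : Plane → ℝ) : Prop where
  smooth : ContDiff ℝ 1 ρ
  eq : ∀ p : ℝ × ℝ, |p.2| ≤ 2 * t₁ / 3 → ρ (tube P.γ p) = p.2
  ge : ∀ p : ℝ × ℝ, |p.2| < t₁ → p.2 ≤ ρ (tube P.γ p)
  off : ∀ x, x ∉ tube P.γ '' (univ ×ˢ Ioo (-t₁) t₁) → ρ x = t₁

lemma mem_strip_iff {t : ℝ} {p : ℝ × ℝ} : p ∈ (univ : Set ℝ) ×ˢ Ioo (-t) t ↔ |p.2| < t := by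
  simp [abs_lt]

lemma IsTube.strip_descent (hT : IsTube P K t₁) {c : ℝ → ℝ} (hc : ContDiff ℝ 1 c) {r : ℝ}
    (hr : r < t₁) (h0 : ∀ t, r ≤ |t| → c t = 0) :
    ∃ G : Plane → ℝ, ContDiff ℝ 1 G ∧ (∀ p : ℝ × ℝ, |p.2| < t₁ → G (tube P.γ p) = c p.2) ∧
      ∀ x, x ∉ tube P.γ '' (univ ×ˢ Icc (-r) r) → G x = 0 := by
  obtain ⟨G, h1, h2, h3⟩ := exists_descent hT (O := univ ×ˢ Ioo (-t₁) t₁)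
    (K' := univ ×ˢ Icc (-r) r) (F := fun p => c p.2) (isOpen_univ.prod isOpen_Ioo)
    (fun p hp => mem_strip_iff.1 hp) (hc.comp contDiff_snd)
    (fun p hp q hq h => by
      rw [(hT.inj p q (mem_strip_iff.1 hp) (mem_strip_iff.1 hq) h).1])
    (fun p hp => ⟨trivial, by linarith [hp.2.1], by linarith [hp.2.2]⟩)
    (isClosed_image_strip P r)
    (fun p _ hp => h0 _ (by
      by_contra h
      push Not at h
      have := abs_lt.1 h
      exact hp ⟨trivial, by linarith, by linarith⟩))
  exact ⟨G, h1, fun p hp => h2 p (mem_strip_iff.2 hp), h3⟩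

lemma exists_rho (hT : IsTube P K t₁) : ∃ ρ, IsRho P t₁ ρ := by
  have ht := hT.pos
  obtain ⟨χ, hχ, h1, h0, hb⟩ := exists_bump 0 (a := 2 * t₁ / 3) (b := 5 * t₁ / 6)
    (by linarith) (by linarith)
  simp only [sub_zero] at h1 h0
  obtain ⟨G, hG, hG1, hG2⟩ := hT.strip_descent (c := fun t => χ t * (t - t₁)) (r := 5 * t₁ / 6)
    (hχ.mul (contDiff_id.sub contDiff_const)) (by linarith) (fun t h => by simp [h0 t h])
  refine ⟨fun x => t₁ + G x, contDiff_const.add hG, fun p hp => ?_, fun p hp => ?_, fun x hx => ?_⟩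
  · rw [hG1 p (by linarith), h1 _ hp]; ring
  · rw [hG1 p hp]
    have := abs_lt.1 hp
    nlinarith [hb p.2]
  · rw [hG2 x, add_zero]
    rintro ⟨p, hp, rfl⟩
    refine hx ⟨p, ⟨trivial, ?_, ?_⟩, rfl⟩
    · linarith [hp.2.1]
    · linarith [hp.2.2]

lemma IsTube.cases_mem (hT : IsTube P K t₁) {x : Plane} (hx : x ∈ Ω) :
    (∃ p : ℝ × ℝ, 0 < p.2 ∧ p.2 < t₁ ∧ tube P.γ p = x) ∨
      x ∉ tube P.γ '' (univ ×ˢ Ioo (-t₁) t₁) := by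
  by_cases h : x ∈ tube P.γ '' (univ ×ˢ Ioo (-t₁) t₁)
  · obtain ⟨p, hp, rfl⟩ := h
    left
    refine ⟨p, ?_, hp.2.2, rfl⟩
    by_contra h0
    exact hT.notMem p hp.2.1 (not_lt.1 h0) hx
  · exact Or.inr h

lemma IsRho.nonneg (hT : IsTube P K t₁) {ρ : Plane → ℝ} (hρ : IsRho P t₁ ρ) {x : Plane}
    (hx : x ∈ Ω) : 0 ≤ ρ x := by
  rcases hT.cases_mem hx with ⟨p, h1, h2, rfl⟩ | h
  · exact h1.le.trans (hρ.ge p (by rw [abs_of_pos h1]; exact h2))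
  · rw [hρ.off x h]; exact hT.pos.le

lemma IsRho.frontier (hT : IsTube P K t₁) {ρ : Plane → ℝ} (hρ : IsRho P t₁ ρ) {x : Plane}
    (hx : x ∈ frontier Ω) : ρ x = 0 := by
  rw [← P.range_eq] at hx
  obtain ⟨s, rfl⟩ := hx
  have h := hρ.eq (s, 0) (by simp; linarith [hT.pos])
  simpa [tube] using h

lemma exp_le_sinh {a τ q : ℝ} (ha : 0 ≤ a) (hq : τ - 2 ≤ q) :
    Real.exp (2 * a * τ) ≤ 4 * Real.exp (4 * a) * (1 + Real.sinh (a * q) ^ 2) := by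
  have h1 : Real.exp (2 * a * τ) ≤ Real.exp (4 * a) * Real.exp (2 * (a * q)) := by
    rw [← Real.exp_add]
    apply Real.exp_le_exp.2
    nlinarith
  have h2 : Real.exp (2 * (a * q)) ≤ 4 * (1 + Real.sinh (a * q) ^ 2) := by
    have e : Real.exp (2 * (a * q)) = Real.exp (a * q) ^ 2 := by
      rw [← Real.exp_nat_mul]; norm_num
    have e2 : Real.exp (a * q) * Real.exp (-(a * q)) = 1 := by rw [← Real.exp_add]; simp
    rw [e, Real.sinh_eq]
    nlinarith [sq_nonneg (Real.exp (-(a * q)))]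
  calc _ ≤ _ := h1
    _ ≤ Real.exp (4 * a) * (4 * (1 + Real.sinh (a * q) ^ 2)) :=
      mul_le_mul_of_nonneg_left h2 (Real.exp_pos _).le
    _ = _ := by ring

lemma gradSq_sinh_le {g : ℝ → ℝ} {G : Plane → ℝ} {a κ C : ℝ} (hg : ContDiff ℝ 1 g)
    (hG : ContDiff ℝ 1 G) {x : Plane} (hg1 : |deriv g (G x)| ≤ κ) (hC : gradSq G x ≤ C) :
    gradSq (fun y => Real.sinh (a * g (G y))) x ≤
      a ^ 2 * κ ^ 2 * C * (1 + Real.sinh (a * g (G x)) ^ 2) := by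
  have hh : ContDiff ℝ 1 fun τ => Real.sinh (a * g τ) :=
    Real.contDiff_sinh.comp (contDiff_const.mul hg)
  have hd : HasDerivAt (fun τ => Real.sinh (a * g τ)) (Real.cosh (a * g (G x)) * (a * deriv g (G x)))
      (G x) :=
    (((hg.differentiable one_ne_zero) (G x)).hasDerivAt.const_mul a).sinh
  rw [gradSq_comp hh hG, hd.deriv, ← Real.cosh_sq']
  have h1 : deriv g (G x) ^ 2 ≤ κ ^ 2 := by
    rw [← sq_abs]
    exact pow_le_pow_left₀ (abs_nonneg _) hg1 2
  have h2 := mul_le_mul h1 hC (gradSq_nonneg _ _) (sq_nonneg κ)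
  have h3 := mul_le_mul_of_nonneg_left h2
    (mul_nonneg (sq_nonneg a) (sq_nonneg (Real.cosh (a * g (G x)))))
  calc _ = a ^ 2 * Real.cosh (a * g (G x)) ^ 2 * (deriv g (G x) ^ 2 * gradSq G x) := by ring
    _ ≤ _ := h3
    _ = _ := by ring

set_option maxHeartbeats 1000000 in
/-- Exponential weights away from the boundary. -/
lemma exists_boundary_weight (hΩ : IsOpen Ω) (hb : Bornology.IsBounded Ω) (hT : IsTube P K t₁)
    {ρ : Plane → ℝ} (hρ : IsRho P t₁ ρ) :
    ∃ a > 0, ∃ C > 0, ∃ f : ℝ → Plane → ℝ, (∀ B, ContDiff ℝ 1 (f B)) ∧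
      ∀ B ≥ 40, ∀ A : Plane → Plane, ContDiff ℝ 1 A → (∀ x ∈ Ω, |curl2 A x - 1| ≤ 1 / 10) →
      ∀ lam, 0 ≤ lam → lam ≤ 4 / 5 * B → ∀ u : Plane → ℂ, ContDiff ℝ 1 u → mass Ω u = 1 →
      energy Ω B A u ≤ lam + 1 →
      energy Ω B A (rmul (f B) u) - lam * mass Ω (rmul (f B) u) ≤
        (∫ x in Ω, gradSq (f B) x * ‖u x‖ ^ 2) + 1 →
      ∫ x in Ω, Real.exp (a * (√B * ρ x)) * (magSq B A u x / B + ‖u x‖ ^ 2) ≤ C := by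
  obtain ⟨p, hp, hp0, hp1, hp2⟩ := exists_ramp
  obtain ⟨Cρ, hCρ, hgρ⟩ := exists_bound hb (continuous_gradSq hρ.smooth)
  set a := 1 / (40 * (Cρ + 1)) with ha
  have hapos : 0 < a := by positivity
  have haC : a ^ 2 * Cρ ≤ 1 / 40 := by
    have h1 : a ≤ 1 := by rw [ha, div_le_one (by positivity)]; linarith
    have h2 : a * (Cρ + 1) = 1 / 40 := by rw [ha]; field_simp
    nlinarith
  have hg : ∀ B : ℝ, ContDiff ℝ 1 fun τ => p (√B * τ) := fun B =>
    hp.comp (contDiff_const.mul contDiff_id)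
  have hf : ∀ B : ℝ, ContDiff ℝ 1 fun x => Real.sinh (a * p (√B * ρ x)) := fun B =>
    Real.contDiff_sinh.comp (contDiff_const.mul ((hg B).comp hρ.smooth))
  refine ⟨2 * a, by positivity, 20 * Real.exp (4 * a), by positivity,
    fun B x => Real.sinh (a * p (√B * ρ x)), hf, ?_⟩
  intro B hB A hA hcurl lam hlam0 hlam u hu hm hE hnear
  have hB0 : 0 < B := by linarith
  have hr2 : √B ^ 2 = B := Real.sq_sqrt hB0.le
  set f : Plane → ℝ := fun x => Real.sinh (a * p (√B * ρ x)) with hfdef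
  have hfC : ContDiff ℝ 1 f := hf B
  have hgrad : ∀ x ∈ Ω, gradSq f x ≤ B / 40 * (1 + f x ^ 2) := by
    intro x hx
    have hd : HasDerivAt (fun τ => p (√B * τ)) (deriv p (√B * ρ x) * (√B * 1)) (ρ x) :=
      ((hp.differentiable one_ne_zero) (√B * ρ x)).hasDerivAt.comp (ρ x)
        ((hasDerivAt_id (ρ x)).const_mul √B)
    have h := gradSq_sinh_le (a := a) (hg B) hρ.smooth (κ := √B) (x := x) (by
      rw [hd.deriv, mul_one, abs_mul, abs_of_nonneg (hp1 _).1, abs_of_nonneg (Real.sqrt_nonneg B)]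
      exact mul_le_of_le_one_left (Real.sqrt_nonneg B) (hp1 _).2) (hgρ x hx)
    refine h.trans (mul_le_mul_of_nonneg_right ?_ (by positivity))
    rw [hr2]
    nlinarith
  have hN : IsOpen {x | √B * ρ x < 1} :=
    isOpen_lt (continuous_const.mul hρ.smooth.continuous) continuous_const
  have hlow := energy_ge_of_vanish hΩ hb (B := B) hA (contDiff_rmul hfC hu) hN
    (fun x hx => by simp [hρ.frontier hT hx]) (fun x hx _ => by
      have : √B * ρ x < 1 := hx
      simp [rmul, hfdef, hp0 _ this.le])
  have hcont : Continuous fun x => ‖rmul f u x‖ ^ 2 :=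
    (contDiff_rmul hfC hu).continuous.norm.pow 2
  have hlow2 : (9 / 10) * mass Ω (rmul f u) ≤ ∫ x in Ω, curl2 A x * ‖rmul f u x‖ ^ 2 := by
    unfold mass
    rw [← integral_const_mul]
    refine setIntegral_mono_on ((integrableOn_of_bdd hb hcont).const_mul _) ?_ hΩ.measurableSet
      fun x hx => ?_
    · refine integrableOn_of_bdd hb (Continuous.mul ?_ hcont)
      have h1 := (hA.snd).continuous_fderiv one_ne_zero
      have h2 := (hA.fst).continuous_fderiv one_ne_zero
      unfold curl2
      exact (h1.clm_apply continuous_const).sub (h2.clm_apply continuous_const)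
    · have := (abs_le.1 (hcurl x hx)).1
      exact mul_le_mul_of_nonneg_right (by linarith) (sq_nonneg _)
  have hm0 : 0 ≤ mass Ω (rmul f u) := mass_nonneg _ _
  obtain ⟨hm1, hE1⟩ := agmon_step hΩ hb (β := B / 10) (κ := B / 40) (ε := 1) hA.continuous hfC hu hm
    hlam0 (by linarith) (by linarith) (by linarith) (by linarith) hgrad hnear (by
      have h1 : lam + B / 10 ≤ B * (9 / 10) := by linarith
      calc _ ≤ B * (9 / 10) * mass Ω (rmul f u) := mul_le_mul_of_nonneg_right h1 hm0
        _ = B * (9 / 10 * mass Ω (rmul f u)) := by ring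
        _ ≤ _ := mul_le_mul_of_nonneg_left hlow2 hB0.le
        _ ≤ _ := hlow)
  have hfc := hfC.continuous
  have huc := hu.continuous
  have hρc := hρ.smooth.continuous
  have hmc := continuous_magSq (B := B) hA.continuous hu
  have i1 : IntegrableOn (fun x => ‖u x‖ ^ 2) Ω := integrableOn_of_bdd hb (by fun_prop)
  have i2 : IntegrableOn (fun x => f x ^ 2 * ‖u x‖ ^ 2) Ω := integrableOn_of_bdd hb (by fun_prop)
  have i3 : IntegrableOn (magSq B A u) Ω := integrableOn_of_bdd hb hmc
  have i4 : IntegrableOn (fun x => f x ^ 2 * magSq B A u x) Ω := integrableOn_of_bdd hb (by fun_prop)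
  have i5 : IntegrableOn (fun x => Real.exp (2 * a * (√B * ρ x)) * (magSq B A u x / B + ‖u x‖ ^ 2))
      Ω := integrableOn_of_bdd hb (by fun_prop)
  have j1 : IntegrableOn (fun x => B⁻¹ * magSq B A u x) Ω := i3.const_mul _
  have j2 : IntegrableOn (fun x => B⁻¹ * (f x ^ 2 * magSq B A u x)) Ω := i4.const_mul _
  have j3 : IntegrableOn (fun x => B⁻¹ * magSq B A u x + B⁻¹ * (f x ^ 2 * magSq B A u x)) Ω :=
    j1.add j2
  have j4 : IntegrableOn (fun x => ‖u x‖ ^ 2 + f x ^ 2 * ‖u x‖ ^ 2) Ω := i1.add i2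
  have hb1 : (∫ x in Ω, Real.exp (2 * a * (√B * ρ x)) * (magSq B A u x / B + ‖u x‖ ^ 2)) ≤
      ∫ x in Ω, 4 * Real.exp (4 * a) * ((B⁻¹ * magSq B A u x + B⁻¹ * (f x ^ 2 * magSq B A u x)) +
        (‖u x‖ ^ 2 + f x ^ 2 * ‖u x‖ ^ 2)) := by
    refine setIntegral_mono_on i5 ((j3.add j4).const_mul _) hΩ.measurableSet fun x _ => ?_
    have h1 := exp_le_sinh (τ := √B * ρ x) hapos.le (hp2 (√B * ρ x))
    have h2 : 0 ≤ magSq B A u x / B + ‖u x‖ ^ 2 :=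
      add_nonneg (div_nonneg (magSq_nonneg _ _ _ _) hB0.le) (sq_nonneg _)
    have h3 := mul_le_mul_of_nonneg_right h1 h2
    calc _ ≤ _ := h3
      _ = _ := by rw [div_eq_inv_mul]; ring
  rw [integral_const_mul, integral_add j3 j4, integral_add j1 j2, integral_add i1 i2, integral_const_mul,
    integral_const_mul] at hb1
  have e1 : (∫ x in Ω, magSq B A u x) = energy Ω B A u := rfl
  have e2 : (∫ x in Ω, ‖u x‖ ^ 2) = 1 := hm
  rw [e1, e2, ← mass_rmul] at hb1
  refine hb1.trans ?_
  have j1 : B⁻¹ * energy Ω B A u ≤ 1 := by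
    rw [inv_mul_le_one₀ hB0]; linarith
  have j2 : B⁻¹ * (∫ x in Ω, f x ^ 2 * magSq B A u x) ≤ 2 := by
    rw [inv_mul_le_iff₀ hB0]; linarith
  have j3 : 0 < Real.exp (4 * a) := Real.exp_pos _
  nlinarith

end Weights

end SC

namespace SC

section Transfer

variable {Ω : Set Plane} {P : BoundaryParam Ω} {K t₁ : ℝ}

lemma magSq_eq_zero {B : ℝ} {A : Plane → Plane} {u : Plane → ℂ} {x : Plane}
    (h : ∀ᶠ y in 𝓝 x, u y = 0) : magSq B A u x = 0 := by
  have h' : u =ᶠ[𝓝 x] fun _ => 0 := h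
  unfold magSq
  rw [h'.fderiv_eq, h'.eq_of_nhds]
  simp

lemma sden_eq_zero {B k a : ℝ} {w : ℝ × ℝ → ℂ} {p : ℝ × ℝ} (h : ∀ᶠ y in 𝓝 p, w y = 0) :
    sden B k a w p = 0 := by
  have h' : w =ᶠ[𝓝 p] fun _ => 0 := h
  unfold sden
  rw [h'.fderiv_eq, h'.eq_of_nhds]
  simp

/-- Vanishing of the magnetic gradient off a relatively closed support. -/
lemma magSq_eq_zero_off {B : ℝ} {A : Plane → Plane} {u : Plane → ℂ} {Z : Set Plane}
    (hΩ : IsOpen Ω) (hZ : IsClosed Z) (hu : ∀ x ∈ Ω, x ∉ Z → u x = 0) {x : Plane} (hx : x ∈ Ω)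
    (hxZ : x ∉ Z) : magSq B A u x = 0 := by
  apply magSq_eq_zero
  filter_upwards [hΩ.mem_nhds hx, hZ.isOpen_compl.mem_nhds hxZ] with y h1 h2 using hu y h1 h2

lemma IsTube.mono (hT : IsTube P K t₁) {t : ℝ} (ht : 0 < t) (h : t ≤ t₁) : IsTube P K t where
  pos := ht
  K_pos := hT.K_pos
  curv := hT.curv
  small := (mul_le_mul_of_nonneg_right h hT.K_pos.le).trans hT.small
  inj p q h1 h2 h3 := hT.inj p q (h1.trans_le h) (h2.trans_le h) h3
  mem p h1 h2 := hT.mem p h1 (h2.trans_le h)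
  notMem p h1 h2 := hT.notMem p (by linarith) h2

/-- The weighted energy in boundary coordinates. -/
lemma weighted_energy_eq (hT : IsTube P K t₁) (hΩ : IsOpen Ω) (a : ℝ) {A : Plane → Plane}
    {φ : ℝ × ℝ → ℝ} (hφ : IsGauge P A φ) (B : ℝ) {u : Plane → ℂ} (hu : ContDiff ℝ 1 u)
    (W : Plane → ℝ)
    (h0 : ∀ x ∈ Ω, x ∉ tube P.γ '' (Ioo a (a + P.L) ×ˢ Ioo 0 t₁) → magSq B A u x = 0) :
    ∫ x in Ω, W x * magSq B A u x = ∫ p in Ioo a (a + P.L) ×ˢ Ioo 0 t₁,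
      W (tube P.γ p) * sden B (curvOf P.γ p.1) (fluxPot P A p) (toStrip P B φ u) p := by
  rw [hT.integral_eq hΩ a (fun x hx hx' => by rw [h0 x hx hx', mul_zero])]
  refine setIntegral_congr_fun (measurableSet_Ioo.prod measurableSet_Ioo) fun p hp => ?_
  have hj := hT.jac (p := p) (by rw [abs_of_pos hp.2.1]; exact hp.2.2)
  have := magSq_toStrip hφ B hu (p := p) (by linarith)
  rw [← this]
  ring

/-- The weighted mass in boundary coordinates. -/
lemma weighted_mass_eq (hT : IsTube P K t₁) (hΩ : IsOpen Ω) (a : ℝ) 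
    (φ : ℝ × ℝ → ℝ) (B : ℝ) {u : Plane → ℂ} (W : Plane → ℝ)
    (h0 : ∀ x ∈ Ω, x ∉ tube P.γ '' (Ioo a (a + P.L) ×ˢ Ioo 0 t₁) → u x = 0) :
    ∫ x in Ω, W x * ‖u x‖ ^ 2 = ∫ p in Ioo a (a + P.L) ×ˢ Ioo 0 t₁,
      W (tube P.γ p) * ((1 - p.2 * curvOf P.γ p.1) * ‖toStrip P B φ u p‖ ^ 2) := by
  rw [hT.integral_eq hΩ a (fun x hx hx' => by rw [h0 x hx hx']; simp)]
  refine setIntegral_congr_fun (measurableSet_Ioo.prod measurableSet_Ioo) fun p hp => ?_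
  simp only [norm_toStrip]
  ring

/-- Any compactly supported strip function comes from a function on the plane. -/
lemma exists_of_strip (hT : IsTube P K t₁) (hΩ : IsOpen Ω) {a b c r : ℝ} (hab : a < b)
    (hc : c < a + P.L) (hr : r < t₁) {A : Plane → Plane} {φ : ℝ × ℝ → ℝ}
    (hφ : IsGauge P A φ) (B : ℝ) {w : ℝ × ℝ → ℂ} (hw : ContDiff ℝ 1 w)
    (h0 : ∀ p ∈ Ioo a (a + P.L) ×ˢ Ioo (-t₁) t₁, p ∉ Icc b c ×ˢ Icc (-r) r → w p = 0) :
    ∃ v : Plane → ℂ, ContDiff ℝ 1 v ∧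
      (energy Ω B A v = ∫ p in Ioo a (a + P.L) ×ˢ Ioo 0 t₁,
        sden B (curvOf P.γ p.1) (fluxPot P A p) w p) ∧
      (mass Ω v = ∫ p in Ioo a (a + P.L) ×ˢ Ioo 0 t₁,
        (1 - p.2 * curvOf P.γ p.1) * ‖w p‖ ^ 2) := by
  set O : Set (ℝ × ℝ) := Ioo a (a + P.L) ×ˢ Ioo (-t₁) t₁ with hO
  have hOo : IsOpen O := isOpen_Ioo.prod isOpen_Ioo
  have hsub : Icc b c ×ˢ Icc (-r) r ⊆ O := fun p hp =>
    ⟨⟨by linarith [hp.1.1], by linarith [hp.1.2]⟩, by linarith [hp.2.1], by linarith [hp.2.2]⟩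
  obtain ⟨v, hv, hv1, hv2⟩ := exists_descent hT hOo (fun p hp => abs_lt.2 hp.2)
    (F := fun p => Complex.exp (((B * φ p : ℝ) : ℂ) * Complex.I) * w p)
    ((contDiff_phase hφ.1 B).mul hw)
    (fun p hp q hq h => by rw [hT.injOn_rect a hp hq h]) hsub
    (isClosed_image_rect P b c (-r) r) (fun p hp hp' => by simp [h0 p hp hp'])
  have hstrip : ∀ p ∈ O, toStrip P B φ v p = w p := by
    intro p hp
    rw [toStrip_eq, hv1 p hp, ← mul_assoc, ← Complex.exp_add]
    have : ((((-B) * φ p : ℝ) : ℂ) * Complex.I) + ((B * φ p : ℝ) : ℂ) * Complex.I = 0 := by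
      push_cast; ring
    rw [this]; simp
  have hRO : ∀ p ∈ Ioo a (a + P.L) ×ˢ Ioo 0 t₁, p ∈ O := fun p hp =>
    ⟨hp.1, by linarith [hp.2.1, hT.pos], hp.2.2⟩
  have hoff : ∀ x ∈ Ω, x ∉ tube P.γ '' (Ioo a (a + P.L) ×ˢ Ioo 0 t₁) →
      x ∉ tube P.γ '' (Icc b c ×ˢ Icc (-r) r) := by
    rintro x hx hx' ⟨p, hp, rfl⟩
    refine hx' ⟨p, ⟨(hsub hp).1, ?_, (hsub hp).2.2⟩, rfl⟩
    by_contra h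
    exact hT.notMem p (hsub hp).2.1 (not_lt.1 h) hx
  have hms : MeasurableSet (Ioo a (a + P.L) ×ˢ Ioo 0 t₁) := measurableSet_Ioo.prod measurableSet_Ioo
  refine ⟨v, hv, ?_, ?_⟩
  · have h1 := weighted_energy_eq hT hΩ a hφ B hv (fun _ => 1) fun x hx hx' =>
      magSq_eq_zero_off hΩ (isClosed_image_rect P b c (-r) r) (fun y _ hy => hv2 y hy) hx
        (hoff x hx hx')
    simp only [one_mul] at h1
    refine h1.trans (setIntegral_congr_fun hms fun p hp => sden_congr ?_)
    filter_upwards [hOo.mem_nhds (hRO p hp)] with q hq using hstrip q hq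
  · have h1 := weighted_mass_eq hT hΩ a φ B (u := v) (fun _ => 1) fun x hx hx' =>
      hv2 x (hoff x hx hx')
    simp only [one_mul] at h1
    refine h1.trans (setIntegral_congr_fun hms fun p hp => ?_)
    rw [hstrip p (hRO p hp)]

/-- The strip density of a product function. -/
lemma sden_product {B k a θ : ℝ} {χ g : ℝ → ℝ} (hχ : ContDiff ℝ 1 χ) (hg : ContDiff ℝ 1 g)
    (p : ℝ × ℝ) :
    sden B k a (fun q => Complex.exp (((θ * q.1 : ℝ) : ℂ) * Complex.I) * ((χ q.1 * g q.2 : ℝ) : ℂ))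
      p = (1 - p.2 * k) * (χ p.1 ^ 2 * deriv g p.2 ^ 2) + (1 - p.2 * k)⁻¹ *
        (((θ + B * a) ^ 2 * χ p.1 ^ 2 + deriv χ p.1 ^ 2) * g p.2 ^ 2) := by
  have h1 : HasFDerivAt (fun q : ℝ × ℝ => χ q.1 * g q.2)
      (χ p.1 • (deriv g p.2 • ContinuousLinearMap.snd ℝ ℝ ℝ) +
        g p.2 • (deriv χ p.1 • ContinuousLinearMap.fst ℝ ℝ ℝ)) p :=
    HasFDerivAt.mul
      (((hχ.differentiable one_ne_zero) p.1).hasDerivAt.comp_hasFDerivAt p hasFDerivAt_fst)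
      (((hg.differentiable one_ne_zero) p.2).hasDerivAt.comp_hasFDerivAt p hasFDerivAt_snd)
  have h2 : HasFDerivAt (fun q : ℝ × ℝ => ((χ q.1 * g q.2 : ℝ) : ℂ)) (Complex.ofRealCLM.comp
      (χ p.1 • (deriv g p.2 • ContinuousLinearMap.snd ℝ ℝ ℝ) +
        g p.2 • (deriv χ p.1 • ContinuousLinearMap.fst ℝ ℝ ℝ))) p :=
    Complex.ofRealCLM.hasFDerivAt.comp p h1
  have hφ : ContDiff ℝ 1 (fun q : ℝ × ℝ => q.1) := contDiff_fst
  have hG : ContDiff ℝ 1 fun q : ℝ × ℝ => ((χ q.1 * g q.2 : ℝ) : ℂ) :=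
    Complex.ofRealCLM.contDiff.comp ((hχ.comp contDiff_fst).mul (hg.comp contDiff_snd))
  have hf : fderiv ℝ (fun q : ℝ × ℝ => q.1) p = ContinuousLinearMap.fst ℝ ℝ ℝ :=
    hasFDerivAt_fst.fderiv
  have d1 := fderiv_phase_mul hφ θ hG p (0, 1)
  have d2 := fderiv_phase_mul hφ θ hG p (1, 0)
  unfold sden
  rw [d1, d2, h2.fderiv, hf]
  simp only [ContinuousLinearMap.comp_apply, add_apply, smul_apply, Complex.ofRealCLM_apply,
    ContinuousLinearMap.coe_fst', ContinuousLinearMap.coe_snd', smul_eq_mul, mul_one, mul_zero,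
    add_zero, zero_add, Complex.ofReal_zero, zero_mul]
  have e1 : -Complex.I * (Complex.exp (((θ * p.1 : ℝ) : ℂ) * Complex.I) *
      (((g p.2 * deriv χ p.1 : ℝ) : ℂ) + (θ : ℂ) * Complex.I * ((χ p.1 * g p.2 : ℝ) : ℂ))) +
      ((B * a : ℝ) : ℂ) * (Complex.exp (((θ * p.1 : ℝ) : ℂ) * Complex.I) *
        ((χ p.1 * g p.2 : ℝ) : ℂ)) = Complex.exp (((θ * p.1 : ℝ) : ℂ) * Complex.I) *
      (((θ + B * a) * (χ p.1 * g p.2) : ℝ) + ((-(g p.2 * deriv χ p.1) : ℝ) : ℂ) * Complex.I) := by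
    push_cast
    linear_combination (-Complex.exp ((θ * p.1) * Complex.I) * θ * χ p.1 * g p.2) * Complex.I_sq
  rw [e1, norm_mul, norm_mul, norm_phase, one_mul, one_mul, ← Complex.normSq_eq_norm_sq,
    ← Complex.normSq_eq_norm_sq, Complex.normSq_add_mul_I, Complex.normSq_ofReal]
  ring

end Transfer

end SC

namespace SC

lemma trial_aux {r m τ z F G χ ψ δ M : ℝ} (hr : 1 ≤ r) (hm : 1 / 2 ≤ m) (hm2 : m ≤ 3 / 2)
    (hτ : 0 ≤ τ) (hz : |z| ≤ (M + 2) * (1 + τ)) (hF : 0 ≤ F) (hG : 0 ≤ G) (hχ : 0 ≤ χ)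
    (hψ : 0 ≤ ψ) (hδ : 0 ≤ δ) (hδ1 : δ ≤ 1) (hM : 1 ≤ M) :
    (m * (χ * (r ^ 2 * G)) + m⁻¹ * ((r ^ 2 * z ^ 2 * χ + ψ) * F)) + 4 * r * δ * ((1 + τ) *
      ((m * (χ * (r ^ 2 * G)) + m⁻¹ * ((r ^ 2 * z ^ 2 * χ + ψ) * F)) / r ^ 2) +
      (1 + τ) ^ 4 * (χ * F)) ≤
    χ * (r ^ 2 * (m * G + z ^ 2 / m * F) +
      4 * r * δ * (2 * (M + 2) ^ 2 + 1) * ((1 + τ) ^ 4 * (F + G))) +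
      ψ * (10 * ((1 + τ) ^ 4 * (F + G))) := by
  have hr0 : 0 < r := by linarith
  have hm0 : 0 < m := by linarith
  have hmi : m⁻¹ ≤ 2 := by
    rw [inv_le_comm₀ hm0 (by norm_num)]; linarith
  have hmi0 : 0 < m⁻¹ := inv_pos.2 hm0
  set Φ := (1 + τ) ^ 4 * (F + G) with hΦ
  have h1 : (1:ℝ) ≤ (1 + τ) ^ 3 := one_le_pow₀ (by linarith)
  have hF1 : (1 + τ) * F ≤ Φ := by
    have : (1 + τ) * F ≤ (1 + τ) * ((1 + τ) ^ 3 * (F + G)) := by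
      apply mul_le_mul_of_nonneg_left _ (by linarith)
      nlinarith
    rw [hΦ]; linarith
  have hG1 : (1 + τ) * G + (1 + τ) ^ 3 * F ≤ Φ := by
    have e : Φ = (1 + τ) * ((1 + τ) ^ 3 * (F + G)) := by rw [hΦ]; ring
    have : G ≤ (1 + τ) ^ 3 * G := le_mul_of_one_le_left hG h1
    have h2 : (1 + τ) * G ≤ (1 + τ) * ((1 + τ) ^ 3 * G) :=
      mul_le_mul_of_nonneg_left this (by linarith)
    have h3 : 0 ≤ τ * ((1 + τ) ^ 3 * F) := by positivity
    rw [e]; linarith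
  have hz2 : z ^ 2 ≤ (M + 2) ^ 2 * (1 + τ) ^ 2 := by
    rw [← mul_pow, ← sq_abs]; exact pow_le_pow_left₀ (abs_nonneg z) hz 2
  set Q := m * G + z ^ 2 / m * F with hQ
  have hQ1 : (1 + τ) * Q ≤ 2 * (M + 2) ^ 2 * Φ := by
    have a1 : m * G ≤ 2 * (M + 2) ^ 2 * G := mul_le_mul_of_nonneg_right (by nlinarith) hG
    have a2 : z ^ 2 / m * F ≤ 2 * (M + 2) ^ 2 * ((1 + τ) ^ 2 * F) := by
      have : z ^ 2 / m ≤ (M + 2) ^ 2 * (1 + τ) ^ 2 * 2 := by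
        rw [div_eq_mul_inv]; exact mul_le_mul hz2 hmi hmi0.le (by positivity)
      calc _ ≤ (M + 2) ^ 2 * (1 + τ) ^ 2 * 2 * F := mul_le_mul_of_nonneg_right this hF
        _ = _ := by ring
    calc (1 + τ) * Q ≤ (1 + τ) * (2 * (M + 2) ^ 2 * G + 2 * (M + 2) ^ 2 * ((1 + τ) ^ 2 * F)) :=
          mul_le_mul_of_nonneg_left (by rw [hQ]; linarith) (by linarith)
      _ = 2 * (M + 2) ^ 2 * ((1 + τ) * G + (1 + τ) ^ 3 * F) := by ring
      _ ≤ _ := mul_le_mul_of_nonneg_left hG1 (by positivity)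
  have hΦ0 : 0 ≤ Φ := by positivity
  have hΦF : F ≤ Φ := by nlinarith
  have h4F : (1 + τ) ^ 4 * F ≤ Φ := mul_le_mul_of_nonneg_left (by linarith) (by positivity)
  have eS : m * (χ * (r ^ 2 * G)) + m⁻¹ * ((r ^ 2 * z ^ 2 * χ + ψ) * F) =
      r ^ 2 * (χ * Q) + ψ * (m⁻¹ * F) := by
    rw [hQ]; field_simp; ring
  have eS2 : (m * (χ * (r ^ 2 * G)) + m⁻¹ * ((r ^ 2 * z ^ 2 * χ + ψ) * F)) / r ^ 2 =
      χ * Q + ψ * (m⁻¹ * F) / r ^ 2 := by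
    rw [eS]; field_simp
  rw [eS2, eS]
  have b1 : ψ * (m⁻¹ * F) ≤ ψ * (2 * Φ) :=
    mul_le_mul_of_nonneg_left (mul_le_mul hmi hΦF hF (by norm_num)) hψ
  have b2 : 4 * r * δ * ((1 + τ) * (χ * Q)) ≤ 4 * r * δ * (χ * (2 * (M + 2) ^ 2 * Φ)) := by
    apply mul_le_mul_of_nonneg_left _ (by positivity)
    calc (1 + τ) * (χ * Q) = χ * ((1 + τ) * Q) := by ring
      _ ≤ _ := mul_le_mul_of_nonneg_left hQ1 hχ
  have b3 : 4 * r * δ * ((1 + τ) ^ 4 * (χ * F)) ≤ 4 * r * δ * (χ * Φ) := by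
    apply mul_le_mul_of_nonneg_left _ (by positivity)
    calc (1 + τ) ^ 4 * (χ * F) = χ * ((1 + τ) ^ 4 * F) := by ring
      _ ≤ _ := mul_le_mul_of_nonneg_left h4F hχ
  have b4 : 4 * r * δ * ((1 + τ) * (ψ * (m⁻¹ * F) / r ^ 2)) ≤ ψ * (8 * Φ) := by
    have c1 : δ / r ≤ 1 := by rw [div_le_one hr0]; linarith
    have c2 : m⁻¹ * ((1 + τ) * F) ≤ 2 * Φ := mul_le_mul hmi hF1 (by positivity) (by norm_num)
    calc _ = ψ * (4 * (δ / r * (m⁻¹ * ((1 + τ) * F)))) := by field_simp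
      _ ≤ ψ * (4 * (1 * (2 * Φ))) := by
        apply mul_le_mul_of_nonneg_left _ hψ
        apply mul_le_mul_of_nonneg_left _ (by norm_num)
        exact mul_le_mul c1 c2 (by positivity) (by norm_num)
      _ = _ := by ring
  calc _ = r ^ 2 * (χ * Q) + ψ * (m⁻¹ * F) + (4 * r * δ * ((1 + τ) * (χ * Q)) +
        4 * r * δ * ((1 + τ) * (ψ * (m⁻¹ * F) / r ^ 2)) +
        4 * r * δ * ((1 + τ) ^ 4 * (χ * F))) := by ring
    _ ≤ r ^ 2 * (χ * Q) + ψ * (2 * Φ) + (4 * r * δ * (χ * (2 * (M + 2) ^ 2 * Φ)) +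
        ψ * (8 * Φ) + 4 * r * δ * (χ * Φ)) := by linarith
    _ = _ := by ring

/-- Rescaling an integral over a half-line variable whose integrand has bounded support. -/
lemma integral_rescale {F : ℝ → ℝ} {r t T : ℝ} (hr : 0 < r) (hT : T ≤ r * t)
    (h0T : 0 ≤ T) (hF : ContinuousOn F (Icc 0 (r * t)))
    (h0 : ∀ τ, T < τ → F τ = 0) : ∫ x in (0:ℝ)..t, F (r * x) = r⁻¹ * ∫ τ in (0:ℝ)..T, F τ := by
  rw [intervalIntegral.integral_comp_mul_left (fun x => F x) hr.ne', mul_zero, smul_eq_mul]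
  congr 1
  have hi : ∀ a b, 0 ≤ a → a ≤ b → b ≤ r * t → IntervalIntegrable F volume a b :=
    fun a b h1 h2 h3 => (hF.mono (by
      rw [uIcc_of_le h2]; exact Icc_subset_Icc h1 h3)).intervalIntegrable
  rw [← intervalIntegral.integral_add_adjacent_intervals (hi 0 T le_rfl h0T hT)
    (hi T (r * t) h0T hT le_rfl), add_eq_left, intervalIntegral.integral_of_le hT]
  exact setIntegral_eq_zero_of_forall_eq_zero fun x hx => h0 x hx.1

end SC

namespace SC

section Trial

variable {Ω : Set Plane} {P : BoundaryParam Ω} {K t₁ : ℝ}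

lemma IsGauge.continuous_fluxPot {A : Plane → Plane} {φ : ℝ × ℝ → ℝ} (hA : Continuous A)
    (hφ : IsGauge P A φ) : Continuous (fluxPot P A) := by
  have e : fluxPot P A = fun p => fderiv ℝ φ p (1, 0) -
      (1 - p.2 * curvOf P.γ p.1) * dot2 (A (tube P.γ p)) (deriv P.γ p.1) := by
    funext p
    have := (hφ.2 p).2
    unfold fluxPot
    linarith
  have h1 := continuous_fderiv_dir hφ.1 (1, 0)
  have h2 := (contDiff_curvOf P).continuous
  have h3 : Continuous fun p : ℝ × ℝ => A (tube P.γ p) := hA.comp (contDiff_tube P).continuous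
  have h4 : Continuous (deriv P.γ) := (contDiff_tangent P).continuous
  have h5 : Continuous fun p : ℝ × ℝ => deriv P.γ p.1 := h4.comp continuous_fst
  rw [e]
  exact h1.sub ((continuous_const.sub (continuous_snd.mul (h2.comp continuous_fst))).mul
    ((h3.fst.mul h5.fst).add (h3.snd.mul h5.snd)))

lemma IsTube.mul_curv_le (hT : IsTube P K t₁) {p : ℝ × ℝ} (h0 : 0 ≤ p.2) (h1 : p.2 ≤ t₁)
    (s : ℝ) : |p.2 * curvOf P.γ s| ≤ 1 / 2 := by
  rw [abs_mul, abs_of_nonneg h0]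
  exact (mul_le_mul h1 (hT.curv s) (abs_nonneg _) hT.pos.le).trans hT.small

lemma fluxPot_approx' (hT : IsTube P K t₁) {A : Plane → Plane} (hA : ContDiff ℝ 2 A) {D ε : ℝ}
    (hD : ∀ x ∈ closure Ω, ‖fderiv ℝ (curl2 A) x‖ ≤ D) (h1 : ∀ x ∈ frontier Ω, curl2 A x = 1)
    (hε : 0 ≤ ε) {p : ℝ × ℝ} (hp0 : 0 ≤ p.2) (hp1 : p.2 < t₁) {k : ℝ}
    (hk : |curvOf P.γ p.1 - k| ≤ ε) :
    |(p.2 - k * p.2 ^ 2 / 2) - fluxPot P A p| ≤ (ε + D) * p.2 ^ 2 := by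
  have h := fluxPot_approx hT hA hD h1 hp0 hp1
  have e : (p.2 - k * p.2 ^ 2 / 2) - fluxPot P A p =
      -(fluxPot P A p - (p.2 - curvOf P.γ p.1 * p.2 ^ 2 / 2)) +
        (curvOf P.γ p.1 - k) * (p.2 ^ 2 / 2) := by ring
  rw [e]
  refine (abs_add_le _ _).trans ?_
  rw [abs_neg, abs_mul, abs_of_nonneg (by positivity : (0:ℝ) ≤ p.2 ^ 2 / 2)]
  have h2 : |curvOf P.γ p.1 - k| * (p.2 ^ 2 / 2) ≤ ε * (p.2 ^ 2 / 2) :=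
    mul_le_mul_of_nonneg_right hk (by positivity)
  nlinarith [sq_nonneg p.2, mul_nonneg hε (sq_nonneg p.2)]

/-- Upper bound for the energy density of a product trial function. -/
lemma sden_trial_le (hT : IsTube P K t₁) {A : Plane → Plane} (hA : ContDiff ℝ 2 A) {D ε : ℝ}
    (hD0 : 0 ≤ D) (hD : ∀ x ∈ closure Ω, ‖fderiv ℝ (curl2 A) x‖ ≤ D)
    (h1 : ∀ x ∈ frontier Ω, curl2 A x = 1) (hε : 0 ≤ ε) (hδ : 2 * ε + D ≤ 1) {B : ℝ} (hB : 1 ≤ B)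
    {p : ℝ × ℝ} (hp0 : 0 < p.2) (hp1 : p.2 < t₁) {s1 : ℝ}
    (hk : |curvOf P.γ p.1 - curvOf P.γ s1| ≤ ε) {χ g f : ℝ → ℝ} (hχ : ContDiff ℝ 1 χ)
    (hg : ContDiff ℝ 1 g) {ξ M : ℝ} (hM : 1 ≤ M) (hξ : |ξ| ≤ M) (hgf : g p.2 = f (√B * p.2))
    (hgf' : deriv g p.2 = √B * deriv f (√B * p.2)) :
    sden B (curvOf P.γ p.1) (fluxPot P A p) (fun q =>
      Complex.exp (((ξ * √B * q.1 : ℝ) : ℂ) * Complex.I) * ((χ q.1 * g q.2 : ℝ) : ℂ)) p ≤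
    χ p.1 ^ 2 * (B * ((1 - curvOf P.γ s1 / √B * (√B * p.2)) * deriv f (√B * p.2) ^ 2 +
        (ξ + √B * p.2 - curvOf P.γ s1 / √B * (√B * p.2) ^ 2 / 2) ^ 2 /
          (1 - curvOf P.γ s1 / √B * (√B * p.2)) * f (√B * p.2) ^ 2) +
      4 * √B * (2 * ε + D) * (2 * (M + 2) ^ 2 + 1) * ((1 + √B * p.2) ^ 4 *
        (f (√B * p.2) ^ 2 + deriv f (√B * p.2) ^ 2))) +
    deriv χ p.1 ^ 2 * (10 * ((1 + √B * p.2) ^ 4 *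
        (f (√B * p.2) ^ 2 + deriv f (√B * p.2) ^ 2))) := by
  have hr : 1 ≤ √B := by rw [Real.one_le_sqrt]; exact hB
  have hr2 : √B ^ 2 = B := Real.sq_sqrt (by linarith)
  set r := √B with hrdef
  have hr0 : 0 < r := by linarith
  set k1 := curvOf P.γ s1 with hk1
  have hb := abs_le.1 (hT.mul_curv_le hp0.le hp1.le s1)
  have hb' := abs_le.1 (hT.mul_curv_le hp0.le hp1.le p.1)
  rw [← hk1] at hb
  have em : 1 - k1 / r * (r * p.2) = 1 - p.2 * k1 := by field_simp
  have ez : k1 / r * (r * p.2) ^ 2 / 2 = r * (k1 * p.2 ^ 2 / 2) := by field_simp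
  rw [em, ez]
  set z := ξ + r * p.2 - r * (k1 * p.2 ^ 2 / 2) with hz
  have hzb : |z| ≤ (M + 2) * (1 + r * p.2) := by
    have h2 : |r * p.2 - r * (k1 * p.2 ^ 2 / 2)| ≤ 2 * (r * p.2) := by
      have : r * p.2 - r * (k1 * p.2 ^ 2 / 2) = r * p.2 * (1 - p.2 * k1 / 2) := by ring
      rw [this, abs_mul, abs_of_pos (by positivity), mul_comm]
      apply mul_le_mul_of_nonneg_right _ (by positivity)
      rw [abs_le]; constructor <;> linarith [hb.1, hb.2]
    have h3 : |z| ≤ |ξ| + |r * p.2 - r * (k1 * p.2 ^ 2 / 2)| := by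
      rw [hz, add_sub_assoc]; exact abs_add_le _ _
    have h4 : 0 ≤ r * p.2 := by positivity
    nlinarith
  have hfr := sden_freeze (w := fun q : ℝ × ℝ =>
      Complex.exp (((ξ * r * q.1 : ℝ) : ℂ) * Complex.I) * ((χ q.1 * g q.2 : ℝ) : ℂ)) (p := p)
    (k := k1) (k' := curvOf P.γ p.1) (a := p.2 - k1 * p.2 ^ 2 / 2) (a' := fluxPot P A p)
    (ε := ε) (ε' := ε + D) hB hp0.le (by linarith [hb.2]) (by linarith [hb.1])
    (by linarith [hb'.2]) hε (by linarith) (by linarith) (by rw [abs_sub_comm]; exact hk)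
    (fluxPot_approx' hT hA hD h1 hε hp0.le hp1 hk)
  refine hfr.trans ?_
  rw [← hrdef, sden_product hχ hg, hgf, hgf']
  have hn : ‖Complex.exp (((ξ * r * p.1 : ℝ) : ℂ) * Complex.I) *
      ((χ p.1 * f (r * p.2) : ℝ) : ℂ)‖ ^ 2 = χ p.1 ^ 2 * f (r * p.2) ^ 2 := by
    rw [norm_mul, norm_phase, one_mul, Complex.norm_real, Real.norm_eq_abs, sq_abs, mul_pow]
  rw [hn]
  have eB : ξ * r + B * (p.2 - k1 * p.2 ^ 2 / 2) = r * z := by rw [← hr2, hz]; ring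
  rw [eB, mul_pow r z, mul_pow r (deriv f (r * p.2))]
  have := trial_aux (r := r) (m := 1 - p.2 * k1) (τ := r * p.2) (z := z) (F := f (r * p.2) ^ 2)
    (G := deriv f (r * p.2) ^ 2) (χ := χ p.1 ^ 2) (ψ := deriv χ p.1 ^ 2) (δ := 2 * ε + D) (M := M)
    hr (by linarith [hb.2]) (by linarith [hb.1]) (by positivity) hzb (sq_nonneg _) (sq_nonneg _)
    (sq_nonneg _) (sq_nonneg _) (by linarith) hδ hM
  rw [hr2] at this ⊢
  rw [show ε + (ε + D) = 2 * ε + D by ring]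
  exact this

end Trial

end SC

namespace SC

section Trial

variable {Ω : Set Plane} {P : BoundaryParam Ω} {K t₁ : ℝ}

lemma integrableOn_rect {a b T : ℝ} {F : ℝ × ℝ → ℝ} (hF : ContinuousOn F (Icc a b ×ˢ Icc 0 T)) :
    IntegrableOn F (Ioo a b ×ˢ Ioo 0 T) :=
  (hF.integrableOn_compact (isCompact_Icc.prod isCompact_Icc)).mono_set
    (prod_mono Ioo_subset_Icc_self Ioo_subset_Icc_self)

lemma integral_rect_separable {a b T : ℝ} (hab : a ≤ b) (hT : 0 ≤ T) {α α' β β' : ℝ → ℝ}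
    (hα : Continuous α) (hα' : Continuous α') (hβ : ContinuousOn β (Icc 0 T))
    (hβ' : ContinuousOn β' (Icc 0 T)) :
    ∫ p in Ioo a b ×ˢ Ioo 0 T, (α p.1 * β p.2 + α' p.1 * β' p.2) =
      (∫ s in a..b, α s) * (∫ t in (0:ℝ)..T, β t) +
        (∫ s in a..b, α' s) * (∫ t in (0:ℝ)..T, β' t) := by
  have hm : MapsTo (Prod.snd : ℝ × ℝ → ℝ) (Icc a b ×ˢ Icc 0 T) (Icc 0 T) := fun p hp => hp.2
  have h1 : ContinuousOn (fun p : ℝ × ℝ => α p.1 * β p.2 + α' p.1 * β' p.2)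
      (Icc a b ×ˢ Icc 0 T) :=
    ((hα.comp continuous_fst).continuousOn.mul (hβ.comp continuousOn_snd hm)).add
      ((hα'.comp continuous_fst).continuousOn.mul (hβ'.comp continuousOn_snd hm))
  have hi : ∀ {β : ℝ → ℝ}, ContinuousOn β (Icc 0 T) → IntervalIntegrable β volume 0 T :=
    fun h => ContinuousOn.intervalIntegrable (by rwa [uIcc_of_le hT])
  have hia : ∀ {α : ℝ → ℝ}, Continuous α → IntervalIntegrable α volume a b :=
    fun h => h.intervalIntegrable _ _
  rw [integral_rect_eq hab hT h1]
  have h2 : ∀ t, ∫ s in a..b, (α s * β t + α' s * β' t) =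
      (∫ s in a..b, α s) * β t + (∫ s in a..b, α' s) * β' t := fun t => by
    rw [intervalIntegral.integral_add ((hia hα).mul_const _) ((hia hα').mul_const _),
      intervalIntegral.integral_mul_const, intervalIntegral.integral_mul_const]
  simp only [h2]
  rw [intervalIntegral.integral_add ((hi hβ).const_mul _) ((hi hβ').const_mul _),
    intervalIntegral.integral_const_mul, intervalIntegral.integral_const_mul]

set_option maxHeartbeats 1000000 in
/-- The ground state energy is bounded above through a product trial function. -/
lemma product_trial (hT : IsTube P K t₁) (hΩ : IsOpen Ω) {A : Plane → Plane}
    (hA : ContDiff ℝ 2 A) {D ε : ℝ} (hD0 : 0 ≤ D)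
    (hD : ∀ x ∈ closure Ω, ‖fderiv ℝ (curl2 A) x‖ ≤ D)
    (h1 : ∀ x ∈ frontier Ω, curl2 A x = 1) (hε : 0 ≤ ε) (hδ : 2 * ε + D ≤ 1) {B : ℝ} (hB : 1 ≤ B)
    {s1 η : ℝ} (hη : 0 < η) (hηL : η < P.L / 2)
    (hk : ∀ s, |s - s1| ≤ η → |curvOf P.γ s - curvOf P.γ s1| ≤ ε) {χ : ℝ → ℝ}
    (hχ : ContDiff ℝ 1 χ) (hχ0 : ∀ s, η ≤ |s - s1| → χ s = 0) {ξ M : ℝ} (hM : 1 ≤ M)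
    (hξ : |ξ| ≤ M) {f : ℝ → ℝ} (hf : Adm1 (2 * (t₁ / 3 * √B)) f) :
    lamS Ω univ B A * ((∫ s in (s1 - P.L / 2)..(s1 - P.L / 2 + P.L), χ s ^ 2) *
      (n1 (curvOf P.γ s1 / √B) (2 * (t₁ / 3 * √B)) f - ε / √B *
        ∫ τ in (0:ℝ)..(2 * (t₁ / 3 * √B)), (1 + τ) ^ 4 * (f τ ^ 2 + deriv f τ ^ 2))) ≤
    (∫ s in (s1 - P.L / 2)..(s1 - P.L / 2 + P.L), χ s ^ 2) *
      (B * q1 (curvOf P.γ s1 / √B) ξ (2 * (t₁ / 3 * √B)) f +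
        4 * √B * (2 * ε + D) * (2 * (M + 2) ^ 2 + 1) *
        ∫ τ in (0:ℝ)..(2 * (t₁ / 3 * √B)), (1 + τ) ^ 4 * (f τ ^ 2 + deriv f τ ^ 2)) +
    (∫ s in (s1 - P.L / 2)..(s1 - P.L / 2 + P.L), deriv χ s ^ 2) *
      (10 * ∫ τ in (0:ℝ)..(2 * (t₁ / 3 * √B)), (1 + τ) ^ 4 * (f τ ^ 2 + deriv f τ ^ 2)) := by
  have ht := hT.pos
  have hL := P.L_pos
  have hr : 1 ≤ √B := by rw [Real.one_le_sqrt]; exact hB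
  have hr0 : 0 < √B := by linarith
  set r := √B with hrdef
  set a := s1 - P.L / 2 with ha
  set T := 2 * (t₁ / 3 * r) with hTdef
  set κ := curvOf P.γ s1 / r with hκ
  set Φ : ℝ → ℝ := fun τ => (1 + τ) ^ 4 * (f τ ^ 2 + deriv f τ ^ 2) with hΦ
  set Q : ℝ → ℝ := fun τ => (1 - κ * τ) * deriv f τ ^ 2 +
    (ξ + τ - κ * τ ^ 2 / 2) ^ 2 / (1 - κ * τ) * f τ ^ 2 with hQ
  set N : ℝ → ℝ := fun τ => (1 - κ * τ) * f τ ^ 2 with hN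
  have hfc : Continuous f := hf.1.continuous
  have hdc : Continuous (deriv f) := hf.1.continuous_deriv le_rfl
  have hΦc : Continuous Φ := by fun_prop
  have hNc : Continuous N := by fun_prop
  have hmz : ∀ τ ∈ Icc 0 (r * t₁), 1 - κ * τ ≠ 0 := by
    intro τ hτ
    have h2 := abs_le.1 (hT.mul_curv_le (p := (s1, τ / r)) (by have := hτ.1; positivity)
      (by rw [div_le_iff₀ hr0]; linarith [hτ.2]) s1)
    have e : κ * τ = (s1, τ / r).2 * curvOf P.γ s1 := by rw [hκ]; field_simp
    rw [e]; linarith [h2.2]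
  have hQc : ContinuousOn Q (Icc 0 (r * t₁)) := by
    have c1 : ContinuousOn (fun τ : ℝ => 1 - κ * τ) (Icc 0 (r * t₁)) :=
      Continuous.continuousOn (by fun_prop)
    have c2 : ContinuousOn (fun τ : ℝ => (ξ + τ - κ * τ ^ 2 / 2) ^ 2) (Icc 0 (r * t₁)) :=
      Continuous.continuousOn (by fun_prop)
    exact (c1.mul (hdc.pow 2).continuousOn).add ((c2.div c1 hmz).mul (hfc.pow 2).continuousOn)
  have hTr : T ≤ r * t₁ := by
    rw [hTdef]; have : 0 < r * t₁ := by positivity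
    linarith
  have hT0 : 0 ≤ T := by positivity
  have hf0 : ∀ τ, T < τ → f τ = 0 := fun τ h => hf.2 τ h.le
  have hd0 : ∀ τ, T < τ → deriv f τ = 0 := by
    intro τ h
    have : f =ᶠ[𝓝 τ] fun _ => 0 := by
      filter_upwards [lt_mem_nhds h] with y hy using hf0 y hy
    rw [this.deriv_eq]; simp
  have hQ0 : ∀ τ, T < τ → Q τ = 0 := fun τ h => by simp [hQ, hf0 τ h, hd0 τ h]
  have hΦ0 : ∀ τ, T < τ → Φ τ = 0 := fun τ h => by simp [hΦ, hf0 τ h, hd0 τ h]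
  have hN0 : ∀ τ, T < τ → N τ = 0 := fun τ h => by simp [hN, hf0 τ h]
  -- trial function
  obtain ⟨φ, hφ'⟩ := exists_gauge P (hA.of_le (by norm_num)) a
  have hφ : IsGauge P A φ := hφ'
  obtain ⟨c, hc, hc1, hc0, -⟩ := exists_bump 0 (a := 2 * t₁ / 3) (b := 5 * t₁ / 6) (by positivity)
    (by linarith)
  set g : ℝ → ℝ := fun t => f (r * t) * c t with hg
  have hgC : ContDiff ℝ 1 g := (hf.1.comp (contDiff_const.mul contDiff_id)).mul hc
  have hgf : ∀ t, 0 < t → g t = f (r * t) := by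
    intro t ht0
    rcases le_total t (2 * t₁ / 3) with h | h
    · simp only [hg]; rw [hc1 t (by rw [sub_zero, abs_of_pos ht0]; exact h), mul_one]
    · have : f (r * t) = 0 := hf.2 _ (by
        rw [hTdef]
        have := mul_le_mul_of_nonneg_left h hr0.le
        linarith)
      simp only [hg, this, zero_mul]
  have hgd : ∀ t, 0 < t → deriv g t = r * deriv f (r * t) := by
    intro t ht0
    have : g =ᶠ[𝓝 t] fun t => f (r * t) := by
      filter_upwards [lt_mem_nhds ht0] with y hy using hgf y hy
    rw [this.deriv_eq, deriv_comp_mul_left, smul_eq_mul]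
  set w : ℝ × ℝ → ℂ := fun q =>
    Complex.exp (((ξ * r * q.1 : ℝ) : ℂ) * Complex.I) * ((χ q.1 * g q.2 : ℝ) : ℂ) with hw
  have hwC : ContDiff ℝ 1 w := by
    have e1 : ContDiff ℝ 1 fun q : ℝ × ℝ => (((ξ * r * q.1 : ℝ) : ℂ) * Complex.I) :=
      (Complex.ofRealCLM.contDiff.comp (contDiff_const.mul contDiff_fst)).mul contDiff_const
    have e2 : ContDiff ℝ 1 fun q : ℝ × ℝ => ((χ q.1 * g q.2 : ℝ) : ℂ) :=
      Complex.ofRealCLM.contDiff.comp ((hχ.comp contDiff_fst).mul (hgC.comp contDiff_snd))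
    exact e1.cexp.mul e2
  obtain ⟨v, hv, hvE, hvm⟩ := exists_of_strip (a := a) (b := s1 - η) (c := s1 + η)
    (r := 5 * t₁ / 6) hT hΩ (by rw [ha]; linarith) (by rw [ha]; linarith) (by linarith) hφ B hwC
    (fun p _ hp => by
      by_cases h2 : η ≤ |p.1 - s1|
      · simp only [hw]; rw [hχ0 _ h2]; simp
      · have h3 : 5 * t₁ / 6 ≤ |p.2 - 0| := by
          by_contra h3
          push Not at h2 h3
          rw [sub_zero] at h3
          rw [abs_lt] at h2 h3
          exact hp ⟨⟨by linarith [h2.1], by linarith [h2.2]⟩, by linarith [h3.1],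
            by linarith [h3.2]⟩
        simp only [hw, hg]; rw [hc0 _ h3]; simp)
  have hmain := lamS_mul_mass_le (B := B) (A := A)
    (⟨hv, fun x _ hx => absurd (mem_univ x) hx⟩ : Cls Ω univ v)
  have hE0 : 0 ≤ lamS Ω univ B A := lamS_nonneg _ _ _ _
  rw [hvE, hvm] at hmain
  have hms : MeasurableSet (Ioo a (a + P.L) ×ˢ Ioo 0 t₁) := measurableSet_Ioo.prod measurableSet_Ioo
  have hkc := (contDiff_curvOf P).continuous
  have hjac : ∀ p ∈ Icc a (a + P.L) ×ˢ Icc 0 t₁, 1 - p.2 * curvOf P.γ p.1 ≠ 0 := fun p hp => by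
    have := abs_le.1 (hT.mul_curv_le hp.2.1 hp.2.2 p.1)
    linarith [this.2]
  set R := 4 * r * (2 * ε + D) * (2 * (M + 2) ^ 2 + 1) with hR
  have hcr : Continuous fun t : ℝ => r * t := by fun_prop
  have hmr : MapsTo (fun t : ℝ => r * t) (Icc 0 t₁) (Icc 0 (r * t₁)) := fun t h =>
    ⟨mul_nonneg hr0.le h.1, mul_le_mul_of_nonneg_left h.2 hr0.le⟩
  have hβ : ContinuousOn (fun t => B * Q (r * t) + R * Φ (r * t)) (Icc 0 t₁) :=
    ((hQc.comp hcr.continuousOn hmr).const_smul B).add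
      ((hΦc.comp hcr).const_smul R).continuousOn
  have hβ' : ContinuousOn (fun t => 10 * Φ (r * t)) (Icc 0 t₁) :=
    ((hΦc.comp hcr).const_smul (10:ℝ)).continuousOn
  have hμ : ContinuousOn (fun t => N (r * t) - ε / r * Φ (r * t)) (Icc 0 t₁) :=
    ((hNc.comp hcr).sub ((hΦc.comp hcr).const_smul (ε / r))).continuousOn
  have hχ2 : Continuous fun s => χ s ^ 2 := hχ.continuous.pow 2
  have hχ'2 : Continuous fun s => deriv χ s ^ 2 := (hχ.continuous_deriv le_rfl).pow 2
  have hcon2 : ∀ {β : ℝ → ℝ} {α : ℝ → ℝ}, Continuous α → ContinuousOn β (Icc 0 t₁) →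
      ContinuousOn (fun p : ℝ × ℝ => α p.1 * β p.2) (Icc a (a + P.L) ×ˢ Icc 0 t₁) :=
    fun hα hβ => (hα.comp continuous_fst).continuousOn.mul
      (hβ.comp continuousOn_snd fun p hp => hp.2)
  have hup : (∫ p in Ioo a (a + P.L) ×ˢ Ioo 0 t₁,
      sden B (curvOf P.γ p.1) (fluxPot P A p) w p) ≤
      ∫ p in Ioo a (a + P.L) ×ˢ Ioo 0 t₁, (χ p.1 ^ 2 * (B * Q (r * p.2) + R * Φ (r * p.2)) +
        deriv χ p.1 ^ 2 * (10 * Φ (r * p.2))) := by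
    refine setIntegral_mono_on (integrableOn_rect (continuousOn_sden (hkc.comp continuous_fst)
      (hφ.continuous_fluxPot hA.continuous) hwC hjac))
      (integrableOn_rect ((hcon2 hχ2 hβ).add (hcon2 hχ'2 hβ'))) hms fun p hp => ?_
    rcases le_or_gt |p.1 - s1| η with hs | hs
    · exact sden_trial_le hT hA hD0 hD h1 hε hδ hB hp.2.1 hp.2.2 (hk _ hs) hχ hgC hM hξ
        (hgf _ hp.2.1) (hgd _ hp.2.1)
    · have hz : ∀ᶠ y in 𝓝 p, w y = 0 := by
        have hcont : Continuous fun y : ℝ × ℝ => |y.1 - s1| := by fun_prop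
        filter_upwards [hcont.continuousAt.eventually (lt_mem_nhds hs)] with y hy
        simp only [hw]; rw [hχ0 _ (le_of_lt hy)]; simp
      rw [sden_eq_zero hz, hχ0 _ hs.le]
      have : 0 ≤ Φ (r * p.2) := by
        have := hp.2.1
        simp only [hΦ]; positivity
      rw [zero_pow two_ne_zero, zero_mul, zero_add]
      positivity
  have hlo : (∫ p in Ioo a (a + P.L) ×ˢ Ioo 0 t₁, (χ p.1 ^ 2 * (N (r * p.2) - ε / r * Φ (r * p.2))
        + (0:ℝ) * (0:ℝ))) ≤
      ∫ p in Ioo a (a + P.L) ×ˢ Ioo 0 t₁, (1 - p.2 * curvOf P.γ p.1) * ‖w p‖ ^ 2 := by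
    refine setIntegral_mono_on (integrableOn_rect ((hcon2 hχ2 hμ).add continuousOn_const))
      (integrableOn_rect (Continuous.continuousOn ?_)) hms fun p hp => ?_
    · have := hwC.continuous
      have := hkc.comp (continuous_fst (X := ℝ) (Y := ℝ))
      exact (continuous_const.sub (continuous_snd.mul this)).mul (hwC.continuous.norm.pow 2)
    · have hn : ‖w p‖ ^ 2 = χ p.1 ^ 2 * f (r * p.2) ^ 2 := by
        simp only [hw]
        rw [norm_mul, norm_phase, one_mul, Complex.norm_real, Real.norm_eq_abs, sq_abs, mul_pow,
          hgf _ hp.2.1]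
      rw [hn]
      rcases le_or_gt |p.1 - s1| η with hs | hs
      · have hk' := abs_le.1 (hk _ hs)
        have hp0 := hp.2.1
        have e1 : κ * (r * p.2) = p.2 * curvOf P.γ s1 := by rw [hκ]; field_simp
        have e2 : p.2 * ε * f (r * p.2) ^ 2 ≤ ε / r * Φ (r * p.2) := by
          have e3 : (r * p.2) * f (r * p.2) ^ 2 ≤ Φ (r * p.2) := by
            simp only [hΦ]
            have hx : 0 < r * p.2 := by positivity
            have : r * p.2 ≤ (1 + r * p.2) ^ 4 := by
              have : 1 + r * p.2 ≤ (1 + r * p.2) ^ 4 :=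
                le_self_pow₀ (by linarith) (by norm_num)
              linarith
            exact mul_le_mul this (by linarith [sq_nonneg (deriv f (r * p.2))]) (sq_nonneg _)
              (by positivity)
          calc p.2 * ε * f (r * p.2) ^ 2 = ε / r * ((r * p.2) * f (r * p.2) ^ 2) := by field_simp
            _ ≤ _ := mul_le_mul_of_nonneg_left e3 (by positivity)
        have e4 : p.2 * (curvOf P.γ p.1 - curvOf P.γ s1) ≤ p.2 * ε :=
          mul_le_mul_of_nonneg_left hk'.2 hp0.le
        have e5 : N (r * p.2) - ε / r * Φ (r * p.2) ≤
            (1 - p.2 * curvOf P.γ p.1) * f (r * p.2) ^ 2 := by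
          have e6 : N (r * p.2) = (1 - p.2 * curvOf P.γ s1) * f (r * p.2) ^ 2 := by
            simp only [hN, e1]
          have e7 := mul_le_mul_of_nonneg_right e4 (sq_nonneg (f (r * p.2)))
          rw [e6]; linarith
        have := mul_le_mul_of_nonneg_left e5 (sq_nonneg (χ p.1))
        linarith
      · rw [hχ0 _ hs.le]; simp
  have i1 := integral_rect_separable (a := a) (b := a + P.L) (by linarith) ht.le hχ2 hχ'2 hβ hβ'
  have i2 := integral_rect_separable (a := a) (b := a + P.L) (by linarith) ht.le hχ2
    (continuous_const (y := (0:ℝ))) hμ (continuousOn_const (c := (0:ℝ)))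
  rw [i1] at hup
  rw [i2] at hlo
  have hQi : IntervalIntegrable (fun t => Q (r * t)) volume 0 t₁ :=
    ContinuousOn.intervalIntegrable (by
      rw [uIcc_of_le ht.le]; exact hQc.comp hcr.continuousOn hmr)
  have hΦi : IntervalIntegrable (fun t => Φ (r * t)) volume 0 t₁ :=
    (hΦc.comp hcr).intervalIntegrable _ _
  have hNi : IntervalIntegrable (fun t => N (r * t)) volume 0 t₁ :=
    (hNc.comp hcr).intervalIntegrable _ _
  rw [intervalIntegral.integral_add (hQi.const_mul _) (hΦi.const_mul _),
    intervalIntegral.integral_const_mul, intervalIntegral.integral_const_mul,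
    intervalIntegral.integral_const_mul, integral_rescale hr0 hTr hT0 hQc hQ0,
    integral_rescale hr0 hTr hT0 hΦc.continuousOn hΦ0] at hup
  rw [intervalIntegral.integral_sub hNi (hΦi.const_mul _), intervalIntegral.integral_const_mul,
    integral_rescale hr0 hTr hT0 hNc.continuousOn hN0,
    integral_rescale hr0 hTr hT0 hΦc.continuousOn hΦ0] at hlo
  simp only [intervalIntegral.integral_zero, mul_zero, add_zero] at hlo
  have h5 := (mul_le_mul_of_nonneg_left hlo hE0).trans (hmain.trans hup)
  have h6 := mul_le_mul_of_nonneg_left h5 hr0.le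
  change _ * (_ * ((∫ τ in (0:ℝ)..T, N τ) - ε / r * ∫ τ in (0:ℝ)..T, Φ τ)) ≤
    _ * (B * (∫ τ in (0:ℝ)..T, Q τ) + R * ∫ τ in (0:ℝ)..T, Φ τ) +
    _ * (10 * ∫ τ in (0:ℝ)..T, Φ τ)
  generalize (∫ τ in (0:ℝ)..T, N τ) = iN at *
  generalize (∫ τ in (0:ℝ)..T, Φ τ) = iP at *
  generalize (∫ τ in (0:ℝ)..T, Q τ) = iQ at *
  generalize (∫ s in a..(a + P.L), χ s ^ 2) = X at *
  generalize (∫ s in a..(a + P.L), deriv χ s ^ 2) = X' at *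
  have hri : r * r⁻¹ = 1 := mul_inv_cancel₀ hr0.ne'
  calc lamS Ω univ B A * (X * (iN - ε / r * iP))
      = (r * r⁻¹) * (lamS Ω univ B A * (X * (iN - ε / r * iP))) := by rw [hri, one_mul]
    _ = r * (lamS Ω univ B A * (X * (r⁻¹ * iN - ε / r * (r⁻¹ * iP)))) := by ring
    _ ≤ _ := h6
    _ = (r * r⁻¹) * (X * (B * iQ + R * iP) + X' * (10 * iP)) := by ring
    _ = _ := by rw [hri, one_mul]

end Trial

end SC

namespace SC

section Trial

variable {Ω : Set Plane} {P : BoundaryParam Ω} {K t₁ : ℝ}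

lemma upper_arith {E X X' N I q r Λ c M ε D C : ℝ} (hr : 1 ≤ r) (hX : 0 < X) (hX' : 0 ≤ X')
    (hI0 : 0 ≤ I) (hI : I ≤ M) (hM : 1 ≤ M) (hN : 1 / M ≤ N) (hΛ : Λ ≤ 1)
    (hc : 0 < c) (hε : 0 ≤ ε) (hD : 0 ≤ D) (hC : 0 ≤ C)
    (hq : q ≤ (Λ - c / r) * N) (h1 : ε * M < 1 / M)
    (h2 : ε * M + 8 * ε * C * M ≤ c / (8 * M)) (h3 : 4 * D * C * M ≤ c / (8 * M))
    (h4 : 10 * (X' / X) * M ≤ r * (c / (8 * M)))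
    (h : E * (X * (N - ε / r * I)) ≤ X * (r ^ 2 * q + 4 * r * (2 * ε + D) * C * I) +
      X' * (10 * I)) : E ≤ r ^ 2 * Λ - c * r / 2 := by
  by_contra hE
  push Not at hE
  have hr0 : 0 < r := by linarith
  have hM0 : 0 < M := by linarith
  have hεI : ε / r * I ≤ ε * M := by
    apply mul_le_mul _ hI hI0 hε
    rw [div_le_iff₀ hr0]; nlinarith
  have hpos : 0 < N - ε / r * I := by linarith
  have e1 : E * (N - ε / r * I) ≤ r ^ 2 * q + 4 * r * (2 * ε + D) * C * I +
      10 * (X' / X) * I := by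
    have : X * (E * (N - ε / r * I)) ≤ X * (r ^ 2 * q + 4 * r * (2 * ε + D) * C * I +
      10 * (X' / X) * I) := by
      calc _ = E * (X * (N - ε / r * I)) := by ring
        _ ≤ _ := h
        _ = _ := by field_simp
    exact le_of_mul_le_mul_left this hX
  have e2 := mul_lt_mul_of_pos_right hE hpos
  have e3 : r ^ 2 * q ≤ r ^ 2 * Λ * N - c * r * N := by
    calc r ^ 2 * q ≤ r ^ 2 * ((Λ - c / r) * N) := mul_le_mul_of_nonneg_left hq (by positivity)
      _ = _ := by field_simp
  have e4 : (r ^ 2 * Λ - c * r / 2) * (ε / r * I) ≤ r * (ε * M) := by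
    have a1 : r ^ 2 * Λ - c * r / 2 ≤ r ^ 2 := by
      have : r ^ 2 * Λ ≤ r ^ 2 * 1 := mul_le_mul_of_nonneg_left hΛ (by positivity)
      have : 0 < c * r := by positivity
      linarith
    calc _ ≤ r ^ 2 * (ε / r * I) := mul_le_mul_of_nonneg_right a1 (by positivity)
      _ = r * (ε * I) := by field_simp
      _ ≤ _ := mul_le_mul_of_nonneg_left (mul_le_mul_of_nonneg_left hI hε) hr0.le
  have e5 : 4 * r * (2 * ε + D) * C * I ≤ r * (8 * ε * C * M + 4 * D * C * M) := by
    calc _ ≤ 4 * r * (2 * ε + D) * C * M := mul_le_mul_of_nonneg_left hI (by positivity)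
      _ = _ := by ring
  have e6 : 10 * (X' / X) * I ≤ 10 * (X' / X) * M := mul_le_mul_of_nonneg_left hI (by positivity)
  have e7 : c * r / 2 * (1 / M) ≤ c * r / 2 * N := mul_le_mul_of_nonneg_left hN (by positivity)
  have e8 : c * r / 2 * (1 / M) = 4 * (r * (c / (8 * M))) := by field_simp; norm_num
  have e9 := mul_le_mul_of_nonneg_left h2 hr0.le
  have e10 := mul_le_mul_of_nonneg_left h3 hr0.le
  have e11 : 0 < r * (c / (8 * M)) := by positivity
  linarith

/-- Quantitative upper bound on the ground state energy from a good one-dimensional function. -/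
lemma exists_energy_upper (hT : IsTube P K t₁) (hΩ : IsOpen Ω) (s1 : ℝ) {c M : ℝ} (hc : 0 < c)
    (hM : 1 ≤ M) : ∃ δ > 0, ∃ B₁ ≥ 1, ∀ B ≥ B₁, ∀ D, 0 ≤ D → D ≤ δ → ∀ A : Plane → Plane,
      ContDiff ℝ 2 A → (∀ x ∈ closure Ω, ‖fderiv ℝ (curl2 A) x‖ ≤ D) →
      (∀ x ∈ frontier Ω, curl2 A x = 1) → ∀ Λ ξ f, Λ ≤ 1 → |ξ| ≤ M →
      Adm1 (2 * (t₁ / 3 * √B)) f →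
      1 / M ≤ n1 (curvOf P.γ s1 / √B) (2 * (t₁ / 3 * √B)) f →
      q1 (curvOf P.γ s1 / √B) ξ (2 * (t₁ / 3 * √B)) f ≤
        (Λ - c / √B) * n1 (curvOf P.γ s1 / √B) (2 * (t₁ / 3 * √B)) f →
      (∫ τ in (0:ℝ)..(2 * (t₁ / 3 * √B)), (1 + τ) ^ 4 * (f τ ^ 2 + deriv f τ ^ 2)) ≤ M →
      lamS Ω univ B A ≤ B * Λ - c * √B / 2 := by
  have hL := P.L_pos
  set C := 2 * (M + 2) ^ 2 + 1 with hC
  have hC0 : 0 < C := by positivity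
  have hM0 : 0 < M := by linarith
  set ε := min (1 / 4) (min (1 / (2 * M ^ 2)) (c / (8 * M) / (M + 8 * C * M))) with hε
  have hε0 : 0 < ε := by positivity
  have hε1 : ε ≤ 1 / 4 := min_le_left _ _
  have hε2 : ε * M < 1 / M := by
    have : ε ≤ 1 / (2 * M ^ 2) := (min_le_right _ _).trans (min_le_left _ _)
    calc ε * M ≤ 1 / (2 * M ^ 2) * M := mul_le_mul_of_nonneg_right this hM0.le
      _ = (1 / M) / 2 := by field_simp
      _ < 1 / M := half_lt_self (by positivity)
  have hε3 : ε * M + 8 * ε * C * M ≤ c / (8 * M) := by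
    have : ε ≤ c / (8 * M) / (M + 8 * C * M) := (min_le_right _ _).trans (min_le_right _ _)
    rw [le_div_iff₀ (by positivity)] at this
    calc _ = ε * (M + 8 * C * M) := by ring
      _ ≤ _ := this
  obtain ⟨η', hη', hkη⟩ := Metric.continuousAt_iff.1
    ((contDiff_curvOf P).continuous.continuousAt (x := s1)) ε hε0
  set η := min (η' / 2) (P.L / 4) with hηdef
  have hη : 0 < η := by positivity
  have hη1 : η < η' := (min_le_left _ _).trans_lt (by linarith)
  have hη2 : η < P.L / 2 := (min_le_right _ _).trans_lt (by linarith)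
  obtain ⟨χ, hχ, hχ1, hχ0, -⟩ := exists_bump s1 (a := η / 2) (b := η) (by positivity) (by linarith)
  set X := ∫ s in (s1 - P.L / 2)..(s1 - P.L / 2 + P.L), χ s ^ 2 with hX
  set X' := ∫ s in (s1 - P.L / 2)..(s1 - P.L / 2 + P.L), deriv χ s ^ 2 with hX'
  have hX0 : 0 < X := by
    refine intervalIntegral.integral_pos (by linarith) (hχ.continuous.pow 2).continuousOn
      (fun _ _ => sq_nonneg _) ⟨s1, ⟨by linarith, by linarith⟩, ?_⟩
    rw [hχ1 s1 (by simp; positivity)]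
    norm_num
  have hX'0 : 0 ≤ X' := intervalIntegral.integral_nonneg (by linarith) fun _ _ => sq_nonneg _
  refine ⟨min (1 / 2) (c / (8 * M) / (4 * C * M)), by positivity,
    max 1 ((10 * (X' / X) * M / (c / (8 * M))) ^ 2), le_max_left _ _, ?_⟩
  intro B hB D hD0 hD A hA hDA h1 Λ ξ f hΛ hξ hf hn hq hI
  have hB1 : 1 ≤ B := (le_max_left _ _).trans hB
  have hr : 1 ≤ √B := by rw [Real.one_le_sqrt]; exact hB1
  have hr2 : √B ^ 2 = B := Real.sq_sqrt (by linarith)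
  have h4 : 10 * (X' / X) * M ≤ √B * (c / (8 * M)) := by
    rw [← div_le_iff₀ (by positivity)]
    exact Real.le_sqrt_of_sq_le ((le_max_right _ _).trans hB)
  have h3 : 4 * D * C * M ≤ c / (8 * M) := by
    have := hD.trans (min_le_right _ _)
    rw [le_div_iff₀ (by positivity)] at this
    linarith
  have hD2 := hD.trans (min_le_left _ _)
  have h := product_trial hT hΩ hA hD0 hDA h1 hε0.le (by linarith) hB1 hη hη2
    (fun s hs => by
      have := hkη (x := s) (by rw [Real.dist_eq]; exact hs.trans_lt hη1)
      rw [Real.dist_eq] at this; exact this.le) hχ hχ0 hM hξ hf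
  rw [← hX, ← hX', ← hC] at h
  have hI0 : 0 ≤ ∫ τ in (0:ℝ)..(2 * (t₁ / 3 * √B)), (1 + τ) ^ 4 * (f τ ^ 2 + deriv f τ ^ 2) :=
    intervalIntegral.integral_nonneg (by have := hT.pos; positivity) fun τ _ => by positivity
  have := upper_arith (E := lamS Ω univ B A) hr hX0 hX'0 hI0 hI hM hn hΛ hc hε0.le hD0 hC0.le hq
    hε2 hε3 h3 h4 (by rw [hr2]; exact h)
  rwa [hr2] at this

end Trial

end SC

namespace SC

section Arc

variable {Ω : Set Plane} {P : BoundaryParam Ω} {K t₁ : ℝ}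

/-- The closed tubular neighborhood of an arc. -/
def arc (P : BoundaryParam Ω) (s0 η r : ℝ) : Set Plane :=
  tube P.γ '' (Icc (s0 - η) (s0 + η) ×ˢ Icc (-r) r)

lemma isClosed_arc (P : BoundaryParam Ω) (s0 η r : ℝ) : IsClosed (arc P s0 η r) :=
  isClosed_image_rect P _ _ _ _

lemma IsTube.notMem_arc (hT : IsTube P K t₁) {s0 η r : ℝ} (hη : η < P.L / 2) (hr : r < t₁)
    {p : ℝ × ℝ} (hp : |p.2| < t₁) (h1 : p.1 ∈ Icc (s0 - P.L / 2) (s0 - P.L / 2 + P.L))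
    (h : η < |p.1 - s0| ∨ r < p.2) : tube P.γ p ∉ arc P s0 η r := by
  rintro ⟨q, hq, hqp⟩
  have hq2 : |q.2| < t₁ := (abs_le.2 hq.2).trans_lt hr
  obtain ⟨h2, n, hn⟩ := hT.inj q p hq2 hp hqp
  have hL := P.L_pos
  rcases h with h | h
  · have hq1 : |q.1 - s0| ≤ η := abs_le.2 ⟨by linarith [hq.1.1], by linarith [hq.1.2]⟩
    have hq1' := abs_le.1 hq1
    have ha : (n : ℝ) * P.L < 1 * P.L := by linarith [h1.1]
    have hb : (-1 : ℝ) * P.L < n * P.L := by linarith [h1.2]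
    have ha' : (n : ℝ) < 1 := lt_of_mul_lt_mul_right ha hL.le
    have hb' : (-1 : ℝ) < n := lt_of_mul_lt_mul_right hb hL.le
    have hn0 : n = 0 := by
      have a1 : n < 1 := by exact_mod_cast ha'
      have a2 : -1 < n := by exact_mod_cast hb'
      omega
    rw [hn0] at hn
    rw [show p.1 = q.1 by rw [hn]; simp] at h
    linarith
  · linarith [hq.2.2]

lemma IsTube.arc_subset (hT : IsTube P K t₁) {s0 η r : ℝ} (hη : η < P.L / 2) (hr : r < t₁)
    {t2 : ℝ} (hr2 : r < t2) {x : Plane} (hx : x ∈ Ω) (hxS : x ∈ arc P s0 η r) :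
    x ∈ tube P.γ '' (Ioo (s0 - P.L / 2) (s0 - P.L / 2 + P.L) ×ˢ Ioo 0 t2) := by
  obtain ⟨p, hp, rfl⟩ := hxS
  refine ⟨p, ⟨⟨by linarith [hp.1.1], by linarith [hp.1.2]⟩, ?_, by linarith [hp.2.2]⟩, rfl⟩
  by_contra h
  exact hT.notMem p (by linarith [hp.2.1]) (not_lt.1 h) hx

lemma integral_le_add_of_pointwise {R : Set (ℝ × ℝ)} (hR : MeasurableSet R)
    {X Y F G : ℝ × ℝ → ℝ} {κ B : ℝ} (hX : IntegrableOn X R) (hY : IntegrableOn Y R)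
    (hF : IntegrableOn F R) (hG : IntegrableOn G R)
    (h : ∀ p ∈ R, X p ≤ Y p + κ * (F p / B + G p)) :
    ∫ p in R, X p ≤ (∫ p in R, Y p) + κ * ((∫ p in R, F p) / B + ∫ p in R, G p) := by
  have hF' : IntegrableOn (fun p => F p / B) R := hF.div_const B
  have hFG : IntegrableOn (fun p => κ * (F p / B + G p)) R := (hF'.add hG).const_mul κ
  have e : ∫ p in R, (Y p + κ * (F p / B + G p)) =
      (∫ p in R, Y p) + κ * ((∫ p in R, F p) / B + ∫ p in R, G p) := by
    rw [integral_add hY hFG, integral_const_mul, integral_add hF' hG, integral_div]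
  rw [← e]
  exact setIntegral_mono_on hX (hY.add hFG) hR h

lemma arc_aux {r B τ t m m0 S S0 V Λ ε D : ℝ} (hr : 1 ≤ r) (hB : r ^ 2 = B) (hm : 1 / 2 ≤ m)
    (hτ : τ = r * t) (ht : 0 ≤ t) (hmm : |m - m0| ≤ t * ε) (hS : 0 ≤ S) (hV : 0 ≤ V)
    (hε : 0 ≤ ε) (hD : 0 ≤ D) (hΛ0 : 0 ≤ Λ) (hΛ : Λ ≤ 1)
    (h : S0 ≤ S + 4 * r * (ε + (ε + D)) * ((1 + τ) * (S / B) + (1 + τ) ^ 4 * V)) :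
    B * Λ * (m * V) + S0 - B * Λ * (m0 * V) ≤
      S + 18 * r * (ε + D) * ((1 + τ) ^ 4 * S / B + (1 + τ) ^ 4 * (m * V)) := by
  have hB0 : 0 < B := by rw [← hB]; positivity
  have hr0 : 0 < r := by linarith
  have hτ0 : 0 ≤ τ := by rw [hτ]; positivity
  have h1 : (1 + τ) ≤ (1 + τ) ^ 4 := le_self_pow₀ (by linarith) (by norm_num)
  have hV2 : V ≤ 2 * (m * V) := by nlinarith
  have hmV : 0 ≤ m * V := by linarith
  have a1 : B * Λ * ((m - m0) * V) ≤ r * ε * (2 * ((1 + τ) ^ 4 * (m * V))) := by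
    have h2 : (m - m0) * V ≤ (t * ε) * (2 * (m * V)) :=
      (mul_le_mul_of_nonneg_right ((le_abs_self _).trans hmm) hV).trans
        (mul_le_mul_of_nonneg_left hV2 (by positivity))
    calc B * Λ * ((m - m0) * V) ≤ B * Λ * ((t * ε) * (2 * (m * V))) :=
          mul_le_mul_of_nonneg_left h2 (by positivity)
      _ ≤ B * 1 * ((t * ε) * (2 * (m * V))) := by
          apply mul_le_mul_of_nonneg_right _ (by positivity)
          exact mul_le_mul_of_nonneg_left hΛ hB0.le
      _ = r * ε * (2 * (τ * (m * V))) := by rw [← hB, hτ]; ring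
      _ ≤ _ := by
        apply mul_le_mul_of_nonneg_left _ (by positivity)
        have : τ * (m * V) ≤ (1 + τ) ^ 4 * (m * V) :=
          mul_le_mul_of_nonneg_right (by linarith) hmV
        linarith
  have a2 : 4 * r * (ε + (ε + D)) * ((1 + τ) * (S / B)) ≤
      4 * r * (2 * (ε + D)) * ((1 + τ) ^ 4 * S / B) := by
    apply mul_le_mul _ _ (by positivity) (by positivity)
    · exact mul_le_mul_of_nonneg_left (by linarith) (by positivity)
    · rw [mul_div_assoc]; exact mul_le_mul_of_nonneg_right h1 (by positivity)
  have a3 : 4 * r * (ε + (ε + D)) * ((1 + τ) ^ 4 * V) ≤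
      4 * r * (2 * (ε + D)) * ((1 + τ) ^ 4 * (2 * (m * V))) := by
    apply mul_le_mul _ _ (by positivity) (by positivity)
    · exact mul_le_mul_of_nonneg_left (by linarith) (by positivity)
    · exact mul_le_mul_of_nonneg_left hV2 (by positivity)
  have a4 : 0 ≤ r * D * ((1 + τ) ^ 4 * (m * V)) := by positivity
  have a5 : 0 ≤ r * (ε + D) * ((1 + τ) ^ 4 * S / B) := by positivity
  linarith

end Arc

end SC

namespace SC

section FrozenArc

variable {Ω : Set Plane} {P : BoundaryParam Ω} {K t₁ : ℝ}

/-- Functions supported near a short arc have energy bounded below by the model with frozen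
curvature, up to weighted errors. -/
lemma frozen_arc (hT : IsTube P K t₁) (hΩ : IsOpen Ω) {ρ : Plane → ℝ} (hρ : IsRho P t₁ ρ)
    {A : Plane → Plane} (hA : ContDiff ℝ 2 A) {B D ε s0 η r0 Λ : ℝ} (hB : 1 ≤ B) (hD0 : 0 ≤ D)
    (hD : ∀ x ∈ closure Ω, ‖fderiv ℝ (curl2 A) x‖ ≤ D) (h1 : ∀ x ∈ frontier Ω, curl2 A x = 1)
    (hη : η < P.L / 2) (hr0 : r0 < t₁ / 3) (hε : 0 ≤ ε)
    (hk : ∀ s, |s - s0| ≤ η → |curvOf P.γ s - curvOf P.γ s0| ≤ ε) (hεD : ε + D ≤ 1)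
    (hΛ0 : 0 ≤ Λ) (hΛ1 : Λ ≤ 1)
    (hlow : ∀ ξ f, Adm1 (t₁ / 3 * √B) f → Λ * n1 (curvOf P.γ s0 / √B) (t₁ / 3 * √B) f ≤
      q1 (curvOf P.γ s0 / √B) ξ (t₁ / 3 * √B) f)
    {u : Plane → ℂ} (hu : Cls Ω (arc P s0 η r0) u) :
    B * Λ * mass Ω u ≤ energy Ω B A u + 18 * √B * (ε + D) *
      ((∫ x in Ω, (1 + √B * ρ x) ^ 4 * magSq B A u x) / B +
        ∫ x in Ω, (1 + √B * ρ x) ^ 4 * ‖u x‖ ^ 2) := by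
  have ht1 := hT.pos
  have hL := P.L_pos
  have hT2 : IsTube P K (t₁ / 3) := hT.mono (by linarith) (by linarith)
  set t2 := t₁ / 3 with ht2
  have ht2p : 0 < t2 := hT2.pos
  have hr : 1 ≤ √B := by rw [Real.one_le_sqrt]; exact hB
  have hr2 : √B ^ 2 = B := Real.sq_sqrt (by linarith)
  set a := s0 - P.L / 2 with ha
  obtain ⟨φ, hφ⟩ := exists_gauge P (hA.of_le (by norm_num)) a
  set w := toStrip P B φ u with hw
  have hwC : ContDiff ℝ 1 w := contDiff_toStrip B hφ.1 hu.1
  set k0 := curvOf P.γ s0 with hk0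
  -- vanishing of `w` off the arc
  have hw0 : ∀ p : ℝ × ℝ, 0 < p.2 → p.2 < t₁ → p.1 ∈ Icc a (a + P.L) →
      (η < |p.1 - s0| ∨ r0 < p.2) → w p = 0 := by
    intro p hp0 hp1 hp2 h
    have h3 : tube P.γ p ∉ arc P s0 η r0 :=
      hT.notMem_arc hη (by linarith) (by rw [abs_of_pos hp0]; exact hp1) hp2 h
    rw [hw, toStrip_eq, hu.2 _ (hT.mem p hp0 hp1) h3, mul_zero]
  have hside : ∀ s ∈ Icc a (a + P.L), η < |s - s0| → ∀ t ∈ Icc 0 t2, w (s, t) = 0 := by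
    intro s hs hs' t ht
    have hc : Continuous fun τ : ℝ => w (s, τ) := hwC.continuous.comp (by fun_prop)
    have hcl : IsClosed {τ : ℝ | w (s, τ) = 0} := isClosed_eq hc continuous_const
    have hsub : Ioo 0 t₁ ⊆ {τ : ℝ | w (s, τ) = 0} := fun τ hτ =>
      hw0 (s, τ) hτ.1 hτ.2 hs (Or.inl hs')
    have h4 := hcl.closure_subset_iff.2 hsub
    rw [closure_Ioo ht1.ne] at h4
    exact h4 ⟨ht.1, by linarith [ht.2]⟩
  have hfl := frozen_lower (k := k0) (B := B) (t2 := t2) (t3 := 2 * t2) (Λ := Λ) (a := a)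
    (b := a + P.L) (by linarith) (by linarith)
    (by have := hT2.mul_curv_le (p := (0, t2)) ht2p.le le_rfl s0
        rw [abs_mul, abs_of_pos ht2p] at this; linarith)
    ht2p.le (by linarith) hlow hwC
    (fun t ht => hside a ⟨le_rfl, by linarith⟩ (by
      rw [ha, abs_sub_comm, show s0 - (s0 - P.L / 2) = P.L / 2 by ring, abs_of_pos (by linarith)]
      exact hη) t ht)
    (fun t ht => hside (a + P.L) ⟨by linarith, le_rfl⟩ (by
      rw [ha, show s0 - P.L / 2 + P.L - s0 = P.L / 2 by ring, abs_of_pos (by linarith)]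
      exact hη) t ht)
    (fun s hs t ht => hw0 (s, t) (by linarith [ht.1]) (by
      have := ht.2
      change t < t₁
      linarith) hs (Or.inr (by
      have := ht.1
      change r0 < t
      linarith)))
  have hoff : ∀ x ∈ Ω, x ∉ tube P.γ '' (Ioo a (a + P.L) ×ˢ Ioo 0 t2) → x ∉ arc P s0 η r0 :=
    fun x hx hx' h => hx' (hT.arc_subset hη (by linarith) hr0 hx h)
  have hoffm : ∀ x ∈ Ω, x ∉ tube P.γ '' (Ioo a (a + P.L) ×ˢ Ioo 0 t2) → magSq B A u x = 0 :=
    fun x hx hx' => magSq_eq_zero_off hΩ (isClosed_arc P s0 η r0) hu.2 hx (hoff x hx hx')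
  have hoffu : ∀ x ∈ Ω, x ∉ tube P.γ '' (Ioo a (a + P.L) ×ˢ Ioo 0 t2) → u x = 0 :=
    fun x hx hx' => hu.2 x hx (hoff x hx hx')
  set R : Set (ℝ × ℝ) := Ioo a (a + P.L) ×ˢ Ioo 0 t2 with hR
  have hms : MeasurableSet R := measurableSet_Ioo.prod measurableSet_Ioo
  set S : ℝ × ℝ → ℝ := fun p => sden B (curvOf P.γ p.1) (fluxPot P A p) w p with hS
  set V : ℝ × ℝ → ℝ := fun p => (1 - p.2 * curvOf P.γ p.1) * ‖w p‖ ^ 2 with hV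
  have hρR : ∀ p ∈ R, ρ (tube P.γ p) = p.2 := fun p hp =>
    hρ.eq p (by rw [abs_of_pos hp.2.1]; linarith [hp.2.2])
  have eE : energy Ω B A u = ∫ p in R, S p := by
    have := weighted_energy_eq hT2 hΩ a hφ B hu.1 (fun _ => 1) hoffm
    simp only [one_mul] at this
    exact this
  have eM : mass Ω u = ∫ p in R, V p := by
    have := weighted_mass_eq hT2 hΩ a φ B (fun _ => 1) hoffu
    simp only [one_mul] at this
    exact this
  have eE4 : ∫ x in Ω, (1 + √B * ρ x) ^ 4 * magSq B A u x =
      ∫ p in R, (1 + √B * p.2) ^ 4 * S p := by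
    rw [weighted_energy_eq hT2 hΩ a hφ B hu.1 (fun x => (1 + √B * ρ x) ^ 4) hoffm]
    exact setIntegral_congr_fun hms fun p hp => by simp only [hρR p hp]; rfl
  have eM4 : ∫ x in Ω, (1 + √B * ρ x) ^ 4 * ‖u x‖ ^ 2 =
      ∫ p in R, (1 + √B * p.2) ^ 4 * V p := by
    rw [weighted_mass_eq hT2 hΩ a φ B (fun x => (1 + √B * ρ x) ^ 4) hoffu]
    exact setIntegral_congr_fun hms fun p hp => by simp only [hρR p hp]; rfl
  rw [eE, eM, eE4, eM4]
  have hcurv : Continuous fun p : ℝ × ℝ => curvOf P.γ p.1 :=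
    (contDiff_curvOf P).continuous.comp continuous_fst
  have hflux : Continuous (fluxPot P A) := IsGauge.continuous_fluxPot hA.continuous hφ
  have hwc := hwC.continuous
  have hSc : ContinuousOn S (Icc a (a + P.L) ×ˢ Icc 0 t2) :=
    continuousOn_sden hcurv hflux hwC fun p hp => by
      have := abs_le.1 (hT2.mul_curv_le hp.2.1 hp.2.2 p.1)
      linarith [this.2]
  have hVc : Continuous V := by rw [hV]; fun_prop
  set S0 : ℝ × ℝ → ℝ := fun p => sden B k0 (p.2 - k0 * p.2 ^ 2 / 2) w p with hS0
  have hS0c : ContinuousOn S0 (Icc a (a + P.L) ×ˢ Icc 0 t2) :=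
    continuousOn_sden (k := fun _ => k0) (α := fun p => p.2 - k0 * p.2 ^ 2 / 2)
      continuous_const (by fun_prop) hwC fun p hp => by
      have := abs_le.1 (hT2.mul_curv_le hp.2.1 hp.2.2 s0)
      rw [← hk0] at this
      linarith [this.2]
  set V0 : ℝ × ℝ → ℝ := fun p => (1 - p.2 * k0) * ‖w p‖ ^ 2 with hV0
  have hV0c : Continuous V0 := by rw [hV0]; fun_prop
  have hp4 : Continuous fun p : ℝ × ℝ => (1 + √B * p.2) ^ 4 := by fun_prop
  have iS : IntegrableOn S R := integrableOn_rect hSc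
  have iV : IntegrableOn V R := integrableOn_rect hVc.continuousOn
  have iS0 : IntegrableOn S0 R := integrableOn_rect hS0c
  have iV0 : IntegrableOn V0 R := integrableOn_rect hV0c.continuousOn
  have iF : IntegrableOn (fun p => (1 + √B * p.2) ^ 4 * S p) R :=
    integrableOn_rect (hp4.continuousOn.mul hSc)
  have iG : IntegrableOn (fun p => (1 + √B * p.2) ^ 4 * V p) R :=
    integrableOn_rect (hp4.mul hVc).continuousOn
  have iX1 : IntegrableOn (fun p => B * Λ * V p) R := iV.const_mul _
  have iX3 : IntegrableOn (fun p => B * Λ * V0 p) R := iV0.const_mul _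
  have iX2 : IntegrableOn (fun p => B * Λ * V p + S0 p) R := iX1.add iS0
  have iX : IntegrableOn (fun p => B * Λ * V p + S0 p - B * Λ * V0 p) R := iX2.sub iX3
  have key := integral_le_add_of_pointwise (κ := 18 * √B * (ε + D)) (B := B) hms iX iS iF iG ?_
  · rw [integral_sub iX2 iX3, integral_add iX1 iS0, integral_const_mul, integral_const_mul] at key
    have hfl' : B * Λ * (∫ p in R, V0 p) ≤ ∫ p in R, S0 p := hfl
    linarith
  · intro p hp
    have hbk := abs_le.1 (hT2.mul_curv_le hp.2.1.le hp.2.2.le p.1)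
    have hbk0 := abs_le.1 (hT2.mul_curv_le hp.2.1.le hp.2.2.le s0)
    rw [← hk0] at hbk0
    by_cases hps : |p.1 - s0| ≤ η
    · have hkp := hk p.1 hps
      have hm : 1 / 2 ≤ 1 - p.2 * curvOf P.γ p.1 := by linarith [hbk.2]
      refine arc_aux (t := p.2) (ε := ε) (D := D) (Λ := Λ) (S := S p) (V := ‖w p‖ ^ 2) (S0 := S0 p)
        (m := 1 - p.2 * curvOf P.γ p.1) (m0 := 1 - p.2 * k0) (τ := √B * p.2)
        hr hr2 hm rfl hp.2.1.le ?_ (sden_nonneg (by linarith)) (sq_nonneg _) hε hD0 hΛ0 hΛ1 ?_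
      · rw [show 1 - p.2 * curvOf P.γ p.1 - (1 - p.2 * k0) = -(p.2 * (curvOf P.γ p.1 - k0)) by ring,
          abs_neg, abs_mul, abs_of_pos hp.2.1]
        exact mul_le_mul_of_nonneg_left hkp hp.2.1.le
      · exact sden_freeze hB hp.2.1.le hm (by linarith [hbk.1]) (by linarith [hbk0.2]) hε
          (by linarith) hεD hkp (by
            rw [abs_sub_comm]
            exact fluxPot_approx' hT2 hA hD h1 hε hp.2.1.le hp.2.2 hkp)
    · push Not at hps
      have hz : ∀ᶠ q in 𝓝 p, w q = 0 := by
        have ho : IsOpen {q : ℝ × ℝ | η < |q.1 - s0|} :=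
          isOpen_lt continuous_const (by fun_prop)
        filter_upwards [ho.mem_nhds hps, (isOpen_Ioo.prod isOpen_Ioo).mem_nhds hp] with q hq hqR
        exact hw0 q hqR.2.1 (by linarith [hqR.2.2]) (Ioo_subset_Icc_self hqR.1) (Or.inl hq)
      have e1 : S p = 0 := sden_eq_zero hz
      have e2 : S0 p = 0 := sden_eq_zero hz
      have e3 : V p = 0 := by simp only [hV]; rw [hz.self_of_nhds]; simp
      have e4 : V0 p = 0 := by simp only [hV0]; rw [hz.self_of_nhds]; simp
      rw [e1, e2, e3, e4]; simp

end FrozenArc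

end SC

namespace SC

section ArcGap

variable {Ω : Set Plane} {P : BoundaryParam Ω} {K t₁ : ℝ}

lemma one_add_pow_four_le_exp {a τ : ℝ} (ha : 0 < a) (hτ : 0 ≤ τ) :
    (1 + τ) ^ 4 ≤ (1 + 4 / a) ^ 4 * Real.exp (a * τ) := by
  have h1 : 1 + τ ≤ (1 + 4 / a) * Real.exp (a * τ / 4) := by
    have h2 : a * τ / 4 + 1 ≤ Real.exp (a * τ / 4) := Real.add_one_le_exp _
    have h3 : (1 + 4 / a) * (a * τ / 4 + 1) = 1 + τ + a * τ / 4 + 4 / a := by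
      field_simp; ring
    have h4 := mul_le_mul_of_nonneg_left h2 (by positivity : 0 ≤ 1 + 4 / a)
    have h5 : 0 ≤ a * τ / 4 + 4 / a := by positivity
    linarith
  calc (1 + τ) ^ 4 ≤ ((1 + 4 / a) * Real.exp (a * τ / 4)) ^ 4 :=
        pow_le_pow_left₀ (by linarith) h1 4
    _ = (1 + 4 / a) ^ 4 * Real.exp (a * τ) := by
        rw [mul_pow, ← Real.exp_nat_mul]
        congr 2
        push_cast; ring

/-- Exponential boundary localization controls polynomial moments. -/
lemma moment_of_exp (hΩ : IsOpen Ω) (hb : Bornology.IsBounded Ω) (hT : IsTube P K t₁)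
    {ρ : Plane → ℝ} (hρ : IsRho P t₁ ρ) {A : Plane → Plane} (hA : Continuous A) {B a C : ℝ}
    (hB : 0 < B) (ha : 0 < a) {u : Plane → ℂ} (hu : ContDiff ℝ 1 u)
    (h : ∫ x in Ω, Real.exp (a * (√B * ρ x)) * (magSq B A u x / B + ‖u x‖ ^ 2) ≤ C) :
    (∫ x in Ω, (1 + √B * ρ x) ^ 4 * magSq B A u x) / B +
      ∫ x in Ω, (1 + √B * ρ x) ^ 4 * ‖u x‖ ^ 2 ≤ (1 + 4 / a) ^ 4 * C := by
  have hm := continuous_magSq (B := B) hA hu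
  have hr := hρ.smooth.continuous
  have hu0 := hu.continuous
  have i1 : IntegrableOn (fun x => (1 + √B * ρ x) ^ 4 * magSq B A u x / B) Ω :=
    integrableOn_of_bdd hb (by fun_prop)
  have i2 : IntegrableOn (fun x => (1 + √B * ρ x) ^ 4 * ‖u x‖ ^ 2) Ω :=
    integrableOn_of_bdd hb (by fun_prop)
  have i3 : IntegrableOn (fun x => (1 + 4 / a) ^ 4 * (Real.exp (a * (√B * ρ x)) *
      (magSq B A u x / B + ‖u x‖ ^ 2))) Ω := integrableOn_of_bdd hb (by fun_prop)
  rw [← integral_div, ← integral_add i1 i2]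
  calc _ ≤ ∫ x in Ω, (1 + 4 / a) ^ 4 * (Real.exp (a * (√B * ρ x)) *
      (magSq B A u x / B + ‖u x‖ ^ 2)) := by
        refine setIntegral_mono_on (i1.add i2) i3 hΩ.measurableSet fun x hx => ?_
        have h0 : 0 ≤ √B * ρ x := mul_nonneg (Real.sqrt_nonneg _) (hρ.nonneg hT hx)
        have h1 := one_add_pow_four_le_exp ha h0
        have h2 : 0 ≤ magSq B A u x / B + ‖u x‖ ^ 2 :=
          add_nonneg (div_nonneg (magSq_nonneg _ _ _ _) hB.le) (sq_nonneg _)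
        have h3 := mul_le_mul_of_nonneg_right h1 h2
        calc _ = (1 + √B * ρ x) ^ 4 * (magSq B A u x / B + ‖u x‖ ^ 2) := by ring
          _ ≤ _ := h3
          _ = _ := by ring
    _ ≤ _ := by
        rw [integral_const_mul]
        exact mul_le_mul_of_nonneg_left h (by positivity)

/-- Near an arc of small curvature the energy exceeds the ground state energy by a definite
amount. -/
lemma exists_arc_gap (hΩ : IsOpen Ω) (hb : Bornology.IsBounded Ω) (hT : IsTube P K t₁)
    (hnd : ∃ s t, curvOf P.γ s ≠ curvOf P.γ t) :
    ∃ s0 η r0, 0 < η ∧ η < P.L / 2 ∧ 0 < r0 ∧ r0 < t₁ / 3 ∧ ∃ c > 0, ∃ δ > 0, ∃ B₁ ≥ 1,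
      ∀ B ≥ B₁, ∀ D, 0 ≤ D → D ≤ δ → ∀ A : Plane → Plane, ContDiff ℝ 2 A →
      (∀ x ∈ closure Ω, ‖fderiv ℝ (curl2 A) x‖ ≤ D) → (∀ x ∈ frontier Ω, curl2 A x = 1) →
      (∀ x ∈ Ω, |curl2 A x - 1| ≤ 1 / 10) → lamS Ω univ B A ≤ 4 / 5 * B ∧
      ∀ u, Cls Ω (arc P s0 η r0) u →
        (lamS Ω univ B A + c * √B) * mass Ω u ≤ energy Ω B A u := by
  obtain ⟨ρ, hρ⟩ := exists_rho hT
  have ht := hT.pos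
  have hL := P.L_pos
  obtain ⟨s0, s1, hs⟩ : ∃ s t, curvOf P.γ s < curvOf P.γ t := by
    obtain ⟨s, t, h⟩ := hnd
    rcases lt_or_gt_of_ne h with h | h
    exacts [⟨s, t, h⟩, ⟨t, s, h⟩]
  have hc3 : ∀ s, |curvOf P.γ s| * (3 * (t₁ / 3)) ≤ 1 / 2 := fun s => by
    have := hT.mul_curv_le (p := (0, t₁)) ht.le le_rfl s
    rw [abs_mul, abs_of_pos ht] at this
    linarith
  obtain ⟨c, hc, M, hM, Bm, hBm, hmodel⟩ := exists_model_gap_field (t2 := t₁ / 3) hs (by linarith)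
    (hc3 s0) (hc3 s1) (by
      have h1 := abs_le.1 (hT.mul_curv_le (p := (0, t₁)) ht.le le_rfl s0)
      have h2 := abs_le.1 (hT.mul_curv_le (p := (0, t₁)) ht.le le_rfl s1)
      dsimp only at h1 h2
      linarith [h1.1, h2.2])
  obtain ⟨δ1, hδ1, B2, hB2, hupper⟩ := exists_energy_upper hT hΩ s1 hc hM
  obtain ⟨a, ha, Cw, hCw, f, hf, hweight⟩ := exists_boundary_weight hΩ hb hT hρ
  set C2 := (1 + 4 / a) ^ 4 * Cw with hC2
  have hC20 : 0 < C2 := by positivity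
  set ε := min (1 / 4) (c / (400 * C2)) with hε
  have hε0 : 0 < ε := by positivity
  have hε1 : ε ≤ 1 / 4 := min_le_left _ _
  have hε2 : ε * C2 ≤ c / 400 := by
    have h2 : ε ≤ c / (400 * C2) := min_le_right _ _
    rw [le_div_iff₀ (by positivity)] at h2
    linarith
  obtain ⟨η, hη0, hηL, hηc⟩ : ∃ η, 0 < η ∧ η < P.L / 2 ∧
      ∀ s, |s - s0| ≤ η → |curvOf P.γ s - curvOf P.γ s0| ≤ ε := by
    obtain ⟨η', hη', h⟩ := Metric.continuous_iff.1 (contDiff_curvOf P).continuous s0 ε hε0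
    refine ⟨min (η' / 2) (P.L / 4), by positivity, by
      linarith [min_le_right (η' / 2) (P.L / 4)], fun s hs' => ?_⟩
    have := h s (by rw [Real.dist_eq]; linarith [min_le_left (η' / 2) (P.L / 4)])
    rw [Real.dist_eq] at this
    exact this.le
  refine ⟨s0, η, t₁ / 6, hη0, hηL, by linarith, by linarith, c / 4, by positivity, min δ1 ε,
    by positivity, max (max Bm B2) (max 40 ((16 / c) ^ 2)), by
      exact hBm.trans ((le_max_left _ _).trans (le_max_left _ _)), ?_⟩
  intro B hB D hD0 hDδ A hA hD h1 hcurl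
  have hBBm : Bm ≤ B := ((le_max_left _ _).trans (le_max_left _ _)).trans hB
  have hBB2 : B2 ≤ B := ((le_max_right _ _).trans (le_max_left _ _)).trans hB
  have hB40 : 40 ≤ B := ((le_max_left _ _).trans (le_max_right _ _)).trans hB
  have hBc : (16 / c) ^ 2 ≤ B := ((le_max_right _ _).trans (le_max_right _ _)).trans hB
  have hrc : 16 ≤ c * √B := by
    have h2 := Real.le_sqrt_of_sq_le hBc
    rw [div_le_iff₀ hc] at h2
    linarith
  obtain ⟨Λ, hΛ0, hΛ1, hlow, ξ, g, hξ, hg, hgn, hgq, hgM⟩ := hmodel B hBBm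
  have hE := hupper B hBB2 D hD0 (hDδ.trans (min_le_left _ _)) A hA hD h1 Λ ξ g (by linarith) hξ hg
    hgn hgq hgM
  set E := lamS Ω univ B A with hEdef
  have hBΛ : B * Λ ≤ 4 / 5 * B := by nlinarith
  refine ⟨by linarith, fun v hv => ?_⟩
  by_contra hcon
  push Not at hcon
  have hm0 : mass Ω v ≠ 0 := fun h => by
    rw [h, mul_zero] at hcon
    linarith [energy_nonneg Ω B A v]
  have hmp : 0 < mass Ω v := lt_of_le_of_ne (mass_nonneg Ω v) hm0.symm
  set ES := lamS Ω (arc P s0 η (t₁ / 6)) B A with hES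
  have hESlt : ES < E + c / 4 * √B :=
    lt_of_mul_lt_mul_right ((lamS_mul_mass_le hv).trans_lt hcon) hmp.le
  obtain ⟨u, hu, hum, hue, hui⟩ := exists_localized_near_min hΩ hb hA.continuous ⟨v, hv, hm0⟩
    (fun _ : Fin 1 => f B) (fun _ => hf B) one_pos
  have hw := hweight B hB40 A (hA.of_le (by norm_num)) hcurl ES (lamS_nonneg _ _ _ _)
    (by linarith) u hu.1 hum hue (hui 0)
  have hmom := moment_of_exp hΩ hb hT hρ hA.continuous (by linarith) ha hu.1 hw
  have hfa := frozen_arc hT hΩ hρ hA (by linarith) hD0 hD h1 hηL (by linarith) hε0.le hηc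
    (by linarith [hDδ.trans (min_le_right _ _)]) hΛ0 (by linarith) hlow hu
  rw [hum, mul_one] at hfa
  have hDε : D ≤ ε := hDδ.trans (min_le_right _ _)
  have hrp : 0 < √B := Real.sqrt_pos.2 (by linarith)
  have hfin : 18 * √B * (ε + D) * ((∫ x in Ω, (1 + √B * ρ x) ^ 4 * magSq B A u x) / B +
      ∫ x in Ω, (1 + √B * ρ x) ^ 4 * ‖u x‖ ^ 2) ≤ 36 / 400 * (c * √B) := by
    calc _ ≤ 18 * √B * (ε + D) * C2 := mul_le_mul_of_nonneg_left hmom (by positivity)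
      _ ≤ 18 * √B * (2 * ε) * C2 := by
        apply mul_le_mul_of_nonneg_right _ hC20.le
        exact mul_le_mul_of_nonneg_left (by linarith) (by positivity)
      _ = 36 * √B * (ε * C2) := by ring
      _ ≤ 36 * √B * (c / 400) := mul_le_mul_of_nonneg_left hε2 (by positivity)
      _ = _ := by ring
  linarith

end ArcGap

end SC

namespace SC

section Cut

variable {Ω : Set Plane} {P : BoundaryParam Ω} {K t₁ : ℝ}

lemma tube_add_int_mul (P : BoundaryParam Ω) (s t : ℝ) (n : ℤ) :
    tube P.γ (s + n * P.L, t) = tube P.γ (s, t) := by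
  have h : Function.Periodic (fun s => tube P.γ (s, t)) P.L := fun s => tube_add_period P s t
  simpa using h.int_mul n s

/-- A weight concentrated on an arc, and a cutoff to a collar of the boundary that removes a
smaller arc. -/
lemma exists_cut (hT : IsTube P K t₁) {ρ : Plane → ℝ} (hρ : IsRho P t₁ ρ) {s0 η r0 : ℝ}
    (hη0 : 0 < η) (hη : η < P.L / 2) (hr0 : 0 < r0) (hr : r0 < t₁ / 3) :
    ∃ G F : Plane → ℝ, ContDiff ℝ 1 G ∧ ContDiff ℝ 1 F ∧
      (∀ x, x ∉ arc P s0 η r0 → G x = 0) ∧ (∀ x, 0 ≤ F x ∧ F x ≤ 1) ∧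
      (∃ r' > 0, ∀ x ∈ Ω, ρ x < r' → G x < 1 / 2 → F x = 1) ∧
      ∃ b c r, s0 < b ∧ c < s0 + P.L ∧ 0 < r ∧ r < t₁ / 3 ∧
        (∀ p ∈ Ioo s0 (s0 + P.L) ×ˢ Ioo (-(t₁ / 3)) (t₁ / 3), p ∉ Icc b c ×ˢ Icc (-r) r →
          F (tube P.γ p) = 0) ∧
        ∀ x, x ∉ tube P.γ '' (Icc b c ×ˢ Icc (-r) r) → F x = 0 := by
  have ht := hT.pos
  have hL := P.L_pos
  obtain ⟨σ, hσ, hσ1, hσ0, hσb⟩ := exists_bump s0 (a := η / 2) (b := η) (by linarith) (by linarith)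
  obtain ⟨c2, hc2, hc21, hc20, hc2b⟩ := exists_bump 0 (a := r0 / 2) (b := r0) (by linarith)
    (by linarith)
  obtain ⟨c1, hc1, hc11, hc10, hc1b⟩ := exists_bump 0 (a := r0 / 4) (b := r0 / 2) (by linarith)
    (by linarith)
  obtain ⟨θ, hθ, hθ1, hθ0, hθb⟩ := exists_bump 1 (a := 1 / 4) (b := 1 / 2) (by norm_num)
    (by norm_num)
  set O : Set (ℝ × ℝ) := Ioo (s0 - P.L / 2) (s0 - P.L / 2 + P.L) ×ˢ Ioo (-t₁) t₁ with hO
  obtain ⟨G, hG, hGt, hG0⟩ := exists_descent hT (O := O)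
    (K' := Icc (s0 - η) (s0 + η) ×ˢ Icc (-r0) r0)
    (F := fun p => σ p.1 * c2 p.2) (isOpen_Ioo.prod isOpen_Ioo) (fun p hp => abs_lt.2 hp.2)
    ((hσ.comp contDiff_fst).mul (hc2.comp contDiff_snd))
    (fun p hp q hq h => by rw [hT.injOn_rect _ hp hq h])
    (fun p hp => ⟨⟨by linarith [hp.1.1], by linarith [hp.1.2]⟩, by linarith [hp.2.1],
      by linarith [hp.2.2]⟩) (isClosed_image_rect P _ _ _ _) (fun p hp hp' => by
      by_cases h1 : |p.1 - s0| < η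
      · by_cases h2 : |p.2| < r0
        · exact absurd ⟨⟨by linarith [(abs_lt.1 h1).1], by linarith [(abs_lt.1 h1).2]⟩,
            (abs_lt.1 h2).1.le, (abs_lt.1 h2).2.le⟩ hp'
        · rw [hc20 p.2 (by rw [sub_zero]; exact not_lt.1 h2), mul_zero]
      · rw [hσ0 p.1 (not_lt.1 h1), zero_mul])
  obtain ⟨H, hH, hHt, hH0⟩ := hT.strip_descent hc1 (r := r0 / 2) (by linarith)
    (fun t h => hc10 t (by rwa [sub_zero]))
  have hHb : ∀ x, 0 ≤ H x ∧ H x ≤ 1 := fun x => by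
    by_cases h : x ∈ tube P.γ '' (univ ×ˢ Icc (-(r0 / 2)) (r0 / 2))
    · obtain ⟨p, hp, rfl⟩ := h
      rw [hHt p (abs_lt.2 ⟨by linarith [hp.2.1], by linarith [hp.2.2]⟩)]
      exact hc1b _
    · rw [hH0 x h]; norm_num
  set F : Plane → ℝ := fun x => H x * (1 - θ (G x)) with hF
  -- values of the cutoff near the removed arc
  have hG1 : ∀ p : ℝ × ℝ, |p.1 - s0| ≤ η / 2 → |p.2| ≤ r0 / 2 → F (tube P.γ p) = 0 := by
    intro p h1 h2
    have h1' := abs_le.1 h1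
    have h2' := abs_le.1 h2
    have : G (tube P.γ p) = 1 := by
      rw [hGt p ⟨⟨by linarith [h1'.1], by linarith [h1'.2]⟩, by linarith [h2'.1],
        by linarith [h2'.2]⟩, hσ1 _ h1, hc21 _ (by rwa [sub_zero]), mul_one]
    simp only [hF]
    rw [this, hθ1 1 (by norm_num)]; simp
  have hstrip : ∀ p : ℝ × ℝ, p.1 ∈ Ico s0 (s0 + P.L) → |p.2| ≤ r0 / 2 →
      p ∉ Icc (s0 + η / 2) (s0 + P.L - η / 2) ×ˢ Icc (-(r0 / 2)) (r0 / 2) →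
      F (tube P.γ p) = 0 := by
    intro p hp h2 hn
    have h2' := abs_le.1 h2
    by_cases ha : p.1 < s0 + η / 2
    · exact hG1 p (abs_le.2 ⟨by linarith [hp.1], by linarith⟩) h2
    · by_cases hb : s0 + P.L - η / 2 < p.1
      · have e : tube P.γ p = tube P.γ (p.1 - P.L, p.2) := by
          have := tube_add_period P (p.1 - P.L) p.2
          rw [sub_add_cancel] at this
          exact this
        rw [e]
        exact hG1 (p.1 - P.L, p.2) (abs_le.2 ⟨by dsimp only; linarith, by
          have := hp.2
          dsimp only; linarith⟩) h2
      · exact absurd ⟨⟨not_lt.1 ha, not_lt.1 hb⟩, h2'.1, h2'.2⟩ hn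
  have hfar : ∀ p : ℝ × ℝ, |p.2| < t₁ → r0 / 2 < |p.2| → F (tube P.γ p) = 0 := by
    intro p h1 h2
    simp only [hF]
    rw [hHt p h1, hc10 p.2 (by rw [sub_zero]; exact h2.le), zero_mul]
  refine ⟨G, F, hG, hH.mul (contDiff_const.sub (hθ.comp hG)), hG0, fun x => ?_,
    ⟨r0 / 4, by linarith, fun x hx hxρ hxG => ?_⟩, s0 + η / 2, s0 + P.L - η / 2, r0 / 2,
    by linarith, by linarith, by linarith, by linarith, fun p hp hn => ?_, fun x hx => ?_⟩
  · have h1 := hHb x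
    have h2 := hθb (G x)
    exact ⟨mul_nonneg h1.1 (by linarith [h2.2]),
      mul_le_one₀ h1.2 (by linarith [h2.2]) (by linarith [h2.1])⟩
  · have hθG : θ (G x) = 0 := hθ0 _ (by
      rw [abs_sub_comm]; exact le_trans (by linarith) (le_abs_self _))
    have hHx : H x = 1 := by
      rcases hT.cases_mem hx with ⟨p, h1, h2, rfl⟩ | h
      · have h3 := hρ.ge p (by rw [abs_of_pos h1]; exact h2)
        rw [hHt p (by rw [abs_of_pos h1]; exact h2)]
        exact hc11 _ (by rw [sub_zero, abs_of_pos h1]; linarith)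
      · have := hρ.off x h
        linarith
    simp only [hF]
    rw [hθG, hHx]; norm_num
  · by_cases h2 : |p.2| ≤ r0 / 2
    · exact hstrip p ⟨hp.1.1.le, hp.1.2⟩ h2 hn
    · exact hfar p (abs_lt.2 ⟨by linarith [hp.2.1], by linarith [hp.2.2]⟩) (not_le.1 h2)
  · by_cases h : x ∈ tube P.γ '' (univ ×ˢ Icc (-(r0 / 2)) (r0 / 2))
    · obtain ⟨q, hq, rfl⟩ := h
      obtain ⟨n, hn, -⟩ := existsUnique_add_zsmul_mem_Ico hL q.1 s0
      have hn' : q.1 + n * P.L ∈ Ico s0 (s0 + P.L) := by simpa [zsmul_eq_mul] using hn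
      have e : tube P.γ (q.1 + n * P.L, q.2) = tube P.γ q := tube_add_int_mul P q.1 q.2 n
      rw [← e]
      refine hstrip _ hn' (abs_le.2 hq.2) fun hmem => hx ?_
      rw [← e]
      exact ⟨_, hmem, rfl⟩
    · simp only [hF]
      rw [hH0 x h, zero_mul]

end Cut

end SC

namespace SC

section Localization

variable {Ω : Set Plane} {P : BoundaryParam Ω} {K t₁ : ℝ}

/-- Cutting off a function in a region where a large weight is integrable costs little. -/
lemma energy_cut_le (hΩ : IsOpen Ω) (hb : Bornology.IsBounded Ω) {B M C CF : ℝ}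
    {A : Plane → Plane} (hA : Continuous A) (hB : 1 ≤ B) (hM : 0 < M) {F W : Plane → ℝ}
    (hF : ContDiff ℝ 1 F) (hF1 : ∀ x, 0 ≤ F x ∧ F x ≤ 1) (hCF0 : 0 ≤ CF)
    (hCF : ∀ x ∈ Ω, gradSq F x ≤ CF) (hW : Continuous W) (hW0 : ∀ x ∈ Ω, 0 ≤ W x)
    (hbad : ∀ x ∈ Ω, M ≤ W x ∨ ∀ᶠ y in 𝓝 x, F y = 1) {u : Plane → ℂ} (hu : ContDiff ℝ 1 u)
    (hI : ∫ x in Ω, W x * (magSq B A u x / B + ‖u x‖ ^ 2) ≤ C) :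
    energy Ω B A (rmul F u) ≤ energy Ω B A u + B * (2 + 2 * CF) * (C / M) ∧
      mass Ω u - C / M ≤ mass Ω (rmul F u) := by
  have hB0 : 0 < B := by linarith
  have hm := continuous_magSq (B := B) hA hu
  have hmF := continuous_magSq (B := B) hA (contDiff_rmul hF hu)
  have huc := hu.continuous
  have hFc := hF.continuous
  have i1 : IntegrableOn (magSq B A (rmul F u)) Ω := integrableOn_of_bdd hb hmF
  have i2 : IntegrableOn (magSq B A u) Ω := integrableOn_of_bdd hb hm
  have i3 : IntegrableOn (fun x => W x * (magSq B A u x / B + ‖u x‖ ^ 2)) Ω :=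
    integrableOn_of_bdd hb (by fun_prop)
  have i4 : IntegrableOn (fun x => ‖u x‖ ^ 2) Ω := integrableOn_of_bdd hb (by fun_prop)
  have i5 : IntegrableOn (fun x => F x ^ 2 * ‖u x‖ ^ 2) Ω := integrableOn_of_bdd hb (by fun_prop)
  have i3' : IntegrableOn (fun x => B * (2 + 2 * CF) / M *
      (W x * (magSq B A u x / B + ‖u x‖ ^ 2))) Ω := i3.const_mul _
  have i3'' : IntegrableOn (fun x => 1 / M *
      (W x * (magSq B A u x / B + ‖u x‖ ^ 2))) Ω := i3.const_mul _
  have i6 : IntegrableOn (fun x => magSq B A u x + B * (2 + 2 * CF) / M *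
      (W x * (magSq B A u x / B + ‖u x‖ ^ 2))) Ω := i2.add i3'
  have i7 : IntegrableOn (fun x => F x ^ 2 * ‖u x‖ ^ 2 + 1 / M *
      (W x * (magSq B A u x / B + ‖u x‖ ^ 2))) Ω := i5.add i3''
  have hH0 : ∀ x, 0 ≤ magSq B A u x / B + ‖u x‖ ^ 2 := fun x =>
    add_nonneg (div_nonneg (magSq_nonneg _ _ _ _) hB0.le) (sq_nonneg _)
  constructor
  · have h : energy Ω B A (rmul F u) ≤ ∫ x in Ω, (magSq B A u x + B * (2 + 2 * CF) / M *
      (W x * (magSq B A u x / B + ‖u x‖ ^ 2))) := by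
      refine setIntegral_mono_on i1 i6 hΩ.measurableSet fun x hx => ?_
      have hm0 := magSq_nonneg B A u x
      rcases hbad x hx with h | h
      · have h1 := magSq_rmul_le (B := B) (A := A) (hF.differentiable one_ne_zero x)
          (hu.differentiable one_ne_zero x)
        have h2 : F x ^ 2 ≤ 1 := pow_le_one₀ (hF1 x).1 (hF1 x).2
        have h3 : F x ^ 2 * magSq B A u x ≤ 1 * magSq B A u x :=
          mul_le_mul_of_nonneg_right h2 hm0
        have h4 : gradSq F x * ‖u x‖ ^ 2 ≤ CF * ‖u x‖ ^ 2 :=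
          mul_le_mul_of_nonneg_right (hCF x hx) (sq_nonneg _)
        have h5 : magSq B A (rmul F u) x ≤
            B * (2 + 2 * CF) * (magSq B A u x / B + ‖u x‖ ^ 2) := by
          have e : B * (2 + 2 * CF) * (magSq B A u x / B + ‖u x‖ ^ 2) =
              (2 + 2 * CF) * magSq B A u x + B * ((2 + 2 * CF) * ‖u x‖ ^ 2) := by
            field_simp
          have h6 : (2 + 2 * CF) * ‖u x‖ ^ 2 ≤ B * ((2 + 2 * CF) * ‖u x‖ ^ 2) :=
            le_mul_of_one_le_left (by positivity) hB
          have h7 : 0 ≤ CF * magSq B A u x := mul_nonneg hCF0 hm0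
          have h8 : 0 ≤ ‖u x‖ ^ 2 := sq_nonneg _
          rw [e]
          linarith
        have h6 : B * (2 + 2 * CF) * (magSq B A u x / B + ‖u x‖ ^ 2) ≤ B * (2 + 2 * CF) / M *
            (W x * (magSq B A u x / B + ‖u x‖ ^ 2)) := by
          have := mul_le_mul_of_nonneg_right h (hH0 x)
          calc _ = B * (2 + 2 * CF) / M * (M * (magSq B A u x / B + ‖u x‖ ^ 2)) := by
                field_simp
            _ ≤ _ := mul_le_mul_of_nonneg_left this (by positivity)
        linarith
      · have e : magSq B A (rmul F u) x = magSq B A u x := by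
          have e1 : rmul F u =ᶠ[𝓝 x] u := by
            filter_upwards [h] with y hy
            simp [rmul, hy]
          unfold magSq
          rw [e1.fderiv_eq, e1.self_of_nhds]
        have : 0 ≤ B * (2 + 2 * CF) / M * (W x * (magSq B A u x / B + ‖u x‖ ^ 2)) :=
          mul_nonneg (by positivity) (mul_nonneg (hW0 x hx) (hH0 x))
        linarith
    rw [integral_add i2 i3', integral_const_mul] at h
    refine h.trans (add_le_add le_rfl ?_)
    calc _ ≤ B * (2 + 2 * CF) / M * C := mul_le_mul_of_nonneg_left hI (by positivity)
      _ = _ := by ring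
  · have h : mass Ω u ≤ ∫ x in Ω, (F x ^ 2 * ‖u x‖ ^ 2 + 1 / M *
      (W x * (magSq B A u x / B + ‖u x‖ ^ 2))) := by
      refine setIntegral_mono_on i4 i7 hΩ.measurableSet fun x hx => ?_
      rcases hbad x hx with h | h
      · have h1 := mul_le_mul_of_nonneg_right h (hH0 x)
        have h2 : magSq B A u x / B + ‖u x‖ ^ 2 ≤ 1 / M *
            (W x * (magSq B A u x / B + ‖u x‖ ^ 2)) := by
          rw [one_div, ← div_eq_inv_mul, le_div_iff₀ hM]; linarith
        have h3 : 0 ≤ magSq B A u x / B := div_nonneg (magSq_nonneg _ _ _ _) hB0.le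
        have h4 : 0 ≤ F x ^ 2 * ‖u x‖ ^ 2 := by positivity
        linarith
      · rw [h.self_of_nhds]
        have : 0 ≤ 1 / M * (W x * (magSq B A u x / B + ‖u x‖ ^ 2)) :=
          mul_nonneg (by positivity) (mul_nonneg (hW0 x hx) (hH0 x))
        linarith
    rw [integral_add i5 i3'', integral_const_mul, ← mass_rmul] at h
    have h2 : 1 / M * (∫ x in Ω, W x * (magSq B A u x / B + ‖u x‖ ^ 2)) ≤ 1 / M * C :=
      mul_le_mul_of_nonneg_left hI (by positivity)
    have h3 : 1 / M * C = C / M := by ring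
    linarith

lemma exp_two_mul_le_sinh (y : ℝ) : Real.exp (2 * y) ≤ 4 * Real.sinh y ^ 2 + 2 := by
  have h := Real.exp_pos (-(2 * y))
  have h1 := Real.cosh_two_mul y
  have h2 := Real.cosh_sq y
  have h3 := Real.cosh_eq (2 * y)
  linarith

/-- Almost minimizers can be cut off on the arc and away from the boundary at exponentially small
cost. -/
lemma exists_localization (hΩ : IsOpen Ω) (hb : Bornology.IsBounded Ω) {ρ G F : Plane → ℝ}
    (hρ : Continuous ρ) {S : Set Plane} (hG : ContDiff ℝ 1 G) (hF : ContDiff ℝ 1 F)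
    (hG0 : ∀ x, x ∉ S → G x = 0) (hF1 : ∀ x, 0 ≤ F x ∧ F x ≤ 1) {r' : ℝ} (hr' : 0 < r')
    (hFG : ∀ x ∈ Ω, ρ x < r' → G x < 1 / 2 → F x = 1) {c a Ca : ℝ} (hc : 0 < c) (ha : 0 < a)
    (hCa : 0 ≤ Ca) :
    ∃ α > 0, ∃ ε₁ > 0, ∃ C > 0, ∀ B ≥ 1, ∀ A : Plane → Plane, Continuous A → ∀ E, 0 ≤ E →
      E ≤ 4 / 5 * B → (∀ u, Cls Ω S u → (E + c * √B) * mass Ω u ≤ energy Ω B A u) →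
      ∀ u, ContDiff ℝ 1 u → mass Ω u = 1 → energy Ω B A u ≤ E + 1 →
      ∫ x in Ω, Real.exp (a * (√B * ρ x)) * (magSq B A u x / B + ‖u x‖ ^ 2) ≤ Ca →
      ∀ ε, ε ≤ c * √B / 4 →
      energy Ω B A (rmul (fun x => Real.sinh (α * (√√B * G x))) u) -
        E * mass Ω (rmul (fun x => Real.sinh (α * (√√B * G x))) u) ≤
        (∫ x in Ω, gradSq (fun x => Real.sinh (α * (√√B * G x))) x * ‖u x‖ ^ 2) + ε →
      energy Ω B A (rmul F u) ≤ energy Ω B A u + B * C * Real.exp (-(ε₁ * √√B)) ∧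
        1 - C * Real.exp (-(ε₁ * √√B)) ≤ mass Ω (rmul F u) := by
  obtain ⟨CG, hCG, hCG'⟩ := exists_bound hb (continuous_gradSq hG)
  obtain ⟨CF, hCF, hCF'⟩ := exists_bound hb (continuous_gradSq hF)
  set α := √(c / (4 * (CG + 1))) with hα
  have hαp : 0 < α := Real.sqrt_pos.2 (by positivity)
  have hα2 : α ^ 2 * CG ≤ c / 4 := by
    rw [hα, Real.sq_sqrt (by positivity), div_mul_eq_mul_div, div_le_div_iff₀ (by positivity)
      (by norm_num)]
    nlinarith
  set C1 := Ca + 18 + 16 * c with hC1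
  have hC1p : 0 < C1 := by positivity
  refine ⟨α, hαp, min (a * r') α, lt_min (by positivity) hαp, (2 + 2 * CF) * C1, by positivity, ?_⟩
  intro B hB A hA E hE0 hE hlow u hu hm hu1 hexp ε hε hnear
  set f : Plane → ℝ := fun x => Real.sinh (α * (√√B * G x)) with hf
  set b := √√B with hbdef
  have hr : 1 ≤ √B := by rw [Real.one_le_sqrt]; exact hB
  have hB0 : 0 < B := by linarith
  have hb1 : 1 ≤ b := by rw [hbdef, Real.one_le_sqrt]; exact hr
  have hb2 : b ^ 2 = √B := Real.sq_sqrt (Real.sqrt_nonneg _)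
  have hr2 : √B ^ 2 = B := Real.sq_sqrt hB0.le
  have hbr : b ≤ √B := by nlinarith
  have hrB : √B ≤ B := by nlinarith
  have hfC : ContDiff ℝ 1 f := Real.contDiff_sinh.comp
    (contDiff_const.mul (contDiff_const.mul hG))
  have hag := agmon_step hΩ hb hA (f := f) hfC hu hm hE0 (β := c * √B) (κ := α ^ 2 * b ^ 2 * CG)
    (ε := ε) (by positivity) (by positivity) (by rw [hb2]; nlinarith) hε (fun x hx => by
      have := gradSq_sinh_le (g := fun τ => b * τ) (G := G) (a := α) (κ := b) (C := CG) (x := x)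
        (contDiff_const.mul contDiff_id) hG (by
          rw [deriv_const_mul _ differentiableAt_id, deriv_id'', mul_one,
            abs_of_pos (by linarith)]) (hCG' x hx)
      exact this) hnear
    (hlow _ ⟨contDiff_rmul hfC hu, fun x _ hx => by simp [rmul, hf, hG0 x hx]⟩)
  have hmc := continuous_magSq (B := B) hA hu
  have huc := hu.continuous
  have hfc := hfC.continuous
  set W : Plane → ℝ := fun x => Real.exp (a * (√B * ρ x)) + 4 * f x ^ 2 + 2 with hW
  have hWc : Continuous W := by rw [hW]; fun_prop
  have hI : ∫ x in Ω, W x * (magSq B A u x / B + ‖u x‖ ^ 2) ≤ C1 := by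
    have i1 : IntegrableOn (fun x => Real.exp (a * (√B * ρ x)) * (magSq B A u x / B + ‖u x‖ ^ 2))
      Ω := integrableOn_of_bdd hb (by fun_prop)
    have i2 : IntegrableOn (fun x => 4 / B * (f x ^ 2 * magSq B A u x)) Ω :=
      integrableOn_of_bdd hb (by fun_prop)
    have i3 : IntegrableOn (fun x => 4 * (f x ^ 2 * ‖u x‖ ^ 2)) Ω :=
      integrableOn_of_bdd hb (by fun_prop)
    have i4 : IntegrableOn (fun x => 2 / B * magSq B A u x) Ω :=
      integrableOn_of_bdd hb (by fun_prop)
    have i5 : IntegrableOn (fun x => 2 * ‖u x‖ ^ 2) Ω := integrableOn_of_bdd hb (by fun_prop)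
    have i12 : IntegrableOn (fun x => Real.exp (a * (√B * ρ x)) *
      (magSq B A u x / B + ‖u x‖ ^ 2) + 4 / B * (f x ^ 2 * magSq B A u x)) Ω := i1.add i2
    have i123 : IntegrableOn (fun x => Real.exp (a * (√B * ρ x)) *
      (magSq B A u x / B + ‖u x‖ ^ 2) + 4 / B * (f x ^ 2 * magSq B A u x) +
      4 * (f x ^ 2 * ‖u x‖ ^ 2)) Ω := i12.add i3
    have i1234 : IntegrableOn (fun x => Real.exp (a * (√B * ρ x)) *
      (magSq B A u x / B + ‖u x‖ ^ 2) + 4 / B * (f x ^ 2 * magSq B A u x) +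
      4 * (f x ^ 2 * ‖u x‖ ^ 2) + 2 / B * magSq B A u x) Ω := i123.add i4
    have e : ∀ x, W x * (magSq B A u x / B + ‖u x‖ ^ 2) = Real.exp (a * (√B * ρ x)) *
      (magSq B A u x / B + ‖u x‖ ^ 2) + 4 / B * (f x ^ 2 * magSq B A u x) +
      4 * (f x ^ 2 * ‖u x‖ ^ 2) + 2 / B * magSq B A u x + 2 * ‖u x‖ ^ 2 := fun x => by
      simp only [hW]; ring
    simp only [e]
    rw [integral_add i1234 i5, integral_add i123 i4, integral_add i12 i3, integral_add i1 i2,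
      integral_const_mul, integral_const_mul, integral_const_mul, integral_const_mul, ← mass_rmul]
    have h1 : 4 / B * (∫ x in Ω, f x ^ 2 * magSq B A u x) ≤ 8 + 16 * c := by
      rw [div_mul_eq_mul_div, div_le_iff₀ hB0]
      have := hag.2
      have h3 : c * √B ≤ c * B := mul_le_mul_of_nonneg_left hrB hc.le
      linarith
    have h2 : 2 / B * (∫ x in Ω, magSq B A u x) ≤ 4 := by
      rw [div_mul_eq_mul_div, div_le_iff₀ hB0]
      have : (∫ x in Ω, magSq B A u x) ≤ E + 1 := hu1
      linarith
    have h3 : (∫ x in Ω, ‖u x‖ ^ 2) = 1 := hm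
    have h4 := hag.1
    rw [h3]
    linarith
  have hM : 0 < Real.exp (min (a * r') α * b) := Real.exp_pos _
  have hcut := energy_cut_le hΩ hb hA hB hM hF hF1 hCF hCF' hWc (fun x _ => by
    simp only [hW]; positivity) (fun x hx => ?_) hu hI
  · have e : C1 / Real.exp (min (a * r') α * b) = C1 * Real.exp (-(min (a * r') α * b)) := by
      rw [Real.exp_neg]; rfl
    rw [e, hm] at hcut
    have hp := Real.exp_pos (-(min (a * r') α * b))
    constructor
    · calc _ ≤ _ := hcut.1
        _ = _ := by ring
    · refine le_trans ?_ hcut.2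
      have : 0 ≤ (1 + 2 * CF) * C1 * Real.exp (-(min (a * r') α * b)) := by positivity
      linarith
  · by_cases h : ρ x < r' ∧ G x < 1 / 2
    · right
      filter_upwards [hΩ.mem_nhds hx, (isOpen_lt hρ continuous_const).mem_nhds h.1,
        (isOpen_lt hG.continuous continuous_const).mem_nhds h.2] with y h1 h2 h3
      exact hFG y h1 h2 h3
    · left
      have h0 := Real.exp_pos (a * (√B * ρ x))
      by_cases h1 : ρ x < r'
      · have h2 : 1 / 2 ≤ G x := by
          by_contra h3
          exact h ⟨h1, not_le.1 h3⟩
        have h3 : Real.exp (min (a * r') α * b) ≤ Real.exp (2 * (α * (b * G x))) := by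
          apply Real.exp_le_exp.2
          have h4 : min (a * r') α * b ≤ α * b :=
            mul_le_mul_of_nonneg_right (min_le_right _ _) (by linarith)
          have h5 : α * b * (1 / 2) ≤ α * b * G x := mul_le_mul_of_nonneg_left h2 (by positivity)
          linarith
        have h4 := exp_two_mul_le_sinh (α * (b * G x))
        simp only [hW, hf]
        linarith
      · have h3 : Real.exp (min (a * r') α * b) ≤ Real.exp (a * (√B * ρ x)) := by
          apply Real.exp_le_exp.2
          calc _ ≤ a * r' * b := mul_le_mul_of_nonneg_right (min_le_left _ _) (by linarith)
            _ ≤ a * r' * √B := mul_le_mul_of_nonneg_left hbr (by positivity)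
            _ = a * (√B * r') := by ring
            _ ≤ _ := mul_le_mul_of_nonneg_left
              (mul_le_mul_of_nonneg_left (not_lt.1 h1) (by linarith)) ha.le
        have : 0 ≤ f x ^ 2 := sq_nonneg _
        simp only [hW]
        linarith

/-- Exponential weighted bounds survive multiplication by a cutoff function. -/
lemma exp_moment_rmul (hΩ : IsOpen Ω) (hb : Bornology.IsBounded Ω) {ρ F : Plane → ℝ}
    (hρ : Continuous ρ) (hF : ContDiff ℝ 1 F) (hF1 : ∀ x, 0 ≤ F x ∧ F x ≤ 1) {CF : ℝ}
    (hCF0 : 0 ≤ CF) (hCF : ∀ x ∈ Ω, gradSq F x ≤ CF) {A : Plane → Plane} (hA : Continuous A)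
    {B a C : ℝ} (hB : 1 ≤ B) {u : Plane → ℂ} (hu : ContDiff ℝ 1 u)
    (h : ∫ x in Ω, Real.exp (a * (√B * ρ x)) * (magSq B A u x / B + ‖u x‖ ^ 2) ≤ C) :
    ∫ x in Ω, Real.exp (a * (√B * ρ x)) * (magSq B A (rmul F u) x / B + ‖rmul F u x‖ ^ 2) ≤
      (2 + 2 * CF) * C := by
  have hB0 : 0 < B := by linarith
  have hm := continuous_magSq (B := B) hA hu
  have hFu := contDiff_rmul hF hu
  have hmF := continuous_magSq (B := B) hA hFu
  have huc := hu.continuous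
  have hFuc := hFu.continuous
  have i1 : IntegrableOn (fun x => Real.exp (a * (√B * ρ x)) *
      (magSq B A (rmul F u) x / B + ‖rmul F u x‖ ^ 2)) Ω := integrableOn_of_bdd hb (by fun_prop)
  have i2 : IntegrableOn (fun x => (2 + 2 * CF) * (Real.exp (a * (√B * ρ x)) *
      (magSq B A u x / B + ‖u x‖ ^ 2))) Ω := integrableOn_of_bdd hb (by fun_prop)
  refine (setIntegral_mono_on i1 i2 hΩ.measurableSet fun x hx => ?_).trans ?_
  · have h1 := magSq_rmul_le (B := B) (A := A) (hF.differentiable one_ne_zero x)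
      (hu.differentiable one_ne_zero x)
    have hm0 := magSq_nonneg B A u x
    have h2 : F x ^ 2 ≤ 1 := pow_le_one₀ (hF1 x).1 (hF1 x).2
    have h3 : F x ^ 2 * magSq B A u x ≤ 1 * magSq B A u x := mul_le_mul_of_nonneg_right h2 hm0
    have h4 : gradSq F x * ‖u x‖ ^ 2 ≤ CF * ‖u x‖ ^ 2 :=
      mul_le_mul_of_nonneg_right (hCF x hx) (sq_nonneg _)
    have h5 : ‖rmul F u x‖ ^ 2 ≤ ‖u x‖ ^ 2 := by
      have : ‖rmul F u x‖ ^ 2 = F x ^ 2 * ‖u x‖ ^ 2 := by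
        simp only [rmul]
        rw [norm_mul, mul_pow, Complex.norm_real, Real.norm_eq_abs, sq_abs]
      rw [this]
      exact mul_le_of_le_one_left (sq_nonneg _) h2
    have h8 : 0 ≤ ‖u x‖ ^ 2 := sq_nonneg _
    have h6 : magSq B A (rmul F u) x / B ≤ 2 * (magSq B A u x / B) + 2 * CF * ‖u x‖ ^ 2 := by
      rw [div_le_iff₀ hB0]
      have e : (2 * (magSq B A u x / B) + 2 * CF * ‖u x‖ ^ 2) * B =
          2 * magSq B A u x + B * (2 * CF * ‖u x‖ ^ 2) := by field_simp
      have : 2 * CF * ‖u x‖ ^ 2 ≤ B * (2 * CF * ‖u x‖ ^ 2) :=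
        le_mul_of_one_le_left (by positivity) hB
      rw [e]; linarith
    have h7 : 0 ≤ CF * (magSq B A u x / B) := by positivity
    calc _ ≤ Real.exp (a * (√B * ρ x)) * ((2 + 2 * CF) * (magSq B A u x / B + ‖u x‖ ^ 2)) := by
          refine mul_le_mul_of_nonneg_left ?_ (Real.exp_pos _).le
          linarith
      _ = _ := by ring
  · rw [integral_const_mul]
    exact mul_le_mul_of_nonneg_left h (by positivity)

end Localization

end SC

namespace SC

section Transfer

variable {Ω : Set Plane} {P : BoundaryParam Ω} {K t₁ : ℝ}

lemma contDiff_F0 {n : WithTop ℕ∞} : ContDiff ℝ n F0 := by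
  unfold F0
  exact (contDiff_snd.neg.div_const _).prodMk (contDiff_fst.div_const _)

lemma curl2_F0 : curl2 F0 = fun _ => 1 := by
  funext x
  have h1 : HasFDerivAt (fun y : Plane => (F0 y).2)
      ((2 : ℝ)⁻¹ • ContinuousLinearMap.fst ℝ ℝ ℝ) x := by
    have h : HasFDerivAt (fun y : Plane => (2 : ℝ)⁻¹ * y.1) _ x :=
      (hasFDerivAt_fst (𝕜 := ℝ)).const_mul _
    exact h.congr_of_eventuallyEq (Eventually.of_forall fun y => by simp [F0]; ring)
  have h2 : HasFDerivAt (fun y : Plane => (F0 y).1)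
      ((-(2 : ℝ)⁻¹) • ContinuousLinearMap.snd ℝ ℝ ℝ) x := by
    have h : HasFDerivAt (fun y : Plane => (-(2 : ℝ)⁻¹) * y.2) _ x :=
      (hasFDerivAt_snd (𝕜 := ℝ)).const_mul _
    exact h.congr_of_eventuallyEq (Eventually.of_forall fun y => by simp [F0]; ring)
  unfold curl2
  rw [h1.fderiv, h2.fderiv]
  simp
  norm_num

lemma transfer_aux {X S V W m r τ D B : ℝ} (hr : 0 ≤ r) (hD : 0 ≤ D) (hτ : 0 ≤ τ) (hS : 0 ≤ S)
    (hB : 0 < B) (hW : 0 ≤ W) (hm : 1 / 2 ≤ m) (hV : V = m * W)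
    (h : X ≤ S + 4 * r * (0 + D) * ((1 + τ) * (S / B) + (1 + τ) ^ 4 * W)) :
    X ≤ S + 8 * r * D * ((1 + τ) ^ 4 * S / B + (1 + τ) ^ 4 * V) := by
  have h1 : 1 + τ ≤ (1 + τ) ^ 4 := le_self_pow₀ (by linarith) (by norm_num)
  have h0 : 0 ≤ S / B := by positivity
  have h2 : (1 + τ) * (S / B) ≤ 2 * ((1 + τ) ^ 4 * S / B) := by
    have := mul_le_mul_of_nonneg_right h1 h0
    have h3 : 0 ≤ (1 + τ) ^ 4 * (S / B) := by positivity
    rw [mul_div_assoc]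
    linarith
  have h3 : (1 + τ) ^ 4 * W ≤ 2 * ((1 + τ) ^ 4 * V) := by
    have h4 : W ≤ 2 * V := by rw [hV]; nlinarith
    have := mul_le_mul_of_nonneg_left h4 (by positivity : 0 ≤ (1 + τ) ^ 4)
    linarith
  have h5 : 0 ≤ 4 * r * D := by positivity
  have h6 := mul_le_mul_of_nonneg_left (add_le_add h2 h3) h5
  linarith

/-- A function vanishing on a full transversal of the boundary strip can be transplanted from the
field `A` to the homogeneous field. -/
lemma lam1_mul_mass_le (hT : IsTube P K t₁) (hΩ : IsOpen Ω) {ρ : Plane → ℝ} (hρ : IsRho P t₁ ρ)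
    {A : Plane → Plane} (hA : ContDiff ℝ 2 A) {B D s0 b c r : ℝ} (hB : 1 ≤ B) (hD0 : 0 ≤ D)
    (hD1 : D ≤ 1) (hD : ∀ x ∈ closure Ω, ‖fderiv ℝ (curl2 A) x‖ ≤ D)
    (h1 : ∀ x ∈ frontier Ω, curl2 A x = 1) (hbs : s0 < b) (hc : c < s0 + P.L) (hr : r < t₁ / 3)
    {v : Plane → ℂ} (hv : ContDiff ℝ 1 v)
    (hv0 : ∀ p ∈ Ioo s0 (s0 + P.L) ×ˢ Ioo (-(t₁ / 3)) (t₁ / 3), p ∉ Icc b c ×ˢ Icc (-r) r →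
      v (tube P.γ p) = 0)
    (hvZ : ∀ x, x ∉ tube P.γ '' (Icc b c ×ˢ Icc (-r) r) → v x = 0) :
    lam1 Ω B * mass Ω v ≤ energy Ω B A v + 8 * √B * D *
      ((∫ x in Ω, (1 + √B * ρ x) ^ 4 * magSq B A v x) / B +
        ∫ x in Ω, (1 + √B * ρ x) ^ 4 * ‖v x‖ ^ 2) := by
  have ht1 := hT.pos
  have hT2 : IsTube P K (t₁ / 3) := hT.mono (by linarith) (by linarith)
  set t2 := t₁ / 3 with ht2
  have ht2p : 0 < t2 := hT2.pos
  have hB0 : 0 < B := by linarith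
  obtain ⟨φ, hφ⟩ := exists_gauge P (hA.of_le (by norm_num)) s0
  obtain ⟨φ', hφ'⟩ := exists_gauge P (contDiff_F0 (n := 1)) s0
  set w := toStrip P B φ v with hw
  have hwC : ContDiff ℝ 1 w := contDiff_toStrip B hφ.1 hv
  obtain ⟨v', hv', hE', hM'⟩ := exists_of_strip hT2 hΩ hbs hc hr hφ' B hwC (fun p hp hp' => by
    rw [hw, toStrip_eq, hv0 p hp hp', mul_zero])
  have hoff : ∀ x ∈ Ω, x ∉ tube P.γ '' (Ioo s0 (s0 + P.L) ×ˢ Ioo 0 t2) →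
      x ∉ tube P.γ '' (Icc b c ×ˢ Icc (-r) r) := by
    rintro x hx hx' ⟨p, hp, rfl⟩
    refine hx' ⟨p, ⟨⟨by linarith [hp.1.1], by linarith [hp.1.2]⟩, ?_, by linarith [hp.2.2]⟩, rfl⟩
    by_contra h
    exact hT2.notMem p (by linarith [hp.2.1]) (not_lt.1 h) hx
  have hoffm : ∀ x ∈ Ω, x ∉ tube P.γ '' (Ioo s0 (s0 + P.L) ×ˢ Ioo 0 t2) → magSq B A v x = 0 :=
    fun x hx hx' => magSq_eq_zero_off hΩ (isClosed_image_rect P b c (-r) r) (fun y _ hy => hvZ y hy)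
      hx (hoff x hx hx')
  have hoffu : ∀ x ∈ Ω, x ∉ tube P.γ '' (Ioo s0 (s0 + P.L) ×ˢ Ioo 0 t2) → v x = 0 :=
    fun x hx hx' => hvZ x (hoff x hx hx')
  set R : Set (ℝ × ℝ) := Ioo s0 (s0 + P.L) ×ˢ Ioo 0 t2 with hR
  have hms : MeasurableSet R := measurableSet_Ioo.prod measurableSet_Ioo
  set S : ℝ × ℝ → ℝ := fun p => sden B (curvOf P.γ p.1) (fluxPot P A p) w p with hS
  set X : ℝ × ℝ → ℝ := fun p => sden B (curvOf P.γ p.1) (fluxPot P F0 p) w p with hX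
  set V : ℝ × ℝ → ℝ := fun p => (1 - p.2 * curvOf P.γ p.1) * ‖w p‖ ^ 2 with hV
  have hρR : ∀ p ∈ R, ρ (tube P.γ p) = p.2 := fun p hp =>
    hρ.eq p (by rw [abs_of_pos hp.2.1]; linarith [hp.2.2])
  have eE : energy Ω B A v = ∫ p in R, S p := by
    have := weighted_energy_eq hT2 hΩ s0 hφ B hv (fun _ => 1) hoffm
    simp only [one_mul] at this
    exact this
  have eM : mass Ω v = ∫ p in R, V p := by
    have := weighted_mass_eq hT2 hΩ s0 φ B (fun _ => 1) hoffu
    simp only [one_mul] at this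
    exact this
  have eE4 : ∫ x in Ω, (1 + √B * ρ x) ^ 4 * magSq B A v x =
      ∫ p in R, (1 + √B * p.2) ^ 4 * S p := by
    rw [weighted_energy_eq hT2 hΩ s0 hφ B hv (fun x => (1 + √B * ρ x) ^ 4) hoffm]
    exact setIntegral_congr_fun hms fun p hp => by simp only [hρR p hp]; rfl
  have eM4 : ∫ x in Ω, (1 + √B * ρ x) ^ 4 * ‖v x‖ ^ 2 =
      ∫ p in R, (1 + √B * p.2) ^ 4 * V p := by
    rw [weighted_mass_eq hT2 hΩ s0 φ B (fun x => (1 + √B * ρ x) ^ 4) hoffu]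
    exact setIntegral_congr_fun hms fun p hp => by simp only [hρR p hp]; rfl
  have hlam : lam1 Ω B * mass Ω v ≤ ∫ p in R, X p := by
    have h := lamS_mul_mass_le (S := univ) (B := B) (A := F0)
      (show Cls Ω univ v' from ⟨hv', fun x _ hx => absurd (mem_univ x) hx⟩)
    have e : lam1 Ω B = lamS Ω univ B F0 := lam1A_eq_lamS hΩ B F0
    rw [hM', hE', ← e] at h
    rw [eM]
    exact h
  refine hlam.trans ?_
  rw [eE, eE4, eM4]
  have hcurv : Continuous fun p : ℝ × ℝ => curvOf P.γ p.1 :=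
    (contDiff_curvOf P).continuous.comp continuous_fst
  have hflux : Continuous (fluxPot P A) := IsGauge.continuous_fluxPot hA.continuous hφ
  have hflux' : Continuous (fluxPot P F0) :=
    IsGauge.continuous_fluxPot (contDiff_F0 (n := 1)).continuous hφ'
  have hwc := hwC.continuous
  have hden : ∀ p ∈ Icc s0 (s0 + P.L) ×ˢ Icc 0 t2, 1 - p.2 * curvOf P.γ p.1 ≠ 0 := fun p hp => by
    have := abs_le.1 (hT2.mul_curv_le hp.2.1 hp.2.2 p.1)
    linarith [this.2]
  have hSc : ContinuousOn S (Icc s0 (s0 + P.L) ×ˢ Icc 0 t2) :=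
    continuousOn_sden hcurv hflux hwC hden
  have hXc : ContinuousOn X (Icc s0 (s0 + P.L) ×ˢ Icc 0 t2) :=
    continuousOn_sden hcurv hflux' hwC hden
  have hVc : Continuous V := by rw [hV]; fun_prop
  have hp4 : Continuous fun p : ℝ × ℝ => (1 + √B * p.2) ^ 4 := by fun_prop
  refine integral_le_add_of_pointwise hms (integrableOn_rect hXc) (integrableOn_rect hSc)
    (integrableOn_rect (hp4.continuousOn.mul hSc)) (integrableOn_rect (hp4.mul hVc).continuousOn)
    fun p hp => ?_
  have hbk := abs_le.1 (hT2.mul_curv_le hp.2.1.le hp.2.2.le p.1)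
  have hm : 1 / 2 ≤ 1 - p.2 * curvOf P.γ p.1 := by linarith [hbk.2]
  have hfl : |fluxPot P A p - fluxPot P F0 p| ≤ D * p.2 ^ 2 := by
    have e1 := fluxPot_approx hT2 hA hD h1 hp.2.1.le hp.2.2
    have e2 := fluxPot_approx hT2 (contDiff_F0 (n := 2)) (D := 0)
      (fun x _ => by rw [curl2_F0]; simp) (fun x _ => by rw [curl2_F0]) hp.2.1.le hp.2.2
    rw [zero_mul, abs_nonpos_iff, sub_eq_zero] at e2
    rw [e2]
    exact e1
  have h := sden_freeze (w := w) hB hp.2.1.le hm (by linarith [hbk.1]) hm le_rfl hD0 hD1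
    (by simp) hfl
  have hS0 : 0 ≤ S p := sden_nonneg (by linarith)
  exact transfer_aux (Real.sqrt_nonneg _) hD0 (mul_nonneg (Real.sqrt_nonneg _) hp.2.1.le) hS0 hB0
    (sq_nonneg _) hm rfl h

end Transfer

end SC

namespace SC

section Comparison

variable {Ω : Set Plane}

lemma pow_four_mul_exp_neg_le {ε b : ℝ} (hε : 0 < ε) (hb : 0 ≤ b) :
    b ^ 4 * Real.exp (-(ε * b)) ≤ (1 + 4 / (ε / 2)) ^ 4 * Real.exp (-(ε / 2 * b)) := by
  have h := one_add_pow_four_le_exp (a := ε / 2) (by positivity) hb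
  have h1 : b ^ 4 ≤ (1 + b) ^ 4 := by gcongr; linarith
  calc b ^ 4 * Real.exp (-(ε * b)) ≤ ((1 + 4 / (ε / 2)) ^ 4 * Real.exp (ε / 2 * b)) *
        Real.exp (-(ε * b)) := mul_le_mul_of_nonneg_right (h1.trans h) (Real.exp_pos _).le
    _ = _ := by rw [mul_assoc, ← Real.exp_add]; congr 2; ring

lemma comparison_arith {E lam n e0 e1 err C K B X : ℝ} (hE0 : 0 ≤ E) (hE : E ≤ 4 / 5 * B)
    (hC : 0 ≤ C) (he1 : 0 ≤ e1) (hK : B * e1 ≤ K * e0) (hX : X ≤ E + e0 + B * C * e1)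
    (hn : 1 - C * e1 ≤ n) (hn2 : 1 / 2 ≤ n) (h : lam * n ≤ X + err) :
    lam - 2 * ((1 + 2 * C * K) * e0 + err) ≤ E ∨ lam ≤ E := by
  by_cases hl : lam ≤ E
  · exact Or.inr hl
  · left
    have h1 : (lam - E) * (1 / 2) ≤ (lam - E) * n :=
      mul_le_mul_of_nonneg_left hn2 (by linarith [not_le.1 hl])
    have h2 : E * (1 - n) ≤ C * (K * e0) := by
      have h3 : E * (1 - n) ≤ E * (C * e1) := mul_le_mul_of_nonneg_left (by linarith) hE0
      have h4 : E * (C * e1) ≤ 4 / 5 * B * (C * e1) :=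
        mul_le_mul_of_nonneg_right hE (by positivity)
      have h5 := mul_le_mul_of_nonneg_left hK hC
      have h6 : 0 ≤ B * (C * e1) := mul_nonneg (by linarith) (by positivity)
      linarith
    have h5 := mul_le_mul_of_nonneg_left hK hC
    linarith

/-- Comparison of the ground state energies for globally defined fields. -/
lemma exists_comparison (hΩ : IsOpen Ω) (hb : Bornology.IsBounded Ω) (P : BoundaryParam Ω)
    (hnd : ∃ s t, curvOf P.γ s ≠ curvOf P.γ t) :
    ∃ B₀ ≥ 1, ∃ ε₀ > 0, ∃ C > 0, ∃ δ > 0, ∀ B ≥ B₀, ∀ D, 0 ≤ D → D ≤ δ → ∀ A : Plane → Plane,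
      ContDiff ℝ 2 A → (∀ x ∈ closure Ω, ‖fderiv ℝ (curl2 A) x‖ ≤ D) →
      (∀ x ∈ frontier Ω, curl2 A x = 1) → (∀ x ∈ Ω, |curl2 A x - 1| ≤ 1 / 10) →
      lam1 Ω B - C * (D * √B + Real.exp (-(ε₀ * √√B))) ≤ lamS Ω univ B A := by
  obtain ⟨K, t₁, hT⟩ := exists_isTube hΩ hb P
  obtain ⟨ρ, hρ⟩ := exists_rho hT
  have hne : Ω.Nonempty := by
    obtain ⟨ε, hε, h⟩ := P.inward 0
    exact ⟨_, h (ε / 2) ⟨by linarith, by linarith⟩⟩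
  obtain ⟨s0, η, r0, hη0, hη, hr0, hr0t, c, hc, δ, hδ, B₁, hB₁, hgap⟩ := exists_arc_gap hΩ hb hT hnd
  obtain ⟨a, ha, Ca, hCa, fw, hfw, hweight⟩ := exists_boundary_weight hΩ hb hT hρ
  obtain ⟨G, F, hG, hF, hG0, hF1, ⟨r', hr', hFG⟩, b1, c1, r1, hb1, hc1, hr1, hr1t, hFv, hFZ⟩ :=
    exists_cut hT hρ (s0 := s0) hη0 hη hr0 hr0t
  obtain ⟨α, hα, ε₁, hε₁, C1, hC1, hloc⟩ := exists_localization hΩ hb hρ.smooth.continuous hG hF hG0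
    hF1 hr' hFG hc ha hCa.le
  obtain ⟨CF, hCF, hCF'⟩ := exists_bound hb (continuous_gradSq hF)
  set K1 := (1 + 4 / (ε₁ / 2)) ^ 4 with hK1
  have hK1p : 0 < K1 := by positivity
  set M := (1 + 4 / a) ^ 4 * ((2 + 2 * CF) * Ca) with hM
  have hMp : 0 < M := by positivity
  refine ⟨max B₁ (max 40 (max ((4 / c) ^ 2) (2 * C1 * K1))), hB₁.le.trans (le_max_left _ _), ε₁ / 2,
    by positivity, 2 * (1 + 2 * C1 * K1) + 16 * M, by positivity, min δ 1, by positivity, ?_⟩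
  intro B hB D hD0 hD A hA hDA h1A hA10
  have hBB₁ : B₁ ≤ B := (le_max_left _ _).trans hB
  have hB' := (le_max_right _ _).trans hB
  have hB40 : 40 ≤ B := (le_max_left _ _).trans hB'
  have hB'' := (le_max_right _ _).trans hB'
  have hBc : (4 / c) ^ 2 ≤ B := (le_max_left _ _).trans hB''
  have hBC : 2 * C1 * K1 ≤ B := (le_max_right _ _).trans hB''
  have hB1 : 1 ≤ B := by linarith
  have hB0 : 0 < B := by linarith
  set b := √√B with hbdef
  have hb0 : 0 ≤ b := Real.sqrt_nonneg _
  have hb4 : b ^ 4 = B := by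
    rw [show b ^ 4 = (b ^ 2) ^ 2 by ring, hbdef, Real.sq_sqrt (Real.sqrt_nonneg _),
      Real.sq_sqrt hB0.le]
  set e0 := Real.exp (-(ε₁ / 2 * b)) with he0
  have he0p : 0 < e0 := Real.exp_pos _
  have he01 : e0 ≤ 1 := Real.exp_le_one_iff.2 (by
    have : 0 ≤ ε₁ / 2 * b := by positivity
    linarith)
  set e1 := Real.exp (-(ε₁ * b)) with he1
  have he1p : 0 < e1 := Real.exp_pos _
  have hKe : B * e1 ≤ K1 * e0 := by
    have := pow_four_mul_exp_neg_le hε₁ hb0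
    rwa [hb4] at this
  have hcB : 1 ≤ c * √B / 4 := by
    have := Real.le_sqrt_of_sq_le hBc
    rw [div_le_iff₀ hc] at this
    linarith
  have hAc := hA.continuous
  obtain ⟨hE, hlow⟩ := hgap B hBB₁ D hD0 (hD.trans (min_le_left _ _)) A hA hDA h1A hA10
  have hE0 : 0 ≤ lamS Ω univ B A := lamS_nonneg _ _ _ _
  set E := lamS Ω univ B A with hEdef
  have hgC : ContDiff ℝ 1 fun x => Real.sinh (α * (b * G x)) := Real.contDiff_sinh.comp
    (contDiff_const.mul (contDiff_const.mul hG))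
  obtain ⟨u, hu, hm, hue, hnear⟩ := exists_localized_near_min hΩ hb (B := B) hAc
    (exists_cls_univ hΩ hb hne) ![fw B, fun x => Real.sinh (α * (b * G x))]
    (Fin.forall_fin_two.2 ⟨hfw B, hgC⟩) he0p
  have hn1 := hnear 0
  have hn2 := hnear 1
  simp only [Matrix.cons_val_zero, Matrix.cons_val_one] at hn1 hn2
  rw [← hEdef] at hue hn1 hn2
  have hexp := hweight B hB40 A (hA.of_le (by norm_num)) hA10 E hE0 hE u hu.1 hm (by linarith)
    (by linarith)
  obtain ⟨hv1, hv2⟩ := hloc B hB1 A hAc E hE0 hE hlow u hu.1 hm (by linarith) hexp e0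
    (by linarith) hn2
  have hmom := moment_of_exp hΩ hb hT hρ hAc hB0 ha (contDiff_rmul hF hu.1)
    (exp_moment_rmul hΩ hb hρ.smooth.continuous hF hF1 hCF hCF' hAc hB1 hu.1 hexp)
  have htr := lam1_mul_mass_le hT hΩ hρ hA hB1 hD0 (hD.trans (min_le_right _ _)) hDA h1A hb1 hc1
    hr1t (contDiff_rmul hF hu.1) (fun p hp hp' => by simp [rmul, hFv p hp hp'])
    (fun x hx => by simp [rmul, hFZ x hx])
  have h8 : 0 ≤ 8 * √B * D := by positivity
  have hn12 : 1 / 2 ≤ mass Ω (rmul F u) := by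
    have h3 : C1 * e1 ≤ 1 / 2 := by
      have h4 : B * (C1 * e1) ≤ B * (1 / 2) := by
        calc B * (C1 * e1) = C1 * (B * e1) := by ring
          _ ≤ C1 * (K1 * e0) := mul_le_mul_of_nonneg_left hKe hC1.le
          _ ≤ C1 * (K1 * 1) := by gcongr
          _ ≤ _ := by linarith
      exact le_of_mul_le_mul_left h4 hB0
    linarith
  have htr' := htr.trans (add_le_add le_rfl (mul_le_mul_of_nonneg_left hmom h8))
  have hfin := comparison_arith (lam := lam1 Ω B) hE0 hE hC1.le he1p.le hKe
    (hv1.trans (add_le_add hue le_rfl)) hv2 hn12 htr'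
  have h9 : 0 ≤ D * √B := by positivity
  have h10 : 0 ≤ C1 * K1 := by positivity
  rcases hfin with h | h
  · refine le_trans ?_ h
    have h11 : 0 ≤ M * e0 := by positivity
    have h12 : 0 ≤ (1 + 2 * C1 * K1) * (D * √B) := by positivity
    linarith
  · refine le_trans ?_ h
    have : 0 ≤ (2 * (1 + 2 * C1 * K1) + 16 * M) * (D * √B + e0) := by positivity
    linarith

end Comparison

end SC

namespace SC

lemma rpow_one_quarter {B : ℝ} (hB : 0 ≤ B) : B ^ ((1 : ℝ) / 4) = √√B := by
  rw [Real.sqrt_eq_rpow, Real.sqrt_eq_rpow, ← Real.rpow_mul hB]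
  norm_num

lemma mul_rpow_neg_quarter_le {B C δ : ℝ} (hB : 1 ≤ B) (hC : 0 < C) (hδ : 0 < δ)
    (h : (C / δ) ^ 4 ≤ B) : C * B ^ (-(1 : ℝ) / 4) ≤ δ := by
  have hB0 : 0 < B := by linarith
  rw [neg_div, Real.rpow_neg hB0.le, rpow_one_quarter hB0.le]
  have h1 : C / δ ≤ √√B := by
    refine Real.le_sqrt_of_sq_le (Real.le_sqrt_of_sq_le ?_)
    rw [← pow_mul]
    exact h
  have h2 : 0 < √√B := lt_of_lt_of_le (by positivity) h1
  rw [div_le_iff₀ hδ] at h1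
  rw [← div_eq_mul_inv, div_le_iff₀ h2]
  linarith

lemma curl2_congr {A A' : Plane → Plane} {x : Plane} (h : A =ᶠ[𝓝 x] A') :
    curl2 A x = curl2 A' x := by
  have h1 : (fun y => (A y).2) =ᶠ[𝓝 x] fun y => (A' y).2 := h.fun_comp Prod.snd
  have h2 : (fun y => (A y).1) =ᶠ[𝓝 x] fun y => (A' y).1 := h.fun_comp Prod.fst
  unfold curl2
  rw [h1.fderiv_eq, h2.fderiv_eq]

lemma lamS_congr {Ω S : Set Plane} (hΩ : IsOpen Ω) {B : ℝ} {A A' : Plane → Plane}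
    (hA : ∀ x ∈ Ω, A x = A' x) : lamS Ω S B A = lamS Ω S B A' := by
  unfold lamS
  have h : ∀ u, energy Ω B A u = energy Ω B A' u := fun u => energy_congr hΩ hA fun x _ => rfl
  simp only [h]

end SC

/-- For non-disc domains, comparison of `λ₁(B·A)` with the constant field
eigenvalue with exponentially small error:
`λ₁(B·A) ≥ λ₁(B) - C(‖curl A - 1‖_{C¹} √B + e^{-ε₀ B^{1/4}})` under condition (★). -/
theorem lam1_comparison_C1
    (Ω : Set SC.Plane) (hΩ_open : IsOpen Ω) (hΩ_bdd : Bornology.IsBounded Ω)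
    (hΩ_sc : SimplyConnectedSpace ↥Ω) (P : SC.BoundaryParam Ω)
    (hnotdisc : ∃ s t : ℝ, SC.curvOf P.γ s ≠ SC.curvOf P.γ t)
    (C₀ : ℝ) (hC₀ : 0 < C₀) :
    ∃ B₀ > 0, ∃ ε₀ > 0, ∃ C > 0, ∀ B ≥ B₀,
      ∀ A : SC.Plane → SC.Plane, SC.StarCond Ω C₀ B A →
        SC.lam1 Ω B - C *
            ((sSup ((fun x => |SC.curl2 A x - 1|) '' closure Ω) +
              sSup ((fun x => ‖fderiv ℝ (SC.curl2 A) x‖) '' closure Ω)) * Real.sqrt B +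
             Real.exp (-ε₀ * B ^ ((1 : ℝ) / 4)))
          ≤ SC.lam1A Ω B A := by
  obtain ⟨B₁, hB₁, ε₀, hε₀, C, hC, δ, hδ, H⟩ :=
    SC.exists_comparison hΩ_open hΩ_bdd P hnotdisc
  refine ⟨max B₁ (max ((C₀ / δ) ^ 4) ((C₀ / (1 / 10)) ^ 4)), by
    have := le_max_left B₁ (max ((C₀ / δ) ^ 4) ((C₀ / (1 / 10)) ^ 4))
    linarith, ε₀, hε₀, C, hC, ?_⟩
  intro B hB A hA
  obtain ⟨hA2, -, -, -, hcurl, hdcurl, hbd⟩ := hA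
  have hB1 : 1 ≤ B := hB₁.le.trans ((le_max_left _ _).trans hB)
  have hBδ : C₀ * B ^ (-(1 : ℝ) / 4) ≤ δ := SC.mul_rpow_neg_quarter_le hB1 hC₀ hδ
    ((le_max_left _ _).trans ((le_max_right _ _).trans hB))
  have hB10 : C₀ * B ^ (-(1 : ℝ) / 4) ≤ 1 / 10 := SC.mul_rpow_neg_quarter_le hB1 hC₀ (by norm_num)
    ((le_max_right _ _).trans ((le_max_right _ _).trans hB))
  obtain ⟨A', hA', V, hV, hΩV, hAA'⟩ := hA2.exists_contDiff
  have hnear : ∀ x ∈ V, A =ᶠ[𝓝 x] A' := fun x hx => by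
    filter_upwards [hV.mem_nhds hx] with y hy using hAA' y hy
  have hc : ∀ x ∈ V, SC.curl2 A x = SC.curl2 A' x := fun x hx => SC.curl2_congr (hnear x hx)
  have hdc : ∀ x ∈ V, fderiv ℝ (SC.curl2 A) x = fderiv ℝ (SC.curl2 A') x := fun x hx => by
    have h : SC.curl2 A =ᶠ[𝓝 x] SC.curl2 A' := by
      filter_upwards [hV.mem_nhds hx] with y hy using hc y hy
    exact h.fderiv_eq
  have hD : ∀ x ∈ closure Ω, ‖fderiv ℝ (SC.curl2 A) x‖ ≤
      sSup ((fun x => ‖fderiv ℝ (SC.curl2 A) x‖) '' closure Ω) := fun x hx =>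
    le_csSup ⟨C₀ * B ^ (-(1 : ℝ) / 4), by rintro _ ⟨y, hy, rfl⟩; exact hdcurl y hy⟩
      (mem_image_of_mem _ hx)
  have hDδ : sSup ((fun x => ‖fderiv ℝ (SC.curl2 A) x‖) '' closure Ω) ≤ δ :=
    Real.sSup_le (by rintro _ ⟨y, hy, rfl⟩; exact (hdcurl y hy).trans hBδ) hδ.le
  have hD0 : 0 ≤ sSup ((fun x => ‖fderiv ℝ (SC.curl2 A) x‖) '' closure Ω) :=
    Real.sSup_nonneg (by rintro _ ⟨y, -, rfl⟩; exact norm_nonneg _)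
  have hS0 : 0 ≤ sSup ((fun x => |SC.curl2 A x - 1|) '' closure Ω) :=
    Real.sSup_nonneg (by rintro _ ⟨y, -, rfl⟩; exact abs_nonneg _)
  have key := H B ((le_max_left _ _).trans hB) _ hD0 hDδ A' (by exact_mod_cast hA')
    (fun x hx => by rw [← hdc x (hΩV hx)]; exact hD x hx)
    (fun x hx => by rw [← hc x (hΩV (frontier_subset_closure hx))]; exact hbd x hx)
    (fun x hx => by
      rw [← hc x (hΩV (subset_closure hx))]
      exact (hcurl x (subset_closure hx)).trans hB10)
  rw [SC.lam1A_eq_lamS hΩ_open,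
    SC.lamS_congr hΩ_open fun x hx => hAA' x (hΩV (subset_closure hx)),
    SC.rpow_one_quarter (by linarith), neg_mul]
  refine le_trans (sub_le_sub_left (mul_le_mul_of_nonneg_left ?_ hC.le) _) key
  have := mul_nonneg hS0 (Real.sqrt_nonneg B)
  linarith
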